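/- For every integer n ≥ 5, the (n+1)-th prime satisfies p_{n+1} < n·(ln(n·ln n) + 1). -/

import Mathlib

open Finset Real

/-- `nthPrime n` is the n-th prime number with 1-based indexing:
`nthPrime 1 = 2`, `nthPrime 2 = 3`, `nthPrime 3 = 5`, ... -/
noncomputable def nthPrime (n : ℕ) : ℕ := Nat.nth Nat.Prime (n - 1)

/-- The arithmetic average of the first `n` primes. -/
noncomputable def avgPrime (n : ℕ) : ℝ := (1 / (n : ℝ)) * ∑ i ∈ Finset.Icc 1 n, (nthPrime i : ℝ)

/-- The gap in the averaged primes. -/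
noncomputable def avgGap (n : ℕ) : ℝ := avgPrime (n + 1) - avgPrime n

/-- The averaged-prime counting function `π̄(x) = #{i ≥ 1 : p̄_i ≤ x}`. -/
noncomputable def avgPrimeCount (x : ℝ) : ℕ := Nat.card {i : ℕ | 1 ≤ i ∧ avgPrime i ≤ x}

/-- The ordinary prime counting function for a real argument. -/
noncomputable def primeCount (x : ℝ) : ℕ := Nat.card {q : ℕ | q.Prime ∧ (q : ℝ) ≤ x}

/-! ### Partial fractions of the logarithmic derivative of an entire function -/

section Landau

lemma exists_factor_single {f : ℂ → ℂ} (hf : Differentiable ℂ f) {ρ : ℂ}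
    (hρ : analyticOrderAt f ρ ≠ ⊤) :
    ∃ g : ℂ → ℂ, Differentiable ℂ g ∧ g ρ ≠ 0 ∧
      ∀ z, f z = (z - ρ) ^ analyticOrderNatAt f ρ * g z := by
  classical
  set n := analyticOrderNatAt f ρ with hn
  have hfa : AnalyticAt ℂ f ρ := hf.analyticAt ρ
  have hnn : analyticOrderAt f ρ = n := (Nat.cast_analyticOrderNatAt hρ).symm
  obtain ⟨g, hg, hg0, hfg⟩ := hfa.analyticOrderAt_eq_natCast.1 hnn
  let G : ℂ → ℂ := fun z => if z = ρ then g ρ else f z / (z - ρ) ^ n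
  have hGg : ∀ᶠ z in nhds ρ, G z = g z := by
    filter_upwards [hfg] with z hz
    by_cases h : z = ρ
    · simp [G, h]
    · have : (z - ρ) ^ n ≠ 0 := pow_ne_zero _ (sub_ne_zero.2 h)
      simp only [G, if_neg h, hz, smul_eq_mul]
      field_simp
  refine ⟨G, fun z => ?_, by simpa [G] using hg0, fun z => ?_⟩
  · by_cases h : z = ρ
    · subst h
      exact (hg.congr (hGg.mono fun _ h => h.symm)).differentiableAt
    · have h1 : ∀ᶠ w in nhds z, f w / (w - ρ) ^ n = G w := by
        filter_upwards [isOpen_ne.mem_nhds h] with w hw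
        have : w ≠ ρ := hw
        simp [G, this]
      have h2 : DifferentiableAt ℂ (fun w => f w / (w - ρ) ^ n) z :=
        (hf z).div (by fun_prop) (pow_ne_zero _ (sub_ne_zero.2 h))
      exact h2.congr_of_eventuallyEq (h1.mono fun _ h => h.symm)
  · by_cases h : z = ρ
    · subst h
      have := hfg.self_of_nhds
      simpa [G, smul_eq_mul] using this
    · have : (z - ρ) ^ n ≠ 0 := pow_ne_zero _ (sub_ne_zero.2 h)
      simp only [G, if_neg h]
      field_simp

lemma exists_factor_finset {f : ℂ → ℂ} (hf : Differentiable ℂ f)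
    (hord : ∀ ρ, analyticOrderAt f ρ ≠ ⊤) (S : Finset ℂ) :
    ∃ g : ℂ → ℂ, Differentiable ℂ g ∧ (∀ ρ ∈ S, g ρ ≠ 0) ∧
      (∀ ρ ∉ S, analyticOrderAt g ρ = analyticOrderAt f ρ) ∧
      ∀ z, f z = (∏ ρ ∈ S, (z - ρ) ^ analyticOrderNatAt f ρ) * g z := by
  classical
  induction S using Finset.induction_on with
  | empty => exact ⟨f, hf, by simp, by simp, by simp⟩
  | insert a S ha ih =>
    obtain ⟨g, hg, hg0, hgo, hfg⟩ := ih
    have hga : analyticOrderAt g a ≠ ⊤ := by rw [hgo a ha]; exact hord a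
    obtain ⟨k, hk, hk0, hgk⟩ := exists_factor_single hg hga
    have hnat : analyticOrderNatAt g a = analyticOrderNatAt f a := by
      simp [analyticOrderNatAt, hgo a ha]
    refine ⟨k, hk, ?_, ?_, fun z => ?_⟩
    · intro ρ hρ
      rcases Finset.mem_insert.1 hρ with rfl | h
      · exact hk0
      · intro h0
        apply hg0 ρ h
        rw [hgk ρ, h0, mul_zero]
    · intro ρ hρ
      rw [mem_insert, not_or] at hρ
      rw [← hgo ρ hρ.2]
      have hp : AnalyticAt ℂ (fun z : ℂ => (z - a) ^ analyticOrderNatAt g a) ρ := by fun_prop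
      have h1 : g = (fun z : ℂ => (z - a) ^ analyticOrderNatAt g a) * k := by
        ext z; simpa using hgk z
      have h2 := analyticOrderAt_mul hp (hk.analyticAt ρ)
      rw [← h1] at h2
      have h3 : analyticOrderAt (fun z : ℂ => (z - a) ^ analyticOrderNatAt g a) ρ = 0 := by
        rw [hp.analyticOrderAt_eq_zero]
        exact pow_ne_zero _ (sub_ne_zero.2 hρ.1)
      rw [h2, h3, zero_add]
    · rw [Finset.prod_insert ha, hfg z, hgk z, hnat]
      ring

lemma norm_deriv_sub_le_of_norm_le {l : ℂ → ℂ} {R C : ℝ} (hR : 0 < R)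
    (hl : DifferentiableOn ℂ l (Metric.ball 0 R)) (hC : ∀ z ∈ Metric.ball (0 : ℂ) R, ‖l z‖ ≤ C)
    {z : ℂ} (hz : ‖z‖ ≤ R / 4) :
    ‖deriv l z - deriv l 0‖ ≤ 8 * C / R ^ 2 * ‖z‖ := by
  have hC0 : 0 ≤ C := (norm_nonneg _).trans (hC 0 (by simpa using hR))
  have hsub : ∀ w ∈ Metric.closedBall (0 : ℂ) (R / 4), ∀ v ∈ Metric.closedBall w (R / 2),
      v ∈ Metric.ball (0 : ℂ) R := by
    intro w hw v hv
    simp only [Metric.mem_closedBall, dist_zero_right, Metric.mem_ball] at *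
    have : ‖v‖ ≤ ‖v - w‖ + ‖w‖ := by simpa using norm_add_le (v - w) w
    rw [dist_eq_norm] at hv
    linarith
  have hd2 : ∀ w ∈ Metric.closedBall (0 : ℂ) (R / 4), ‖deriv (deriv l) w‖ ≤ 8 * C / R ^ 2 := by
    intro w hw
    have h := Complex.norm_iteratedDeriv_le_of_forall_mem_sphere_norm_le (F := ℂ) (c := w)
      (R := R / 2) (C := C) (f := l) 2 (by positivity) ?_ ?_
    · rw [iteratedDeriv_succ, iteratedDeriv_one] at h
      refine h.trans_eq ?_
      norm_num [Nat.factorial]; field_simp; ring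
    · apply DifferentiableOn.diffContOnCl
      apply hl.mono
      intro v hv
      exact hsub w hw v (Metric.closure_ball_subset_closedBall hv)
    · intro v hv
      exact hC v (hsub w hw v (Metric.sphere_subset_closedBall hv))
  have hdiff : ∀ w ∈ Metric.closedBall (0 : ℂ) (R / 4), DifferentiableAt ℂ (deriv l) w := by
    intro w hw
    have hw' : w ∈ Metric.ball (0 : ℂ) R := hsub w hw w (Metric.mem_closedBall_self (by positivity))
    exact ((hl.analyticOnNhd Metric.isOpen_ball).deriv w hw').differentiableAt
  have h := (convex_closedBall (0 : ℂ) (R / 4)).norm_image_sub_le_of_norm_deriv_le hdiff hd2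
    (Metric.mem_closedBall_self (by positivity)) (show z ∈ Metric.closedBall (0 : ℂ) (R / 4) by
      simpa using hz)
  simpa using h

/-- If `f` is entire with `f 0 = 1` and `‖f‖ ≤ exp B` on the disc of radius `2 R`, then the
logarithmic derivative of `f` is, up to a small error, the sum of the fractions of its zeros in the
disc of radius `R`. -/
theorem norm_logDeriv_sub_sum_le {f : ℂ → ℂ} (hf : Differentiable ℂ f) (hf0 : f 0 = 1)
    {R B : ℝ} (hR : 0 < R) (hB : 0 < B) (hfB : ∀ z, ‖z‖ ≤ 2 * R → ‖f z‖ ≤ exp B)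
    (S : Finset ℂ) (hS : ∀ ρ, ρ ∈ S ↔ f ρ = 0 ∧ ‖ρ‖ ≤ R)
    {z : ℂ} (hz : ‖z‖ ≤ R / 8) (hfz : f z ≠ 0) :
    ‖logDeriv f z - logDeriv f 0 - ∑ ρ ∈ S, (analyticOrderNatAt f ρ : ℂ) * (1 / (z - ρ) + 1 / ρ)‖
      ≤ 64 * B / R ^ 2 * ‖z‖ := by
  have hord : ∀ ρ, analyticOrderAt f ρ ≠ ⊤ := by
    intro ρ h
    have h1 : AnalyticOnNhd ℂ f Set.univ := fun w _ => hf.analyticAt w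
    have h2 : ∀ᶠ w in nhds ρ, f w = 0 := analyticOrderAt_eq_top.1 h
    have h3 := h1.eq_of_eventuallyEq (g := fun _ => 0) (fun _ _ => analyticAt_const) (z₀ := ρ) h2
    have : f 0 = 0 := congrFun h3 0
    rw [hf0] at this
    exact one_ne_zero this
  obtain ⟨g, hg, hgS, -, hfg⟩ := exists_factor_finset hf hord S
  have hρ0 : ∀ ρ ∈ S, ρ ≠ 0 := by
    rintro ρ hρ rfl
    have := ((hS 0).1 hρ).1
    rw [hf0] at this
    exact one_ne_zero this
  have hg_ne : ∀ w ∈ Metric.ball (0 : ℂ) R, g w ≠ 0 := by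
    intro w hw h0
    have h1 : f w = 0 := by rw [hfg w, h0, mul_zero]
    exact hgS w ((hS w).2 ⟨h1, by simpa using (Metric.mem_ball.1 hw).le⟩) h0
  have hg0 : g 0 ≠ 0 := hg_ne 0 (by simpa using hR)
  -- bound for `g / g 0`
  have hgb : ∀ w ∈ Metric.ball (0 : ℂ) R, ‖g w / g 0‖ ≤ exp B := by
    have hsphere : ∀ w ∈ frontier (Metric.ball (0 : ℂ) (2 * R)), ‖g w / g 0‖ ≤ exp B := by
      intro w hw
      rw [frontier_ball _ (by positivity)] at hw
      have hwn : ‖w‖ = 2 * R := by simpa using hw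
      have h1 := hfg w
      have h2 := hfg 0
      rw [hf0] at h2
      have hprod : ‖∏ ρ ∈ S, (0 - ρ) ^ analyticOrderNatAt f ρ‖
          ≤ ‖∏ ρ ∈ S, (w - ρ) ^ analyticOrderNatAt f ρ‖ := by
        rw [norm_prod, norm_prod]
        apply Finset.prod_le_prod
        · intros; positivity
        · intro ρ hρ
          rw [norm_pow, norm_pow]
          have := ((hS ρ).1 hρ).2
          have h3 : ‖w‖ ≤ ‖w - ρ‖ + ‖ρ‖ := by simpa using norm_add_le (w - ρ) ρ
          gcongr
          simp only [zero_sub, norm_neg]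
          linarith
      set a := ∏ ρ ∈ S, (w - ρ) ^ analyticOrderNatAt f ρ
      set b := ∏ ρ ∈ S, (0 - ρ) ^ analyticOrderNatAt f ρ
      have hfw := hfB w hwn.le
      have h4 : ‖b‖ * ‖g 0‖ = 1 := by rw [← norm_mul, ← h2, norm_one]
      have hg0' : 0 < ‖g 0‖ := norm_pos_iff.2 hg0
      rw [norm_div, div_le_iff₀ hg0']
      have hb : 0 < ‖b‖ := by
        by_contra hcon
        have : ‖b‖ = 0 := le_antisymm (not_lt.1 hcon) (norm_nonneg _)
        rw [this, zero_mul] at h4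
        exact zero_ne_one h4
      have h5 : ‖a‖ * ‖g w‖ ≤ exp B := by rw [← norm_mul, ← h1]; exact hfw
      have h6 : ‖b‖ * ‖g w‖ ≤ exp B := le_trans (by gcongr) h5
      calc ‖g w‖ = (‖b‖ * ‖g w‖) * ‖g 0‖ := by rw [mul_right_comm, h4, one_mul]
        _ ≤ exp B * ‖g 0‖ := by gcongr
    intro w hw
    refine Complex.norm_le_of_forall_mem_frontier_norm_le Metric.isBounded_ball
      (f := fun w => g w / g 0) (U := Metric.ball (0 : ℂ) (2 * R)) ?_ hsphere ?_
    · exact (hg.div_const _).diffContOnCl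
    · apply subset_closure
      rw [Metric.mem_ball] at *
      linarith
  -- a branch of the logarithm of `g / g 0`
  have hld : DifferentiableOn ℂ (logDeriv g) (Metric.ball 0 R) := by
    intro w hw
    have : DifferentiableAt ℂ (fun w => deriv g w / g w) w :=
      ((hg.analyticAt w).deriv.differentiableAt).div (hg w) (hg_ne w hw)
    exact this.differentiableWithinAt
  obtain ⟨l, hl0, hl⟩ := (hld.isExactOn_ball).with_val_at 0 0
  have hldiff : DifferentiableOn ℂ l (Metric.ball 0 R) := fun w hw =>
    (hl w hw).differentiableAt.differentiableWithinAt
  have hexp : ∀ w ∈ Metric.ball (0 : ℂ) R, Complex.exp (l w) = g w / g 0 := by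
    have hconst : ∀ w ∈ Metric.ball (0 : ℂ) R,
        Complex.exp (-l w) * g w = Complex.exp (-l 0) * g 0 := by
      intro w hw
      refine Metric.isOpen_ball.is_const_of_deriv_eq_zero (𝕜 := ℂ)
        (f := fun w => Complex.exp (-l w) * g w)
        (convex_ball (0 : ℂ) R).isPreconnected ?_ ?_ hw (by simpa using hR)
      · intro v hv
        exact ((((hl v hv).differentiableAt).neg.cexp).mul (hg v)).differentiableWithinAt
      · intro v hv
        have h1 : HasDerivAt (fun w => Complex.exp (-l w) * g w)
            (Complex.exp (-l v) * (-logDeriv g v) * g v + Complex.exp (-l v) * deriv g v) v :=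
          ((hl v hv).neg.cexp).mul (hg v).hasDerivAt
        rw [h1.deriv, logDeriv_apply]
        have := hg_ne v hv
        simp only [Pi.zero_apply]
        field_simp
        ring
    intro w hw
    have h := hconst w hw
    rw [hl0, neg_zero, Complex.exp_zero, one_mul, Complex.exp_neg] at h
    have h2 := Complex.exp_ne_zero (l w)
    field_simp at h ⊢
    rw [h]
  have hre : Set.MapsTo l (Metric.ball 0 R) {w | w.re ≤ B} := by
    intro w hw
    have h := hgb w hw
    rw [← hexp w hw, Complex.norm_exp] at h
    exact Real.exp_le_exp.1 h
  have hl2 : ∀ w ∈ Metric.ball (0 : ℂ) (R / 2), ‖l w‖ ≤ 2 * B := by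
    intro w hw
    have hwn : ‖w‖ < R / 2 := by simpa using hw
    have hw' : w ∈ Metric.ball (0 : ℂ) R := by
      rw [Metric.mem_ball] at *
      linarith
    have h := Complex.borelCaratheodory_zero hB hldiff hre hR hw' hl0
    refine h.trans ?_
    rw [div_le_iff₀ (by linarith)]
    nlinarith [norm_nonneg w]
  have hmain := norm_deriv_sub_le_of_norm_le (l := l) (R := R / 2) (C := 2 * B) (by positivity)
    (hldiff.mono (Metric.ball_subset_ball (by linarith))) hl2 (z := z) (by linarith)
  have hzR : z ∈ Metric.ball (0 : ℂ) R := by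
    rw [Metric.mem_ball, dist_zero_right]
    linarith
  have h0R : (0 : ℂ) ∈ Metric.ball (0 : ℂ) R := by simpa using hR
  rw [(hl z hzR).deriv, (hl 0 h0R).deriv] at hmain
  have hlog : ∀ w ∈ Metric.ball (0 : ℂ) R, f w ≠ 0 →
      logDeriv f w = ∑ ρ ∈ S, (analyticOrderNatAt f ρ : ℂ) * (1 / (w - ρ)) + logDeriv g w := by
    intro w hw hfw
    have h1 : f = fun w => (∏ ρ ∈ S, (w - ρ) ^ analyticOrderNatAt f ρ) * g w := funext hfg
    have hne : ∀ ρ ∈ S, (w - ρ) ≠ 0 := by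
      intro ρ hρ h
      rw [sub_eq_zero] at h
      exact hfw (h ▸ ((hS ρ).1 hρ).1)
    have hd : ∀ ρ ∈ S, DifferentiableAt ℂ (fun w : ℂ => (w - ρ) ^ analyticOrderNatAt f ρ) w :=
      fun ρ _ => by fun_prop
    conv_lhs => rw [h1]
    rw [logDeriv_mul (f := fun w => ∏ ρ ∈ S, (w - ρ) ^ analyticOrderNatAt f ρ) (g := g) w
      (Finset.prod_ne_zero_iff.2 fun ρ hρ => pow_ne_zero _ (hne ρ hρ)) (hg_ne w hw)
      (by fun_prop) (hg w), logDeriv_prod (f := fun ρ w => (w - ρ) ^ analyticOrderNatAt f ρ)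
        (fun ρ hρ => pow_ne_zero _ (hne ρ hρ)) hd]
    congr 1
    apply sum_congr rfl
    intro ρ hρ
    have h2 : DifferentiableAt ℂ (fun w : ℂ => w - ρ) w := by fun_prop
    rw [logDeriv_fun_pow h2, logDeriv_apply]
    simp
  rw [hlog z hzR hfz, hlog 0 h0R (by rw [hf0]; exact one_ne_zero)]
  have heq : ∑ ρ ∈ S, (analyticOrderNatAt f ρ : ℂ) * (1 / (z - ρ)) + logDeriv g z -
      (∑ ρ ∈ S, (analyticOrderNatAt f ρ : ℂ) * (1 / (0 - ρ)) + logDeriv g 0) -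
      ∑ ρ ∈ S, (analyticOrderNatAt f ρ : ℂ) * (1 / (z - ρ) + 1 / ρ) = logDeriv g z - logDeriv g 0 := by
    have : ∑ ρ ∈ S, (analyticOrderNatAt f ρ : ℂ) * (1 / (z - ρ) + 1 / ρ) =
        ∑ ρ ∈ S, (analyticOrderNatAt f ρ : ℂ) * (1 / (z - ρ)) -
        ∑ ρ ∈ S, (analyticOrderNatAt f ρ : ℂ) * (1 / (0 - ρ)) := by
      rw [← sum_sub_distrib]
      apply sum_congr rfl
      intro ρ _
      rw [zero_sub, one_div_neg_eq_neg_one_div]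
      ring
    rw [this]
    ring
  rw [heq]
  refine hmain.trans_eq ?_
  field_simp
  ring

end Landau

/-! ### The Riemann xi function -/

section Xi

open HurwitzZeta in
lemma exists_nonneg_f_modif : ∃ φ : ℝ → ℝ, (∀ x, 0 ≤ φ x) ∧
    (hurwitzEvenFEPair 0).f_modif = fun x => ((φ x : ℝ) : ℂ) := by
  have h1 : ∀ x : ℝ, 0 < x → 1 ≤ evenKernel 0 x := by
    intro x hx
    have h := hasSum_int_evenKernel 0 hx
    have h2 := h.summable.sum_le_tsum {(0 : ℤ)} (fun _ _ => (Real.exp_pos _).le)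
    rw [h.tsum_eq] at h2
    simpa using h2
  refine ⟨fun x => (Set.Ioi 1).indicator (fun x => evenKernel 0 x - 1) x +
    (Set.Ioo 0 1).indicator (fun x => evenKernel 0 x - x ^ (-(1 / 2) : ℝ)) x, fun x => ?_, ?_⟩
  · apply add_nonneg
    · apply Set.indicator_nonneg
      intro x hx
      linarith [h1 x (zero_lt_one.trans hx)]
    · apply Set.indicator_nonneg
      intro x hx
      rw [evenKernel_functional_equation, ← evenKernel_eq_cosKernel_of_zero,
        Real.rpow_neg hx.1.le]
      have h2 := h1 (1 / x) (one_div_pos.2 hx.1)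
      have h3 : 0 < x ^ (1 / 2 : ℝ) := Real.rpow_pos_of_pos hx.1 _
      rw [← one_div, sub_nonneg]
      exact le_mul_of_one_le_right (by positivity) h2
  · ext x
    simp only [WeakFEPair.f_modif, hurwitzEvenFEPair, Pi.add_apply, Complex.ofReal_add]
    congr 1
    · by_cases hx : x ∈ Set.Ioi (1 : ℝ)
      · simp [Set.indicator_of_mem hx]
      · simp [Set.indicator_of_notMem hx]
    · by_cases hx : x ∈ Set.Ioo (0 : ℝ) 1
      · simp only [Set.indicator_of_mem hx]
        simp
      · simp [Set.indicator_of_notMem hx]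

open HurwitzZeta in
lemma norm_completedRiemannZeta₀_le {A : ℝ} {s : ℂ} (h1 : 1 - A ≤ s.re) (h2 : s.re ≤ A) :
    ‖completedRiemannZeta₀ s‖ ≤ 2 * ‖completedRiemannZeta₀ A‖ := by
  obtain ⟨φ, hφ, hf⟩ := exists_nonneg_f_modif
  set P := hurwitzEvenFEPair 0 with hP
  have hconv : ∀ w : ℂ, MellinConvergent P.f_modif w := fun w =>
    (P.isStrongFEPair_toStrongFEPair.hasMellin w).1
  have key : ∀ r : ℝ, mellin P.f_modif (r : ℂ) = ((∫ x in Set.Ioi (0 : ℝ), x ^ (r - 1) * φ x : ℝ) : ℂ) := by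
    intro r
    rw [mellin, ← integral_complex_ofReal]
    refine MeasureTheory.setIntegral_congr_fun measurableSet_Ioi fun x hx => ?_
    simp only [hf, smul_eq_mul, Complex.ofReal_mul, Complex.ofReal_cpow (le_of_lt hx)]
    push_cast
    rfl
  have hInt : ∀ r : ℝ, MeasureTheory.IntegrableOn (fun x => x ^ (r - 1) * φ x) (Set.Ioi 0) := by
    intro r
    have h := hconv r
    rw [MellinConvergent] at h
    have h' := h.re
    refine MeasureTheory.IntegrableOn.congr_fun h' (fun x hx => ?_) measurableSet_Ioi
    simp only [hf, smul_eq_mul]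
    have : ((x : ℂ) ^ ((r : ℂ) - 1)) = ((x ^ (r - 1) : ℝ) : ℂ) := by
      rw [Complex.ofReal_cpow (le_of_lt hx)]; push_cast; rfl
    rw [this, ← Complex.ofReal_mul]
    simp
  have hnn : ∀ r : ℝ, 0 ≤ ∫ x in Set.Ioi (0 : ℝ), x ^ (r - 1) * φ x := fun r =>
    MeasureTheory.setIntegral_nonneg measurableSet_Ioi fun x hx =>
      mul_nonneg (Real.rpow_nonneg (le_of_lt hx) _) (hφ x)
  have hnorm : ∀ r : ℝ, ‖mellin P.f_modif (r : ℂ)‖ = ∫ x in Set.Ioi (0 : ℝ), x ^ (r - 1) * φ x := by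
    intro r
    rw [key, Complex.norm_real, Real.norm_of_nonneg (hnn r)]
  have hle : ‖mellin P.f_modif (s / 2)‖ ≤
      ‖mellin P.f_modif ((A / 2 : ℝ) : ℂ)‖ + ‖mellin P.f_modif (((1 - A) / 2 : ℝ) : ℂ)‖ := by
    rw [hnorm, hnorm, ← MeasureTheory.integral_add (hInt _) (hInt _), mellin]
    refine (MeasureTheory.norm_integral_le_integral_norm _).trans ?_
    refine MeasureTheory.setIntegral_mono_on (hconv _).norm ((hInt _).add (hInt _))
      measurableSet_Ioi fun x hx => ?_
    have hx' : (0 : ℝ) < x := hx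
    simp only [hf, norm_smul, Complex.norm_real, Real.norm_of_nonneg (hφ x)]
    rw [← add_mul]
    apply mul_le_mul_of_nonneg_right _ (hφ x)
    rw [Complex.norm_cpow_eq_rpow_re_of_pos hx']
    have hre : (s / 2 - 1).re = s.re / 2 - 1 := by simp
    rw [hre]
    rcases le_total 1 x with h | h
    · have : x ^ (s.re / 2 - 1) ≤ x ^ (A / 2 - 1) := Real.rpow_le_rpow_of_exponent_le h (by linarith)
      have := Real.rpow_nonneg hx'.le ((1 - A) / 2 - 1)
      linarith
    · have : x ^ (s.re / 2 - 1) ≤ x ^ ((1 - A) / 2 - 1) :=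
        Real.rpow_le_rpow_of_exponent_ge hx' h (by linarith)
      have := Real.rpow_nonneg hx'.le (A / 2 - 1)
      linarith
  have hdef : ∀ w : ℂ, completedRiemannZeta₀ w = mellin P.f_modif (w / 2) / 2 := fun w => rfl
  have hsymm : ‖mellin P.f_modif (((1 - A) / 2 : ℝ) : ℂ)‖ = ‖mellin P.f_modif ((A / 2 : ℝ) : ℂ)‖ := by
    have h := completedRiemannZeta₀_one_sub (A : ℂ)
    rw [hdef, hdef] at h
    have h' := mul_right_cancel₀ (b := (2 : ℂ)⁻¹) (by norm_num)
      (by simpa only [div_eq_mul_inv] using h)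
    push_cast
    simp only [div_eq_mul_inv]
    rw [h']
  rw [hdef, hdef, norm_div, norm_div]
  rw [hsymm] at hle
  push_cast at hle
  have : (0 : ℝ) < ‖(2 : ℂ)‖ := by simp
  rw [← mul_div_assoc]
  gcongr
  linarith

/-- The entire function `s (s - 1) π^(-s/2) Γ(s/2) ζ(s)`. -/
noncomputable def xi (s : ℂ) : ℂ := s * (s - 1) * completedRiemannZeta₀ s + 1

lemma differentiable_xi : Differentiable ℂ xi := by
  have := differentiable_completedZeta₀
  unfold xi
  fun_prop

lemma xi_zero : xi 0 = 1 := by simp [xi]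

lemma xi_one_sub (s : ℂ) : xi (1 - s) = xi s := by
  simp only [xi, completedRiemannZeta₀_one_sub]; ring

lemma xi_eq {s : ℂ} (h0 : s ≠ 0) (h1 : s ≠ 1) : xi s = s * (s - 1) * completedRiemannZeta s := by
  rw [xi, completedRiemannZeta_eq]
  have : (1 - s) ≠ 0 := sub_ne_zero.2 h1.symm
  field_simp
  ring

lemma xi_eq_zeta {s : ℂ} (h0 : s ≠ 0) (h1 : s ≠ 1) (hG : Complex.Gammaℝ s ≠ 0) :
    xi s = s * (s - 1) * (Complex.Gammaℝ s * riemannZeta s) := by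
  rw [xi_eq h0 h1, riemannZeta_def_of_ne_zero h0]
  field_simp

lemma zero_re_of_xi_eq_zero {s : ℂ} (h : xi s = 0) : 0 < s.re ∧ s.re < 1 := by
  have key : ∀ s : ℂ, xi s = 0 → s.re < 1 := by
    intro s h
    by_contra hcon
    push Not at hcon
    have h0 : s ≠ 0 := by rintro rfl; simp at hcon; linarith
    have h1 : s ≠ 1 := by
      rintro rfl
      rw [← sub_zero (1 : ℂ), xi_one_sub, xi_zero] at h
      exact one_ne_zero h
    have hG : Complex.Gammaℝ s ≠ 0 := Complex.Gammaℝ_ne_zero_of_re_pos (by linarith)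
    rw [xi_eq_zeta h0 h1 hG] at h
    have hz := riemannZeta_ne_zero_of_one_le_re hcon
    have := sub_ne_zero.2 h1
    simp_all
  refine ⟨?_, key s h⟩
  have := key (1 - s) (by rw [xi_one_sub, h])
  simp at this
  exact this

lemma xi_ne_zero_of_one_le_re {s : ℂ} (h : 1 ≤ s.re) : xi s ≠ 0 := fun h0 => by
  linarith [(zero_re_of_xi_eq_zero h0).2]

lemma norm_xi_le {N : ℕ} (hN : 2 ≤ N) {s : ℂ} (hs : ‖s‖ ≤ 2 * N - 1) :
    ‖xi s‖ ≤ exp ((N + 2) * log N + 4) := by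
  have hN' : (2 : ℝ) ≤ N := by exact_mod_cast hN
  have habs := abs_le.1 (Complex.abs_re_le_norm s)
  have hb := norm_completedRiemannZeta₀_le (A := 2 * N) (s := s) (by linarith) (by linarith)
  have hA : ‖completedRiemannZeta₀ ((2 * N : ℝ) : ℂ)‖ ≤ 3 * (N : ℝ) ^ N := by
    have h0 : ((2 * N : ℝ) : ℂ) ≠ 0 := by
      norm_cast; positivity
    have h1 := completedRiemannZeta_eq ((2 * N : ℝ) : ℂ)
    have h2 : completedRiemannZeta ((2 * N : ℝ) : ℂ) =
        Complex.Gammaℝ ((2 * N : ℝ) : ℂ) * riemannZeta ((2 * N : ℝ) : ℂ) := by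
      rw [riemannZeta_def_of_ne_zero h0]
      have : Complex.Gammaℝ ((2 * N : ℝ) : ℂ) ≠ 0 :=
        Complex.Gammaℝ_ne_zero_of_re_pos (by simp; linarith)
      field_simp
    have h3 : ‖Complex.Gammaℝ ((2 * N : ℝ) : ℂ)‖ ≤ (N : ℝ) ^ N := by
      rw [Complex.Gammaℝ_def, norm_mul]
      have e1 : ‖(π : ℂ) ^ (-((2 * N : ℝ) : ℂ) / 2)‖ ≤ 1 := by
        rw [Complex.norm_cpow_eq_rpow_re_of_pos Real.pi_pos]
        apply Real.rpow_le_one_of_one_le_of_nonpos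
        · linarith [Real.pi_gt_three]
        · simp
          linarith
      have e2 : ‖Complex.Gamma (((2 * N : ℝ) : ℂ) / 2)‖ ≤ (N : ℝ) ^ N := by
        have : (((2 * N : ℝ) : ℂ) / 2) = ((N - 1 : ℕ) : ℂ) + 1 := by
          rw [Nat.cast_sub (by omega)]; push_cast; ring
        rw [this, Complex.Gamma_nat_eq_factorial, Complex.norm_natCast]
        norm_cast
        exact (Nat.factorial_le (Nat.sub_le N 1)).trans (Nat.factorial_le_pow N)
      calc _ ≤ 1 * (N : ℝ) ^ N := by gcongr
        _ = _ := one_mul _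
    have h4 : ‖riemannZeta ((2 * N : ℝ) : ℂ)‖ ≤ 2 := by
      have e := zeta_nat_eq_tsum_of_gt_one (k := 2 * N) (by omega)
      have e2 : ((2 * N : ℝ) : ℂ) = ((2 * N : ℕ) : ℂ) := by push_cast; rfl
      rw [e2, e]
      have hs2 : HasSum (fun n : ℕ => 1 / (n : ℝ) ^ 2) (π ^ 2 / 6) := hasSum_zeta_two
      have hle : ∀ n : ℕ, ‖1 / (n : ℂ) ^ (2 * N)‖ ≤ 1 / (n : ℝ) ^ 2 := by
        intro n
        rcases Nat.eq_zero_or_pos n with rfl | hn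
        · have : (2 * N) ≠ 0 := by omega
          simp [this]
        · rw [norm_div, norm_pow, Complex.norm_natCast, norm_one]
          have : (1 : ℝ) ≤ n := by exact_mod_cast hn
          have := pow_le_pow_right₀ this (show 2 ≤ 2 * N by omega)
          gcongr
      refine (tsum_of_norm_bounded hs2 hle).trans ?_
      have := Real.pi_lt_d2
      nlinarith [Real.pi_pos]
    have h5 : completedRiemannZeta₀ ((2 * N : ℝ) : ℂ) =
        Complex.Gammaℝ ((2 * N : ℝ) : ℂ) * riemannZeta ((2 * N : ℝ) : ℂ)
          + ((1 / (2 * N) + 1 / (1 - 2 * N) : ℝ) : ℂ) := by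
      rw [← h2, h1]; push_cast; ring
    rw [h5]
    refine (norm_add_le _ _).trans ?_
    rw [norm_mul, Complex.norm_real]
    have h6 : ‖(1 / (2 * N) + 1 / (1 - 2 * N) : ℝ)‖ ≤ 1 := by
      rw [Real.norm_eq_abs, abs_le]
      have a1 : (0 : ℝ) < 1 / (2 * N) := by positivity
      have a2 : (1 : ℝ) / (2 * N) ≤ 1 := by
        rw [div_le_one (by positivity)]; linarith
      have a3 : (1 : ℝ) / (1 - 2 * N) < 0 := one_div_neg.2 (by linarith)
      have a4 : -1 ≤ (1 : ℝ) / (1 - 2 * N) := by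
        rw [le_div_iff_of_neg (by linarith)]; linarith
      constructor <;> linarith
    have h7 : (1 : ℝ) ≤ (N : ℝ) ^ N := one_le_pow₀ (by linarith)
    have h8 : ‖Complex.Gammaℝ ((2 * N : ℝ) : ℂ)‖ * ‖riemannZeta ((2 * N : ℝ) : ℂ)‖ ≤ (N : ℝ) ^ N * 2 := by
      gcongr
    linarith
  have hexp : exp ((N + 2) * log N + 4) = exp 4 * (N : ℝ) ^ (N + 2) := by
    rw [Real.exp_add, mul_comm]
    congr 1
    rw [mul_comm, ← Real.rpow_def_of_pos (by linarith)]
    norm_cast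
  have he4 : (50 : ℝ) ≤ exp 4 := by
    have := Real.exp_one_gt_d9
    have h : exp 4 = exp 1 ^ 4 := by rw [← Real.exp_nat_mul]; norm_num
    rw [h]
    calc (50 : ℝ) ≤ 2.7 ^ 4 := by norm_num
      _ ≤ _ := by gcongr; linarith
  rw [hexp, xi]
  refine (norm_add_le _ _).trans ?_
  rw [norm_mul, norm_mul, norm_one]
  have hs1 : ‖s - 1‖ ≤ 2 * N := by
    refine (norm_sub_le _ _).trans ?_
    rw [norm_one]; linarith
  push_cast at hb hA
  have h9 : ‖completedRiemannZeta₀ s‖ ≤ 6 * (N : ℝ) ^ N := by linarith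
  have h10 : (1 : ℝ) ≤ (N : ℝ) ^ (N + 2) := one_le_pow₀ (by linarith)
  calc ‖s‖ * ‖s - 1‖ * ‖completedRiemannZeta₀ s‖ + 1
      ≤ (2 * N) * (2 * N) * (6 * (N : ℝ) ^ N) + 1 := by
        gcongr; linarith
    _ = 24 * (N : ℝ) ^ (N + 2) + 1 := by ring
    _ ≤ exp 4 * (N : ℝ) ^ (N + 2) := by nlinarith

end Xi

/-! ### The partial fraction expansion of the logarithmic derivative of xi -/

section PartialFractions

open Filter Topology ComplexConjugate

lemma finite_xi_zeros (R : ℝ) : {ρ : ℂ | xi ρ = 0 ∧ ‖ρ‖ ≤ R}.Finite := by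
  have hz := AnalyticOnNhd.preimage_zero_mem_codiscrete (f := xi) (x := 0)
    (fun z _ => differentiable_xi.analyticAt z) (by rw [xi_zero]; exact one_ne_zero)
  rw [mem_codiscrete'] at hz
  have hcl : IsClosed (xi ⁻¹' {0}) := by simpa using hz.1
  have hK : IsCompact (Metric.closedBall (0 : ℂ) R ∩ xi ⁻¹' {0}) :=
    (isCompact_closedBall 0 R).inter_right hcl
  refine (hK.finite ?_).subset ?_
  · have : IsDiscrete (xi ⁻¹' {0}) := by simpa using hz.2
    exact this.mono Set.inter_subset_right
  · rintro ρ ⟨h1, h2⟩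
    exact ⟨by simpa using h2, h1⟩

/-- The zeros of `xi` of norm at most `N - 1/2`. -/
noncomputable def xiZeros (N : ℕ) : Finset ℂ := (finite_xi_zeros (N - 1 / 2)).toFinset

lemma mem_xiZeros {N : ℕ} {ρ : ℂ} : ρ ∈ xiZeros N ↔ xi ρ = 0 ∧ ‖ρ‖ ≤ N - 1 / 2 := by
  simp [xiZeros]

/-- The multiplicity of a zero of `xi`. -/
noncomputable def xiOrd (ρ : ℂ) : ℝ := analyticOrderNatAt xi ρ

lemma xiOrd_nonneg (ρ : ℂ) : 0 ≤ xiOrd ρ := Nat.cast_nonneg _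

lemma one_le_xiOrd {ρ : ℂ} (h : xi ρ = 0) : 1 ≤ xiOrd ρ := by
  have han : AnalyticAt ℂ xi ρ := differentiable_xi.analyticAt ρ
  have htop : analyticOrderAt xi ρ ≠ ⊤ := by
    intro htop
    rw [analyticOrderAt_eq_top] at htop
    have := AnalyticOnNhd.eqOn_zero_of_preconnected_of_eventuallyEq_zero (U := Set.univ)
      (fun z _ => differentiable_xi.analyticAt z) isPreconnected_univ (Set.mem_univ ρ) htop
    have := this (Set.mem_univ (0 : ℂ))
    rw [xi_zero] at this
    exact one_ne_zero this
  have h0 : analyticOrderAt xi ρ ≠ 0 := by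
    rw [ne_eq, han.analyticOrderAt_eq_zero]
    simp [h]
  have : analyticOrderNatAt xi ρ ≠ 0 := by
    intro h1
    rw [← Nat.cast_analyticOrderNatAt htop, h1] at h0
    simp at h0
  rw [xiOrd]
  exact_mod_cast Nat.one_le_iff_ne_zero.2 this

lemma xiZeros_mono {M N : ℕ} (h : M ≤ N) : xiZeros M ⊆ xiZeros N := by
  intro ρ hρ
  rw [mem_xiZeros] at hρ ⊢
  have : (M : ℝ) ≤ N := by exact_mod_cast h
  exact ⟨hρ.1, by linarith [hρ.2]⟩

lemma exists_subset_xiZeros (S : Finset ℂ) (hS : ∀ ρ ∈ S, xi ρ = 0) : ∃ N, S ⊆ xiZeros N := by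
  obtain ⟨N, hN⟩ := exists_nat_ge (∑ ρ ∈ S, ‖ρ‖ + 1 / 2)
  refine ⟨N, fun ρ hρ => mem_xiZeros.2 ⟨hS ρ hρ, ?_⟩⟩
  have := Finset.single_le_sum (f := fun ρ : ℂ => ‖ρ‖) (fun _ _ => norm_nonneg _) hρ
  linarith

/-- The error in the truncated partial fraction expansion. -/
noncomputable def xiErr (N : ℕ) : ℝ := 64 * ((N + 2) * log N + 4) / (N - 1 / 2) ^ 2

lemma tendsto_xiErr : Tendsto xiErr atTop (𝓝 0) := by
  have h1 : Tendsto (fun x : ℝ => log x / x) atTop (𝓝 0) := by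
    simpa using Real.tendsto_pow_log_div_mul_add_atTop 1 0 1 one_ne_zero
  have h2 : Tendsto (fun x : ℝ => 1 / x) atTop (𝓝 0) := by
    simpa using tendsto_inv_atTop_zero (𝕜 := ℝ)
  have h3 : Tendsto (fun x : ℝ => 64 * ((1 + 2 * (1 / x)) * (log x / x) + 4 * (1 / x) * (1 / x)) /
      (1 - 1 / 2 * (1 / x)) ^ 2) atTop (𝓝 (64 * ((1 + 2 * 0) * 0 + 4 * 0 * 0) / (1 - 1 / 2 * 0) ^ 2)) := by
    refine Tendsto.div (tendsto_const_nhds.mul ?_) ?_ (by norm_num)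
    · exact ((tendsto_const_nhds.add (h2.const_mul 2)).mul h1).add ((h2.const_mul 4).mul h2)
    · exact (tendsto_const_nhds.sub (h2.const_mul _)).pow 2
  have h4 := h3.comp tendsto_natCast_atTop_atTop
  have e : (64 * ((1 + 2 * 0) * 0 + 4 * 0 * 0) / (1 - 1 / 2 * 0) ^ 2 : ℝ) = 0 := by norm_num
  rw [e] at h4
  refine h4.congr' ?_
  filter_upwards [eventually_ge_atTop 1] with N hN
  have hN' : (1 : ℝ) ≤ N := by exact_mod_cast hN
  simp only [Function.comp, xiErr]
  have : (N : ℝ) - 1 / 2 ≠ 0 := by linarith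
  have h5 : (1 - 1 / 2 * (1 / (N : ℝ))) ≠ 0 := by
    have : 1 / (N : ℝ) ≤ 1 := by rw [div_le_one (by linarith)]; exact hN'
    linarith
  have h6 : (N : ℝ) ≠ 0 := by linarith
  have h7 : (N : ℝ) - 1 / 2 = N * (1 - 1 / 2 * (1 / (N : ℝ))) := by field_simp
  rw [h7]
  field_simp

lemma norm_logDeriv_xi_sub_le {N : ℕ} (hN : 2 ≤ N) {z : ℂ} (hz : ‖z‖ ≤ (N - 1 / 2) / 8)
    (hx : xi z ≠ 0) : ‖logDeriv xi z - logDeriv xi 0 -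
      ∑ ρ ∈ xiZeros N, (xiOrd ρ : ℂ) * (1 / (z - ρ) + 1 / ρ)‖ ≤ xiErr N * ‖z‖ := by
  have hN' : (2 : ℝ) ≤ N := by exact_mod_cast hN
  have hlog : 0 ≤ log N := Real.log_nonneg (by linarith)
  have := norm_logDeriv_sub_sum_le (f := xi) (R := N - 1 / 2) (B := (N + 2) * log N + 4)
    (S := xiZeros N) (z := z) differentiable_xi xi_zero (by linarith) (by positivity)
    (fun w hw => norm_xi_le hN (by linarith)) (fun ρ => mem_xiZeros) hz hx
  simpa [xiErr, xiOrd] using this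

lemma tendsto_sum_logDeriv_xi {z : ℂ} (hx : xi z ≠ 0) :
    Tendsto (fun N => ∑ ρ ∈ xiZeros N, (xiOrd ρ : ℂ) * (1 / (z - ρ) + 1 / ρ)) atTop
      (𝓝 (logDeriv xi z - logDeriv xi 0)) := by
  rw [tendsto_iff_norm_sub_tendsto_zero]
  have h : Tendsto (fun N => xiErr N * ‖z‖) atTop (𝓝 0) := by
    simpa using tendsto_xiErr.mul_const ‖z‖
  refine squeeze_zero' (Eventually.of_forall fun _ => norm_nonneg _) ?_ h
  obtain ⟨M, hM⟩ := exists_nat_ge (8 * ‖z‖ + 1 / 2)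
  filter_upwards [eventually_ge_atTop M, eventually_ge_atTop 2] with N h1 h2
  rw [norm_sub_rev]
  have : (M : ℝ) ≤ N := by exact_mod_cast h1
  exact norm_logDeriv_xi_sub_le h2 (by linarith) hx

lemma Gammaℝ_conj (s : ℂ) : Complex.Gammaℝ (conj s) = conj (Complex.Gammaℝ s) := by
  rw [Complex.Gammaℝ_def, Complex.Gammaℝ_def, map_mul, ← Complex.Gamma_conj]
  congr 1
  · have h := Complex.cpow_conj (π : ℂ) (-s / 2) (by
      rw [Complex.arg_ofReal_of_nonneg Real.pi_pos.le]; exact Real.pi_pos.ne)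
    rw [Complex.conj_ofReal] at h
    rw [← h, map_div₀, map_neg, map_ofNat]
  · rw [map_div₀, map_ofNat]

lemma xi_conj (s : ℂ) : xi (conj s) = conj (xi s) := by
  have key : ∀ s : ℂ, 0 < s.re → xi (conj s) = conj (xi s) := by
    intro s hs
    by_cases h1 : s = 1
    · subst h1
      have : xi 1 = 1 := by simpa [xi_zero] using xi_one_sub 0
      simp [this]
    · have h0 : s ≠ 0 := by rintro rfl; simp at hs
      rw [xi_eq_zeta h0 h1 (Complex.Gammaℝ_ne_zero_of_re_pos hs),
        xi_eq_zeta (by simpa using h0)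
        (fun h => h1 (by simpa using congrArg conj h)) (Complex.Gammaℝ_ne_zero_of_re_pos (by simpa using hs)), riemannZeta_conj, Gammaℝ_conj]
      simp
  rcases lt_or_ge 0 s.re with h | h
  · exact key s h
  · rw [← xi_one_sub (conj s), ← xi_one_sub s]
    have := key (1 - s) (by simp; linarith)
    simpa using this

lemma logDeriv_xi_conj (s : ℂ) : logDeriv xi (conj s) = conj (logDeriv xi s) := by
  have hd : deriv xi (conj s) = conj (deriv xi s) := by
    have h := (differentiable_xi s).hasDerivAt.conj_conj
    have e : (conj ∘ xi ∘ conj : ℂ → ℂ) = xi := by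
      ext z; simp [xi_conj]
    rw [e] at h
    exact h.deriv
  rw [logDeriv_apply, logDeriv_apply, hd, xi_conj, map_div₀]

lemma logDeriv_xi_one_sub (s : ℂ) : logDeriv xi (1 - s) = -logDeriv xi s := by
  have h : HasDerivAt (fun z => xi (1 - z)) (-deriv xi (1 - s)) s := by
    have := (differentiable_xi (1 - s)).hasDerivAt.comp s ((hasDerivAt_id s).const_sub 1)
    simpa [Function.comp_def] using this
  have e : (fun z => xi (1 - z)) = xi := by ext z; exact xi_one_sub z
  rw [e] at h
  rw [logDeriv_apply, logDeriv_apply, h.deriv, xi_one_sub]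
  ring

/-- The contribution of `ρ` and its mirror image `1 - conj ρ` to the real part of `ξ'/ξ`. -/
noncomputable def pairKernel (z ρ : ℂ) : ℝ := (1 / (z - ρ)).re + (1 / (z - (1 - conj ρ))).re

lemma tendsto_sum_pairKernel {z : ℂ} (hx : xi z ≠ 0) :
    Tendsto (fun N => ∑ ρ ∈ xiZeros N, xiOrd ρ * pairKernel z ρ) atTop
      (𝓝 (2 * (logDeriv xi z).re)) := by
  have hx' : xi (1 - conj z) ≠ 0 := by
    rw [xi_one_sub, xi_conj]; simpa using hx
  have h := (Complex.continuous_re.tendsto _).comp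
    ((tendsto_sum_logDeriv_xi hx).sub (tendsto_sum_logDeriv_xi hx'))
  have e : (logDeriv xi z - logDeriv xi 0 - (logDeriv xi (1 - conj z) - logDeriv xi 0)).re =
      2 * (logDeriv xi z).re := by
    rw [logDeriv_xi_one_sub, logDeriv_xi_conj]
    simp; ring
  rw [e] at h
  refine h.congr fun N => ?_
  simp only [Function.comp]
  rw [← sum_sub_distrib, Complex.re_sum]
  refine sum_congr rfl fun ρ _ => ?_
  rw [← mul_sub, Complex.re_ofReal_mul, pairKernel]
  congr 1
  have e2 : (1 / (1 - conj z - ρ)).re = -(1 / (z - (1 - conj ρ))).re := by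
    rw [← Complex.conj_re, ← Complex.neg_re]
    congr 1
    rw [map_div₀, ← div_neg]
    simp
    ring_nf
  simp only [Complex.sub_re, Complex.add_re, e2]
  ring

lemma pairKernel_eq {z ρ : ℂ} (h1 : z ≠ ρ) (h2 : z ≠ 1 - conj ρ) :
    pairKernel z ρ = 2 * (z.re - 1 / 2) * ((z.re - 1 / 2) ^ 2 - (ρ.re - 1 / 2) ^ 2 + (z.im - ρ.im) ^ 2)
      / (((z.re - 1 / 2) ^ 2 - (ρ.re - 1 / 2) ^ 2 + (z.im - ρ.im) ^ 2) ^ 2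
        + 4 * (ρ.re - 1 / 2) ^ 2 * (z.im - ρ.im) ^ 2) := by
  have a1 : Complex.normSq (z - ρ) ≠ 0 := by simpa [sub_eq_zero] using h1
  have a2 : Complex.normSq (z - (1 - conj ρ)) ≠ 0 := by simpa [sub_eq_zero] using h2
  have e : ((z.re - 1 / 2) ^ 2 - (ρ.re - 1 / 2) ^ 2 + (z.im - ρ.im) ^ 2) ^ 2
        + 4 * (ρ.re - 1 / 2) ^ 2 * (z.im - ρ.im) ^ 2 =
      Complex.normSq (z - ρ) * Complex.normSq (z - (1 - conj ρ)) := by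
    simp [Complex.normSq_apply]; ring
  rw [e, pairKernel, eq_div_iff (mul_ne_zero a1 a2)]
  simp only [one_div, Complex.inv_re]
  field_simp
  simp [Complex.normSq_apply]
  ring

lemma pairKernel_nonneg {z ρ : ℂ} (hz : 1 ≤ z.re) (hρ : xi ρ = 0) : 0 ≤ pairKernel z ρ := by
  have h := zero_re_of_xi_eq_zero hρ
  rw [pairKernel, one_div, one_div, Complex.inv_re, Complex.inv_re]
  have h1 : 0 ≤ (z - ρ).re := by simp; linarith
  have h2 : 0 ≤ (z - (1 - conj ρ)).re := by simp; linarith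
  exact add_nonneg (div_nonneg h1 (Complex.normSq_nonneg _)) (div_nonneg h2 (Complex.normSq_nonneg _))

lemma sum_pairKernel_le {z : ℂ} (hz : 1 ≤ z.re) (S : Finset ℂ) (hS : ∀ ρ ∈ S, xi ρ = 0) :
    ∑ ρ ∈ S, xiOrd ρ * pairKernel z ρ ≤ 2 * (logDeriv xi z).re := by
  obtain ⟨M, hM⟩ := exists_subset_xiZeros S hS
  refine ge_of_tendsto (tendsto_sum_pairKernel (xi_ne_zero_of_one_le_re hz)) ?_
  filter_upwards [eventually_ge_atTop M] with N hN
  refine sum_le_sum_of_subset_of_nonneg (hM.trans (xiZeros_mono hN)) fun ρ hρ _ => ?_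
  exact mul_nonneg (xiOrd_nonneg ρ) (pairKernel_nonneg hz (mem_xiZeros.1 hρ).1)

lemma xi_one_sub_conj_eq_zero {ρ : ℂ} (h : xi ρ = 0) : xi (1 - conj ρ) = 0 := by
  rw [xi_one_sub, xi_conj, h, map_zero]

lemma pairKernel_mirror (z ρ : ℂ) : pairKernel z (1 - conj ρ) = pairKernel z ρ := by
  simp [pairKernel]; ring

/-- An off-line zero counts twice, through its mirror image. -/
lemma pairKernel_add_sum_le {z ρ : ℂ} (hz : 1 ≤ z.re) (hρ : xi ρ = 0) (hoff : ρ.re ≠ 1 / 2)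
    (S : Finset ℂ) (hS : ∀ ρ ∈ S, xi ρ = 0 ∧ ρ.re = 1 / 2) :
    pairKernel z ρ + ∑ ρ ∈ S, (1 / (z - ρ)).re ≤ (logDeriv xi z).re := by
  classical
  have hne : ρ ≠ 1 - conj ρ := by
    intro h
    apply hoff
    have := congrArg Complex.re h
    simp at this
    linarith
  have hon : ∀ ρ ∈ S, pairKernel z ρ = 2 * (1 / (z - ρ)).re := by
    intro ρ hρ
    have : 1 - conj ρ = ρ := by
      have h := (hS ρ hρ).2
      apply Complex.ext <;> simp [h]; norm_num
    rw [pairKernel, this]; ring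
  have hρS : ρ ∉ insert (1 - conj ρ) S := by
    rw [mem_insert, not_or]
    exact ⟨hne, fun h => hoff (hS ρ h).2⟩
  have hρS' : 1 - conj ρ ∉ S := by
    intro h
    apply hoff
    have := (hS _ h).2
    simp at this
    linarith
  have h := sum_pairKernel_le hz (insert ρ (insert (1 - conj ρ) S)) (by
    intro w hw
    rw [mem_insert, mem_insert] at hw
    rcases hw with rfl | rfl | hw
    · exact hρ
    · exact xi_one_sub_conj_eq_zero hρ
    · exact (hS w hw).1)
  rw [sum_insert hρS, sum_insert hρS', pairKernel_mirror] at h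
  have h1 := mul_le_mul_of_nonneg_right (one_le_xiOrd hρ) (pairKernel_nonneg hz hρ)
  have h2 := mul_le_mul_of_nonneg_right (one_le_xiOrd (xi_one_sub_conj_eq_zero hρ)) (pairKernel_nonneg hz hρ)
  have h3 : ∑ ρ ∈ S, 2 * (1 / (z - ρ)).re ≤ ∑ ρ ∈ S, xiOrd ρ * pairKernel z ρ := by
    refine sum_le_sum fun w hw => ?_
    rw [← hon w hw]
    have := mul_le_mul_of_nonneg_right (one_le_xiOrd (hS w hw).1) (pairKernel_nonneg hz (hS w hw).1)
    linarith
  rw [← mul_sum] at h3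
  linarith

lemma logDeriv_xi_zero_re : (logDeriv xi 0).re ≤ 0 := by
  have h := sum_pairKernel_le (z := 1) (by simp) ∅ (by simp)
  have h2 := logDeriv_xi_one_sub 1
  rw [sub_self] at h2
  rw [h2]
  simp at h ⊢
  exact h

lemma logDeriv_xi_ofReal (x : ℝ) : logDeriv xi x = ((logDeriv xi x).re : ℂ) := by
  have h := logDeriv_xi_conj x
  rw [Complex.conj_ofReal] at h
  exact (Complex.conj_eq_iff_re.1 h.symm).symm

end PartialFractions

/-! ### The digamma function and the logarithmic derivative of zeta -/

section Digamma

open Filter Topology Complex MeasureTheory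

lemma tendsto_deriv_of_bounded {F : ℕ → ℂ → ℂ} {f : ℂ → ℂ} {c : ℂ} {r C : ℝ} (hr : 0 < r)
    (hF : ∀ᶠ n in atTop, DifferentiableOn ℂ (F n) (Metric.closedBall c r))
    (hf : DifferentiableOn ℂ f (Metric.closedBall c r))
    (hb : ∀ᶠ n in atTop, ∀ z ∈ Metric.sphere c r, ‖F n z‖ ≤ C)
    (hlim : ∀ z ∈ Metric.sphere c r, Tendsto (fun n => F n z) atTop (𝓝 (f z))) :
    Tendsto (fun n => deriv (F n) c) atTop (𝓝 (deriv f c)) := by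
  have hpi : (2 * π * I : ℂ) ≠ 0 := by simp [Real.pi_ne_zero]
  have key : ∀ g : ℂ → ℂ, DifferentiableOn ℂ g (Metric.closedBall c r) →
      deriv g c = (2 * π * I)⁻¹ * ∮ z in C(c, r), (1 / (z - c) ^ 2) • g z := by
    intro g hg
    rw [hg.deriv_eq_smul_circleIntegral hr, smul_eq_mul, ← mul_assoc, inv_mul_cancel₀ hpi, one_mul]
  rw [key f hf]
  have hT : Tendsto (fun n => ∮ z in C(c, r), (1 / (z - c) ^ 2) • F n z) atTop
      (𝓝 (∮ z in C(c, r), (1 / (z - c) ^ 2) • f z)) := by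
    have hmem : ∀ θ : ℝ, circleMap c r θ ∈ Metric.sphere c r := circleMap_mem_sphere c hr.le
    have hnorm : ∀ θ : ℝ, ‖circleMap c r θ - c‖ = r := fun θ => by
      simpa [dist_eq_norm] using hmem θ
    refine intervalIntegral.tendsto_integral_filter_of_dominated_convergence
      (fun _ => r * (1 / r ^ 2 * C)) ?_ ?_ intervalIntegrable_const ?_
    · filter_upwards [hF] with n hn
      refine Continuous.aestronglyMeasurable ?_
      have h1 : Continuous fun θ => F n (circleMap c r θ) :=
        hn.continuousOn.comp_continuous (continuous_circleMap c r)
          fun θ => Metric.sphere_subset_closedBall (hmem θ)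
      have h2 : Continuous fun θ => 1 / (circleMap c r θ - c) ^ 2 := by
        refine continuous_const.div (by fun_prop) fun θ => ?_
        have := hnorm θ
        intro h0
        rw [pow_eq_zero_iff two_ne_zero] at h0
        rw [h0, norm_zero] at this
        exact hr.ne this
      have h3 : Continuous fun θ => deriv (circleMap c r) θ := by
        simp only [deriv_circleMap]
        fun_prop
      exact h3.smul (h2.smul h1)
    · filter_upwards [hb] with n hn
      refine Eventually.of_forall fun θ _ => ?_
      rw [norm_smul, norm_smul, norm_div, norm_pow, hnorm θ, norm_one]
      have : ‖deriv (circleMap c r) θ‖ = r := by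
        simp [deriv_circleMap, abs_of_pos hr]
      rw [this]
      gcongr
      exact hn _ (hmem θ)
    · refine Eventually.of_forall fun θ _ => ?_
      exact ((hlim _ (hmem θ)).const_smul _).const_smul _
  refine (hT.const_mul _).congr' ?_
  filter_upwards [hF] with n hn
  rw [key _ hn]

lemma norm_GammaSeq_le {z : ℂ} (hz : 0 < z.re) {n : ℕ} (hn : n ≠ 0) :
    ‖Complex.GammaSeq z n‖ ≤ Real.Gamma z.re := by
  rw [GammaSeq_eq_approx_Gamma_integral hz hn, Real.Gamma_eq_integral hz]
  have hInt := Real.GammaIntegral_convergent hz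
  have hn0 : (0 : ℝ) ≤ n := n.cast_nonneg
  have h1 : ‖∫ x : ℝ in (0 : ℝ)..n, (((1 - x / n) ^ n : ℝ) : ℂ) * (x : ℂ) ^ (z - 1)‖ ≤
      ∫ x : ℝ in (0 : ℝ)..n, Real.exp (-x) * x ^ (z.re - 1) := by
    refine intervalIntegral.norm_integral_le_of_norm_le hn0 ?_ ?_
    · refine Eventually.of_forall fun x hx => ?_
      rw [norm_mul, Complex.norm_real, norm_cpow_eq_rpow_re_of_pos hx.1]
      have hpos : 0 ≤ 1 - x / n := by
        rw [sub_nonneg, div_le_one (by positivity)]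
        exact hx.2
      rw [Real.norm_of_nonneg (pow_nonneg hpos _)]
      simp only [sub_re, one_re]
      exact mul_le_mul_of_nonneg_right (Real.one_sub_div_pow_le_exp_neg hx.2)
        (Real.rpow_nonneg hx.1.le _)
    · rw [intervalIntegrable_iff_integrableOn_Ioc_of_le hn0]
      exact hInt.mono_set Set.Ioc_subset_Ioi_self
  refine h1.trans ?_
  rw [intervalIntegral.integral_of_le hn0]
  refine setIntegral_mono_set hInt ?_ (Eventually.of_forall Set.Ioc_subset_Ioi_self)
  rw [EventuallyLE, ae_restrict_iff' measurableSet_Ioi]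
  exact Eventually.of_forall fun x hx =>
    mul_nonneg (Real.exp_pos _).le (Real.rpow_nonneg (le_of_lt hx) _)

lemma add_natCast_ne_zero {z : ℂ} (hz : 0 < z.re) (j : ℕ) : z + j ≠ 0 := by
  intro h
  have := congrArg Complex.re h
  simp at this
  have hj : (0 : ℝ) ≤ j := j.cast_nonneg
  linarith

lemma hasDerivAt_GammaSeq {z : ℂ} (hz : 0 < z.re) {n : ℕ} (hn : n ≠ 0) :
    HasDerivAt (fun w => Complex.GammaSeq w n)
      (Complex.GammaSeq z n * (Complex.log n - ∑ j ∈ range (n + 1), 1 / (z + j))) z := by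
  have hnC : (n : ℂ) ≠ 0 := by exact_mod_cast hn
  have hprod : ∏ j ∈ range (n + 1), (z + (j : ℂ)) ≠ 0 :=
    Finset.prod_ne_zero_iff.2 fun j _ => add_natCast_ne_zero hz j
  have hfac : (n.factorial : ℂ) ≠ 0 := by exact_mod_cast n.factorial_ne_zero
  have hA : DifferentiableAt ℂ (fun w : ℂ => (n : ℂ) ^ w * n.factorial) z :=
    ((hasDerivAt_id z).const_cpow (Or.inl hnC)).differentiableAt.mul_const _
  have hB : DifferentiableAt ℂ (fun w : ℂ => ∏ j ∈ range (n + 1), (w + (j : ℂ))) z := by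
    fun_prop
  have hne : (n : ℂ) ^ z * n.factorial ≠ 0 := by
    simp [hfac, hnC, cpow_eq_zero_iff]
  have hd : DifferentiableAt ℂ (fun w => Complex.GammaSeq w n) z := by
    unfold Complex.GammaSeq
    exact hA.div hB hprod
  have hlog : logDeriv (fun w => Complex.GammaSeq w n) z =
      Complex.log n - ∑ j ∈ range (n + 1), 1 / (z + j) := by
    unfold Complex.GammaSeq
    rw [logDeriv_div z hne hprod hA hB, logDeriv_mul_const z _ hfac]
    congr 1
    · have : HasDerivAt (fun w : ℂ => (n : ℂ) ^ w) ((n : ℂ) ^ z * Complex.log n * 1) z :=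
        (hasDerivAt_id z).const_cpow (Or.inl hnC)
      rw [logDeriv_apply, this.deriv]
      have h0 : (n : ℂ) ^ z ≠ 0 := by simp [hnC, cpow_eq_zero_iff]
      field_simp
    · rw [logDeriv_prod (fun j _ => add_natCast_ne_zero hz j) (fun j _ => by fun_prop)]
      refine sum_congr rfl fun j _ => ?_
      rw [logDeriv_apply]
      simp
  have hG : Complex.GammaSeq z n ≠ 0 := div_ne_zero hne hprod
  have := hd.hasDerivAt
  rw [logDeriv_apply] at hlog
  rw [← hlog]
  rwa [mul_div_cancel₀ _ hG]

lemma tendsto_digamma {w : ℂ} (hw : 0 < w.re) :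
    Tendsto (fun n : ℕ => Complex.log n - ∑ j ∈ range (n + 1), 1 / (w + j)) atTop
      (𝓝 (digamma w)) := by
  have hre : ∀ z ∈ Metric.closedBall w (w.re / 2), w.re / 2 ≤ z.re ∧ z.re ≤ 3 * w.re / 2 := by
    intro z hz
    rw [Metric.mem_closedBall, dist_eq_norm] at hz
    have := abs_le.1 ((abs_re_le_norm (z - w)).trans hz)
    simp only [sub_re] at this
    constructor <;> linarith
  obtain ⟨C, hC⟩ : ∃ C, ∀ x ∈ Set.Icc (w.re / 2) (3 * w.re / 2), Real.Gamma x ≤ C := by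
    have hc : ContinuousOn Real.Gamma (Set.Icc (w.re / 2) (3 * w.re / 2)) := fun x hx =>
      (Real.differentiableAt_Gamma fun m => by
        have := hx.1
        have hm : (0 : ℝ) ≤ m := m.cast_nonneg
        linarith).continuousAt.continuousWithinAt
    obtain ⟨C, hC⟩ := isCompact_Icc.bddAbove_image hc
    exact ⟨C, fun x hx => hC ⟨x, hx, rfl⟩⟩
  have hder := tendsto_deriv_of_bounded (F := fun n z => Complex.GammaSeq z n) (f := Complex.Gamma)
    (c := w) (r := w.re / 2) (C := C) (by linarith) ?_ ?_ ?_ fun z _ => GammaSeq_tendsto_Gamma z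
  · have hG := GammaSeq_tendsto_Gamma w
    have hne := Gamma_ne_zero_of_re_pos hw
    refine (hder.div hG hne).congr' ?_
    filter_upwards [eventually_ne_atTop 0] with n hn
    rw [Pi.div_apply, (hasDerivAt_GammaSeq hw hn).deriv, mul_div_cancel_left₀]
    refine div_ne_zero ?_ (Finset.prod_ne_zero_iff.2 fun j _ => add_natCast_ne_zero hw j)
    have hnC : (n : ℂ) ≠ 0 := by exact_mod_cast hn
    have hfac : (n.factorial : ℂ) ≠ 0 := by exact_mod_cast n.factorial_ne_zero
    simp [hfac, hnC, cpow_eq_zero_iff]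
  · filter_upwards [eventually_ne_atTop 0] with n hn z hz
    exact (hasDerivAt_GammaSeq (by linarith [(hre z hz).1]) hn).differentiableAt.differentiableWithinAt
  · intro z hz
    refine (differentiableAt_Gamma z fun m h => ?_).differentiableWithinAt
    have := (hre z hz).1
    rw [h] at this
    simp at this
    have hm : (0 : ℝ) ≤ m := m.cast_nonneg
    linarith
  · filter_upwards [eventually_ne_atTop 0] with n hn z hz
    have h := hre z (Metric.sphere_subset_closedBall hz)
    exact (norm_GammaSeq_le (by linarith) hn).trans (hC _ h)

lemma tendsto_digamma_re {w : ℂ} (hw : 0 < w.re) :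
    Tendsto (fun n : ℕ => Real.log n - ∑ j ∈ range (n + 1), (w.re + j) / ((w.re + j) ^ 2 + w.im ^ 2))
      atTop (𝓝 (digamma w).re) := by
  refine ((continuous_re.tendsto _).comp (tendsto_digamma hw)).congr fun n => ?_
  simp only [Function.comp, sub_re, re_sum]
  congr 1
  · rw [← natCast_log, ofReal_re]
  · refine sum_congr rfl fun j _ => ?_
    simp [Complex.inv_re, normSq_apply, sq]

lemma tendsto_log_sub_log_sq (a y : ℝ) :
    Tendsto (fun n : ℕ => Real.log n - 1 / 2 * Real.log ((n + a) ^ 2 + y ^ 2)) atTop (𝓝 0) := by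
  have h2 : Tendsto (fun x : ℝ => 1 / x) atTop (𝓝 0) := by
    simpa using tendsto_inv_atTop_zero (𝕜 := ℝ)
  have h3 : Tendsto (fun x : ℝ => (1 + a * (1 / x)) ^ 2 + (y * (1 / x)) ^ 2) atTop
      (𝓝 ((1 + a * 0) ^ 2 + (y * 0) ^ 2)) :=
    ((tendsto_const_nhds.add (h2.const_mul a)).pow 2).add ((h2.const_mul y).pow 2)
  have e : ((1 + a * 0) ^ 2 + (y * 0) ^ 2 : ℝ) = 1 := by ring
  rw [e] at h3
  have h4 := ((h3.log one_ne_zero).const_mul (-(1 / 2))).comp tendsto_natCast_atTop_atTop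
  rw [Real.log_one, mul_zero] at h4
  refine h4.congr' ?_
  have h5 : ∀ᶠ n : ℕ in atTop, (0 : ℝ) < n + a := by
    obtain ⟨N, hN⟩ := exists_nat_gt (-a)
    filter_upwards [eventually_ge_atTop N] with n hn
    have : (N : ℝ) ≤ n := by exact_mod_cast hn
    linarith
  filter_upwards [eventually_ge_atTop 1, h5] with n hn hpos
  have hn' : (0 : ℝ) < n := by exact_mod_cast hn
  have e2 : ((n : ℝ) + a) ^ 2 + y ^ 2 = n ^ 2 * ((1 + a * (1 / n)) ^ 2 + (y * (1 / n)) ^ 2) := by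
    field_simp
  have hne : (1 + a * (1 / (n : ℝ))) ^ 2 + (y * (1 / n)) ^ 2 ≠ 0 := by
    intro h0
    rw [h0, mul_zero] at e2
    have : 0 < ((n : ℝ) + a) ^ 2 + y ^ 2 := by positivity
    exact this.ne' e2
  simp only [Function.comp]
  rw [e2, Real.log_mul (by positivity) hne, Real.log_pow]
  push_cast
  ring

lemma artanh_le {q : ℝ} (h0 : 0 ≤ q) (h1 : q ≤ 1 / 4) :
    1 / 2 * Real.log ((1 + q) / (1 - q)) ≤ q + 2 / 5 * q ^ 3 := by
  have h := Real.log_div_le_sum_range_add h0 (by linarith) 2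
  simp only [sum_range_succ, sum_range_zero] at h
  norm_num at h
  have h2 : q ^ 5 / (1 - q ^ 2) ≤ 1 / 15 * q ^ 3 := by
    have hq2 : q ^ 2 ≤ 1 / 16 := by nlinarith
    rw [div_le_iff₀ (by linarith)]
    have : q ^ 3 * q ^ 2 ≤ q ^ 3 * (1 / 16) := mul_le_mul_of_nonneg_left hq2 (by positivity)
    nlinarith
  linarith

/-- The midpoint rule for the real part of `1 / (u + iy)`. -/
lemma midpoint_log_bounds {u y : ℝ} (hu : 1 / 2 < u) (hy : 2 ≤ y) :
    1 / 2 * Real.log ((u + 1 / 2) ^ 2 + y ^ 2) - 1 / 2 * Real.log ((u - 1 / 2) ^ 2 + y ^ 2)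
      ≤ u / (u ^ 2 + y ^ 2) + 2 / 5 / y * (1 / (u ^ 2 + y ^ 2)) ∧
    u / (u ^ 2 + y ^ 2) - 1 / 8 / y * (1 / (u ^ 2 + y ^ 2)) ≤
      1 / 2 * Real.log ((u + 1 / 2) ^ 2 + y ^ 2) - 1 / 2 * Real.log ((u - 1 / 2) ^ 2 + y ^ 2) := by
  set q := u / (u ^ 2 + y ^ 2 + 1 / 4) with hq
  have hu0 : 0 < u := by linarith
  have hD : 0 < u ^ 2 + y ^ 2 + 1 / 4 := by positivity
  have hD' : 0 < u ^ 2 + y ^ 2 := by positivity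
  have hq0 : 0 ≤ q := by positivity
  have hq1 : q ≤ 1 / (2 * y) := by
    rw [hq, div_le_div_iff₀ hD (by positivity)]
    nlinarith [sq_nonneg (u - y)]
  have hq2 : q ≤ 1 / 4 := hq1.trans (by
    rw [div_le_div_iff₀ (by positivity) (by norm_num)]; linarith)
  have e : 1 / 2 * Real.log ((u + 1 / 2) ^ 2 + y ^ 2) - 1 / 2 * Real.log ((u - 1 / 2) ^ 2 + y ^ 2) =
      1 / 2 * Real.log ((1 + q) / (1 - q)) := by
    rw [← mul_sub, ← Real.log_div (by positivity) (by positivity)]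
    congr 2
    have h1 : 1 - q ≠ 0 := by linarith
    have h2 : (u - 1 / 2) ^ 2 + y ^ 2 ≠ 0 := by positivity
    rw [div_eq_div_iff h2 h1, hq]
    field_simp
    ring
  have hqf : q ≤ u / (u ^ 2 + y ^ 2) := by
    rw [hq]; exact div_le_div_of_nonneg_left hu0.le hD' (by linarith)
  rw [e]
  constructor
  · refine (artanh_le hq0 hq2).trans ?_
    have h3 : q ^ 2 ≤ 1 / (u ^ 2 + y ^ 2) := by
      rw [hq, div_pow, div_le_div_iff₀ (by positivity) hD']
      nlinarith
    have h4 : q ^ 3 ≤ 1 / y * (1 / (u ^ 2 + y ^ 2)) := by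
      have : q ≤ 1 / y := hq1.trans (by gcongr; linarith)
      calc q ^ 3 = q * q ^ 2 := by ring
        _ ≤ _ := by gcongr
    have e5 : 2 / 5 / y * (1 / (u ^ 2 + y ^ 2)) = 2 / 5 * (1 / y * (1 / (u ^ 2 + y ^ 2))) := by ring
    rw [e5]
    linarith
  · have h := Real.sum_range_le_log_div hq0 (by linarith) 1
    simp at h
    have h6 : u / (u ^ 2 + y ^ 2) - q ≤ 1 / 8 / y * (1 / (u ^ 2 + y ^ 2)) := by
      have e6 : u / (u ^ 2 + y ^ 2) - q = u / 4 / (u ^ 2 + y ^ 2 + 1 / 4) * (1 / (u ^ 2 + y ^ 2)) := by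
        rw [hq]; field_simp; ring
      rw [e6]
      refine mul_le_mul_of_nonneg_right ?_ (by positivity)
      rw [div_div, div_div, div_le_div_iff₀ (by positivity) (by positivity)]
      nlinarith [sq_nonneg (u - y)]
    simp only [one_div] at h h6 ⊢
    linarith

lemma sum_one_div_sq_add_sq_le {x y : ℝ} (hx : 1 ≤ x) (hy : 2 ≤ y) (n : ℕ) :
    ∑ j ∈ range n, 1 / ((x + j) ^ 2 + y ^ 2) ≤ 2 / y := by
  have hstep : ∀ j : ℕ, 1 / ((x + j) ^ 2 + y ^ 2) ≤ 2 * (1 / (y + j)) - 2 * (1 / (y + (j + 1 : ℕ))) := by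
    intro j
    have hj : (0 : ℝ) ≤ j := j.cast_nonneg
    push_cast
    rw [← mul_sub, div_sub_div _ _ (by positivity) (by positivity), mul_div_assoc',
      div_le_div_iff₀ (by positivity) (by positivity)]
    nlinarith [sq_nonneg (x + j - y), mul_nonneg hj (sub_nonneg.2 hx)]
  calc ∑ j ∈ range n, 1 / ((x + j) ^ 2 + y ^ 2)
      ≤ ∑ j ∈ range n, (2 * (1 / (y + j)) - 2 * (1 / (y + (j + 1 : ℕ)))) :=
        sum_le_sum fun j _ => hstep j
    _ = 2 * (1 / (y + (0 : ℕ))) - 2 * (1 / (y + n)) :=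
        sum_range_sub' (fun j : ℕ => 2 * (1 / (y + (j : ℝ)))) n
    _ ≤ 2 / y := by
        have : (0 : ℝ) ≤ 2 * (1 / (y + n)) := by positivity
        have e : 2 * (1 / (y + ((0 : ℕ) : ℝ))) = 2 / y := by push_cast; ring
        linarith

lemma digamma_re_bounds {w : ℂ} (hx : 1 ≤ w.re) (hy : 2 ≤ w.im) :
    (digamma w).re ≤ 1 / 2 * Real.log ((w.re - 1 / 2) ^ 2 + w.im ^ 2) + 4 / 5 / w.im ^ 2 ∧
    1 / 2 * Real.log ((w.re - 1 / 2) ^ 2 + w.im ^ 2) - 1 / 4 / w.im ^ 2 ≤ (digamma w).re := by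
  set x := w.re
  set y := w.im
  have hlim := tendsto_digamma_re (w := w) (by linarith)
  have htele : ∀ n : ℕ, ∑ j ∈ range (n + 1), (1 / 2 * Real.log ((x + j + 1 / 2) ^ 2 + y ^ 2)
      - 1 / 2 * Real.log ((x + j - 1 / 2) ^ 2 + y ^ 2)) =
      1 / 2 * Real.log ((n + (x + 1 / 2)) ^ 2 + y ^ 2) - 1 / 2 * Real.log ((x - 1 / 2) ^ 2 + y ^ 2) := by
    intro n
    have := sum_range_sub (fun j : ℕ => 1 / 2 * Real.log ((x + j - 1 / 2) ^ 2 + y ^ 2)) (n + 1)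
    push_cast at this
    rw [show x + 0 - 1 / 2 = x - 1 / 2 by ring,
      show x + ((n : ℝ) + 1) - 1 / 2 = n + (x + 1 / 2) by ring] at this
    rw [← this]
    refine sum_congr rfl fun j _ => ?_
    rw [show x + ((j : ℝ) + 1) - 1 / 2 = x + j + 1 / 2 by ring]
  have hmid : ∀ j : ℕ, _ := fun j =>
    midpoint_log_bounds (u := x + j) (y := y) (by have : (0:ℝ) ≤ j := j.cast_nonneg; linarith) hy
  have hy0 : 0 < y := by linarith
  have h0 := tendsto_log_sub_log_sq (x + 1 / 2) y
  constructor
  · have hl : Tendsto (fun n : ℕ => (Real.log n - 1 / 2 * Real.log ((n + (x + 1 / 2)) ^ 2 + y ^ 2)) +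
        (1 / 2 * Real.log ((x - 1 / 2) ^ 2 + y ^ 2) + 4 / 5 / y ^ 2)) atTop
        (𝓝 (0 + (1 / 2 * Real.log ((x - 1 / 2) ^ 2 + y ^ 2) + 4 / 5 / y ^ 2))) := h0.add_const _
    rw [zero_add] at hl
    refine le_of_tendsto_of_tendsto hlim hl (Eventually.of_forall fun n => ?_)
    have h1 := sum_le_sum fun (j : ℕ) (_ : j ∈ range (n + 1)) => (hmid j).1
    rw [htele, sum_add_distrib, ← mul_sum] at h1
    have h2 := mul_le_mul_of_nonneg_left (sum_one_div_sq_add_sq_le hx hy (n + 1))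
      (show 0 ≤ 2 / 5 / y by positivity)
    have e : 2 / 5 / y * (2 / y) = 4 / 5 / y ^ 2 := by field_simp; norm_num
    simp only
    linarith
  · have hl : Tendsto (fun n : ℕ => (Real.log n - 1 / 2 * Real.log ((n + (x + 1 / 2)) ^ 2 + y ^ 2)) +
        (1 / 2 * Real.log ((x - 1 / 2) ^ 2 + y ^ 2) - 1 / 4 / y ^ 2)) atTop
        (𝓝 (0 + (1 / 2 * Real.log ((x - 1 / 2) ^ 2 + y ^ 2) - 1 / 4 / y ^ 2))) := h0.add_const _
    rw [zero_add] at hl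
    refine le_of_tendsto_of_tendsto hl hlim (Eventually.of_forall fun n => ?_)
    have h1 := sum_le_sum fun (j : ℕ) (_ : j ∈ range (n + 1)) => (hmid j).2
    rw [htele, sum_sub_distrib, ← mul_sum] at h1
    have h2 := mul_le_mul_of_nonneg_left (sum_one_div_sq_add_sq_le hx hy (n + 1))
      (show 0 ≤ 1 / 8 / y by positivity)
    have e : 1 / 8 / y * (2 / y) = 1 / 4 / y ^ 2 := by field_simp; norm_num
    simp only
    linarith

lemma digamma_re_le_log_sub {x : ℝ} (hx : 0 < x) :
    (digamma x).re ≤ Real.log x - 1 / (2 * x) := by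
  have hlim := tendsto_digamma_re (w := x) (by simpa using hx)
  have h0 := tendsto_log_sub_log_sq (x + 1) 0
  have h00 : Tendsto (fun n : ℕ => 1 / 2 * (1 / (x + ((n + 1 : ℕ) : ℝ)))) atTop (𝓝 (1 / 2 * 0)) := by
    refine Tendsto.const_mul _ (tendsto_const_nhds.div_atTop ?_)
    exact tendsto_atTop_add_const_left _ _ (tendsto_natCast_atTop_atTop.comp (tendsto_add_atTop_nat 1))
  have hl := (h0.add h00).add_const (Real.log x - 1 / (2 * x))
  rw [mul_zero, zero_add, zero_add] at hl
  refine le_of_tendsto_of_tendsto hlim hl (Eventually.of_forall fun n => ?_)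
  have hstep : ∀ j : ℕ, (Real.log (x + (j + 1 : ℕ)) - 1 / 2 * (1 / (x + (j + 1 : ℕ)))) -
      (Real.log (x + j) - 1 / 2 * (1 / (x + j))) ≤
      ((x : ℂ).re + j) / (((x : ℂ).re + j) ^ 2 + (x : ℂ).im ^ 2) := by
    intro j
    have hj : (0 : ℝ) ≤ j := j.cast_nonneg
    set u := x + j with hu
    have hp : 0 < u := by positivity
    simp only [Complex.ofReal_re, Complex.ofReal_im, ← hu]
    have e : x + ((j + 1 : ℕ) : ℝ) = u + 1 := by push_cast; ring
    rw [e]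
    have h1 := Real.log_div_le_sum_range_add (x := 1 / (2 * u + 1)) (by positivity)
      (by rw [div_lt_one (by positivity)]; linarith) 0
    have e2 : (1 + 1 / (2 * u + 1)) / (1 - 1 / (2 * u + 1)) = (u + 1) / u := by
      field_simp
      ring
    rw [e2, Real.log_div (by positivity) hp.ne'] at h1
    simp only [Finset.range_zero, sum_empty, zero_add, mul_zero, pow_one] at h1
    have e3 : 1 / (2 * u + 1) / (1 - (1 / (2 * u + 1)) ^ 2) = 1 / 4 * (1 / u + 1 / (u + 1)) := by
      have : (2 * u + 1) ^ 2 - 1 ≠ 0 := by nlinarith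
      have h3 : 1 - (1 / (2 * u + 1)) ^ 2 = ((2 * u + 1) ^ 2 - 1) / (2 * u + 1) ^ 2 := by
        field_simp
      rw [h3]
      field_simp
      ring
    rw [e3] at h1
    have e4 : u / (u ^ 2 + 0 ^ 2) = 1 / u := by field_simp; simp
    rw [e4]
    linarith
  have h1 := sum_le_sum fun (j : ℕ) (_ : j ∈ range (n + 1)) => hstep j
  rw [sum_range_sub (fun j : ℕ => Real.log (x + j) - 1 / 2 * (1 / (x + j)))] at h1
  have e : (1 : ℝ) / 2 * Real.log ((n + (x + 1)) ^ 2 + 0 ^ 2) = Real.log (x + (n + 1 : ℕ)) := by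
    rw [show ((n : ℝ) + (x + 1)) ^ 2 + 0 ^ 2 = (x + (n + 1 : ℕ)) ^ 2 by push_cast; ring, Real.log_pow]
    push_cast; ring
  have e5 : 1 / (2 * x) = 1 / 2 * (1 / x) := by field_simp
  have key : Real.log (x + ((n + 1 : ℕ) : ℝ)) - 1 / 2 * (1 / (x + ((n + 1 : ℕ) : ℝ))) - (Real.log x - 1 / (2 * x)) ≤
    ∑ j ∈ range (n + 1), ((x : ℂ).re + j) / (((x : ℂ).re + j) ^ 2 + (x : ℂ).im ^ 2) := by
    rw [e5]; simpa using h1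
  simp only
  rw [e]
  linarith

lemma digamma_re_le_log {x : ℝ} (hx : 0 < x) : (digamma x).re ≤ Real.log x := by
  have : 0 ≤ 1 / (2 * x) := by positivity
  linarith [digamma_re_le_log_sub hx]

/-- The logarithmic derivative of zeta in terms of the zeros. -/
lemma neg_logDeriv_zeta_eq {s : ℂ} (hs : 1 < s.re) :
    -deriv riemannZeta s / riemannZeta s =
      1 / (s - 1) + 1 / 2 * digamma (s / 2 + 1) - 1 / 2 * (Real.log π : ℂ) - logDeriv xi s := by
  have hs0 : s ≠ 0 := by rintro rfl; simp at hs; linarith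
  have hs1 : s ≠ 1 := by rintro rfl; simp at hs
  have hz : riemannZeta s ≠ 0 := riemannZeta_ne_zero_of_one_le_re hs.le
  have hev : xi =ᶠ[𝓝 s] fun z => 2 * (z - 1) * ((π : ℂ) ^ (-z / 2)) * (Complex.Gamma (z / 2 + 1)) * riemannZeta z := by
    have : {z : ℂ | 1 < z.re} ∈ 𝓝 s := (isOpen_lt continuous_const continuous_re).mem_nhds hs
    filter_upwards [this] with z hz
    have hz' : 1 < z.re := hz
    have hz0 : z ≠ 0 := by rintro rfl; simp at hz'; linarith
    have hz1 : z ≠ 1 := by rintro rfl; simp at hz'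
    rw [xi_eq_zeta hz0 hz1 (Gammaℝ_ne_zero_of_re_pos (by linarith)), Gammaℝ_def,
      Complex.Gamma_add_one _ (by simpa using hz0)]
    ring
  have hpi : (π : ℂ) ≠ 0 := by simp [Real.pi_ne_zero]
  have hG : Complex.Gamma (s / 2 + 1) ≠ 0 := Gamma_ne_zero_of_re_pos (by simp; linarith)
  have hre : ∀ m : ℕ, s / 2 + 1 ≠ -m := fun m h => by
    have := congrArg Complex.re h
    simp at this
    have hm : (0 : ℝ) ≤ m := m.cast_nonneg
    linarith
  have d1 : DifferentiableAt ℂ (fun z : ℂ => 2 * (z - 1)) s := by fun_prop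
  have d2 : HasDerivAt (fun z : ℂ => (π : ℂ) ^ (-z / 2)) ((π : ℂ) ^ (-s / 2) * Complex.log π * (-1 / 2)) s :=
    (((hasDerivAt_id s).neg).div_const 2).const_cpow (Or.inl hpi)
  have d3 : HasDerivAt (fun z : ℂ => Complex.Gamma (z / 2 + 1)) (deriv Complex.Gamma (s / 2 + 1) * (1 / 2)) s := by
    have h1 := (differentiableAt_Gamma _ hre).hasDerivAt
    have h2 : HasDerivAt (fun z : ℂ => z / 2 + 1) (1 / 2) s := ((hasDerivAt_id s).div_const 2).add_const 1
    exact h1.comp s h2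
  have d4 : DifferentiableAt ℂ riemannZeta s := differentiableAt_riemannZeta hs1
  have n1 : 2 * (s - 1) ≠ 0 := mul_ne_zero two_ne_zero (sub_ne_zero.2 hs1)
  have n2 : (π : ℂ) ^ (-s / 2) ≠ 0 := by simp [cpow_eq_zero_iff, hpi]
  have h := logDeriv_congr_nhds hev
  have h' := h.eq_of_nhds
  have m1 := logDeriv_mul (f := fun z : ℂ => 2 * (z - 1) * (π : ℂ) ^ (-z / 2) * Complex.Gamma (z / 2 + 1))
    (g := riemannZeta) s (mul_ne_zero (mul_ne_zero n1 n2) hG) hz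
    ((d1.mul d2.differentiableAt).mul d3.differentiableAt) d4
  have m2 := logDeriv_mul (f := fun z : ℂ => 2 * (z - 1) * (π : ℂ) ^ (-z / 2))
    (g := fun z : ℂ => Complex.Gamma (z / 2 + 1)) s (mul_ne_zero n1 n2) hG
    (d1.mul d2.differentiableAt) d3.differentiableAt
  have m3 := logDeriv_mul (f := fun z : ℂ => 2 * (z - 1)) (g := fun z : ℂ => (π : ℂ) ^ (-z / 2))
    s n1 n2 d1 d2.differentiableAt
  rw [m1, m2, m3] at h'
  rw [logDeriv_apply (fun z : ℂ => (π : ℂ) ^ (-z / 2)), d2.deriv,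
    logDeriv_apply (fun z : ℂ => Complex.Gamma (z / 2 + 1)), d3.deriv,
    logDeriv_apply riemannZeta, logDeriv_apply (fun z : ℂ => 2 * (z - 1))] at h'
  have d5 : deriv (fun z : ℂ => 2 * (z - 1)) s = 2 := by
    have : HasDerivAt (fun z : ℂ => 2 * (z - 1)) (2 * 1) s := ((hasDerivAt_id s).sub_const 1).const_mul 2
    rw [this.deriv, mul_one]
  rw [d5] at h'
  rw [h', digamma_def, logDeriv_apply, ofReal_log Real.pi_pos.le]
  have hs2 : s - 1 ≠ 0 := sub_ne_zero.2 hs1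
  field_simp
  ring

end Digamma

/-! ### A zero-free region -/

section ZeroFree

open Filter Topology ComplexConjugate

lemma stechkin_kernel {a A κ b y : ℝ} (ha : 1 / 2 ≤ a) (haA : a ≤ A) (hA : 5 / 4 ≤ A ^ 2)
    (hκ : 0 ≤ κ) (hκA : κ * A ≤ a) (hb : b ^ 2 < 1 / 4) :
    κ * (2 * A * (A ^ 2 - b ^ 2 + y ^ 2) / ((A ^ 2 - b ^ 2 + y ^ 2) ^ 2 + 4 * b ^ 2 * y ^ 2)) ≤
      2 * a * (a ^ 2 - b ^ 2 + y ^ 2) / ((a ^ 2 - b ^ 2 + y ^ 2) ^ 2 + 4 * b ^ 2 * y ^ 2) := by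
  set P := a ^ 2 - b ^ 2 + y ^ 2 with hP
  set Q := A ^ 2 - b ^ 2 + y ^ 2 with hQ
  have hy : 0 ≤ y ^ 2 := sq_nonneg y
  have hb0 : 0 ≤ b ^ 2 := sq_nonneg b
  have ha2 : 1 / 4 ≤ a ^ 2 := by nlinarith
  have hP1 : y ^ 2 < P := by rw [hP]; linarith
  have hQ1 : 1 ≤ Q := by rw [hQ]; linarith
  have hP0 : 0 < P := by linarith
  have hQ0 : 0 < Q := by linarith
  have hPQ : P ≤ Q := by
    have : a ^ 2 ≤ A ^ 2 := by gcongr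
    rw [hP, hQ]; linarith
  have hκA0 : 0 ≤ κ * A := mul_nonneg hκ (by linarith)
  have h1 : 4 * b ^ 2 * y ^ 2 ≤ P * Q := by
    have : 4 * b ^ 2 * y ^ 2 ≤ 1 * y ^ 2 := by gcongr; linarith
    nlinarith
  rw [mul_div_assoc', div_le_div_iff₀ (by positivity) (by positivity)]
  have h2 : 0 ≤ (a - κ * A) * (P * (P * Q + 4 * b ^ 2 * y ^ 2)) := by
    apply mul_nonneg (by linarith); positivity
  have h3 : 0 ≤ (Q - P) * (a * (P * Q) - κ * A * (4 * b ^ 2 * y ^ 2)) := by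
    apply mul_nonneg (by linarith)
    have : κ * A * (4 * b ^ 2 * y ^ 2) ≤ a * (P * Q) := by
      gcongr
    linarith
  nlinarith [h2, h3]

lemma stechkin_pairKernel {z w ρ : ℂ} {κ : ℝ} (hz : 1 ≤ z.re) (hzw : z.re ≤ w.re)
    (hw : 5 / 4 ≤ (w.re - 1 / 2) ^ 2) (him : z.im = w.im) (hκ : 0 ≤ κ)
    (hκA : κ * (w.re - 1 / 2) ≤ z.re - 1 / 2) (hρ : xi ρ = 0) :
    κ * pairKernel w ρ ≤ pairKernel z ρ := by
  have h := zero_re_of_xi_eq_zero hρ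
  have hne : ∀ u : ℂ, 1 ≤ u.re → u ≠ ρ ∧ u ≠ 1 - conj ρ := by
    intro u hu
    constructor
    · rintro rfl; linarith
    · rintro rfl; simp at hu; linarith
  rw [pairKernel_eq (hne z hz).1 (hne z hz).2, pairKernel_eq (hne w (by linarith)).1 (hne w (by linarith)).2,
    ← him]
  exact stechkin_kernel (by linarith) (by linarith) hw hκ hκA (by nlinarith)

lemma stechkin_sum_le {z w : ℂ} {κ : ℝ} (hz : 1 ≤ z.re) (hzw : z.re ≤ w.re)
    (hw : 5 / 4 ≤ (w.re - 1 / 2) ^ 2) (him : z.im = w.im) (hκ : 0 ≤ κ)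
    (hκA : κ * (w.re - 1 / 2) ≤ z.re - 1 / 2) (S : Finset ℂ) (hS : ∀ ρ ∈ S, xi ρ = 0) :
    ∑ ρ ∈ S, xiOrd ρ * (pairKernel z ρ - κ * pairKernel w ρ) ≤
      2 * ((logDeriv xi z).re - κ * (logDeriv xi w).re) := by
  obtain ⟨M, hM⟩ := exists_subset_xiZeros S hS
  have h1 := tendsto_sum_pairKernel (xi_ne_zero_of_one_le_re hz)
  have h2 := tendsto_sum_pairKernel (xi_ne_zero_of_one_le_re (hz.trans hzw))
  have h3 := h1.sub (h2.const_mul κ)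
  rw [show 2 * (logDeriv xi z).re - κ * (2 * (logDeriv xi w).re) =
    2 * ((logDeriv xi z).re - κ * (logDeriv xi w).re) by ring] at h3
  refine ge_of_tendsto h3 ?_
  filter_upwards [eventually_ge_atTop M] with N hN
  rw [mul_sum, ← sum_sub_distrib]
  have e : ∀ ρ, xiOrd ρ * pairKernel z ρ - κ * (xiOrd ρ * pairKernel w ρ) =
    xiOrd ρ * (pairKernel z ρ - κ * pairKernel w ρ) := fun ρ => by ring
  simp only [e]
  refine sum_le_sum_of_subset_of_nonneg (hM.trans (xiZeros_mono hN)) fun ρ hρ _ => ?_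
  exact mul_nonneg (xiOrd_nonneg ρ)
    (sub_nonneg.2 (stechkin_pairKernel hz hzw hw him hκ hκA (mem_xiZeros.1 hρ).1))

lemma stechkin_off_line {z w ρ : ℂ} {κ : ℝ} (hz : 1 ≤ z.re) (hzw : z.re ≤ w.re)
    (hw : 5 / 4 ≤ (w.re - 1 / 2) ^ 2) (him : z.im = w.im) (hκ : 0 ≤ κ)
    (hκA : κ * (w.re - 1 / 2) ≤ z.re - 1 / 2) (hρ : xi ρ = 0) (hoff : ρ.re ≠ 1 / 2) :
    pairKernel z ρ - κ * pairKernel w ρ ≤ (logDeriv xi z).re - κ * (logDeriv xi w).re := by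
  classical
  have hne : ρ ≠ 1 - conj ρ := by
    intro h
    apply hoff
    have := congrArg Complex.re h
    simp at this
    linarith
  have hρ' := xi_one_sub_conj_eq_zero hρ
  have h := stechkin_sum_le hz hzw hw him hκ hκA {ρ, 1 - conj ρ} (by
    intro u hu
    rw [mem_insert, Finset.mem_singleton] at hu
    rcases hu with rfl | rfl
    exacts [hρ, hρ'])
  rw [sum_pair hne, pairKernel_mirror, pairKernel_mirror] at h
  have h0 : 0 ≤ pairKernel z ρ - κ * pairKernel w ρ :=
    sub_nonneg.2 (stechkin_pairKernel hz hzw hw him hκ hκA hρ)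
  have h1 := mul_le_mul_of_nonneg_right (one_le_xiOrd hρ) h0
  have h2 := mul_le_mul_of_nonneg_right (one_le_xiOrd hρ') h0
  linarith

open ArithmeticFunction in
lemma hasSum_neg_logDeriv_zeta_re {s : ℂ} (hs : 1 < s.re) :
    HasSum (fun n : ℕ => vonMangoldt n * (exp (-(s.re * Real.log n)) * Real.cos (s.im * Real.log n)))
      (-deriv riemannZeta s / riemannZeta s).re := by
  have h1 : LSeriesSummable (fun n => (vonMangoldt n : ℂ)) s :=
    ArithmeticFunction.LSeriesSummable_vonMangoldt hs
  have h2 := h1.LSeriesHasSum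
  have h3 := ArithmeticFunction.LSeries_vonMangoldt_eq_deriv_riemannZeta_div hs
  rw [h3] at h2
  refine (Complex.hasSum_re h2).congr_fun fun n => ?_
  rcases Nat.eq_zero_or_pos n with rfl | hn
  · simp
  · have hn' : (n : ℂ) ≠ 0 := by exact_mod_cast hn.ne'
    rw [LSeries.term_of_ne_zero hn.ne', div_eq_mul_inv, ← Complex.cpow_neg, Complex.re_ofReal_mul,
      Complex.cpow_def_of_ne_zero hn', ← Complex.natCast_log, Complex.exp_re,
      Complex.re_ofReal_mul, Complex.im_ofReal_mul, Complex.neg_re, Complex.neg_im, mul_neg, mul_neg,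
      Real.cos_neg, mul_comm s.re, mul_comm s.im]

open ArithmeticFunction in
lemma neg_logDeriv_zeta_re_nonneg {σ : ℝ} (hσ : 1 < σ) :
    0 ≤ (-deriv riemannZeta σ / riemannZeta σ).re := by
  have h := hasSum_neg_logDeriv_zeta_re (s := σ) (by simpa using hσ)
  refine h.nonneg fun n => ?_
  simp only [Complex.ofReal_im, zero_mul, Real.cos_zero, mul_one]
  exact mul_nonneg vonMangoldt_nonneg (Real.exp_pos _).le

lemma trig_poly_nonneg (φ : ℝ) : 0 ≤ (1.361499 : ℝ) * Real.cos (0 * φ) + 2.32362 * Real.cos (1 * φ) +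
    1.42745 * Real.cos (2 * φ) + 0.585 * Real.cos (3 * φ) + 0.125 * Real.cos (4 * φ) := by
  rw [zero_mul, Real.cos_zero, one_mul, Real.cos_two_mul, Real.cos_three_mul,
    show 4 * φ = 2 * (2 * φ) by ring, Real.cos_two_mul (2 * φ), Real.cos_two_mul]
  have : 0 ≤ ((0.9 + Real.cos φ) * (0.27 + Real.cos φ)) ^ 2 := sq_nonneg _
  nlinarith [this]

/-- The combination of logarithmic derivatives used in Stechkin's method. -/
noncomputable def stechkinDiff (κ σ σ₁ t : ℝ) : ℝ :=
  (-deriv riemannZeta ⟨σ, t⟩ / riemannZeta ⟨σ, t⟩).re -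
    κ * (-deriv riemannZeta ⟨σ₁, t⟩ / riemannZeta ⟨σ₁, t⟩).re

open ArithmeticFunction in
lemma stechkin_trig {κ σ σ₁ t : ℝ} (hσ : 1 < σ) (hσ₁ : σ ≤ σ₁) (hκ : κ ≤ 1) :
    0 ≤ (1.361499 : ℝ) * stechkinDiff κ σ σ₁ (0 * t) + 2.32362 * stechkinDiff κ σ σ₁ (1 * t) +
    1.42745 * stechkinDiff κ σ σ₁ (2 * t) + 0.585 * stechkinDiff κ σ σ₁ (3 * t)
      + 0.125 * stechkinDiff κ σ σ₁ (4 * t) := by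
  have h : ∀ u : ℝ, HasSum (fun n : ℕ => vonMangoldt n * ((exp (-(σ * Real.log n)) -
      κ * exp (-(σ₁ * Real.log n))) * Real.cos (u * Real.log n))) (stechkinDiff κ σ σ₁ u) := by
    intro u
    have h1 := hasSum_neg_logDeriv_zeta_re (s := ⟨σ, u⟩) hσ
    have h2 := hasSum_neg_logDeriv_zeta_re (s := ⟨σ₁, u⟩) (hσ.trans_le hσ₁)
    refine (h1.sub (h2.mul_left κ)).congr_fun fun n => ?_
    ring
  have hall := (((((h (0 * t)).mul_left 1.361499).add ((h (1 * t)).mul_left 2.32362)).add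
    ((h (2 * t)).mul_left 1.42745)).add ((h (3 * t)).mul_left 0.585)).add ((h (4 * t)).mul_left 0.125)
  refine hall.nonneg fun n => ?_
  have hp := trig_poly_nonneg (t * Real.log n)
  have hc : 0 ≤ vonMangoldt n * (exp (-(σ * Real.log n)) - κ * exp (-(σ₁ * Real.log n))) := by
    apply mul_nonneg vonMangoldt_nonneg
    have hlog : 0 ≤ Real.log n := Real.log_natCast_nonneg n
    have h1 : exp (-(σ₁ * Real.log n)) ≤ exp (-(σ * Real.log n)) := by
      apply Real.exp_le_exp.2
      have := mul_le_mul_of_nonneg_right hσ₁ hlog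
      linarith
    have h2 := mul_le_mul hκ h1 (Real.exp_pos _).le zero_le_one
    linarith
  have := mul_nonneg hc hp
  refine this.trans (le_of_eq ?_)
  simp only [mul_assoc]
  ring

end ZeroFree

/-! ### A zero-free region, explicit form -/

section ZeroFreeExplicit

open ComplexConjugate

lemma log_pi_bounds : 1.1447 ≤ log π ∧ log π ≤ 1.1448 := by
  have e : log π = log 2 + log (π / 2) := by
    rw [← Real.log_mul (by norm_num) (by positivity)]; congr 1; ring
  have l2 := Real.log_two_gt_d9
  have l2' := Real.log_two_lt_d9
  have p1 := Real.pi_gt_d6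
  have p2 := Real.pi_lt_d6
  constructor
  · have h := Real.sum_range_le_log_div (x := 0.22203) (by norm_num) (by norm_num) 4
    norm_num [sum_range_succ] at h
    have h2 : log (122203 / 77797) ≤ log (π / 2) :=
      Real.log_le_log (by norm_num) (by linarith)
    rw [e]; linarith
  · have h := Real.log_div_le_sum_range_add (x := 0.2220317) (by norm_num) (by norm_num) 4
    norm_num [sum_range_succ] at h
    have h2 : log (π / 2) ≤ log (12220317 / 7779683) :=
      Real.log_le_log (by positivity) (by linarith)
    rw [e]; linarith

lemma log_three_bounds : 1.0986 ≤ log 3 ∧ log 3 ≤ 1.0987 := by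
  have e : log 3 = log 2 + log (3 / 2) := by
    rw [← Real.log_mul (by norm_num) (by norm_num)]; norm_num
  have l2 := Real.log_two_gt_d9
  have l2' := Real.log_two_lt_d9
  have h := Real.sum_range_le_log_div (x := 1 / 5) (by norm_num) (by norm_num) 4
  have h' := Real.log_div_le_sum_range_add (x := 1 / 5) (by norm_num) (by norm_num) 4
  norm_num [sum_range_succ] at h h'
  rw [e]
  constructor <;> linarith

lemma stechkinDiff_le {κ σ σ₁ t : ℝ} (hκ : 0 ≤ κ) (hσ : 1 < σ) (hσ₁ : σ ≤ 11 / 10) (hσσ : σ ≤ σ₁)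
    (ht : 1000 ≤ t) (hκ1 : κ ≤ 1) :
    stechkinDiff κ σ σ₁ t ≤ (1 - κ) / 2 * (log (t / 2) - log π) + 1 / 100000 -
      ((logDeriv xi ⟨σ, t⟩).re - κ * (logDeriv xi ⟨σ₁, t⟩).re) := by
  have key : ∀ u : ℝ, 1 < u → (-deriv riemannZeta ⟨u, t⟩ / riemannZeta ⟨u, t⟩).re =
      (u - 1) / ((u - 1) ^ 2 + t ^ 2) + 1 / 2 * (Complex.digamma ⟨u / 2 + 1, t / 2⟩).re
        - 1 / 2 * log π - (logDeriv xi ⟨u, t⟩).re := by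
    intro u hu
    rw [neg_logDeriv_zeta_eq (s := ⟨u, t⟩) hu]
    have e1 : ((⟨u, t⟩ : ℂ) / 2 + 1) = ⟨u / 2 + 1, t / 2⟩ := by
      apply Complex.ext <;> simp
    have e2 : (1 / ((⟨u, t⟩ : ℂ) - 1)).re = (u - 1) / ((u - 1) ^ 2 + t ^ 2) := by
      rw [one_div, Complex.inv_re, Complex.normSq_apply]
      simp [sq]
    have e3 : (1 / 2 * Complex.digamma ⟨u / 2 + 1, t / 2⟩).re =
        1 / 2 * (Complex.digamma ⟨u / 2 + 1, t / 2⟩).re := by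
      rw [show (1 / 2 : ℂ) = ((1 / 2 : ℝ) : ℂ) by push_cast; rfl, Complex.re_ofReal_mul]
    have e4 : (1 / 2 * (log π : ℂ)).re = 1 / 2 * log π := by
      rw [show (1 / 2 : ℂ) = ((1 / 2 : ℝ) : ℂ) by push_cast; rfl, Complex.re_ofReal_mul,
        Complex.ofReal_re]
    rw [Complex.sub_re, Complex.sub_re, Complex.add_re, e1, e2, e3, e4]
  rw [stechkinDiff, key σ hσ, key σ₁ (by linarith)]
  have hY : (500 : ℝ) ≤ t / 2 := by linarith
  have d1 := (digamma_re_bounds (w := ⟨σ / 2 + 1, t / 2⟩) (by simp; linarith) (by simp; linarith)).1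
  have d2 := (digamma_re_bounds (w := ⟨σ₁ / 2 + 1, t / 2⟩) (by simp; linarith) (by simp; linarith)).2
  simp only at d1 d2
  set Y := t / 2
  have hY2 : (250000 : ℝ) ≤ Y ^ 2 := by nlinarith
  have hY0 : 0 < Y ^ 2 := by linarith
  have l1 : log ((σ / 2 + 1 - 1 / 2) ^ 2 + Y ^ 2) ≤ 2 * log Y + 2 / 250000 := by
    have e : (σ / 2 + 1 - 1 / 2) ^ 2 + Y ^ 2 = Y ^ 2 * (1 + (σ / 2 + 1 - 1 / 2) ^ 2 / Y ^ 2) := by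
      field_simp; ring
    rw [e, Real.log_mul (by positivity) (by positivity), Real.log_pow]
    have h1 := Real.log_le_sub_one_of_pos (x := 1 + (σ / 2 + 1 - 1 / 2) ^ 2 / Y ^ 2) (by positivity)
    have h2 : (σ / 2 + 1 - 1 / 2) ^ 2 / Y ^ 2 ≤ 2 / 250000 := by
      rw [div_le_div_iff₀ hY0 (by norm_num)]
      nlinarith
    push_cast
    linarith
  have l2 : 2 * log Y ≤ log ((σ₁ / 2 + 1 - 1 / 2) ^ 2 + Y ^ 2) := by
    have : 2 * log Y = log (Y ^ 2) := by rw [Real.log_pow]; push_cast; ring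
    rw [this]
    exact Real.log_le_log hY0 (by nlinarith [sq_nonneg (σ₁ / 2 + 1 - 1 / 2)])
  have f1 : 4 / 5 / Y ^ 2 ≤ 4 / 5 / 250000 := by gcongr
  have f2 : 1 / 4 / Y ^ 2 ≤ 1 / 4 / 250000 := by gcongr
  have f3 : (σ - 1) / ((σ - 1) ^ 2 + t ^ 2) ≤ 1 / 1000000 := by
    rw [div_le_div_iff₀ (by positivity) (by norm_num)]
    nlinarith [sq_nonneg (σ - 1)]
  have f4 : 0 ≤ (σ₁ - 1) / ((σ₁ - 1) ^ 2 + t ^ 2) := by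
    apply div_nonneg (by linarith); positivity
  have g2 : log Y - 1 / 4 / 250000 ≤ (Complex.digamma ⟨σ₁ / 2 + 1, Y⟩).re := by linarith
  have g3 := mul_le_mul_of_nonneg_left g2 hκ
  have g4 := mul_nonneg hκ f4
  nlinarith

lemma stechkinDiff_zero_le {κ σ σ₁ : ℝ} (hκ : 0 ≤ κ) (hσ : 1 < σ) (hσ₁ : σ ≤ 1.068) (hσσ : σ ≤ σ₁) :
    stechkinDiff κ σ σ₁ 0 ≤ 1 / (σ - 1) - 0.52 := by
  have c : ∀ u : ℝ, (⟨u, 0⟩ : ℂ) = (u : ℂ) := fun u => rfl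
  rw [stechkinDiff, c, c]
  have h1 := mul_nonneg hκ (neg_logDeriv_zeta_re_nonneg (σ := σ₁) (by linarith))
  have h2 := neg_logDeriv_zeta_eq (s := σ) (by simpa using hσ)
  have h3 := congrArg Complex.re h2
  have hZ := sum_pairKernel_le (z := σ) (by simpa using hσ.le) ∅ (by simp)
  rw [sum_empty] at hZ
  have e1 : ((σ : ℂ) / 2 + 1) = ((σ / 2 + 1 : ℝ) : ℂ) := by push_cast; rfl
  have e2 : (1 / ((σ : ℂ) - 1)).re = 1 / (σ - 1) := by
    rw [show (1 / ((σ : ℂ) - 1)) = ((1 / (σ - 1) : ℝ) : ℂ) by push_cast; rfl, Complex.ofReal_re]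
  have e3 : ∀ w : ℂ, (1 / 2 * w).re = 1 / 2 * w.re := by
    intro w
    rw [show (1 / 2 : ℂ) = ((1 / 2 : ℝ) : ℂ) by push_cast; rfl, Complex.re_ofReal_mul]
  rw [Complex.sub_re, Complex.sub_re, Complex.add_re, e1, e2, e3, e3, Complex.ofReal_re] at h3
  have hd := digamma_re_le_log_sub (x := σ / 2 + 1) (by linarith)
  have hl : log (σ / 2 + 1) ≤ 0.4281 := by
    have h := Real.log_div_le_sum_range_add (x := 0.21075) (by norm_num) (by norm_num) 3
    norm_num [sum_range_succ] at h
    have h2 : log (σ / 2 + 1) ≤ log (4843 / 3157) :=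
      Real.log_le_log (by linarith) (by norm_num at hσ₁ ⊢; linarith)
    linarith
  have hinv : 0.3259 ≤ 1 / (2 * (σ / 2 + 1)) := by
    rw [le_div_iff₀ (by linarith)]
    norm_num at hσ₁ ⊢
    linarith
  have lp := log_pi_bounds.1
  rw [h3]
  linarith

/-- An explicit zero-free region for the Riemann zeta function. -/
lemma zero_free_region {ρ : ℂ} (hρ : xi ρ = 0) (him : 1000 ≤ ρ.im) :
    1 / (9.8 * log (ρ.im / 6.5)) ≤ 1 - ρ.re := by
  by_contra hcon
  push Not at hcon
  have hre := zero_re_of_xi_eq_zero hρ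
  set γ := ρ.im with hγ
  set l := log (γ / 6.5) with hl
  set δ := 1 - ρ.re with hδ
  have hl5 : 5 ≤ l := by
    have h : log (2 ^ 7 * (6 / 5)) ≤ l := Real.log_le_log (by norm_num) (by
      rw [le_div_iff₀ (by norm_num)]; norm_num; linarith)
    rw [Real.log_mul (by norm_num) (by norm_num), Real.log_pow] at h
    have h2 := Real.sum_range_le_log_div (x := 1 / 11) (by norm_num) (by norm_num) 1
    norm_num [sum_range_succ] at h h2
    have := Real.log_two_gt_d9
    linarith
  have hl0 : 0 < l := by linarith
  set η := 0.334 / l with hη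
  have hη0 : 0 < η := by positivity
  have hη1 : η ≤ 0.0668 := by
    rw [hη, div_le_iff₀ hl0]; norm_num; linarith
  have hδ1 : δ ≤ 0.0205 := by
    refine hcon.le.trans ?_
    rw [div_le_iff₀ (by positivity)]; norm_num; linarith
  have hδ0 : 0 < δ := by rw [hδ]; linarith [hre.2]
  norm_num at hη1 hδ1
  have hlδ : l * δ ≤ 1 / 9.8 := by
    have := hcon.le
    rw [le_div_iff₀ (by positivity)] at this
    rw [le_div_iff₀ (by norm_num)]; linarith
  have hoff : ρ.re ≠ 1 / 2 := by
    intro h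
    rw [hδ, h] at hδ1
    norm_num at hδ1
  have htrig := stechkin_trig (κ := 0.44) (σ := 1 + η) (σ₁ := 1.6181) (t := γ) (by linarith)
    (by norm_num; linarith) (by norm_num)
  have hst : ∀ t, 1000 ≤ t → stechkinDiff 0.44 (1 + η) 1.6181 t ≤
      0.28 * (log (t / 2) - log π) + 1 / 100000 := by
    intro t ht
    have h := stechkinDiff_le (κ := 0.44) (σ := 1 + η) (σ₁ := 1.6181) (by norm_num) (by linarith)
      (by linarith) (by norm_num; linarith) ht (by norm_num)
    have h2 := stechkin_sum_le (z := ⟨1 + η, t⟩) (w := ⟨1.6181, t⟩) (κ := 0.44) (by simp; linarith)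
      (by norm_num; linarith) (by norm_num) rfl (by norm_num) (by norm_num; linarith) ∅ (by simp)
    rw [sum_empty] at h2
    norm_num at h h2 ⊢
    linarith
  have h1 : stechkinDiff 0.44 (1 + η) 1.6181 γ ≤
      0.28 * (log (γ / 2) - log π) + 1 / 100000 - (1 / (η + δ) - 0.051) := by
    have h := stechkinDiff_le (κ := 0.44) (σ := 1 + η) (σ₁ := 1.6181) (by norm_num) (by linarith)
      (by linarith) (by norm_num; linarith) him (by norm_num)
    have h2 := stechkin_off_line (z := ⟨1 + η, γ⟩) (w := ⟨1.6181, γ⟩) (κ := 0.44) (by simp; linarith)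
      (by norm_num; linarith) (by norm_num) rfl (by norm_num) (by norm_num; linarith) hρ hoff
    have e : ∀ u : ℝ, pairKernel ⟨u, γ⟩ ρ = 1 / (u - ρ.re) + 1 / (u - 1 + ρ.re) := by
      intro u
      have e1 : (⟨u, γ⟩ : ℂ) - ρ = ((u - ρ.re : ℝ) : ℂ) := by
        apply Complex.ext <;> simp [hγ]
      have e2 : (⟨u, γ⟩ : ℂ) - (1 - conj ρ) = ((u - 1 + ρ.re : ℝ) : ℂ) := by
        apply Complex.ext <;> simp [hγ]
        ring
      rw [pairKernel, e1, e2, ← Complex.ofReal_one, ← Complex.ofReal_div, ← Complex.ofReal_div,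
        Complex.ofReal_re, Complex.ofReal_re]
    rw [e, e] at h2
    have eδ : ρ.re = 1 - δ := by rw [hδ]; ring
    rw [eδ] at h2
    have a1 : 1 + η - (1 - δ) = η + δ := by ring
    have a2 : 0.9373 ≤ 1 / (1 + η - 1 + (1 - δ)) := by
      rw [le_div_iff₀ (by linarith)]; norm_num; linarith
    have a3 : 1 / (1.6181 - (1 - δ)) ≤ 1.6179 := by
      rw [div_le_iff₀ (by norm_num; linarith)]; norm_num; linarith
    have a4 : 1 / (1.6181 - 1 + (1 - δ)) ≤ 0.626 := by
      rw [div_le_iff₀ (by norm_num; linarith)]; norm_num; linarith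
    rw [a1] at h2
    norm_num at h h2 a2 a3 a4 ⊢
    linarith
  have h0 := stechkinDiff_zero_le (κ := 0.44) (σ := 1 + η) (σ₁ := 1.6181) (by norm_num) (by linarith)
      (by norm_num; linarith) (by norm_num; linarith)
  have h2 := hst (2 * γ) (by linarith)
  have h3 := hst (3 * γ) (by linarith)
  have h4 := hst (4 * γ) (by linarith)
  have hγ0 : 0 < γ := by linarith
  have lg1 : log (γ / 2) = log γ - log 2 := Real.log_div hγ0.ne' (by norm_num)
  have lg2 : log (2 * γ / 2) = log γ := by congr 1; ring
  have lg3 : log (3 * γ / 2) = log 3 + log γ - log 2 := by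
    rw [Real.log_div (by positivity) (by norm_num), Real.log_mul (by norm_num) hγ0.ne']
  have lg4 : log (4 * γ / 2) = log 2 + log γ := by
    rw [← Real.log_mul (by norm_num) hγ0.ne']; congr 1; ring
  rw [lg1] at h1
  rw [lg2] at h2
  rw [lg3] at h3
  rw [lg4] at h4
  rw [zero_mul, one_mul] at htrig
  have hη' : 1 / (1 + η - 1) = l / 0.334 := by
    rw [add_sub_cancel_left, hη, one_div_div]
  rw [hη'] at h0
  have hηδ : 5.3289 * l ≤ 2.32362 * (1 / (η + δ)) := by
    rw [mul_one_div, le_div_iff₀ (by positivity), hη]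
    have : l * (0.334 / l) = 0.334 := by field_simp
    have e : 5.3289 * l * (0.334 / l + δ) = 5.3289 * (l * (0.334 / l) + l * δ) := by ring
    rw [e, this]
    norm_num at hlδ ⊢
    linarith
  have hll : l = log γ - log 6.5 := Real.log_div hγ0.ne' (by norm_num)
  have l65 : log 6.5 ≤ 1.8719 := by
    have h := Real.log_div_le_sum_range_add (x := 1 / 25) (by norm_num) (by norm_num) 2
    norm_num [sum_range_succ] at h
    have : log 6.5 = log 2 + log 3 + log (13 / 12) := by
      rw [← Real.log_mul (by norm_num) (by norm_num), ← Real.log_mul (by norm_num) (by norm_num)]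
      norm_num
    have l2 := Real.log_two_lt_d9
    have l3 := log_three_bounds.2
    rw [this]
    linarith
  have b1 := Real.log_two_gt_d9
  have b2 := Real.log_two_lt_d9
  have b3 := log_three_bounds
  have b4 := log_pi_bounds
  norm_num at htrig h0 h1 h2 h3 h4 hηδ l65 b1 b2 b3 b4
  linarith

end ZeroFreeExplicit

/-! ### Logarithmically weighted averages of the Chebyshev function -/

section Average

open Filter Topology MeasureTheory Asymptotics

lemma mellin_log_pow {f : ℝ → ℂ} {b : ℝ} (hf : LocallyIntegrableOn f (Set.Ioi 0))
    (htop : f =O[atTop] fun t : ℝ => t ^ b) (hbot : ∀ t < 1, f t = 0) (k : ℕ) {s : ℂ} (hs : b < s.re) :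
    MellinConvergent (fun t => (log t ^ k : ℝ) • f t) (-s) ∧
    HasDerivAt (fun w => mellin (fun t => (log t ^ k : ℝ) • f t) (-w))
      (-mellin (fun t => (log t ^ (k + 1) : ℝ) • f t) (-s)) s := by
  have hInt : LocallyIntegrableOn (fun t => (log t ^ k : ℝ) • f t) (Set.Ioi 0) := by
    refine hf.continuousOn_smul isOpen_Ioi.isLocallyClosed ?_
    exact (Real.continuousOn_log.mono fun t ht => (ne_of_gt ht)).pow k
  set b' := (b + s.re) / 2 with hb'
  have ht : (fun t => (log t ^ k : ℝ) • f t) =O[atTop] fun t : ℝ => t ^ (-(-b')) := by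
    have h1 : (fun t : ℝ => log t ^ k) =O[atTop] fun t : ℝ => t ^ (b' - b) := by
      have := (isLittleO_log_rpow_rpow_atTop (s := b' - b) (k : ℝ) (by rw [hb']; linarith)).isBigO
      simpa only [Real.rpow_natCast] using this
    refine (h1.smul htop).trans (EventuallyEq.isBigO ?_)
    filter_upwards [eventually_gt_atTop 0] with t ht
    rw [smul_eq_mul, ← Real.rpow_add ht]
    congr 1; ring
  have hbt : (fun t => (log t ^ k : ℝ) • f t) =O[𝓝[>] 0] fun t : ℝ => t ^ (-((-s).re - 1)) := by
    refine EventuallyEq.trans_isBigO (f₂ := fun _ => (0 : ℂ)) ?_ (isBigO_zero _ _)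
    filter_upwards [mem_nhdsWithin_of_mem_nhds (Iio_mem_nhds zero_lt_one)] with t ht
    rw [hbot t ht, smul_zero]
  have hlt : (-s).re < -b' := by rw [Complex.neg_re, hb']; linarith
  have h := mellin_hasDerivAt_of_isBigO_rpow hInt ht hlt hbt (by linarith)
  refine ⟨mellinConvergent_of_isBigO_rpow hInt ht hlt hbt (by linarith), ?_⟩
  have h2 := h.2.scomp s (hasDerivAt_neg s)
  have e : (fun t => log t • (log t ^ k : ℝ) • f t) = fun t => (log t ^ (k + 1) : ℝ) • f t := by
    ext t; rw [smul_smul, pow_succ']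
  rw [e] at h2
  simpa [Function.comp_def] using h2

lemma iteratedDeriv_mellin_neg {f : ℝ → ℂ} {b : ℝ} (hf : LocallyIntegrableOn f (Set.Ioi 0))
    (htop : f =O[atTop] fun t : ℝ => t ^ b) (hbot : ∀ t < 1, f t = 0) (k : ℕ) {s : ℂ} (hs : b < s.re) :
    iteratedDeriv k (fun w => mellin f (-w)) s =
      (-1) ^ k * mellin (fun t => (log t ^ k : ℝ) • f t) (-s) := by
  induction k generalizing s with
  | zero => simp
  | succ k ih =>
    rw [iteratedDeriv_succ]
    have hev : iteratedDeriv k (fun w => mellin f (-w)) =ᶠ[𝓝 s]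
        fun w => (-1) ^ k * mellin (fun t => (log t ^ k : ℝ) • f t) (-w) := by
      filter_upwards [(isOpen_lt continuous_const Complex.continuous_re).mem_nhds hs] with w hw
      exact ih hw
    rw [hev.deriv_eq, ((mellin_log_pow hf htop hbot k hs).2.const_mul _).deriv]
    ring

lemma iteratedDeriv_sum_simple_fractions {ι : Type*} (S : Finset ι) (c a : ι → ℂ) {U : Set ℂ}
    (hU : IsOpen U) (ha : ∀ i ∈ S, a i ∉ U) (k : ℕ) {s : ℂ} (hs : s ∈ U) :
    iteratedDeriv k (fun w => ∑ i ∈ S, c i / (w - a i)) s =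
      (-1) ^ k * k.factorial * ∑ i ∈ S, c i / (s - a i) ^ (k + 1) := by
  have hne : ∀ w ∈ U, ∀ i ∈ S, w - a i ≠ 0 := fun w hw i hi h =>
    ha i hi (by rw [← sub_eq_zero.1 h]; exact hw)
  induction k generalizing s with
  | zero => simp
  | succ k ih =>
    rw [iteratedDeriv_succ]
    have hev : iteratedDeriv k (fun w => ∑ i ∈ S, c i / (w - a i)) =ᶠ[𝓝 s]
        fun w => (-1) ^ k * k.factorial * ∑ i ∈ S, c i / (w - a i) ^ (k + 1) := by
      filter_upwards [hU.mem_nhds hs] with w hw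
      exact ih hw
    have hd : HasDerivAt (fun w => (-1) ^ k * (k.factorial : ℂ) * ∑ i ∈ S, c i / (w - a i) ^ (k + 1))
        ((-1) ^ k * (k.factorial : ℂ) * ∑ i ∈ S, (-(k + 1) * (c i / (s - a i) ^ (k + 1 + 1)))) s := by
      refine HasDerivAt.const_mul _ (HasDerivAt.fun_sum fun i hi => ?_)
      have h0 := hne s hs i hi
      have h1 : HasDerivAt (fun w : ℂ => (w - a i) ^ (k + 1)) (((k + 1 : ℕ) : ℂ) * (s - a i) ^ k * 1) s :=
        ((hasDerivAt_id s).sub_const (a i)).pow (k + 1)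
      have h2 : HasDerivAt (fun w => c i / (w - a i) ^ (k + 1)) _ s :=
        (hasDerivAt_const s (c i)).div h1 (pow_ne_zero _ h0)
      refine h2.congr_deriv ?_
      push_cast
      rw [mul_div_assoc', div_eq_div_iff (pow_ne_zero _ (pow_ne_zero _ h0)) (pow_ne_zero _ h0)]
      ring
    rw [hev.deriv_eq, hd.deriv, ← mul_sum, Nat.factorial_succ]
    push_cast
    ring

lemma tendsto_iteratedDeriv {F : ℕ → ℂ → ℂ} {f : ℂ → ℂ} {U : Set ℂ} (hU : IsOpen U)
    (h : TendstoLocallyUniformlyOn F f atTop U) (hF : ∀ n, DifferentiableOn ℂ (F n) U) (k : ℕ) :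
    TendstoLocallyUniformlyOn (fun n => iteratedDeriv k (F n)) (iteratedDeriv k f) atTop U ∧
      ∀ n, DifferentiableOn ℂ (iteratedDeriv k (F n)) U := by
  induction k with
  | zero => simpa using ⟨h, hF⟩
  | succ k ih =>
    simp only [iteratedDeriv_succ]
    exact ⟨ih.1.deriv (Eventually.of_forall ih.2) hU, fun n => (ih.2 n).deriv hU⟩

lemma integral_rpow_mul_log_pow {a : ℝ} (ha : 0 < a) (k : ℕ) :
    IntegrableOn (fun t : ℝ => t ^ (-a - 1) * log t ^ k) (Set.Ioi 1) ∧
    ∫ t in Set.Ioi (1 : ℝ), t ^ (-a - 1) * log t ^ k = k.factorial / a ^ (k + 1) := by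
  set f : ℝ → ℂ := (Set.Ioi (1 : ℝ)).indicator fun _ => 1 with hf
  have hInt : LocallyIntegrableOn f (Set.Ioi 0) :=
    ((locallyIntegrable_const (1 : ℂ)).indicator measurableSet_Ioi).locallyIntegrableOn _
  have htop : f =O[atTop] fun t : ℝ => t ^ (0 : ℝ) := by
    simp only [Real.rpow_zero]
    refine IsBigO.of_bound 1 (Eventually.of_forall fun t => ?_)
    rw [hf]
    refine (norm_indicator_le_norm_self _ _).trans ?_
    simp
  have hbot : ∀ t < 1, f t = 0 := fun t ht => by
    rw [hf, Set.indicator_of_notMem (by simpa using ht.le)]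
  have hm : ∀ k : ℕ, ∀ s : ℂ, mellin (fun t => (log t ^ k : ℝ) • f t) (-s) =
      ∫ t in Set.Ioi (1 : ℝ), (t : ℂ) ^ (-s - 1) * ((log t ^ k : ℝ) : ℂ) := by
    intro k s
    rw [mellin, ← integral_indicator measurableSet_Ioi, ← integral_indicator measurableSet_Ioi]
    congr 1
    ext t
    by_cases ht : t ∈ Set.Ioi (1 : ℝ)
    · have h0 : t ∈ Set.Ioi (0 : ℝ) := Set.Ioi_subset_Ioi zero_le_one ht
      rw [Set.indicator_of_mem ht, Set.indicator_of_mem h0, hf, Set.indicator_of_mem ht]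
      simp
    · rw [Set.indicator_of_notMem ht]
      by_cases h0 : t ∈ Set.Ioi (0 : ℝ)
      · rw [Set.indicator_of_mem h0, hf, Set.indicator_of_notMem ht]; simp
      · rw [Set.indicator_of_notMem h0]
  have hconv := (mellin_log_pow hInt htop hbot k (s := a) (by simpa using ha)).1
  have hreal : ∀ t ∈ Set.Ioi (1 : ℝ), ((t : ℂ) ^ (-(a : ℂ) - 1) * ((log t ^ k : ℝ) : ℂ)) =
      ((t ^ (-a - 1) * log t ^ k : ℝ) : ℂ) := by
    intro t ht
    have ht0 : (0 : ℝ) ≤ t := (zero_lt_one.trans ht).le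
    rw [Complex.ofReal_mul, Complex.ofReal_cpow ht0]
    push_cast
    rfl
  constructor
  · have h1 : IntegrableOn (fun t : ℝ => (t : ℂ) ^ (-(a : ℂ) - 1) • ((log t ^ k : ℝ) • f t)) (Set.Ioi 1) :=
      hconv.mono_set (Set.Ioi_subset_Ioi zero_le_one)
    refine (IntegrableOn.congr_fun h1.re (fun t ht => ?_) measurableSet_Ioi)
    simp only [hf, Set.indicator_of_mem ht]
    have := hreal t ht
    simp only [smul_eq_mul, Complex.real_smul, mul_one]
    rw [this, RCLike.re_to_complex, Complex.ofReal_re]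
  · have h1 := iteratedDeriv_mellin_neg hInt htop hbot k (s := a) (by simpa using ha)
    have h2 : ∀ s : ℂ, 0 < s.re → mellin f (-s) = ∑ i ∈ ({0} : Finset ℕ), 1 / (s - 0) := by
      intro s hs
      have h3 := hm 0 s
      simp only [pow_zero, one_smul, Complex.ofReal_one, mul_one] at h3
      rw [h3, integral_Ioi_cpow_of_lt (by simp; linarith) one_pos]
      simp
    have hU : IsOpen {s : ℂ | 0 < s.re} := isOpen_lt continuous_const Complex.continuous_re
    have hsU : (a : ℂ) ∈ {s : ℂ | 0 < s.re} := by simpa using ha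
    have h4 := iteratedDeriv_sum_simple_fractions ({0} : Finset ℕ) (fun _ => (1 : ℂ)) (fun _ => 0) hU
      (by simp) k hsU
    have h5 : iteratedDeriv k (fun w => mellin f (-w)) (a : ℂ) =
        iteratedDeriv k (fun w => ∑ i ∈ ({0} : Finset ℕ), 1 / (w - 0)) (a : ℂ) := by
      refine Filter.EventuallyEq.iteratedDeriv_eq k ?_
      filter_upwards [hU.mem_nhds hsU] with s hs
      exact h2 s hs
    rw [h5, h4, hm, mul_assoc] at h1
    have h6 := mul_left_cancel₀ (pow_ne_zero k (neg_ne_zero.2 one_ne_zero)) h1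
    rw [setIntegral_congr_fun measurableSet_Ioi hreal, integral_complex_ofReal] at h6
    have h7 : ((∫ t in Set.Ioi (1 : ℝ), t ^ (-a - 1) * log t ^ k : ℝ) : ℂ) = ((k.factorial / a ^ (k + 1) : ℝ) : ℂ) := by
      rw [← h6]; push_cast; simp [div_eq_mul_inv]
    exact_mod_cast h7

end Average

section AverageFormula

open Filter Topology MeasureTheory Asymptotics Chebyshev

lemma locallyIntegrableOn_psi : LocallyIntegrableOn (fun t : ℝ => (ψ t : ℂ)) (Set.Ioi 0) := by
  have h : LocallyIntegrable ψ := psi_mono.locallyIntegrable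
  have h2 : LocallyIntegrable (fun t : ℝ => (ψ t : ℂ)) := fun x => by
    obtain ⟨u, hu, hi⟩ := h x
    exact ⟨u, hu, hi.ofReal⟩
  exact h2.locallyIntegrableOn _

lemma isBigO_psi : (fun t : ℝ => (ψ t : ℂ)) =O[atTop] fun t : ℝ => t ^ (1 : ℝ) := by
  refine IsBigO.of_bound (Real.log 4 + 4) ?_
  filter_upwards [eventually_ge_atTop 0] with t ht
  rw [Complex.norm_real, Real.norm_of_nonneg (psi_nonneg t), Real.rpow_one, Real.norm_of_nonneg ht]
  exact psi_le_const_mul_self ht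

lemma psi_eq_zero_of_lt_one' : ∀ t : ℝ, t < 1 → ((ψ t : ℝ) : ℂ) = 0 := fun t ht => by
  rw [psi_eq_zero_of_le_one ht.le, Complex.ofReal_zero]

open ArithmeticFunction in
lemma mellin_psi {s : ℂ} (hs : 1 < s.re) :
    mellin (fun t : ℝ => (ψ t : ℂ)) (-s) = -deriv riemannZeta s / riemannZeta s / s := by
  have hs0 : s ≠ 0 := by rintro rfl; simp at hs; linarith
  have hsum : ∀ t : ℝ, ∑ k ∈ Icc 1 ⌊t⌋₊, vonMangoldt k = ψ t := fun t => by
    rw [psi_eq_sum_Icc, ← Finset.add_sum_Ioc_eq_sum_Icc (Nat.zero_le _), ArithmeticFunction.map_zero, zero_add]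
    rfl
  have hO : (fun n : ℕ => ∑ k ∈ Icc 1 n, vonMangoldt k) =O[atTop] fun n : ℕ => (n : ℝ) ^ (1 : ℝ) := by
    refine IsBigO.of_bound (Real.log 4 + 4) (Eventually.of_forall fun n => ?_)
    have h := hsum n
    rw [Nat.floor_natCast] at h
    rw [h, Real.norm_of_nonneg (psi_nonneg _), Real.rpow_one, Real.norm_of_nonneg n.cast_nonneg]
    exact psi_le_const_mul_self n.cast_nonneg
  have h := LSeries_eq_mul_integral_of_nonneg (fun n => vonMangoldt n) zero_le_one hs hO
    fun n => vonMangoldt_nonneg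
  rw [← LSeries_vonMangoldt_eq_deriv_riemannZeta_div hs, h, mul_div_cancel_left₀ _ hs0, mellin,
    ← integral_indicator measurableSet_Ioi, ← integral_indicator measurableSet_Ioi]
  congr 1
  ext t
  by_cases ht : t ∈ Set.Ioi (1 : ℝ)
  · have h0 : t ∈ Set.Ioi (0 : ℝ) := Set.Ioi_subset_Ioi zero_le_one ht
    rw [Set.indicator_of_mem ht, Set.indicator_of_mem h0, ← Complex.ofReal_sum, hsum, smul_eq_mul, mul_comm]
    congr 2
    ring
  · rw [Set.indicator_of_notMem ht]
    by_cases h0 : t ∈ Set.Ioi (0 : ℝ)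
    · rw [Set.indicator_of_mem h0, psi_eq_zero_of_le_one (by simpa using ht)]; simp
    · rw [Set.indicator_of_notMem h0]

/-- The truncated partial fraction expansion of `-ζ'/ζ(s)/s`: index set. -/
noncomputable def fracIndex (N : ℕ) : Finset (Bool ⊕ (ℕ ⊕ ℂ)) :=
  (Finset.univ : Finset Bool).disjSum ((range (N + 1)).disjSum (xiZeros N))

/-- The poles in the partial fraction expansion. -/
noncomputable def fracPole : Bool ⊕ (ℕ ⊕ ℂ) → ℂ :=
  Sum.elim (fun b => if b then 1 else 0) (Sum.elim (fun j => -(2 * (j + 1))) fun ρ => ρ)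

/-- The coefficient at `1 / s`. -/
noncomputable def fracConst (N : ℕ) : ℝ :=
  -1 + 1 / 2 * Real.log N - 1 / 2 * (harmonic (N + 1) : ℝ) - 1 / 2 * Real.log π - (logDeriv xi 0).re

/-- The residues in the partial fraction expansion. -/
noncomputable def fracCoeff (N : ℕ) : Bool ⊕ (ℕ ⊕ ℂ) → ℂ :=
  Sum.elim (fun b => if b then 1 else (fracConst N : ℂ))
    (Sum.elim (fun j => 1 / (2 * (j + 1))) fun ρ => -xiOrd ρ / ρ)

lemma fracPole_notMem {N : ℕ} : ∀ i ∈ fracIndex N, fracPole i ∉ {s : ℂ | 1 < s.re} := by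
  rintro (b | j | ρ) hi
  · cases b <;> simp [fracPole]
  · have : (0 : ℝ) ≤ j := j.cast_nonneg
    simp [fracPole]; linarith
  · have hρ : ρ ∈ xiZeros N := by simpa [fracIndex] using hi
    simp [fracPole]
    exact (zero_re_of_xi_eq_zero (mem_xiZeros.1 hρ).1).2.le

lemma sum_fracIndex (N : ℕ) (g : Bool ⊕ (ℕ ⊕ ℂ) → ℂ) :
    ∑ i ∈ fracIndex N, g i = (g (Sum.inl true) + g (Sum.inl false)) +
      (∑ j ∈ range (N + 1), g (Sum.inr (Sum.inl j)) + ∑ ρ ∈ xiZeros N, g (Sum.inr (Sum.inr ρ))) := by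
  rw [fracIndex, sum_disjSum, sum_disjSum, Fintype.sum_bool]

lemma norm_digamma_sub_le {w : ℂ} (hw : 0 < w.re) {n : ℕ} (hn : 1 ≤ n) :
    ‖Complex.digamma w - (Complex.log n - ∑ j ∈ range (n + 1), 1 / (w + j))‖ ≤ (‖w‖ + 1) / n := by
  set D : ℕ → ℂ := fun n => Complex.log n - ∑ j ∈ range (n + 1), 1 / (w + j) with hD
  have hn0 : (0 : ℝ) < n := by exact_mod_cast hn
  have hstep : ∀ m : ℕ, 1 ≤ m → ‖D (m + 1) - D m‖ ≤ (‖w‖ + 1) * (1 / m - 1 / (m + 1)) := by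
    intro m hm
    have hm0 : (0 : ℝ) < m := by exact_mod_cast hm
    have e : D (m + 1) - D m = ((Real.log (m + 1) - Real.log m - 1 / (m + 1) : ℝ) : ℂ) +
        w / (((m + 1 : ℝ) : ℂ) * (w + ((m + 1 : ℝ) : ℂ))) := by
      have h0 : w + ((m : ℂ) + 1) ≠ 0 := by
        have := add_natCast_ne_zero hw (m + 1); push_cast at this; exact this
      have h1 : (m : ℂ) + 1 ≠ 0 := by exact_mod_cast Nat.succ_ne_zero m
      simp only [hD]
      rw [sum_range_succ _ (m + 1), ← Complex.natCast_log, ← Complex.natCast_log]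
      push_cast
      field_simp
      ring
    rw [e]
    refine (norm_add_le _ _).trans ?_
    have h1 : ‖((Real.log (m + 1) - Real.log m - 1 / (m + 1) : ℝ) : ℂ)‖ ≤ 1 / m - 1 / (m + 1) := by
      rw [Complex.norm_real, Real.norm_eq_abs, abs_le]
      have u1 := Real.log_le_sub_one_of_pos (x := ((m : ℝ) + 1) / m) (by positivity)
      have u2 := Real.one_sub_inv_le_log_of_pos (x := ((m : ℝ) + 1) / m) (by positivity)
      rw [Real.log_div (by positivity) (by positivity)] at u1 u2
      have v1 : ((m : ℝ) + 1) / m - 1 = 1 / m := by field_simp; ring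
      have v2 : 1 - (((m : ℝ) + 1) / m)⁻¹ = 1 / (m + 1) := by field_simp; ring
      rw [v1] at u1
      rw [v2] at u2
      have v3 : (1 : ℝ) / (m + 1) ≤ 1 / m := by gcongr; linarith
      constructor <;> linarith
    have h2 : ‖w / (((m + 1 : ℝ) : ℂ) * (w + ((m + 1 : ℝ) : ℂ)))‖ ≤ ‖w‖ * (1 / m - 1 / (m + 1)) := by
      rw [norm_div, norm_mul, Complex.norm_real, Real.norm_of_nonneg (by positivity)]
      have h3 : (m : ℝ) ≤ ‖w + ((m + 1 : ℝ) : ℂ)‖ := by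
        refine le_trans ?_ (Complex.re_le_norm _)
        simp; linarith
      have h4 : (1 : ℝ) / m - 1 / (m + 1) = 1 / ((m + 1) * m) := by field_simp; ring
      rw [h4, mul_one_div]
      gcongr
    linarith
  have hind : ∀ m : ℕ, n ≤ m → ‖D m - D n‖ ≤ (‖w‖ + 1) * (1 / n - 1 / m) := by
    intro m hm
    induction m, hm using Nat.le_induction with
    | base => simp
    | succ m hm ih =>
      have h1 := hstep m (hn.trans hm)
      have h2 := norm_add_le (D (m + 1) - D m) (D m - D n)
      rw [sub_add_sub_cancel] at h2
      push_cast
      linarith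
  have hlim : Tendsto (fun m => ‖D m - D n‖) atTop (𝓝 ‖Complex.digamma w - D n‖) :=
    ((tendsto_digamma hw).sub_const _).norm
  refine le_of_tendsto hlim ?_
  filter_upwards [eventually_ge_atTop n] with m hm
  refine (hind m hm).trans ?_
  rw [mul_sub, mul_one_div]
  have : 0 ≤ (‖w‖ + 1) * (1 / (m : ℝ)) := by positivity
  linarith

lemma norm_zeta_sub_fractions_le {N : ℕ} (hN : 2 ≤ N) {s : ℂ} (hs : 1 < s.re)
    (hsN : ‖s‖ ≤ (N - 1 / 2) / 8) :
    ‖mellin (fun t : ℝ => (ψ t : ℂ)) (-s) - ∑ i ∈ fracIndex N, fracCoeff N i / (s - fracPole i)‖ ≤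
      2 / N + xiErr N := by
  have hs0 : s ≠ 0 := by rintro rfl; simp at hs; linarith
  have hs1 : s - 1 ≠ 0 := sub_ne_zero.2 (by rintro rfl; simp at hs)
  have hns : 1 ≤ ‖s‖ := hs.le.trans (Complex.re_le_norm s)
  have hN0 : (0 : ℝ) < N := by exact_mod_cast (by omega : 0 < N)
  set w := s / 2 + 1 with hw
  have hwre : 0 < w.re := by rw [hw]; simp; linarith
  have hd := norm_digamma_sub_le hwre (n := N) (by omega)
  have hx := norm_logDeriv_xi_sub_le hN hsN (xi_ne_zero_of_one_le_re hs.le)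
  have hZ0 : logDeriv xi 0 = ((logDeriv xi 0).re : ℂ) := by
    have := logDeriv_xi_ofReal 0
    rwa [Complex.ofReal_zero] at this
  have e : mellin (fun t : ℝ => (ψ t : ℂ)) (-s) - ∑ i ∈ fracIndex N, fracCoeff N i / (s - fracPole i) =
      1 / 2 * (Complex.digamma w - (Complex.log N - ∑ j ∈ range (N + 1), 1 / (w + j))) / s -
      (logDeriv xi s - logDeriv xi 0 -
        ∑ ρ ∈ xiZeros N, (xiOrd ρ : ℂ) * (1 / (s - ρ) + 1 / ρ)) / s := by
    rw [mellin_psi hs, neg_logDeriv_zeta_eq hs, ← hw, sum_fracIndex]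
    simp only [fracCoeff, fracPole, Sum.elim_inl, Sum.elim_inr, if_true]
    have r1 : ∑ ρ ∈ xiZeros N, -(xiOrd ρ : ℂ) / ρ / (s - ρ) =
        -(∑ ρ ∈ xiZeros N, (xiOrd ρ : ℂ) * (1 / (s - ρ) + 1 / ρ)) / s := by
      rw [neg_div, sum_div, ← sum_neg_distrib]
      refine sum_congr rfl fun ρ hρ => ?_
      have hρ0 : ρ ≠ 0 := by
        rintro rfl
        have := (mem_xiZeros.1 hρ).1
        rw [xi_zero] at this
        exact one_ne_zero this
      have hsρ : s - ρ ≠ 0 := by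
        intro h
        have h1 := zero_re_of_xi_eq_zero (mem_xiZeros.1 hρ).1
        rw [← sub_eq_zero.1 h] at h1
        linarith [h1.2]
      field_simp
      ring
    have r2 : ∑ j ∈ range (N + 1), (1 / (2 * ((j : ℂ) + 1))) / (s - -(2 * ((j : ℂ) + 1))) =
        1 / 2 * ((harmonic (N + 1) : ℝ) : ℂ) / s - 1 / 2 * (∑ j ∈ range (N + 1), 1 / (w + j)) / s := by
      rw [harmonic]
      push_cast
      rw [mul_sum, mul_sum, sum_div, sum_div, ← sum_sub_distrib]
      refine sum_congr rfl fun j _ => ?_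
      have h1 : (j : ℂ) + 1 ≠ 0 := by exact_mod_cast Nat.succ_ne_zero j
      have h2 : s + 2 * ((j : ℂ) + 1) ≠ 0 := by
        intro h
        have := congrArg Complex.re h
        simp at this
        have hj : (0 : ℝ) ≤ j := j.cast_nonneg
        linarith
      have h3 : w + j = (s + 2 * ((j : ℂ) + 1)) / 2 := by rw [hw]; ring
      rw [h3, sub_neg_eq_add]
      field_simp
      ring
    rw [r1, r2, fracConst, hZ0, ← Complex.natCast_log]
    push_cast
    simp only [sub_zero, Complex.ofReal_re]
    field_simp
    ring
  rw [e]
  refine (norm_sub_le _ _).trans (add_le_add ?_ ?_)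
  · rw [norm_div, norm_mul, div_le_iff₀ (by linarith)]
    have hw2 : ‖w‖ ≤ ‖s‖ / 2 + 1 := by
      rw [hw]
      refine (norm_add_le _ _).trans ?_
      simp
    have h2 : ‖(1 / 2 : ℂ)‖ = 1 / 2 := by simp
    rw [h2]
    calc 1 / 2 * ‖Complex.digamma w - (Complex.log N - ∑ j ∈ range (N + 1), 1 / (w + j))‖
        ≤ 1 / 2 * ((‖w‖ + 1) / N) := by gcongr
      _ = (1 / 2 * (‖w‖ + 1)) / N := by ring
      _ ≤ (2 * ‖s‖) / N := div_le_div_of_nonneg_right (by linarith) hN0.le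
      _ = 2 / N * ‖s‖ := by ring
  · rw [norm_div, div_le_iff₀ (by linarith)]
    exact hx

lemma isOpen_re_gt_one : IsOpen {s : ℂ | 1 < s.re} := isOpen_lt continuous_const Complex.continuous_re

lemma tendstoLocallyUniformlyOn_fractions :
    TendstoLocallyUniformlyOn (fun N s => ∑ i ∈ fracIndex N, fracCoeff N i / (s - fracPole i))
      (fun s => mellin (fun t : ℝ => (ψ t : ℂ)) (-s)) atTop {s : ℂ | 1 < s.re} := by
  rw [Metric.tendstoLocallyUniformlyOn_iff]
  intro ε hε x _
  refine ⟨Metric.ball x 1 ∩ {s : ℂ | 1 < s.re}, ?_, ?_⟩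
  · exact Filter.inter_mem (mem_nhdsWithin_of_mem_nhds (Metric.ball_mem_nhds x one_pos)) self_mem_nhdsWithin
  · have h1 : Tendsto (fun N : ℕ => 2 / (N : ℝ) + xiErr N) atTop (𝓝 (0 + 0)) :=
      (tendsto_const_div_atTop_nhds_zero_nat 2).add tendsto_xiErr
    rw [add_zero] at h1
    obtain ⟨M, hM⟩ := exists_nat_ge (8 * (‖x‖ + 1) + 1 / 2)
    filter_upwards [h1.eventually (gt_mem_nhds hε), eventually_ge_atTop 2, eventually_ge_atTop M]
      with N h2 h3 h4 y hy
    rw [dist_eq_norm]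
    refine (norm_zeta_sub_fractions_le h3 hy.2 ?_).trans_lt h2
    have hyx : ‖y‖ ≤ ‖x‖ + 1 := by
      have h5 : ‖y - x‖ < 1 := by simpa [dist_eq_norm] using hy.1
      have h6 := norm_add_le (y - x) x
      rw [sub_add_cancel] at h6
      linarith
    have : (M : ℝ) ≤ N := by exact_mod_cast h4
    linarith

lemma tendsto_average (k : ℕ) {s : ℂ} (hs : 1 < s.re) :
    Tendsto (fun N => ∑ i ∈ fracIndex N, fracCoeff N i / (s - fracPole i) ^ (k + 1)) atTop
      (𝓝 (mellin (fun t : ℝ => (Real.log t ^ k : ℝ) • (ψ t : ℂ)) (-s) / k.factorial)) := by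
  have h := (tendsto_iteratedDeriv isOpen_re_gt_one tendstoLocallyUniformlyOn_fractions
    (fun N => ?_) k).1.tendsto_at hs
  · rw [iteratedDeriv_mellin_neg locallyIntegrableOn_psi isBigO_psi psi_eq_zero_of_lt_one' k hs] at h
    have hfac : (k.factorial : ℂ) ≠ 0 := by exact_mod_cast k.factorial_ne_zero
    have h2 := h.const_mul ((-1) ^ k / (k.factorial : ℂ))
    have e : ((-1) ^ k : ℂ) * (-1) ^ k = 1 := by rw [← mul_pow]; simp
    have e2 : (-1) ^ k / (k.factorial : ℂ) * ((-1) ^ k *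
        mellin (fun t : ℝ => (Real.log t ^ k : ℝ) • (ψ t : ℂ)) (-s)) =
        mellin (fun t : ℝ => (Real.log t ^ k : ℝ) • (ψ t : ℂ)) (-s) / k.factorial := by
      rw [div_mul_eq_mul_div, ← mul_assoc, e, one_mul]
    rw [e2] at h2
    refine h2.congr fun N => ?_
    rw [iteratedDeriv_sum_simple_fractions _ _ _ isOpen_re_gt_one fracPole_notMem k hs]
    rw [div_mul_eq_mul_div, ← mul_assoc, ← mul_assoc, e, one_mul, mul_div_cancel_left₀ _ hfac]
  · refine DifferentiableOn.fun_sum fun i hi => ?_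
    refine (differentiableOn_const _).div (by fun_prop) fun z hz h => ?_
    exact fracPole_notMem i hi (by rw [← sub_eq_zero.1 h]; exact hz)

lemma integrableOn_average (k : ℕ) {s : ℝ} (hs : 1 < s) :
    IntegrableOn (fun t : ℝ => t ^ (-s - 1) * Real.log t ^ k * ψ t) (Set.Ioi 1) ∧
    mellin (fun t : ℝ => (Real.log t ^ k : ℝ) • (ψ t : ℂ)) (-(s : ℂ)) =
      ((∫ t in Set.Ioi (1 : ℝ), t ^ (-s - 1) * Real.log t ^ k * ψ t : ℝ) : ℂ) := by
  have hreal : ∀ t ∈ Set.Ioi (0 : ℝ), ((t : ℂ) ^ (-(s : ℂ) - 1) • ((Real.log t ^ k : ℝ) • (ψ t : ℂ))) =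
      ((t ^ (-s - 1) * Real.log t ^ k * ψ t : ℝ) : ℂ) := by
    intro t ht
    rw [Complex.ofReal_mul, Complex.ofReal_mul, Complex.ofReal_cpow (le_of_lt ht), smul_eq_mul, Complex.real_smul]
    push_cast
    ring
  constructor
  · have h := (mellin_log_pow locallyIntegrableOn_psi isBigO_psi psi_eq_zero_of_lt_one' k
      (s := s) (by simpa using hs)).1
    have h1 : IntegrableOn (fun t : ℝ => (t : ℂ) ^ (-(s : ℂ) - 1) • ((Real.log t ^ k : ℝ) • (ψ t : ℂ))) (Set.Ioi 1) :=
      h.mono_set (Set.Ioi_subset_Ioi zero_le_one)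
    refine IntegrableOn.congr_fun h1.re (fun t ht => ?_) measurableSet_Ioi
    simp only [hreal t (Set.Ioi_subset_Ioi zero_le_one ht), RCLike.re_to_complex, Complex.ofReal_re]
  · rw [mellin, setIntegral_congr_fun measurableSet_Ioi hreal, integral_complex_ofReal]
    congr 1
    rw [← integral_indicator measurableSet_Ioi, ← integral_indicator measurableSet_Ioi]
    congr 1
    ext t
    by_cases ht : t ∈ Set.Ioi (1 : ℝ)
    · rw [Set.indicator_of_mem ht, Set.indicator_of_mem (Set.Ioi_subset_Ioi zero_le_one ht)]
    · rw [Set.indicator_of_notMem ht]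
      by_cases h0 : t ∈ Set.Ioi (0 : ℝ)
      · rw [Set.indicator_of_mem h0, psi_eq_zero_of_le_one (by simpa using ht), mul_zero]
      · rw [Set.indicator_of_notMem h0]

lemma average_lower_bound (k : ℕ) {lam E : ℝ} (hlam : 0 < lam)
    (hE : ∀ N, ∑ ρ ∈ xiZeros N, xiOrd ρ / (‖ρ‖ * ‖((1 + lam : ℝ) : ℂ) - ρ‖ ^ (k + 1)) ≤ E) :
    1 / lam ^ (k + 1) - 2.08 / (1 + lam) ^ (k + 1) - E ≤
      (∫ t in Set.Ioi (1 : ℝ), t ^ (-(1 + lam) - 1) * Real.log t ^ k * ψ t) / k.factorial := by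
  set s : ℝ := 1 + lam with hs
  have h := tendsto_average k (s := s) (by simp [hs, hlam])
  rw [(integrableOn_average k (s := s) (by linarith)).2] at h
  have h2 := (Complex.continuous_re.tendsto _).comp h
  rw [← Complex.ofReal_natCast, ← Complex.ofReal_div, Complex.ofReal_re] at h2
  refine ge_of_tendsto h2 ?_
  filter_upwards [eventually_ge_atTop 100] with N hN
  have hN' : (100 : ℝ) ≤ N := by exact_mod_cast hN
  simp only [Function.comp]
  rw [sum_fracIndex]
  simp only [fracCoeff, fracPole, Sum.elim_inl, Sum.elim_inr, if_true, Bool.false_eq_true, if_false, sub_zero]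
  have hs0 : 0 < s := by linarith
  have e1 : (1 / ((s : ℂ) - 1) ^ (k + 1)).re = 1 / lam ^ (k + 1) := by
    rw [show (s : ℂ) - 1 = ((lam : ℝ) : ℂ) by rw [hs]; push_cast; ring, ← Complex.ofReal_pow,
      ← Complex.ofReal_one, ← Complex.ofReal_div, Complex.ofReal_re]
  have e2 : ((fracConst N : ℂ) / (s : ℂ) ^ (k + 1)).re = fracConst N / s ^ (k + 1) := by
    rw [← Complex.ofReal_pow, ← Complex.ofReal_div, Complex.ofReal_re]
  have e3 : 0 ≤ (∑ j ∈ range (N + 1), (1 / (2 * ((j : ℂ) + 1))) / ((s : ℂ) - -(2 * ((j : ℂ) + 1))) ^ (k + 1)).re := by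
    rw [Complex.re_sum]
    refine sum_nonneg fun j _ => ?_
    have : (1 / (2 * ((j : ℂ) + 1))) / ((s : ℂ) - -(2 * ((j : ℂ) + 1))) ^ (k + 1) =
        ((1 / (2 * ((j : ℝ) + 1)) / (s + 2 * (j + 1)) ^ (k + 1) : ℝ) : ℂ) := by push_cast; ring_nf
    rw [this, Complex.ofReal_re]
    positivity
  have e4 : -E ≤ (∑ ρ ∈ xiZeros N, -(xiOrd ρ : ℂ) / ρ / ((s : ℂ) - ρ) ^ (k + 1)).re := by
    have h5 : ‖∑ ρ ∈ xiZeros N, -(xiOrd ρ : ℂ) / ρ / ((s : ℂ) - ρ) ^ (k + 1)‖ ≤ E := by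
      refine (norm_sum_le _ _).trans ((le_of_eq ?_).trans (hE N))
      refine sum_congr rfl fun ρ _ => ?_
      rw [norm_div, norm_div, norm_neg, Complex.norm_real, Real.norm_of_nonneg (xiOrd_nonneg ρ), norm_pow,
        div_div]
    exact (abs_le.1 ((Complex.abs_re_le_norm _).trans h5)).1
  have e5 : -2.08 ≤ fracConst N := by
    rw [fracConst]
    have h6 := harmonic_le_one_add_log (N + 1)
    have h7 := log_pi_bounds.2
    have h8 := logDeriv_xi_zero_re
    have h9 : Real.log ((N + 1 : ℕ) : ℝ) ≤ Real.log N + 1 / 100 := by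
      have h10 := Real.log_le_sub_one_of_pos (x := ((N + 1 : ℕ) : ℝ) / N) (by positivity)
      rw [Real.log_div (by positivity) (by positivity)] at h10
      have h11 : ((N + 1 : ℕ) : ℝ) / N - 1 ≤ 1 / 100 := by
        push_cast
        rw [add_div, div_self (by positivity), add_sub_cancel_left]
        gcongr
      linarith
    norm_num at h7
    rw [show (2.08 : ℝ) = 52 / 25 by norm_num]
    push_cast at h6 h9
    linarith
  have e6 : -(2.08 / s ^ (k + 1)) ≤ fracConst N / s ^ (k + 1) := by
    rw [← neg_div]
    gcongr
  rw [Complex.add_re, Complex.add_re, Complex.add_re, e1, e2]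
  linarith

end AverageFormula

section PsiLower

open MeasureTheory Chebyshev

lemma psi_lower_of_zero_sum (k : ℕ) {lam τ E M x : ℝ} (hlam : 0 < lam) (hτ0 : 0 ≤ τ) (hτ : τ < lam)
    (hx : 0 < x) (hM0 : 0 ≤ M) (hM : ∀ t, x ≤ t → ψ t ≤ M * t)
    (hE : ∀ N, ∑ ρ ∈ xiZeros N, xiOrd ρ / (‖ρ‖ * ‖((1 + lam : ℝ) : ℂ) - ρ‖ ^ (k + 1)) ≤ E) :
    ((1 + lam) / lam) ^ (k + 1) * (1 - M * x ^ (-τ) * (lam / (lam - τ)) ^ (k + 1) - lam ^ (k + 1) * E)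
      - 2.08 ≤ ψ x := by
  have h1 := average_lower_bound k hlam hE
  obtain ⟨i1, v1⟩ := integral_rpow_mul_log_pow (a := 1 + lam) (by linarith) k
  obtain ⟨i2, v2⟩ := integral_rpow_mul_log_pow (a := lam - τ) (by linarith) k
  have hfac : (0 : ℝ) < k.factorial := by exact_mod_cast k.factorial_pos
  have hup : ∫ t in Set.Ioi (1 : ℝ), t ^ (-(1 + lam) - 1) * log t ^ k * ψ t ≤
      ∫ t in Set.Ioi (1 : ℝ), (ψ x * (t ^ (-(1 + lam) - 1) * log t ^ k) +
        M * x ^ (-τ) * (t ^ (-(lam - τ) - 1) * log t ^ k)) := by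
    refine setIntegral_mono_on (integrableOn_average k (by linarith)).1
      ((i1.const_mul _).add (i2.const_mul _)) measurableSet_Ioi fun t ht => ?_
    have ht1 : 1 < t := ht
    have ht0 : 0 < t := by linarith
    have hlog : 0 ≤ log t ^ k := pow_nonneg (Real.log_nonneg ht1.le) k
    have hpsi : ψ t ≤ ψ x + M * x ^ (-τ) * t ^ (1 + τ) := by
      rcases le_total t x with h | h
      · have : 0 ≤ M * x ^ (-τ) * t ^ (1 + τ) := by positivity
        linarith [psi_mono h]
      · have h2 : 1 ≤ x ^ (-τ) * t ^ τ := by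
          rw [Real.rpow_neg hx.le, ← div_eq_inv_mul, ← Real.div_rpow ht0.le hx.le]
          exact Real.one_le_rpow ((one_le_div hx).2 h) hτ0
        have h3 : M * t * 1 ≤ M * t * (x ^ (-τ) * t ^ τ) := by gcongr
        have e : M * x ^ (-τ) * t ^ (1 + τ) = M * t * (x ^ (-τ) * t ^ τ) := by
          rw [Real.rpow_add ht0, Real.rpow_one]; ring
        rw [e]
        linarith [hM t h, psi_nonneg x]
    have e : t ^ (-(lam - τ) - 1) = t ^ (-(1 + lam) - 1) * t ^ (1 + τ) := by
      rw [← Real.rpow_add ht0]; congr 1; ring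
    rw [e]
    have h4 : 0 ≤ t ^ (-(1 + lam) - 1) * log t ^ k := by positivity
    have := mul_le_mul_of_nonneg_left hpsi h4
    linarith
  rw [integral_add (i1.const_mul _) (i2.const_mul _), integral_const_mul, integral_const_mul, v1, v2] at hup
  have h2 : (∫ t in Set.Ioi (1 : ℝ), t ^ (-(1 + lam) - 1) * log t ^ k * ψ t) / k.factorial ≤
      ψ x / (1 + lam) ^ (k + 1) + M * x ^ (-τ) / (lam - τ) ^ (k + 1) := by
    rw [div_le_iff₀ hfac]
    refine hup.trans (le_of_eq ?_)
    field_simp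
  have h3 := h1.trans h2
  have hs : 0 < (1 + lam) ^ (k + 1) := by positivity
  have h4 := mul_le_mul_of_nonneg_left h3 hs.le
  have hl : 0 < lam ^ (k + 1) := by positivity
  have hlt : 0 < (lam - τ) ^ (k + 1) := pow_pos (by linarith) _
  rw [div_pow, div_pow]
  have e1 : (1 + lam) ^ (k + 1) * (1 / lam ^ (k + 1) - 2.08 / (1 + lam) ^ (k + 1) - E) =
      (1 + lam) ^ (k + 1) / lam ^ (k + 1) - 2.08 - (1 + lam) ^ (k + 1) * E := by
    field_simp
  have e2 : (1 + lam) ^ (k + 1) * (ψ x / (1 + lam) ^ (k + 1) + M * x ^ (-τ) / (lam - τ) ^ (k + 1)) =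
      ψ x + (1 + lam) ^ (k + 1) * M * x ^ (-τ) / (lam - τ) ^ (k + 1) := by
    field_simp
  rw [e1, e2] at h4
  have e3 : (1 + lam) ^ (k + 1) / lam ^ (k + 1) * (1 - M * x ^ (-τ) * (lam ^ (k + 1) / (lam - τ) ^ (k + 1)) -
      lam ^ (k + 1) * E) = (1 + lam) ^ (k + 1) / lam ^ (k + 1) -
      (1 + lam) ^ (k + 1) * M * x ^ (-τ) / (lam - τ) ^ (k + 1) - (1 + lam) ^ (k + 1) * E := by
    field_simp
  rw [e3]
  linarith

lemma log_one_add_ge {u : ℝ} (hu : 0 ≤ u) : u - u ^ 2 / 2 ≤ log (1 + u) := by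
  have h := Real.le_log_one_add_of_nonneg hu
  refine le_trans ?_ h
  rw [le_div_iff₀ (by linarith)]
  nlinarith [pow_nonneg hu 3]

lemma neg_log_one_sub_le {u : ℝ} (hu : 0 ≤ u) (hu1 : u ≤ 1 / 2) :
    -log (1 - u) ≤ u + u ^ 2 / 2 + 2 * u ^ 3 := by
  have h := Real.abs_log_sub_add_sum_range_le (x := u) (by rw [abs_of_nonneg hu]; linarith) 2
  rw [abs_of_nonneg hu] at h
  simp only [sum_range_succ, sum_range_zero] at h
  norm_num at h
  have h2 : u ^ 3 / (1 - u) ≤ 2 * u ^ 3 := by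
    rw [div_le_iff₀ (by linarith)]
    nlinarith [pow_nonneg hu 3]
  have h3 := neg_abs_le (u + u ^ 2 / 2 + log (1 - u))
  linarith

/-- The choice of parameters: the exponent `2 p` is about `(L c / D) ^ 2`. -/
lemma psi_lower_of_weighted_zero_sum {p : ℕ} {L D c M E : ℝ} (hp : 0 < p) (hD : 0 < D) (hDL : 5 * D ≤ L)
    (hc : 0 < c) (hK : (L * c / D) ^ 2 ≤ 2 * p) (hM0 : 0 ≤ M)
    (hM : ∀ t, exp L ≤ t → ψ t ≤ M * t)
    (hE : ∀ N, ∑ ρ ∈ xiZeros N, xiOrd ρ / ‖ρ‖ *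
      ((2 * p / (L - D)) / ‖((1 + 2 * p / (L - D) : ℝ) : ℂ) - ρ‖) ^ (2 * p) ≤ E)
    (hpos : 0 ≤ 1 - M * exp (-(c ^ 2 / 2) * (1 - 4 * D / (L - D))) - E) :
    exp (L - D - D ^ 2 / (2 * c ^ 2)) *
      (1 - M * exp (-(c ^ 2 / 2) * (1 - 4 * D / (L - D))) - E) - 2.08 ≤ ψ (exp L) := by
  have hp' : (0 : ℝ) < p := by exact_mod_cast hp
  set μ := L - D with hμ
  have hμ0 : 0 < μ := by linarith
  set lam : ℝ := 2 * p / μ with hlam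
  have hlam0 : 0 < lam := by positivity
  set u := D / μ with hu
  have hu0 : 0 < u := by positivity
  have hu1 : u ≤ 1 / 4 := by rw [hu, div_le_iff₀ hμ0]; linarith
  have hL0 : 0 < L := by linarith
  obtain ⟨k, hk⟩ : ∃ k, 2 * p = k + 1 := ⟨2 * p - 1, by omega⟩
  have hτ : lam * u < lam := by nlinarith only [hlam0, hu1]
  have hlp : 0 < lam ^ (2 * p) := by positivity
  have main := psi_lower_of_zero_sum k (lam := lam) (τ := lam * u) (E := E / lam ^ (2 * p)) (M := M)
    (x := exp L) hlam0 (by positivity) hτ (Real.exp_pos _) hM0 hM (by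
      intro N
      rw [le_div_iff₀ hlp]
      refine le_trans (le_of_eq ?_) (hE N)
      rw [sum_mul]
      refine sum_congr rfl fun ρ _ => ?_
      rw [← hk, div_pow]
      ring)
  rw [← hk] at main
  have e1 : lam ^ (2 * p) * (E / lam ^ (2 * p)) = E := by field_simp
  have e2 : lam / (lam - lam * u) = (1 - u)⁻¹ := by
    rw [show lam - lam * u = lam * (1 - u) by ring, div_mul_eq_div_div, div_self hlam0.ne', one_div]
  rw [e1, e2] at main
  have hu2 : 0 < 1 - u := by linarith
  have hKu : c ^ 2 ≤ 2 * p * u ^ 2 := by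
    have h1 : (L * c / D) ^ 2 * u ^ 2 ≤ 2 * p * u ^ 2 := by gcongr
    have h2 : c ^ 2 ≤ (L * c / D) ^ 2 * u ^ 2 := by
      have : (L * c / D) ^ 2 * u ^ 2 = c ^ 2 * (L / μ) ^ 2 := by rw [hu]; field_simp
      rw [this]
      have h3 : 1 ≤ L / μ := by rw [one_le_div hμ0]; linarith
      nlinarith only [mul_nonneg (sq_nonneg c) (sub_nonneg.2 (one_le_pow₀ h3 (n := 2)))]
    linarith
  have hterm : exp L ^ (-(lam * u)) * ((1 - u)⁻¹) ^ (2 * p) ≤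
      exp (-(c ^ 2 / 2) * (1 - 4 * D / μ)) := by
    rw [← Real.exp_mul, ← Real.exp_log (inv_pos.2 hu2), ← Real.exp_nat_mul, ← Real.exp_add, Real.log_inv]
    refine Real.exp_le_exp.2 ?_
    have e : L * -(lam * u) = 2 * p * (-u - u ^ 2) := by
      have : L = μ + D := by rw [hμ]; ring
      rw [this, hlam, hu]; field_simp; ring
    rw [e]
    push_cast
    have h := neg_log_one_sub_le hu0.le (by linarith)
    have h2 : 2 * p * (-u - u ^ 2) + 2 * p * (-log (1 - u)) ≤ 2 * p * (-u ^ 2 / 2 + 2 * u ^ 3) := by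
      rw [← mul_add]
      refine mul_le_mul_of_nonneg_left ?_ (by positivity)
      linarith
    refine h2.trans ?_
    have h3 : 4 * D / μ = 4 * u := by rw [hu]; ring
    rw [h3]
    have h4 : 0 ≤ 1 - 4 * u := by linarith
    nlinarith only [mul_le_mul_of_nonneg_right hKu h4]
  have hfac : exp (μ - D ^ 2 / (2 * c ^ 2)) ≤ ((1 + lam) / lam) ^ (2 * p) := by
    have e : (1 + lam) / lam = 1 + μ / (2 * p) := by rw [hlam]; field_simp; ring
    have h0 : (0 : ℝ) < 1 + μ / (2 * p) := by positivity
    rw [e, ← Real.exp_log h0, ← Real.exp_nat_mul]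
    refine Real.exp_le_exp.2 ?_
    have h := log_one_add_ge (u := μ / (2 * p)) (by positivity)
    have h2 : ((2 * p : ℕ) : ℝ) * (μ / (2 * p) - (μ / (2 * p)) ^ 2 / 2) ≤
        ((2 * p : ℕ) : ℝ) * log (1 + μ / (2 * p)) := by gcongr
    refine le_trans ?_ h2
    push_cast
    have e2 : 2 * (p : ℝ) * (μ / (2 * p) - (μ / (2 * p)) ^ 2 / 2) = μ - μ ^ 2 / (2 * (2 * p)) := by
      field_simp
    rw [e2]
    have h5 : μ ^ 2 / (2 * (2 * p)) ≤ D ^ 2 / (2 * c ^ 2) := by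
      rw [div_le_div_iff₀ (by positivity) (by positivity)]
      have : 2 * p * u ^ 2 * μ ^ 2 = 2 * p * D ^ 2 := by rw [hu]; field_simp
      nlinarith only [this, mul_le_mul_of_nonneg_right hKu (sq_nonneg μ)]
    linarith
  refine le_trans ?_ main
  have h6 : 1 - M * exp (-(c ^ 2 / 2) * (1 - 4 * D / μ)) - E ≤
      1 - M * exp L ^ (-(lam * u)) * (1 - u)⁻¹ ^ (2 * p) - E := by
    have := mul_le_mul_of_nonneg_left hterm hM0
    linarith
  have := mul_le_mul hfac h6 hpos (by positivity)
  linarith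

/-- The contribution of a single zero. -/
lemma zero_weight_le {p : ℕ} {μ : ℝ} (hp : 0 < p) (hμ : 0 < μ) {ρ : ℂ} (h0 : 0 < ρ.re) (h1 : ρ.re < 1) :
    ((2 * p / μ) / ‖((1 + 2 * p / μ : ℝ) : ℂ) - ρ‖) ^ (2 * p) ≤
      exp (-(1 - ρ.re) * μ + μ ^ 2 / (4 * p)) * (1 / (1 + ρ.im ^ 2 / (2 * p / μ + 1) ^ 2) ^ p) := by
  have hp' : (0 : ℝ) < p := by exact_mod_cast hp
  set lam : ℝ := 2 * p / μ with hlam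
  have hlam0 : 0 < lam := by positivity
  set δ := 1 - ρ.re with hδ
  have hδ0 : 0 < δ := by linarith
  have hδ1 : δ < 1 := by linarith
  have hn : ‖((1 + lam : ℝ) : ℂ) - ρ‖ ^ 2 = (lam + δ) ^ 2 + ρ.im ^ 2 := by
    rw [← Complex.normSq_eq_norm_sq, Complex.normSq_apply]
    simp
    rw [hδ]; ring
  rw [pow_mul, div_pow, hn]
  have h2 : lam ^ 2 / ((lam + δ) ^ 2 + ρ.im ^ 2) ≤
      (1 / (1 + δ / lam)) ^ 2 * (1 / (1 + ρ.im ^ 2 / (lam + 1) ^ 2)) := by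
    have e : (1 / (1 + δ / lam)) ^ 2 * (1 / (1 + ρ.im ^ 2 / (lam + 1) ^ 2)) =
        lam ^ 2 / ((lam + δ) ^ 2 * (1 + ρ.im ^ 2 / (lam + 1) ^ 2)) := by
      field_simp
    rw [e]
    gcongr
    rw [mul_add, mul_one]
    gcongr
    rw [mul_div_assoc', div_le_iff₀ (by positivity), mul_comm]
    gcongr
  calc _ ≤ ((1 / (1 + δ / lam)) ^ 2 * (1 / (1 + ρ.im ^ 2 / (lam + 1) ^ 2))) ^ p := by gcongr
    _ = (1 / (1 + δ / lam)) ^ (2 * p) * (1 / (1 + ρ.im ^ 2 / (lam + 1) ^ 2) ^ p) := by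
      rw [mul_pow, ← pow_mul, one_div_pow (1 + ρ.im ^ 2 / (lam + 1) ^ 2)]
    _ ≤ _ := by
      gcongr
      have h3 : (0 : ℝ) < 1 / (1 + δ / lam) := by positivity
      rw [← Real.exp_log h3, ← Real.exp_nat_mul, one_div, Real.log_inv]
      refine Real.exp_le_exp.2 ?_
      have h4 := log_one_add_ge (u := δ / lam) (by positivity)
      push_cast
      have h5 : 2 * (p : ℝ) * (δ / lam - (δ / lam) ^ 2 / 2) ≤ 2 * p * log (1 + δ / lam) := by gcongr
      have e5 : 2 * (p : ℝ) * (δ / lam - (δ / lam) ^ 2 / 2) = δ * μ - δ ^ 2 * (μ ^ 2 / (4 * p)) := by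
        rw [hlam]; field_simp; ring
      have h6 : δ ^ 2 * (μ ^ 2 / (4 * p)) ≤ 1 * (μ ^ 2 / (4 * p)) := by
        gcongr
        nlinarith only [hδ0, hδ1]
      linarith

/-- Counting zeros with the kernel `1 / (σ ^ 2 + γ ^ 2)`. -/
lemma sum_xiOrd_div_le {σ : ℝ} (hσ : 1 < σ) (S : Finset ℂ) (hS : ∀ ρ ∈ S, xi ρ = 0) :
    ∑ ρ ∈ S, xiOrd ρ / (σ ^ 2 + ρ.im ^ 2) ≤
      (1 / (σ - 1) + 1 / 2 * log (σ / 2 + 1) - 1 / 2 * log π) / (σ - 1 / 2) := by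
  have h1 := sum_pairKernel_le (z := σ) (by simpa using hσ.le) S hS
  have h2 := neg_logDeriv_zeta_re_nonneg hσ
  rw [neg_logDeriv_zeta_eq (by simpa using hσ)] at h2
  have h3 := digamma_re_le_log (x := σ / 2 + 1) (by linarith)
  have e1 : (1 / ((σ : ℂ) - 1)).re = 1 / (σ - 1) := by
    rw [show 1 / ((σ : ℂ) - 1) = ((1 / (σ - 1) : ℝ) : ℂ) by push_cast; ring, Complex.ofReal_re]
  have e2 : (1 / 2 * Complex.digamma ((σ : ℂ) / 2 + 1)).re = 1 / 2 * (Complex.digamma ((σ / 2 + 1 : ℝ) : ℂ)).re := by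
    rw [show (1 / 2 : ℂ) = ((1 / 2 : ℝ) : ℂ) by push_cast; ring, Complex.re_ofReal_mul]
    push_cast; rfl
  have e3 : (1 / 2 * (log π : ℂ)).re = 1 / 2 * log π := by
    rw [show (1 / 2 : ℂ) = ((1 / 2 : ℝ) : ℂ) by push_cast; ring, Complex.re_ofReal_mul, Complex.ofReal_re]
  rw [Complex.sub_re, Complex.sub_re, Complex.add_re, e1, e2, e3] at h2
  rw [le_div_iff₀ (by linarith), sum_mul]
  have h4 : ∑ ρ ∈ S, 2 * (xiOrd ρ / (σ ^ 2 + ρ.im ^ 2) * (σ - 1 / 2)) ≤ ∑ ρ ∈ S, xiOrd ρ * pairKernel σ ρ := by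
    refine sum_le_sum fun ρ hρ => ?_
    obtain ⟨r0, r1⟩ := zero_re_of_xi_eq_zero (hS ρ hρ)
    have hk : (2 * σ - 1) / (σ ^ 2 + ρ.im ^ 2) ≤ pairKernel σ ρ := by
      have f1 : (1 / ((σ : ℂ) - ρ)).re = (σ - ρ.re) / ((σ - ρ.re) ^ 2 + ρ.im ^ 2) := by
        rw [one_div, Complex.inv_re, Complex.normSq_apply]; simp; ring
      have f2 : (1 / ((σ : ℂ) - (1 - (starRingEnd ℂ) ρ))).re =
          (σ - 1 + ρ.re) / ((σ - 1 + ρ.re) ^ 2 + ρ.im ^ 2) := by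
        rw [one_div, Complex.inv_re, Complex.normSq_apply]; simp; ring
      rw [pairKernel, f1, f2, show (2 * σ - 1) = (σ - ρ.re) + (σ - 1 + ρ.re) by ring, add_div]
      have a1 : 0 < σ - ρ.re := by linarith
      have a2 : 0 < σ - 1 + ρ.re := by linarith
      gcongr <;> linarith
    have := mul_le_mul_of_nonneg_left hk (xiOrd_nonneg ρ)
    refine le_trans (le_of_eq ?_) this
    ring
  rw [← mul_sum] at h4
  linarith

/-- The zero-free region in exponential form. -/
lemma exp_neg_mul_le {ρ : ℂ} (hρ : xi ρ = 0) {μ : ℝ} (hμ : 0 ≤ μ) (him : 1000 ≤ |ρ.im|) :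
    exp (-(1 - ρ.re) * μ) ≤ |ρ.im| / 6.5 * exp (-2 * √(μ / 9.8)) := by
  have key : 1 / (9.8 * log (|ρ.im| / 6.5)) ≤ 1 - ρ.re := by
    rcases le_total 0 ρ.im with h | h
    · rw [abs_of_nonneg h] at him ⊢
      exact zero_free_region hρ him
    · rw [abs_of_nonpos h] at him ⊢
      have := zero_free_region (ρ := (starRingEnd ℂ) ρ) (by rw [xi_conj, hρ, map_zero]) (by simpa using him)
      simpa using this
  have hg : 0 < |ρ.im| / 6.5 := by positivity
  set l := log (|ρ.im| / 6.5) with hl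
  have hl0 : 0 < l := Real.log_pos (by rw [lt_div_iff₀ (by norm_num)]; linarith)
  rw [← Real.exp_log hg, ← Real.exp_add, ← hl]
  refine Real.exp_le_exp.2 ?_
  have h1 : μ / 9.8 / l ≤ (1 - ρ.re) * μ := by
    have := mul_le_mul_of_nonneg_right key hμ
    refine le_trans (le_of_eq ?_) this
    field_simp
  have h2 : 2 * √(μ / 9.8) ≤ μ / 9.8 / l + l := by
    have hs := Real.sq_sqrt (show 0 ≤ μ / 9.8 by positivity)
    rw [div_add' _ _ _ hl0.ne', le_div_iff₀ hl0]
    nlinarith [sq_nonneg (√(μ / 9.8) - l)]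
  linarith

end PsiLower

section ZeroSums

open Chebyshev

lemma low_zero_term_le {q γ n : ℝ} (hq : 0 < q) (hn : γ ^ 2 + 1 / 4 = n ^ 2) (hn0 : 0 < n)
    {w : ℝ} (hw : 1 + q * γ ^ 2 ≤ w) :
    1 / n * (1 / w) ≤ (50.5 + 1 / (2 * √q)) * (1 / (25 + γ ^ 2)) := by
  have hs := Real.sq_sqrt hq.le
  have hs0 : 0 < √q := Real.sqrt_pos.2 hq
  set s := √q
  have hw1 : 1 ≤ w := by nlinarith [mul_nonneg hq.le (sq_nonneg γ)]
  have hw0 : 0 < w := by linarith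
  have hn2 : 1 / 2 ≤ n := by nlinarith [sq_nonneg γ]
  have hng : n ≤ |γ| + 1 / 2 := by
    refine (pow_le_pow_iff_left₀ hn0.le (by positivity) two_ne_zero).1 ?_
    nlinarith [sq_abs γ, abs_nonneg γ]
  have h1 : |γ| / w ≤ 1 / (2 * s) := by
    rw [div_le_div_iff₀ hw0 (by positivity)]
    nlinarith [sq_nonneg (s * |γ| - 1), sq_abs γ]
  have h2 : (25 + γ ^ 2) * (1 / n * (1 / w)) ≤ 50.5 + 1 / (2 * s) := by
    have e : (25 + γ ^ 2) * (1 / n * (1 / w)) ≤ 25 / (n * w) + n / w := by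
      have : (25 + n ^ 2) * (1 / n * (1 / w)) = 25 / (n * w) + n / w := by field_simp
      rw [← this]
      refine mul_le_mul_of_nonneg_right ?_ (by positivity)
      linarith
    have h3 : 25 / (n * w) ≤ 50 := by
      rw [div_le_iff₀ (by positivity)]
      nlinarith
    have h4 : n / w ≤ |γ| / w + 1 / 2 := by
      have : n / w ≤ (|γ| + 1 / 2) / w := by gcongr
      rw [add_div] at this
      have h5 : 1 / 2 / w ≤ 1 / 2 := div_le_self (by norm_num) hw1
      linarith
    linarith
  rw [mul_one_div (50.5 + 1 / (2 * s)), le_div_iff₀ (by positivity)]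
  linarith

lemma sum_xiOrd_div_five_le (S : Finset ℂ) (hS : ∀ ρ ∈ S, xi ρ = 0) :
    ∑ ρ ∈ S, xiOrd ρ * (1 / (25 + ρ.im ^ 2)) ≤ 0.0677 := by
  have h := sum_xiOrd_div_le (σ := 5) (by norm_num) S hS
  have l1 := log_pi_bounds.1
  have l2 : log (5 / 2 + 1) ≤ 1.2529 := by
    rw [show (5 / 2 + 1 : ℝ) = 7 / 2 by norm_num]
    have h8 : log (7 / 2) = 2 * log 2 + log (7 / 8) := by
      rw [← Real.log_rpow (by norm_num), ← Real.log_mul (by norm_num) (by norm_num)]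
      norm_num
    have := Real.log_two_lt_d9
    have h10 : log (7 / 8) ≤ -0.13345 := by
      have := Real.abs_log_sub_add_sum_range_le (x := 1 / 8) (by norm_num [abs_of_pos]) 4
      norm_num [sum_range_succ, abs_of_pos] at this
      have := (abs_le.1 this).2
      linarith
    linarith
  have e : ∀ ρ ∈ S, xiOrd ρ * (1 / (25 + ρ.im ^ 2)) = xiOrd ρ / (5 ^ 2 + ρ.im ^ 2) := by
    intro ρ _; rw [mul_one_div]; norm_num
  rw [sum_congr rfl e]
  refine h.trans ?_
  rw [div_le_iff₀ (by norm_num)]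
  norm_num
  linarith

/-- The weighted sum over all zeros, given the Riemann hypothesis up to height `T`. -/
lemma weighted_zero_sum_le {p : ℕ} {μ q ι T σ B : ℝ} (hp : 0 < p) (hμ : 0 < μ) (hq : 0 < q)
    (hqp : q * (2 * p / μ + 1) ^ 2 ≤ p) (hι : μ ^ 2 / (4 * p) ≤ ι) (hT : 1000 ≤ T)
    (hRH : ∀ ρ, xi ρ = 0 → |ρ.im| ≤ T → ρ.re = 1 / 2) (hσ : 1 < σ)
    (hB : ∀ y, T ^ 2 ≤ y → (σ ^ 2 + y) / (1 + q * y / p) ^ p ≤ B) (N : ℕ) :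
    ∑ ρ ∈ xiZeros N, xiOrd ρ / ‖ρ‖ * ((2 * p / μ) / ‖((1 + 2 * p / μ : ℝ) : ℂ) - ρ‖) ^ (2 * p) ≤
      exp ι * (exp (-μ / 2) * (0.0677 * (50.5 + 1 / (2 * √q))) +
        exp (-2 * √(μ / 9.8)) / 6.5 * (B *
      ((1 / (σ - 1) + 1 / 2 * log (σ / 2 + 1) - 1 / 2 * log π) / (σ - 1 / 2)))) := by
  classical
  have hp' : (0 : ℝ) < p := by exact_mod_cast hp
  have hgen : ∀ ρ : ℂ, xi ρ = 0 →
      ((2 * p / μ) / ‖((1 + 2 * p / μ : ℝ) : ℂ) - ρ‖) ^ (2 * p) ≤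
        exp ι * exp (-(1 - ρ.re) * μ) * (1 / (1 + q * ρ.im ^ 2 / p) ^ p) := by
    intro ρ hρ
    obtain ⟨r0, r1⟩ := zero_re_of_xi_eq_zero hρ
    refine (zero_weight_le hp hμ r0 r1).trans ?_
    rw [← Real.exp_add]
    have h1 : q * ρ.im ^ 2 / p ≤ ρ.im ^ 2 / (2 * p / μ + 1) ^ 2 := by
      rw [div_le_div_iff₀ hp' (by positivity)]
      nlinarith [mul_le_mul_of_nonneg_right hqp (sq_nonneg ρ.im)]
    gcongr ?_ * (1 / (1 + ?_) ^ p)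
    exact Real.exp_le_exp.2 (by linarith)
  rw [← sum_filter_add_sum_filter_not (xiZeros N) (fun ρ => |ρ.im| ≤ T), mul_add]
  refine add_le_add ?_ ?_
  · have h5 := sum_xiOrd_div_five_le ((xiZeros N).filter fun ρ => |ρ.im| ≤ T)
      (fun ρ hρ => (mem_xiZeros.1 (Finset.mem_filter.1 hρ).1).1)
    have hc : 0 ≤ exp ι * exp (-μ / 2) * (50.5 + 1 / (2 * √q)) := by positivity
    have h6 := mul_le_mul_of_nonneg_left h5 hc
    refine le_trans ?_ (h6.trans (le_of_eq (by ring)))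
    rw [mul_sum]
    refine sum_le_sum fun ρ hρ => ?_
    obtain ⟨hρ1, hρT⟩ := Finset.mem_filter.1 hρ
    have hρ0 := (mem_xiZeros.1 hρ1).1
    have hre := hRH ρ hρ0 hρT
    have hn : ρ.im ^ 2 + 1 / 4 = ‖ρ‖ ^ 2 := by
      rw [← Complex.normSq_eq_norm_sq, Complex.normSq_apply, hre]; ring
    have hn0 : 0 < ‖ρ‖ := by
      rw [norm_pos_iff]; rintro rfl; simp at hre
    have hw : 1 + q * ρ.im ^ 2 ≤ (1 + q * ρ.im ^ 2 / p) ^ p := by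
      have := one_add_mul_le_pow (a := q * ρ.im ^ 2 / p)
        (le_trans (by norm_num) (show (0:ℝ) ≤ q * ρ.im ^ 2 / p by positivity)) p
      rwa [mul_div_cancel₀ _ hp'.ne'] at this
    have h7 := low_zero_term_le hq hn hn0 hw
    have h8 := hgen ρ hρ0
    rw [show -(1 - ρ.re) * μ = -μ / 2 by rw [hre]; ring] at h8
    have hm := xiOrd_nonneg ρ
    calc _ ≤ xiOrd ρ / ‖ρ‖ * (exp ι * exp (-μ / 2) * (1 / (1 + q * ρ.im ^ 2 / p) ^ p)) := by
          gcongr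
      _ = exp ι * exp (-μ / 2) * xiOrd ρ * (1 / ‖ρ‖ * (1 / (1 + q * ρ.im ^ 2 / p) ^ p)) := by ring
      _ ≤ exp ι * exp (-μ / 2) * xiOrd ρ * ((50.5 + 1 / (2 * √q)) * (1 / (25 + ρ.im ^ 2))) := by
          gcongr
      _ = _ := by ring
  · have h5 := sum_xiOrd_div_le hσ ((xiZeros N).filter fun ρ => ¬ |ρ.im| ≤ T)
      (fun ρ hρ => (mem_xiZeros.1 (Finset.mem_filter.1 hρ).1).1)
    have hB0 : 0 ≤ B := le_trans (by positivity) (hB (T ^ 2) le_rfl)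
    have hc : 0 ≤ exp ι * (exp (-2 * √(μ / 9.8)) / 6.5 * B) := by positivity
    have h6 := mul_le_mul_of_nonneg_left h5 hc
    refine le_trans ?_ (h6.trans (le_of_eq (by ring)))
    rw [mul_sum]
    refine sum_le_sum fun ρ hρ => ?_
    obtain ⟨hρ1, hρT⟩ := Finset.mem_filter.1 hρ
    push Not at hρT
    have hρ0 := (mem_xiZeros.1 hρ1).1
    have hm := xiOrd_nonneg ρ
    have him : 0 < |ρ.im| := by linarith
    have hn : |ρ.im| ≤ ‖ρ‖ := Complex.abs_im_le_norm ρ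
    have hn0 : 0 < ‖ρ‖ := by linarith
    have h8 := hgen ρ hρ0
    have h9 := exp_neg_mul_le hρ0 hμ.le (by linarith)
    have h10 := hB (ρ.im ^ 2) (by rw [← sq_abs ρ.im]; gcongr)
    have h11 : 1 / (1 + q * ρ.im ^ 2 / p) ^ p ≤ B / (σ ^ 2 + ρ.im ^ 2) := by
      rw [le_div_iff₀ (by positivity)]
      refine le_trans (le_of_eq ?_) h10
      ring
    calc _ ≤ xiOrd ρ / |ρ.im| * (exp ι * (|ρ.im| / 6.5 * exp (-2 * √(μ / 9.8))) *
            (B / (σ ^ 2 + ρ.im ^ 2))) := by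
          gcongr
          refine h8.trans ?_
          gcongr
      _ = _ := by field_simp

set_option maxHeartbeats 400000 in
/-- A lower bound for `ψ` with all parameters free. -/
lemma psi_lower_of_params {L D c T σ B M : ℝ} (hL : 10 ≤ L) (hD : 0 < D) (hDL : 140 * D ≤ L)
    (hc : 0 < c) (hX : 1000 * L ≤ (L * c / D) ^ 2) (hM0 : 0 ≤ M)
    (hM : ∀ t, exp L ≤ t → ψ t ≤ M * t) (hT : 1000 ≤ T)
    (hRH : ∀ ρ, xi ρ = 0 → |ρ.im| ≤ T → ρ.re = 1 / 2) (hσ : 1 < σ)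
    (hB : ∀ p : ℕ, (L * c / D) ^ 2 ≤ 2 * p → ∀ y, T ^ 2 ≤ y →
      (σ ^ 2 + y) / (1 + 0.49 * (D / c) ^ 2 * y / p) ^ p ≤ B) {E : ℝ}
    (hE : M * exp (-(c ^ 2 / 2) * (1 - 4 * D / (L - D))) +
      exp (D ^ 2 / (2 * c ^ 2)) * (exp (-(L - D) / 2) * (0.0677 * (50.5 + c / (1.4 * D))) +
        exp (-2 * √((L - D) / 9.8)) / 6.5 * (B *
      ((1 / (σ - 1) + 1 / 2 * log (σ / 2 + 1) - 1 / 2 * log π) / (σ - 1 / 2)))) ≤ E)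
    (hE1 : E ≤ 1) :
    exp L * (1 - D - D ^ 2 / (2 * c ^ 2) - E) - 2.08 ≤ ψ (exp L) := by
  set X := (L * c / D) ^ 2 with hXd
  have hX0 : 0 < X := by positivity
  set p := ⌈X / 2⌉₊ with hpd
  have hp1 : X / 2 ≤ p := Nat.le_ceil _
  have hp2 : (p : ℝ) < X / 2 + 1 := Nat.ceil_lt_add_one (by positivity)
  have hp' : (0 : ℝ) < p := by linarith
  have hp : 0 < p := by exact_mod_cast hp'
  set μ := L - D with hμ
  have hμ0 : 0 < μ := by linarith
  have hμL : 0.9928 * L ≤ μ := by rw [hμ]; linarith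
  have hh : (D / c) ^ 2 * X = L ^ 2 := by rw [hXd]; field_simp
  have hhp : 0 < (D / c) ^ 2 := by positivity
  have hqp : 0.49 * (D / c) ^ 2 * (2 * p / μ + 1) ^ 2 ≤ p := by
    have h1 : 2 * p / μ + 1 ≤ 1.001 * (2 * p / μ) := by
      have : 1000 ≤ 2 * p / μ := by rw [le_div_iff₀ hμ0]; linarith
      linarith
    have h2 : (D / c) ^ 2 * (2 * p) ≤ 1.0002 * L ^ 2 := by
      have : 2 * (p : ℝ) ≤ 1.0002 * X := by linarith
      nlinarith only [this, hh, hhp]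
    have h3 : L ^ 2 ≤ μ ^ 2 / 0.9856 := by
      rw [le_div_iff₀ (by norm_num)]; nlinarith only [hμL, hμ0, hL]
    calc _ ≤ 0.49 * (D / c) ^ 2 * (1.001 * (2 * p / μ)) ^ 2 := by gcongr
      _ = 0.49 * 1.001 ^ 2 * 2 * ((D / c) ^ 2 * (2 * p)) / μ ^ 2 * p := by ring_nf
      _ ≤ 1 * p := by
        gcongr
        rw [div_le_iff₀ (by positivity)]
        have : 0 ≤ μ ^ 2 := sq_nonneg μ
        generalize (D / c) ^ 2 * (2 * (p : ℝ)) = A at h2 ⊢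
        norm_num at h3 ⊢
        linarith only [h2, h3, this]
      _ = p := one_mul _
  have hι : μ ^ 2 / (4 * p) ≤ D ^ 2 / (2 * c ^ 2) := by
    have e : D ^ 2 / (2 * c ^ 2) = (D / c) ^ 2 / 2 := by rw [div_pow]; field_simp
    rw [e, div_le_div_iff₀ (by positivity) (by norm_num)]
    have : (D / c) ^ 2 * X ≤ (D / c) ^ 2 * (2 * p) := by gcongr; linarith
    nlinarith only [this, hh, hμ0, hμ, hD]
  have hq : 1 / (2 * √(0.49 * (D / c) ^ 2)) = c / (1.4 * D) := by
    rw [Real.sqrt_mul (by norm_num), Real.sqrt_sq (by positivity),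
      show (0.49 : ℝ) = 0.7 ^ 2 by norm_num, Real.sqrt_sq (by norm_num)]
    field_simp
    norm_num
  have hsum := fun N => weighted_zero_sum_le hp hμ0 (q := 0.49 * (D / c) ^ 2) (by positivity) hqp hι hT hRH hσ
    (hB p (by linarith)) N
  rw [hq] at hsum
  have hK : X ≤ 2 * p := by linarith
  set W := exp (D ^ 2 / (2 * c ^ 2)) * (exp (-μ / 2) * (0.0677 * (50.5 + c / (1.4 * D))) +
        exp (-2 * √(μ / 9.8)) / 6.5 * (B *
      ((1 / (σ - 1) + 1 / 2 * log (σ / 2 + 1) - 1 / 2 * log π) / (σ - 1 / 2)))) with hW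
  have main := psi_lower_of_weighted_zero_sum hp hD (by linarith) hc hK hM0 hM hsum (by linarith)
  refine le_trans ?_ main
  set ι := D ^ 2 / (2 * c ^ 2) with hιd
  have hι0 : 0 ≤ ι := by positivity
  have e : L - D - ι = L + (-(D + ι)) := by ring
  rw [e, Real.exp_add, mul_assoc]
  have h1 : 1 - (D + ι) ≤ exp (-(D + ι)) := by
    have := Real.add_one_le_exp (-(D + ι)); linarith
  have h2 : 1 - (D + ι) - E ≤ exp (-(D + ι)) * (1 - E) := by
    have hE0 : 0 ≤ E := by
      refine le_trans ?_ hE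
      have hs0 := hsum 0
      have : xiZeros 0 = ∅ := by
        ext ρ; simp [mem_xiZeros]
        intro _
        have := norm_nonneg ρ
        linarith
      rw [this, sum_empty] at hs0
      positivity
    have h4 : exp (-(D + ι)) ≤ 1 := Real.exp_le_one_iff.2 (by linarith)
    have h5 := mul_le_mul_of_nonneg_right h4 hE0
    linarith
  have h3 : exp (-(D + ι)) * (1 - E) ≤ exp (-(D + ι)) *
      (1 - M * exp (-(c ^ 2 / 2) * (1 - 4 * D / μ)) - W) := by
    refine mul_le_mul_of_nonneg_left ?_ (Real.exp_pos _).le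
    linarith
  have : exp L * (1 - D - ι - E) ≤ exp L * (exp (-(D + ι)) *
      (1 - M * exp (-(c ^ 2 / 2) * (1 - 4 * D / μ)) - W)) := by
    gcongr
    linarith
  linarith

/-- The cut-off kernel is decreasing past its maximum. -/
lemma kernel_le_at_start {p : ℕ} {q Y : ℝ} (hp : 0 < p) (hq : 0 < q) (hY : 0 < Y)
    (h : 1 + q * Y / p ≤ 2 * (q * Y)) {y : ℝ} (hy : Y ≤ y) :
    (Y + y) / (1 + q * y / p) ^ p ≤ 2 * Y * exp (-(q * Y) + (q * Y) ^ 2 / (2 * p)) := by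
  have hp' : (0 : ℝ) < p := by exact_mod_cast hp
  set A := 1 + q * Y / p with hA
  have hA0 : 0 < A := by positivity
  have e : 1 + q * y / p = A * (1 + q * (y - Y) / p / A) := by
    field_simp; rw [hA]; field_simp; ring
  have hd : 0 ≤ y - Y := by linarith
  have h1 : 1 + (y - Y) / (2 * Y) ≤ (1 + q * (y - Y) / p / A) ^ p := by
    have hb := one_add_mul_le_pow (a := q * (y - Y) / p / A)
      (le_trans (by norm_num) (show (0:ℝ) ≤ q * (y - Y) / p / A by positivity)) p
    refine le_trans ?_ hb
    have e2 : (p : ℝ) * (q * (y - Y) / p / A) = (y - Y) * (q / A) := by field_simp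
    rw [e2, div_eq_mul_one_div]
    gcongr 1 + (y - Y) * ?_
    rw [div_le_div_iff₀ (by positivity) hA0]
    linarith
  have h2 : exp (q * Y - (q * Y) ^ 2 / (2 * p)) ≤ A ^ p := by
    rw [← Real.exp_log hA0, ← Real.exp_nat_mul]
    refine Real.exp_le_exp.2 ?_
    have := mul_le_mul_of_nonneg_left (log_one_add_ge (u := q * Y / p) (by positivity)) hp'.le
    refine le_trans (le_of_eq ?_) this
    field_simp
  have e3 : -(q * Y) + (q * Y) ^ 2 / (2 * p) = -(q * Y - (q * Y) ^ 2 / (2 * p)) := by ring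
  rw [e, mul_pow, e3, Real.exp_neg, ← div_eq_mul_inv, div_le_div_iff₀ (by positivity) (Real.exp_pos _)]
  have h3 : Y + y = 2 * Y * (1 + (y - Y) / (2 * Y)) := by field_simp; ring
  rw [h3]
  have : 0 ≤ (y - Y) / (2 * Y) := by positivity
  calc _ = 2 * Y * (exp (q * Y - (q * Y) ^ 2 / (2 * p)) * (1 + (y - Y) / (2 * Y))) := by ring
    _ ≤ 2 * Y * (A ^ p * (1 + q * (y - Y) / p / A) ^ p) := by gcongr

lemma kernel_le_const {p : ℕ} {q Y : ℝ} (hp : 0 < p) (hq : 0 < q) (hY : 1 ≤ q * Y) (hY0 : 0 < Y)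
    {y : ℝ} (hy : 0 ≤ y) :
    (Y + y) / (1 + q * y / p) ^ p ≤ Y := by
  have hp' : (0 : ℝ) < p := by exact_mod_cast hp
  have hb := one_add_mul_le_pow (a := q * y / p)
      (le_trans (by norm_num) (show (0:ℝ) ≤ q * y / p by positivity)) p
  rw [mul_div_cancel₀ _ hp'.ne'] at hb
  rw [div_le_iff₀ (by positivity)]
  nlinarith

end ZeroSums

section Regimes

open Chebyshev

lemma exp_neg_le_pow {a y : ℝ} (n : ℕ) (ha : 0 < a) (hy : a ≤ y) (hna : n ≤ a) :
    exp (-y) ≤ exp (-a) * (a / y) ^ n := by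
  have hy0 : 0 < y := by linarith
  have h1 : (y / a) ^ n ≤ exp (y - a) := by
    have h2 : y / a ≤ exp (y / a - 1) := by
      have := Real.add_one_le_exp (y / a - 1); linarith
    calc (y / a) ^ n ≤ exp (y / a - 1) ^ n := by gcongr
      _ = exp (n * (y / a - 1)) := by rw [← Real.exp_nat_mul]
      _ ≤ exp (a * (y / a - 1)) := by
        refine Real.exp_le_exp.2 (mul_le_mul_of_nonneg_right hna ?_)
        rw [sub_nonneg, one_le_div ha]; exact hy
      _ = exp (y - a) := by congr 1; field_simp
  have e : exp (-a) = exp (-y) * exp (y - a) := by rw [← Real.exp_add]; ring_nf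
  rw [e, mul_assoc]
  refine le_mul_of_one_le_right (Real.exp_pos _).le ?_
  calc (1 : ℝ) = (y / a) ^ n * (a / y) ^ n := by rw [← mul_pow]; field_simp; simp
    _ ≤ _ := by gcongr

lemma exp_neg_nat_le (n : ℕ) : exp (-(n : ℝ)) ≤ (1 / 2.7182818283) ^ n := by
  rw [Real.exp_neg, ← one_div, one_div_pow, ← Real.exp_one_pow]
  gcongr
  exact Real.exp_one_gt_d9.le

lemma exp_neg_le_of_add {n : ℕ} {r y : ℝ} (hr : 0 ≤ r) (hy : n + r ≤ y) :
    exp (-y) ≤ (1 / 2.7182818283) ^ n / (1 + r + r ^ 2 / 2 + r ^ 3 / 6) := by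
  have h2 : 1 + r + r ^ 2 / 2 + r ^ 3 / 6 ≤ exp r := by
    have := Real.sum_le_exp_of_nonneg hr 4
    norm_num [sum_range_succ, Nat.factorial] at this
    linarith
  have h1 := exp_neg_nat_le n
  have e : exp (-(n + r)) * exp r = exp (-n) := by rw [← Real.exp_add]; ring_nf
  refine (Real.exp_le_exp.2 (neg_le_neg hy)).trans ?_
  rw [le_div_iff₀ (by positivity)]
  refine le_trans ?_ h1
  rw [← e]
  gcongr

lemma exp_le_one_add_add_sq {y b : ℝ} (hy : y ≤ b) (hb : 0 ≤ b) (hb1 : b ≤ 1) : exp y ≤ 1 + b + b ^ 2 := by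
  have h := (abs_le.1 (Real.abs_exp_sub_one_sub_id_le (x := b) (by rw [abs_of_nonneg hb]; exact hb1))).2
  have := Real.exp_le_exp.2 hy
  linarith

lemma psi_le_mul {L : ℝ} (hL : 10 ≤ L) {t : ℝ} (ht : exp L ≤ t) :
    ψ t ≤ (1.3863 + 2 * (L * exp (-(L / 2)))) * t := by
  have hL2 : exp 2 ≤ exp L := Real.exp_le_exp.2 (by linarith)
  have ht0 : 0 < t := (Real.exp_pos L).trans_le ht
  have ht1 : 1 ≤ t := (Real.one_le_exp (by linarith)).trans ht
  refine (psi_le ht1).trans ?_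
  have h := Real.log_div_sqrt_antitoneOn (a := exp L) (b := t) hL2 (hL2.trans ht) ht
  simp only at h
  rw [Real.log_exp, ← Real.exp_half, div_eq_mul_inv L, ← Real.exp_neg] at h
  have hs : 0 < √t := Real.sqrt_pos.2 ht0
  rw [div_le_iff₀ hs] at h
  have h4 : log 4 ≤ 1.3863 := by
    rw [show (4 : ℝ) = 2 ^ 2 by norm_num, Real.log_pow]
    have := Real.log_two_lt_d9
    push_cast; linarith
  have e : t = √t * √t := (Real.mul_self_sqrt ht0.le).symm
  have h5 : 2 * √t * log t ≤ 2 * √t * (L * exp (-(L / 2)) * √t) := by gcongr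
  have h6 : log 4 * t ≤ 1.3863 * t := by gcongr
  calc _ ≤ 1.3863 * t + 2 * √t * (L * exp (-(L / 2)) * √t) := by linarith
    _ = 1.3863 * t + 2 * (L * exp (-(L / 2))) * (√t * √t) := by ring
    _ = _ := by rw [← e]; ring

lemma psi_le_mul_of_ten {L : ℝ} (hL : 10 ≤ L) {t : ℝ} (ht : exp L ≤ t) : ψ t ≤ 1.53 * t := by
  have ht0 : 0 < t := (Real.exp_pos L).trans_le ht
  refine (psi_le_mul hL ht).trans (mul_le_mul_of_nonneg_right ?_ ht0.le)
  have h := exp_neg_le_pow (a := 5) (y := L / 2) 1 (by norm_num) (by linarith) (by norm_num)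
  have h2 := exp_neg_nat_le 5
  norm_num at h2
  have h3 : L * exp (-(L / 2)) ≤ 10 * exp (-5) := by
    calc _ ≤ L * (exp (-5) * (5 / (L / 2)) ^ 1) := by gcongr
      _ = 10 * exp (-5) := by field_simp; norm_num
  linarith

lemma psi_le_mul_of_eighty {L : ℝ} (hL : 80 ≤ L) {t : ℝ} (ht : exp L ≤ t) : ψ t ≤ 1.4 * t := by
  have ht0 : 0 < t := (Real.exp_pos L).trans_le ht
  refine (psi_le_mul (by linarith) ht).trans (mul_le_mul_of_nonneg_right ?_ ht0.le)
  have h := exp_neg_le_pow (a := 40) (y := L / 2) 1 (by norm_num) (by linarith) (by norm_num)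
  have h2 := (Real.exp_le_exp.2 (show (-40 : ℝ) ≤ -(10 : ℕ) by norm_num)).trans (exp_neg_nat_le 10)
  norm_num at h2
  have h3 : L * exp (-(L / 2)) ≤ 80 * exp (-40) := by
    calc _ ≤ L * (exp (-40) * (40 / (L / 2)) ^ 1) := by gcongr
      _ = 80 * exp (-40) := by field_simp; norm_num
  linarith

/-- The zero-counting factor at `σ = 2500`. -/
lemma count_factor_le : (1 / ((2500 : ℝ) - 1) + 1 / 2 * log (2500 / 2 + 1) - 1 / 2 * log π) /
    (2500 - 1 / 2) ≤ 0.001198 := by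
  have l1 := log_pi_bounds.1
  have l2 : log (2500 / 2 + 1) ≤ 7.1318 := by
    have e : log (2500 / 2 + 1) = 10 * log 2 + log (1251 / 1024) := by
      rw [show (10 : ℝ) * log 2 = log (2 ^ 10) by rw [Real.log_pow]; norm_num,
        ← Real.log_mul (by norm_num) (by norm_num)]
      norm_num
    have e2 : log (1251 / 1024) = -log (1 - 227 / 1251) := by
      rw [← Real.log_inv]; norm_num
    have := Real.abs_log_sub_add_sum_range_le (x := 227 / 1251) (by norm_num [abs_of_pos]) 6
    norm_num [sum_range_succ, abs_of_pos] at this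
    have h3 := (abs_le.1 this).1
    norm_num at e2
    have := Real.log_two_lt_d9
    linarith
  rw [div_le_iff₀ (by norm_num)]
  norm_num
  linarith

lemma count_factor_nonneg {σ : ℝ} (hσ : 2500 ≤ σ) :
    0 ≤ (1 / (σ - 1) + 1 / 2 * log (σ / 2 + 1) - 1 / 2 * log π) / (σ - 1 / 2) := by
  have h1 : log π ≤ log (σ / 2 + 1) :=
    Real.log_le_log (by positivity) (by linarith [Real.pi_lt_d2])
  have h2 : 0 ≤ 1 / (σ - 1) := by apply one_div_nonneg.2; linarith
  apply div_nonneg <;> linarith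

/-- The bound on `10 ≤ log x ≤ 80`, with the error split into the part from low zeros and the rest. -/
lemma psi_lower_small (hRH : ∀ ρ, xi ρ = 0 → |ρ.im| ≤ 2500 → ρ.re = 1 / 2) {L : ℝ} (hL : 10 ≤ L)
    (hL2 : L ≤ 80) :
    exp L * (1 - 0.7 / L - 1.05 * (exp (-(L / 2)) * (0.0677 * (50.5 + 30 / 7 * L))) - 0.0014) - 2.08
      ≤ ψ (exp L) := by
  have hL0 : 0 < L := by linarith
  set D := 0.7 / L with hD
  have hD0 : 0 < D := by positivity
  have hD1 : D ≤ 0.07 := by rw [hD, div_le_iff₀ hL0]; linarith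
  have hLD : L * 4.2 / D = 6 * L ^ 2 := by rw [hD]; field_simp; norm_num
  have hDc : (D / 4.2) ^ 2 = 1 / (36 * L ^ 2) := by rw [hD]; field_simp; norm_num
  have hι : D ^ 2 / (2 * 4.2 ^ 2) ≤ 0.00014 := by
    rw [div_le_iff₀ (by norm_num)]; nlinarith
  have hv : 13 ≤ 0.49 * (1 / (36 * L ^ 2)) * 2500 ^ 2 := by
    rw [show 0.49 * (1 / (36 * L ^ 2)) * 2500 ^ 2 = (0.49 / 36 * 2500 ^ 2) / L ^ 2 by field_simp,
      le_div_iff₀ (by positivity)]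
    nlinarith
  have hLD0 : 9.93 ≤ L - D := by linarith
  have main := psi_lower_of_params (L := L) (D := D) (c := 4.2) (T := 2500) (σ := 2500)
    (B := 2 * 2500 ^ 2 * exp (-12.9)) (M := 1.53)
    (E := 1.05 * (exp (-(L / 2)) * (0.0677 * (50.5 + 30 / 7 * L))) + 0.0012) hL hD0 (by linarith) (by norm_num)
    (by rw [hLD]; nlinarith [mul_self_nonneg (L ^ 2 - 100), sq_nonneg L]) (by norm_num)
    (fun t ht => psi_le_mul_of_ten hL ht) (by norm_num) hRH (by norm_num) ?_ ?_ ?_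
  · refine le_trans ?_ main
    have : exp L * (1 - D - 1.05 * (exp (-(L / 2)) * (0.0677 * (50.5 + 30 / 7 * L))) - 0.0014) ≤
      exp L * (1 - D - D ^ 2 / (2 * 4.2 ^ 2) -
        (1.05 * (exp (-(L / 2)) * (0.0677 * (50.5 + 30 / 7 * L))) + 0.0012)) := by
      refine mul_le_mul_of_nonneg_left ?_ (Real.exp_pos _).le
      linarith
    linarith
  · intro p hp y hy
    rw [hLD] at hp
    rw [hDc]
    set v := 0.49 * (1 / (36 * L ^ 2)) * 2500 ^ 2 with hvd
    have hp1 : 180000 ≤ (p : ℝ) := by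
      have : 100 ≤ L ^ 2 := by nlinarith
      nlinarith [mul_self_nonneg (L ^ 2 - 100)]
    have hp0 : (0 : ℝ) < p := by linarith
    have hv2 : v ≤ 851 := by
      rw [hvd, show 0.49 * (1 / (36 * L ^ 2)) * 2500 ^ 2 = (0.49 / 36 * 2500 ^ 2) / L ^ 2 by field_simp,
        div_le_iff₀ (by positivity)]
      nlinarith
    refine (kernel_le_at_start (p := p) (Y := 2500 ^ 2) (q := 0.49 * (1 / (36 * L ^ 2)))
      (by exact_mod_cast hp0) (by positivity) (by norm_num) ?_ hy).trans ?_
    · rw [← hvd]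
      have : v / p ≤ v := div_le_self (by linarith) (by linarith)
      linarith
    · rw [← hvd]
      gcongr
      have : v ^ 2 / (2 * p) ≤ v * 0.0024 := by
        rw [div_le_iff₀ (by positivity)]
        nlinarith
      linarith
  · have e1 : exp (-12.9) ≤ 0.0000027 :=
      (exp_neg_le_of_add (n := 12) (r := 0.9) (by norm_num) (by norm_num)).trans (by norm_num)
    have e2 : exp (-2 * √((L - D) / 9.8)) ≤ 0.1354 := by
      have : 1 ≤ √((L - D) / 9.8) := Real.one_le_sqrt.2 (by rw [le_div_iff₀ (by norm_num)]; linarith)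
      rw [neg_mul]
      exact (exp_neg_le_of_add (n := 2) (r := 0) le_rfl (by push_cast; linarith)).trans (by norm_num)
    have e3 : exp (-(4.2 ^ 2 / 2) * (1 - 4 * D / (L - D))) ≤ 0.0002 := by
      have h0 : 4 * D / (L - D) ≤ 0.0283 := by rw [div_le_iff₀ (by linarith)]; linarith
      rw [neg_mul]
      exact (exp_neg_le_of_add (n := 8) (r := 0.57) (by norm_num) (by norm_num at h0 ⊢; linarith)).trans
        (by norm_num)
    have e4 : exp (D ^ 2 / (2 * 4.2 ^ 2)) ≤ 1.0002 :=
      (exp_le_one_add_add_sq hι (by norm_num) (by norm_num)).trans (by norm_num)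
    have e5 : exp (-(L - D) / 2) ≤ 1.04 * exp (-(L / 2)) := by
      have h : exp (-(L - D) / 2) = exp (-(L / 2)) * exp (D / 2) := by
        rw [← Real.exp_add]; ring_nf
      rw [h, mul_comm]
      gcongr
      exact (exp_le_one_add_add_sq (b := 0.035) (by linarith) (by norm_num) (by norm_num)).trans (by norm_num)
    have e6 : 4.2 / (1.4 * D) = 30 / 7 * L := by rw [hD]; field_simp; norm_num
    rw [e6]
    have hW : 0 ≤ 0.0677 * (50.5 + 30 / 7 * L) := by positivity
    have hZ := count_factor_le
    have hZ0 := count_factor_nonneg (σ := 2500) le_rfl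
    set Z := (1 / ((2500 : ℝ) - 1) + 1 / 2 * log (2500 / 2 + 1) - 1 / 2 * log π) / (2500 - 1 / 2)
    have f1 : exp (-2 * √((L - D) / 9.8)) / 6.5 * (2 * 2500 ^ 2 * exp (-12.9) * Z) ≤
        0.1354 / 6.5 * (2 * 2500 ^ 2 * 0.0000027 * 0.001198) := by gcongr
    have f2 : exp (-(L - D) / 2) * (0.0677 * (50.5 + 30 / 7 * L)) ≤
        1.04 * exp (-(L / 2)) * (0.0677 * (50.5 + 30 / 7 * L)) := by gcongr
    have f3 : exp (D ^ 2 / (2 * 4.2 ^ 2)) * (exp (-(L - D) / 2) * (0.0677 * (50.5 + 30 / 7 * L)) +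
        exp (-2 * √((L - D) / 9.8)) / 6.5 * (2 * 2500 ^ 2 * exp (-12.9) * Z)) ≤
        1.0002 * (1.04 * exp (-(L / 2)) * (0.0677 * (50.5 + 30 / 7 * L)) +
          0.1354 / 6.5 * (2 * 2500 ^ 2 * 0.0000027 * 0.001198)) := by gcongr
    have f4 : 0 ≤ exp (-(L / 2)) * (0.0677 * (50.5 + 30 / 7 * L)) := by positivity
    norm_num at f3 f4 e3 ⊢
    linarith
  · have h := exp_neg_le_pow (a := 5) (y := L / 2) 1 (by norm_num) (by linarith) (by norm_num)
    have h2 := exp_neg_nat_le 5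
    norm_num at h2
    have h3 : exp (-(L / 2)) * L ≤ 10 * exp (-5) := by
      calc _ ≤ (exp (-5) * (5 / (L / 2)) ^ 1) * L := by gcongr
        _ = 10 * exp (-5) := by field_simp; norm_num
    have h4 : exp (-(L / 2)) ≤ exp (-5) := Real.exp_le_exp.2 (by linarith)
    norm_num
    nlinarith

lemma psi_lower_ten (hRH : ∀ ρ, xi ρ = 0 → |ρ.im| ≤ 2500 → ρ.re = 1 / 2) {L : ℝ} (hL : 10 ≤ L)
    (hL2 : L ≤ 80) : 0.87 * exp L ≤ ψ (exp L) := by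
  have hL0 : 0 < L := by linarith
  refine le_trans ?_ (psi_lower_small hRH hL hL2)
  have h := exp_neg_le_pow (a := 5) (y := L / 2) 1 (by norm_num) (by linarith) (by norm_num)
  have h2 := exp_neg_nat_le 5
  norm_num at h2
  have h3 : exp (-(L / 2)) * L ≤ 10 * exp (-5) := by
    calc _ ≤ (exp (-5) * (5 / (L / 2)) ^ 1) * L := by gcongr
      _ = 10 * exp (-5) := by field_simp; norm_num
  have h4 : exp (-(L / 2)) ≤ exp (-5) := Real.exp_le_exp.2 (by linarith)
  have h5 : 0.7 / L ≤ 0.07 := by rw [div_le_iff₀ hL0]; linarith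
  have h6 : (2.7 : ℝ) ^ 10 ≤ exp L := by
    refine le_trans ?_ (Real.exp_le_exp.2 hL)
    rw [show (10 : ℝ) = (10 : ℕ) by norm_num, ← Real.exp_one_pow]
    gcongr
    linarith [Real.exp_one_gt_d9]
  have h7 : 0.871 ≤ 1 - 0.7 / L - 1.05 * (exp (-(L / 2)) * (0.0677 * (50.5 + 30 / 7 * L))) - 0.0014 := by
    norm_num at h5 ⊢
    nlinarith
  have h8 := mul_le_mul_of_nonneg_left h7 (Real.exp_pos L).le
  norm_num at h6 h8 ⊢
  linarith

lemma psi_lower_twelve (hRH : ∀ ρ, xi ρ = 0 → |ρ.im| ≤ 2500 → ρ.re = 1 / 2) {L : ℝ} (hL : 12 ≤ L)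
    (hL2 : L ≤ 80) : (1 - 1.1 / L) * exp L ≤ ψ (exp L) := by
  have hL0 : 0 < L := by linarith
  refine le_trans ?_ (psi_lower_small hRH (by linarith) hL2)
  have h := exp_neg_le_pow (a := 6) (y := L / 2) 2 (by norm_num) (by linarith) (by norm_num)
  have h2 := exp_neg_nat_le 6
  norm_num at h2
  have h3 : exp (-(L / 2)) * L ^ 2 ≤ 144 * exp (-6) := by
    calc _ ≤ (exp (-6) * (6 / (L / 2)) ^ 2) * L ^ 2 := by gcongr
      _ = 144 * exp (-6) := by field_simp; norm_num
  have h4 : exp (-(L / 2)) * L * 12 ≤ 144 * exp (-6) := by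
    refine le_trans ?_ h3
    rw [pow_two, ← mul_assoc]
    gcongr
  have h6 : 2000 * L ≤ exp L := by
    have h7 : exp 11 * (1 + (L - 11)) ≤ exp L := by
      have := mul_le_mul_of_nonneg_left (Real.add_one_le_exp (L - 11)) (Real.exp_pos 11).le
      rw [← Real.exp_add] at this
      ring_nf at this ⊢
      linarith
    have h8 : (2.7 : ℝ) ^ 11 ≤ exp 11 := by
      rw [show (11 : ℝ) = (11 : ℕ) by norm_num, ← Real.exp_one_pow]
      gcongr
      linarith [Real.exp_one_gt_d9]
    norm_num at h8 ⊢
    nlinarith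
  have h7 : (1 - 1.1 / L) + 0.01 / L ≤
      1 - 0.7 / L - 1.05 * (exp (-(L / 2)) * (0.0677 * (50.5 + 30 / 7 * L))) - 0.0014 := by
    have h9 : L * (1.05 * (exp (-(L / 2)) * (0.0677 * (50.5 + 30 / 7 * L))) + 0.0014) ≤ 0.39 := by
      norm_num
      nlinarith
    have h10 : 1.05 * (exp (-(L / 2)) * (0.0677 * (50.5 + 30 / 7 * L))) + 0.0014 ≤ 0.39 / L := by
      rw [le_div_iff₀ hL0]; linarith
    have e : 0.39 / L = 1.1 / L - 0.01 / L - 0.7 / L := by field_simp; norm_num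
    linarith
  have h8 := mul_le_mul_of_nonneg_right h7 (Real.exp_pos L).le
  have h9 : 2.08 ≤ 0.01 / L * exp L := by
    rw [div_mul_eq_mul_div, le_div_iff₀ hL0]
    linarith
  linarith

end Regimes

section LargeRegimes

open Chebyshev

lemma sqrt_sub_div_ge {L D : ℝ} (hL : 80 ≤ L) (hD : D ≤ 0.02) :
    0.6388 * √L - 0.002 ≤ 2 * √((L - D) / 9.8) := by
  have hs := Real.sq_sqrt (show 0 ≤ L by linarith)
  have hs8 : 8 ≤ √L := Real.le_sqrt_of_sq_le (by linarith)
  have : 0.3194 * √L - 0.001 ≤ √((L - D) / 9.8) := by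
    apply Real.le_sqrt_of_sq_le
    rw [le_div_iff₀ (by norm_num)]
    nlinarith
  linarith

lemma inv_pow_four_ge {t a : ℝ} (ht : 0 < t) (ha : 0 < a) : (5 - 4 * (t / a)) / a ^ 4 ≤ 1 / t ^ 4 := by
  have e : 1 / t ^ 4 = 1 / (t / a) ^ 4 / a ^ 4 := by field_simp
  rw [e]
  gcongr
  set y := t / a
  have hy : 0 < y := by positivity
  rw [le_div_iff₀ (by positivity)]
  nlinarith [mul_nonneg (sq_nonneg (y - 1)) (show 0 ≤ 4 * y ^ 3 + 3 * y ^ 2 + 2 * y + 1 by positivity)]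

lemma exp_ge_mul {L : ℝ} (hL : 80 ≤ L) : 2.08 * L ≤ 0.001 * exp L := by
  have h1 := Real.quadratic_le_exp_of_nonneg (x := L / 4) (by linarith)
  have e : exp L = exp (L / 4) ^ 4 := by
    rw [← Real.exp_nat_mul]; congr 1; push_cast; ring
  rw [e]
  have h2 : 100 ≤ exp (L / 4) := by nlinarith
  have h3 : L ≤ exp (L / 4) := by nlinarith
  have h4 : (100 : ℝ) ^ 3 ≤ exp (L / 4) ^ 3 := by gcongr
  nlinarith [Real.exp_pos (L / 4)]

set_option maxHeartbeats 1000000 in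
lemma psi_lower_eighty (hRH : ∀ ρ, xi ρ = 0 → |ρ.im| ≤ 2500 → ρ.re = 1 / 2) {L : ℝ} (hL : 80 ≤ L)
    (hL2 : L ≤ 480) : (1 - 1.85 / L) * exp L ≤ ψ (exp L) := by
  have hL0 : 0 < L := by linarith
  set D := 1.5 / L with hD
  have hD0 : 0 < D := by positivity
  have hD1 : D ≤ 0.01875 := by rw [hD, div_le_iff₀ hL0]; linarith
  have hLD : L * 4.2 / D = 2.8 * L ^ 2 := by rw [hD]; field_simp; norm_num
  have hDc : 0.49 * (D / 4.2) ^ 2 = 0.0625 / L ^ 2 := by rw [hD]; field_simp; norm_num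
  have hι : D ^ 2 / (2 * 4.2 ^ 2) ≤ 0.00001 := by
    rw [div_le_iff₀ (by norm_num)]; nlinarith only [hD0, hD1]
  set v := 390625 / L ^ 2 with hv
  have hv0 : 0 < v := by positivity
  have hvq : 0.0625 / L ^ 2 * 2500 ^ 2 = v := by rw [hv]; field_simp; norm_num
  have hv1 : 1.5 ≤ v := by rw [hv, le_div_iff₀ (by positivity)]; nlinarith only [hL, hL2]
  have hv2 : v ≤ 62 := by rw [hv, div_le_iff₀ (by positivity)]; nlinarith only [hL]
  set t := √L with ht
  have htL : t ^ 2 = L := Real.sq_sqrt hL0.le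
  have ht0 : 0 < t := Real.sqrt_pos.2 hL0
  have ht1 : 8.9 ≤ t := Real.le_sqrt_of_sq_le (by linarith)
  have hLDL : 0 < L - D := by linarith
  -- the contribution of high zeros
  have hhigh : L * (exp (-2 * √((L - D) / 9.8)) * exp (-v + 0.0001)) ≤ 0.0001054 := by
    have h1 := sqrt_sub_div_ge (D := D) hL (by linarith)
    have h2 : t / 19.5 ≤ exp (t / 19.5 - 1) := by
      have := Real.add_one_le_exp (t / 19.5 - 1); linarith
    have h3 : L ≤ 19.5 ^ 2 * exp (2 * (t / 19.5 - 1)) := by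
      rw [← htL]
      have : t ≤ 19.5 * exp (t / 19.5 - 1) := by
        rw [div_le_iff₀ (by norm_num)] at h2; linarith
      calc t ^ 2 ≤ (19.5 * exp (t / 19.5 - 1)) ^ 2 := by gcongr
        _ = _ := by rw [mul_pow, ← Real.exp_nat_mul]; norm_num
    have h4 : 390625 * ((5 - 4 * (t / 19.65)) / 19.65 ^ 4) ≤ v := by
      have := inv_pow_four_ge ht0 (show (0 : ℝ) < 19.65 by norm_num)
      have e : v = 390625 * (1 / t ^ 4) := by rw [hv, ← htL]; field_simp
      rw [e]
      gcongr
    have h5 : 15.1 ≤ 0.6388 * t - 0.002 + v - 0.0001 - 2 * (t / 19.5 - 1) := by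
      norm_num at h4 ⊢
      linarith
    rw [← Real.exp_add]
    calc _ ≤ 19.5 ^ 2 * exp (2 * (t / 19.5 - 1)) *
          exp (-2 * √((L - D) / 9.8) + (-v + 0.0001)) := by gcongr
      _ = 19.5 ^ 2 * exp (-(2 * √((L - D) / 9.8) + v - 0.0001 - 2 * (t / 19.5 - 1))) := by
        rw [mul_assoc, ← Real.exp_add]; ring_nf
      _ ≤ 19.5 ^ 2 * ((1 / 2.7182818283) ^ 15 / (1 + 0.1 + 0.1 ^ 2 / 2 + 0.1 ^ 3 / 6)) := by
        gcongr
        exact exp_neg_le_of_add (by norm_num) (by push_cast; linarith)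
      _ ≤ _ := by norm_num
  have e3 : exp (-(4.2 ^ 2 / 2) * (1 - 4 * D / (L - D))) ≤ 0.000151 := by
    have h0 : 4 * D / (L - D) ≤ 0.00095 := by rw [div_le_iff₀ hLDL]; linarith only [hL, hD1]
    rw [neg_mul]
    exact (exp_neg_le_of_add (n := 8) (r := 0.811) (by norm_num) (by norm_num at h0 ⊢; linarith only [h0])).trans
      (by norm_num)
  have e4 : exp (D ^ 2 / (2 * 4.2 ^ 2)) ≤ 1.0001 :=
    (exp_le_one_add_add_sq hι (by norm_num) (by norm_num)).trans (by norm_num)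
  have e5 : exp (-(L - D) / 2) ≤ 0.000000000001 := by
    rw [neg_div]
    exact (exp_neg_le_of_add (n := 30) (r := 0) le_rfl (by push_cast; linarith)).trans (by norm_num)
  have e6 : 4.2 / (1.4 * D) = 2 * L := by rw [hD]; field_simp; norm_num
  have hZ := count_factor_le
  have hZ0 := count_factor_nonneg (σ := 2500) le_rfl
  set Z := (1 / ((2500 : ℝ) - 1) + 1 / 2 * log (2500 / 2 + 1) - 1 / 2 * log π) / (2500 - 1 / 2)
  set H := exp (-2 * √((L - D) / 9.8)) * exp (-v + 0.0001) with hH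
  have hH0 : 0 < H := by positivity
  have hHL : H ≤ 0.0001054 / L := by rw [le_div_iff₀ hL0]; linarith
  have main := psi_lower_of_params (L := L) (D := D) (c := 4.2) (T := 2500) (σ := 2500)
    (B := 2 * 2500 ^ 2 * exp (-v + 0.0001)) (M := 1.4)
    (E := 0.000211401 + 0.243 / L) (by linarith only [hL]) hD0 (by linarith only [hD1, hL]) (by norm_num)
    (by
      rw [hLD]
      have h1 : 80 * L ≤ L ^ 2 := by nlinarith only [hL]
      nlinarith only [h1, hL]) (by norm_num)
    (fun t ht => psi_le_mul_of_eighty hL ht) (by norm_num) hRH (by norm_num) ?_ ?_ ?_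
  · refine le_trans ?_ main
    have h1 := exp_ge_mul hL
    have h2 : (1 - 1.85 / L) + 0.001 / L ≤ 1 - D - D ^ 2 / (2 * 4.2 ^ 2) - (0.000211401 + 0.243 / L) := by
      have h3 : D ^ 2 / (2 * 4.2 ^ 2) ≤ 0.001 / L := by
        rw [hD, div_le_div_iff₀ (by norm_num) hL0]
        have : (1.5 / L) ^ 2 * L = 2.25 / L := by field_simp; norm_num
        rw [this, div_le_iff₀ hL0]
        norm_num; linarith only [hL]
      have h4 : 0.000211401 ≤ 0.1015 / L := by rw [le_div_iff₀ hL0]; linarith only [hL2]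
      have e : 1.85 / L = D + 0.001 / L + 0.001 / L + (0.243 / L + 0.1015 / L) + 0.0035 / L := by
        rw [hD]; field_simp; norm_num
      have : 0 < 0.0035 / L := by positivity
      linarith only [h3, h4, e, this]
    have h3 := mul_le_mul_of_nonneg_right h2 (Real.exp_pos L).le
    have h4 : 2.08 ≤ 0.001 / L * exp L := by
      rw [div_mul_eq_mul_div, le_div_iff₀ hL0]; linarith only [h1]
    linarith only [h3, h4]
  · intro p hp y hy
    rw [hLD] at hp
    rw [hDc]
    have hp1 : 100000000 ≤ (p : ℝ) := by
      have h1 : (80 : ℝ) ^ 2 ≤ L ^ 2 := by gcongr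
      have h2 : (2.8 * 80 ^ 2 : ℝ) ^ 2 ≤ (2.8 * L ^ 2) ^ 2 := by gcongr
      norm_num at h2 hp
      linarith only [h2, hp]
    have hp0 : (0 : ℝ) < p := by linarith only [hp1]
    refine (kernel_le_at_start (p := p) (Y := 2500 ^ 2) (q := 0.0625 / L ^ 2)
      (by exact_mod_cast hp0) (by positivity) (by norm_num) ?_ hy).trans ?_
    · rw [hvq]
      have : v / p ≤ v * 0.1 := by
        rw [div_le_iff₀ hp0]; nlinarith only [hp1, hv0]
      linarith only [this, hv1]
    · rw [hvq]
      gcongr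
      rw [div_le_iff₀ (by positivity)]
      nlinarith only [hp1, hv0, hv2]
  · rw [e6]
    have f1 : exp (-2 * √((L - D) / 9.8)) / 6.5 * (2 * 2500 ^ 2 * exp (-v + 0.0001) * Z) ≤
        2303.9 * (0.0001054 / L) := by
      calc _ = 2 * 2500 ^ 2 / 6.5 * Z * H := by rw [hH]; ring
        _ ≤ 2 * 2500 ^ 2 / 6.5 * 0.001198 * (0.0001054 / L) := by gcongr
        _ ≤ _ := by gcongr; norm_num
    have f2 : exp (-(L - D) / 2) * (0.0677 * (50.5 + 2 * L)) ≤
        0.000000000001 * (0.0677 * (50.5 + 2 * 480)) := by gcongr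
    have f3 : exp (D ^ 2 / (2 * 4.2 ^ 2)) * (exp (-(L - D) / 2) * (0.0677 * (50.5 + 2 * L)) +
        exp (-2 * √((L - D) / 9.8)) / 6.5 * (2 * 2500 ^ 2 * exp (-v + 0.0001) * Z)) ≤
        1.0001 * (0.000000000001 * (0.0677 * (50.5 + 2 * 480)) + 2303.9 * (0.0001054 / L)) := by gcongr
    have f4 : 1.0001 * (2303.9 * (0.0001054 / L)) ≤ 0.243 / L := by
      rw [← mul_div_assoc, ← mul_div_assoc]
      gcongr
      norm_num
    have f5 : 1.4 * exp (-(4.2 ^ 2 / 2) * (1 - 4 * D / (L - D))) ≤ 1.4 * 0.000151 := by gcongr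
    refine (add_le_add f5 f3).trans ?_
    rw [mul_add]
    have : 1.4 * 0.000151 + 1.0001 * (0.000000000001 * (0.0677 * (50.5 + 2 * 480))) ≤ (0.000211401 : ℝ) := by
      norm_num
    linarith only [this, f4]
  · have : 0.243 / L ≤ 0.5 := by rw [div_le_iff₀ hL0]; linarith only [hL]
    linarith only [this]

set_option maxHeartbeats 1000000 in
lemma psi_lower_large (hRH : ∀ ρ, xi ρ = 0 → |ρ.im| ≤ 2500 → ρ.re = 1 / 2) {L : ℝ} (hL : 480 ≤ L) :
    (1 - 1.85 / L) * exp L ≤ ψ (exp L) := by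
  have hL0 : 0 < L := by linarith
  set s := √L with hs
  have hsL : s ^ 2 = L := Real.sq_sqrt hL0.le
  have hs0 : 0 < s := Real.sqrt_pos.2 hL0
  have hs1 : 21.9 ≤ s := Real.le_sqrt_of_sq_le (by linarith)
  set D := 1 / L with hD
  have hD0 : 0 < D := by positivity
  have hD1 : D ≤ 0.0021 := by rw [hD, div_le_iff₀ hL0]; linarith
  have hDL : D * L = 1 := by rw [hD]; field_simp
  have hLD : L * (s / 5) / D = L ^ 2 * (s / 5) := by rw [hD]; field_simp
  set σ := s ^ 3 / 3.5 with hσ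
  have hs3 : 10503 ≤ s ^ 3 := by
    calc (10503 : ℝ) ≤ 21.9 ^ 3 := by norm_num
      _ ≤ s ^ 3 := by gcongr
  have hσ1 : 3000 ≤ σ := by rw [hσ, le_div_iff₀ (by norm_num)]; linarith
  have hDc : 0.49 * (D / (s / 5)) ^ 2 * σ ^ 2 = 1 := by
    rw [hD, hσ, ← hsL]; field_simp; norm_num
  have hι : D ^ 2 / (2 * (s / 5) ^ 2) ≤ 0.00001 := by
    rw [div_le_iff₀ (by positivity)]
    have : 30 ≤ 2 * (s / 5) ^ 2 := by nlinarith only [hs1]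
    nlinarith only [this, hD0, hD1]
  have hι2 : D ^ 2 / (2 * (s / 5) ^ 2) ≤ 0.001 * D := by
    rw [div_le_iff₀ (by positivity)]
    have : 30 ≤ 2 * (s / 5) ^ 2 := by nlinarith only [hs1]
    nlinarith only [this, hD0, hD1]
  have hlog : log (s ^ 3 / 21) ≤ 6.22 * (s / 21.9) := by
    have h0 : log (21.9 ^ 3 / 21) ≤ 6.22 := by
      rw [Real.log_le_iff_le_exp (by norm_num)]
      have e : exp 6.22 = exp 1 ^ 6 * exp 0.22 := by
        rw [← Real.exp_nat_mul, ← Real.exp_add]; norm_num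
      rw [e]
      have h1 := Real.quadratic_le_exp_of_nonneg (x := 0.22) (by norm_num)
      calc (21.9 ^ 3 / 21 : ℝ) ≤ 2.7182818283 ^ 6 * (1 + 0.22 + 0.22 ^ 2 / 2) := by norm_num
        _ ≤ _ := by gcongr; exact Real.exp_one_gt_d9.le
    have e : log (s ^ 3 / 21) = log (21.9 ^ 3 / 21) + 3 * log (s / 21.9) := by
      rw [show (3 : ℝ) * log (s / 21.9) = log ((s / 21.9) ^ 3) by rw [Real.log_pow]; norm_num,
        ← Real.log_mul (by norm_num) (by positivity)]
      congr 1
      field_simp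
    have h2 := Real.log_le_sub_one_of_pos (show 0 < s / 21.9 by positivity)
    have h3 : 1 ≤ s / 21.9 := by rw [le_div_iff₀ (by norm_num)]; linarith
    rw [e]
    linarith
  have hexp : exp (-(0.6388 * s)) ≤ exp (-13.98) * (21.9 / s) ^ 6 := by
    have h := exp_neg_le_pow (a := 13.98) (y := 13.98 / 21.9 * s) 6 (by norm_num)
      (by rw [div_mul_eq_mul_div, le_div_iff₀ (by norm_num)]; linarith) (by norm_num)
    have e : 13.98 / (13.98 / 21.9 * s) = 21.9 / s := by field_simp
    rw [e] at h
    refine le_trans (Real.exp_le_exp.2 ?_) h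
    norm_num
    linarith
  have hexp2 : exp (-13.98) ≤ 0.00000087 :=
    (exp_neg_le_of_add (n := 13) (r := 0.98) (by norm_num) (by norm_num)).trans (by norm_num)
  have hZ0 := count_factor_nonneg (σ := σ) (by linarith)
  have hZ : σ ^ 2 * ((1 / (σ - 1) + 1 / 2 * log (σ / 2 + 1) - 1 / 2 * log π) / (σ - 1 / 2)) ≤
      1.001 * σ * (3.111 * (s / 21.9)) := by
    have h1 : log (σ / 2 + 1) - log π ≤ log (s ^ 3 / 21) := by
      rw [← Real.log_div (by positivity) (by positivity)]
      refine Real.log_le_log (by positivity) ?_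
      rw [div_le_iff₀ (by positivity), show s ^ 3 = 3.5 * σ by rw [hσ]; field_simp]
      nlinarith only [Real.pi_gt_d2, hσ1]
    have h2 : 1 / (σ - 1) ≤ 0.001 := by
      rw [div_le_iff₀ (by linarith only [hσ1])]; linarith only [hσ1]
    have h3 : 1 ≤ s / 21.9 := by rw [le_div_iff₀ (by norm_num)]; linarith
    have h4 : 1 / (σ - 1) + 1 / 2 * log (σ / 2 + 1) - 1 / 2 * log π ≤ 3.111 * (s / 21.9) := by
      linarith
    rw [mul_div_assoc', div_le_iff₀ (by linarith)]
    have h5 : σ ^ 2 ≤ 1.001 * σ * (σ - 1 / 2) := by nlinarith only [hσ1]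
    calc _ ≤ σ ^ 2 * (3.111 * (s / 21.9)) := by gcongr
      _ ≤ 1.001 * σ * (σ - 1 / 2) * (3.111 * (s / 21.9)) := by gcongr
      _ = _ := by ring
  set Z := (1 / (σ - 1) + 1 / 2 * log (σ / 2 + 1) - 1 / 2 * log π) / (σ - 1 / 2)
  have hexp1 : exp (-2 * √((L - D) / 9.8)) ≤ 1.0021 * exp (-(0.6388 * s)) := by
    have h1 := sqrt_sub_div_ge (L := L) (D := D) (by linarith only [hL]) (by linarith only [hD1])
    have h2 : exp (-2 * √((L - D) / 9.8)) ≤ exp (0.002) * exp (-(0.6388 * s)) := by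
      rw [← Real.exp_add]
      refine Real.exp_le_exp.2 ?_
      linarith
    refine h2.trans ?_
    gcongr
    exact (exp_le_one_add_add_sq (b := 0.002) le_rfl (by norm_num) (by norm_num)).trans (by norm_num)
  have hhigh : L * (exp (-2 * √((L - D) / 9.8)) / 6.5 * (σ ^ 2 * Z)) ≤ 0.61 := by
    calc _ ≤ L * (1.0021 * (0.00000087 * (21.9 / s) ^ 6) / 6.5 * (1.001 * σ * (3.111 * (s / 21.9)))) := by
          have h1 : exp (-2 * √((L - D) / 9.8)) ≤ 1.0021 * (0.00000087 * (21.9 / s) ^ 6) := by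
            refine hexp1.trans ?_
            gcongr
            exact hexp.trans (by gcongr)
          gcongr
      _ = 1.0021 * 0.00000087 * 21.9 ^ 5 / 6.5 * 1.001 * 3.111 / 3.5 := by
          rw [← hsL, hσ]; field_simp
      _ ≤ 0.61 := by norm_num
  have hM : L * (1.4 * exp (-((s / 5) ^ 2 / 2) * (1 - 4 * D / (L - D)))) ≤ 0.05 := by
    have h1 : 4 * D / (L - D) ≤ 0.0001 := by
      rw [div_le_iff₀ (by linarith only [hL, hD1])]; linarith only [hL, hD1]
    have h2 : exp (-((s / 5) ^ 2 / 2) * (1 - 4 * D / (L - D))) ≤ exp (-(0.9999 * L / 50)) := by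
      refine Real.exp_le_exp.2 ?_
      have : (s / 5) ^ 2 / 2 = L / 50 := by rw [div_pow, hsL]; ring
      rw [this]
      nlinarith only [h1, hL0]
    have h3 := exp_neg_le_pow (a := 9.599) (y := 0.9999 * L / 50) 1 (by norm_num) (by linarith only [hL]) (by norm_num)
    have h4 : exp (-9.599) ≤ 0.00007 :=
      (exp_neg_le_of_add (n := 9) (r := 0.59) (by norm_num) (by norm_num)).trans (by norm_num)
    calc _ ≤ L * (1.4 * (0.00007 * (9.599 / (0.9999 * L / 50)) ^ 1)) := by
          gcongr
          exact h2.trans (h3.trans (by gcongr))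
      _ = 1.4 * 0.00007 * 9.599 / 0.9999 * 50 := by field_simp
      _ ≤ 0.05 := by norm_num
  have hlow : L * (exp (-(L - D) / 2) * (0.0677 * (50.5 + (s / 5) / (1.4 * D)))) ≤ 0.001 := by
    have h1 : exp (-(L - D) / 2) ≤ exp (-(L / 4)) ^ 1 * exp (-24) := by
      rw [pow_one, ← Real.exp_add]
      refine Real.exp_le_exp.2 ?_
      linarith
    have h2 := exp_neg_le_pow (a := 120) (y := L / 4) 3 (by norm_num) (by linarith) (by norm_num)
    have h3 : (s / 5) / (1.4 * D) = s * L / 7 := by rw [hD]; field_simp; norm_num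
    have h4 : exp (-24) ≤ 0.0000000001 :=
      (exp_neg_le_of_add (n := 24) (r := 0) (by norm_num) (by norm_num)).trans (by norm_num)
    have h4' : exp (-120) ≤ 0.0000000001 :=
      (exp_neg_le_of_add (n := 24) (r := 0) (by norm_num) (by norm_num)).trans (by norm_num)
    have h5 : s ≤ L := by nlinarith only [hsL, hs1]
    have h6 : 0.0677 * (50.5 + s * L / 7) ≤ L ^ 2 := by nlinarith only [h5, hL, hs0]
    rw [h3]
    calc _ ≤ L * (((0.0000000001 * (120 / (L / 4)) ^ 3) ^ 1 * 0.0000000001) * L ^ 2) := by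
          gcongr
          refine h1.trans ?_
          gcongr
          exact h2.trans (by gcongr)
      _ = 0.0000000001 * 480 ^ 3 * 0.0000000001 := by field_simp; norm_num
      _ ≤ 0.001 := by norm_num
  have e4 : exp (D ^ 2 / (2 * (s / 5) ^ 2)) ≤ 1.0001 :=
    (exp_le_one_add_add_sq hι (by norm_num) (by norm_num)).trans (by norm_num)
  have hE : 1.4 * exp (-((s / 5) ^ 2 / 2) * (1 - 4 * D / (L - D))) +
      exp (D ^ 2 / (2 * (s / 5) ^ 2)) * (exp (-(L - D) / 2) * (0.0677 * (50.5 + (s / 5) / (1.4 * D))) +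
        exp (-2 * √((L - D) / 9.8)) / 6.5 * (σ ^ 2 * Z)) ≤ 0.7 / L := by
    rw [le_div_iff₀ hL0]
    have hpos : 0 ≤ L * (exp (-(L - D) / 2) * (0.0677 * (50.5 + (s / 5) / (1.4 * D)))) +
        L * (exp (-2 * √((L - D) / 9.8)) / 6.5 * (σ ^ 2 * Z)) := by positivity
    have := mul_le_mul_of_nonneg_right e4 hpos
    linarith only [this, hM, hlow, hhigh]
  have main := psi_lower_of_params (L := L) (D := D) (c := s / 5) (T := 2500) (σ := σ)
    (B := σ ^ 2) (M := 1.4) (E := 0.7 / L) (by linarith only [hL]) hD0 (by linarith only [hL, hD1]) (by positivity)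
    (by
      rw [hLD]
      have h1 : 1 ≤ s / 5 := by linarith only [hs1]
      have h2 : 480 * L ≤ L ^ 2 * (s / 5) := by
        calc 480 * L ≤ L * L := by gcongr
          _ = L ^ 2 * 1 := by ring
          _ ≤ _ := by gcongr
      have h3 : 1000 ≤ L ^ 2 * (s / 5) := by linarith only [h2, hL]
      calc 1000 * L ≤ L ^ 2 * (s / 5) * (L ^ 2 * (s / 5)) := by gcongr; linarith only [h2, hL]
        _ = _ := by ring) (by norm_num)
    (fun t ht => psi_le_mul_of_eighty (by linarith only [hL]) ht) (by norm_num) hRH (by linarith only [hσ1]) ?_ hE ?_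
  · refine le_trans ?_ main
    have h1 := exp_ge_mul (L := L) (by linarith only [hL])
    have h2 : (1 - 1.85 / L) + 0.001 / L ≤ 1 - D - D ^ 2 / (2 * (s / 5) ^ 2) - 0.7 / L := by
      have e : 1.85 / L = D + 0.001 * D + 0.001 / L + 0.7 / L + 0.148 / L := by
        rw [hD]; field_simp; norm_num
      have : 0 < 0.148 / L := by positivity
      linarith only [hι2, e, this]
    have h3 := mul_le_mul_of_nonneg_right h2 (Real.exp_pos L).le
    have h4 : 2.08 ≤ 0.001 / L * exp L := by
      rw [div_mul_eq_mul_div, le_div_iff₀ hL0]; linarith only [h1]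
    linarith only [h3, h4]
  · intro p hp y hy
    have hp0 : 0 < p := by
      have : (0 : ℝ) < 2 * p := lt_of_lt_of_le (by positivity) hp
      have : (0 : ℝ) < p := by linarith
      exact_mod_cast this
    exact kernel_le_const hp0 (by positivity) hDc.ge (by positivity) (le_trans (by norm_num) hy)
  · rw [div_le_iff₀ hL0]; linarith only [hL]

end LargeRegimes

section Theta

open Chebyshev MeasureTheory

lemma theta_lower_of_psi {L c : ℝ} (h : c * exp L ≤ ψ (exp L)) :
    (c - 5.4 * (exp (-(L / 2)) + exp (-(2 * L / 3)) + exp (-(4 * L / 5)))) * exp L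
      ≤ θ (exp L) := by
  have h1 := psi_sub_theta_le_psi_add_psi_add_psi (exp L)
  have h2 : ∀ r : ℝ, ψ (exp L ^ r) ≤ 5.4 * exp (-(1 - r) * L) * exp L := by
    intro r
    refine (psi_le_const_mul_self (by positivity)).trans ?_
    rw [mul_assoc, ← Real.exp_add, ← Real.exp_mul, show -(1 - r) * L + L = L * r by ring]
    gcongr
    rw [show (4 : ℝ) = 2 ^ 2 by norm_num, Real.log_pow]
    have := Real.log_two_lt_d9
    push_cast; linarith
  have a1 := h2 2⁻¹
  have a2 := h2 3⁻¹
  have a3 := h2 5⁻¹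
  rw [show -(1 - (2 : ℝ)⁻¹) * L = -(L / 2) by ring] at a1
  rw [show -(1 - (3 : ℝ)⁻¹) * L = -(2 * L / 3) by ring] at a2
  rw [show -(1 - (5 : ℝ)⁻¹) * L = -(4 * L / 5) by ring] at a3
  linarith

lemma primeCounting_ge_of_theta {x a c A : ℝ} (ha : 2 ≤ a) (hax : a ≤ x) (hc0 : 0 ≤ c)
    (hA : A * x ≤ θ x) (hc : ∀ t, a ≤ t → t ≤ x → c * t ≤ θ t) :
    A * x / log x + c * (x - a) / log x ^ 2 ≤ (Nat.primeCounting ⌊x⌋₊ : ℝ) := by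
  have hx : 2 ≤ x := ha.trans hax
  rw [primeCounting_eq_theta_div_log_add_integral hx]
  have hl : 0 < log x := Real.log_pos (by linarith)
  have hInt : ∀ u v : ℝ, 2 ≤ u → u ≤ v → v ≤ x →
      IntervalIntegrable (fun t => θ t / (t * log t ^ 2)) volume u v := by
    intro u v hu huv hv
    rw [intervalIntegrable_iff_integrableOn_Icc_of_le huv]
    exact (integrableOn_theta_div_id_mul_log_sq x).mono_set (Set.Icc_subset_Icc hu hv)
  rw [← intervalIntegral.integral_add_adjacent_intervals (hInt 2 a le_rfl ha hax) (hInt a x ha hax le_rfl)]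
  have h1 : 0 ≤ ∫ t in (2 : ℝ)..a, θ t / (t * log t ^ 2) := by
    refine intervalIntegral.integral_nonneg ha fun t ht => ?_
    have : 0 < t := by linarith [ht.1]
    exact div_nonneg (theta_nonneg t) (by positivity)
  have h2 : ∫ _ in a..x, c / log x ^ 2 ≤ ∫ t in a..x, θ t / (t * log t ^ 2) := by
    refine intervalIntegral.integral_mono_on hax (by simp) (hInt a x ha hax le_rfl) fun t ht => ?_
    have ht0 : 0 < t := by linarith [ht.1]
    have hlt : 0 < log t := Real.log_pos (by linarith [ht.1])
    have h3 := hc t ht.1 ht.2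
    have hll : log t ≤ log x := Real.log_le_log ht0 ht.2
    calc c / log x ^ 2 ≤ c / log t ^ 2 := by gcongr
      _ = c * t / (t * log t ^ 2) := by field_simp
      _ ≤ _ := by gcongr
  rw [intervalIntegral.integral_const, smul_eq_mul] at h2
  have h3 : A * x / log x ≤ θ x / log x := by gcongr
  have e : c * (x - a) / log x ^ 2 = (x - a) * (c / log x ^ 2) := by ring
  linarith

lemma nth_prime_lt_of_primeCounting {n : ℕ} {x : ℝ} (hx : 0 ≤ x)
    (h : (n : ℝ) + 2 ≤ Nat.primeCounting ⌊x⌋₊) : (Nat.nth Nat.Prime n : ℝ) < x := by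
  have h' : n + 2 ≤ Nat.primeCounting ⌊x⌋₊ := by exact_mod_cast h
  have h2 : n < Nat.count Nat.Prime ⌊x⌋₊ := by
    rw [Nat.primeCounting, Nat.primeCounting', Nat.count_succ] at h'
    split_ifs at h' <;> omega
  have h3 : Nat.nth Nat.Prime n < ⌊x⌋₊ := Nat.nth_lt_of_lt_count h2
  exact lt_of_lt_of_le (by exact_mod_cast h3) (Nat.floor_le hx)

/-- The comparison of `n` with `π(x)`, in terms of `L = log x`, where `x = n R`. -/
lemma nth_prime_lt_of_theta {n : ℕ} {R L A c a q : ℝ} (hn : 1 ≤ n) (hL : 12 ≤ L)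
    (hx : (n : ℝ) * R = exp L) (hR : L + 1 - q ≤ R) (hq : q ≤ 1) (ha : 2 ≤ a) (hax : a ≤ exp L) (hc0 : 0 ≤ c)
    (hA : A * exp L ≤ θ (exp L)) (hc : ∀ t, a ≤ t → t ≤ exp L → c * t ≤ θ t)
    (hmain : L / (L + 1 - q) + 2 * L / exp L ≤ A + c * (1 - a / exp L) / L) :
    (Nat.nth Nat.Prime n : ℝ) < n * R := by
  have hL0 : 0 < L := by linarith
  have hX := Real.exp_pos L
  have h := primeCounting_ge_of_theta ha hax hc0 hA hc
  rw [Real.log_exp] at h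
  rw [hx]
  refine nth_prime_lt_of_primeCounting hX.le (le_trans ?_ h)
  have hn1 : (n : ℝ) ≤ exp L / (L + 1 - q) := by
    rw [le_div_iff₀ (by linarith), ← hx]
    gcongr
  have h2 := mul_le_mul_of_nonneg_right hmain (show 0 ≤ exp L / L by positivity)
  have e1 : (L / (L + 1 - q) + 2 * L / exp L) * (exp L / L) = exp L / (L + 1 - q) + 2 := by
    have : L + 1 - q ≠ 0 := by linarith
    field_simp
  have e2 : (A + c * (1 - a / exp L) / L) * (exp L / L) =
      A * exp L / L + c * (exp L - a) / L ^ 2 := by field_simp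
  rw [e1, e2] at h2
  linarith

lemma theta_lower_ten (hRH : ∀ ρ, xi ρ = 0 → |ρ.im| ≤ 2500 → ρ.re = 1 / 2) {t : ℝ} (ht : exp 10 ≤ t) :
    0.82 * t ≤ θ t := by
  have ht0 : 0 < t := (Real.exp_pos _).trans_le ht
  obtain ⟨L, rfl⟩ : ∃ L, t = exp L := ⟨log t, (Real.exp_log ht0).symm⟩
  have hL : 10 ≤ L := Real.exp_le_exp.1 ht
  have hpsi : 0.87 * exp L ≤ ψ (exp L) := by
    rcases le_total L 80 with h | h
    · exact psi_lower_ten hRH hL h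
    · have h1 : 0.87 * exp L ≤ (1 - 1.85 / L) * exp L := by
        gcongr
        have : 1.85 / L ≤ 0.1 := by rw [div_le_iff₀ (by linarith)]; linarith
        linarith
      rcases le_total L 480 with h2 | h2
      · exact h1.trans (psi_lower_eighty hRH h h2)
      · exact h1.trans (psi_lower_large hRH h2)
  refine le_trans ?_ (theta_lower_of_psi hpsi)
  gcongr
  have a1 : exp (-(L / 2)) ≤ 0.00675 :=
    (exp_neg_le_of_add (n := 5) (r := 0) le_rfl (by push_cast; linarith)).trans (by norm_num)
  have a2 : exp (-(2 * L / 3)) ≤ 0.0013 :=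
    (exp_neg_le_of_add (n := 6) (r := 0.66) (by norm_num) (by norm_num; linarith)).trans (by norm_num)
  have a3 : exp (-(4 * L / 5)) ≤ 0.00034 :=
    (exp_neg_le_of_add (n := 8) (r := 0) le_rfl (by push_cast; linarith)).trans (by norm_num)
  linarith

lemma theta_lower_forty (hRH : ∀ ρ, xi ρ = 0 → |ρ.im| ≤ 2500 → ρ.re = 1 / 2) {t : ℝ} (ht : exp 40 ≤ t) :
    0.97 * t ≤ θ t := by
  have ht0 : 0 < t := (Real.exp_pos _).trans_le ht
  obtain ⟨L, rfl⟩ : ∃ L, t = exp L := ⟨log t, (Real.exp_log ht0).symm⟩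
  have hL : 40 ≤ L := Real.exp_le_exp.1 ht
  have hpsi : 0.9715 * exp L ≤ ψ (exp L) := by
    rcases le_total L 80 with h | h
    · refine le_trans ?_ (psi_lower_twelve hRH (by linarith) h)
      gcongr
      have : 1.1 / L ≤ 0.0275 := by rw [div_le_iff₀ (by linarith)]; linarith
      linarith
    · have h1 : 0.9715 * exp L ≤ (1 - 1.85 / L) * exp L := by
        gcongr
        have : 1.85 / L ≤ 0.024 := by rw [div_le_iff₀ (by linarith)]; linarith
        linarith
      rcases le_total L 480 with h2 | h2
      · exact h1.trans (psi_lower_eighty hRH h h2)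
      · exact h1.trans (psi_lower_large hRH h2)
  refine le_trans ?_ (theta_lower_of_psi hpsi)
  gcongr
  have a1 : ∀ y : ℝ, 20 ≤ y → exp (-y) ≤ 0.00001 := fun y hy =>
    (exp_neg_le_of_add (n := 20) (r := 0) le_rfl (by push_cast; linarith)).trans (by norm_num)
  have := a1 (L / 2) (by linarith)
  have := a1 (2 * L / 3) (by linarith)
  have := a1 (4 * L / 5) (by linarith)
  linarith

lemma log_add_one_div_le {l a : ℝ} (ha : 1 ≤ a) (h : a ≤ l) : (log l + 1) / l ≤ (log a + 1) / a := by
  have ha0 : 0 < a := by linarith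
  have hl0 : 0 < l := by linarith
  rw [div_le_div_iff₀ hl0 ha0]
  have e : log l = log a + log (l / a) := by
    rw [← Real.log_mul ha0.ne' (by positivity)]; congr 1; field_simp
  have h1 := Real.log_le_sub_one_of_pos (show 0 < l / a by positivity)
  have h2 : a * (l / a) = l := by field_simp
  have h3 := Real.log_nonneg ha
  rw [e]
  nlinarith

/-- The statement for large `n`, given the Riemann hypothesis up to height `2500`. -/
lemma nth_prime_lt_of_large (hRH : ∀ ρ, xi ρ = 0 → |ρ.im| ≤ 2500 → ρ.re = 1 / 2) {n : ℕ} (hn : 13400 ≤ n) :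
    (Nat.nth Nat.Prime n : ℝ) < (n : ℝ) * (log ((n : ℝ) * log n) + 1) := by
  have hn' : (13400 : ℝ) ≤ n := by exact_mod_cast hn
  have hn0 : (0 : ℝ) < n := by linarith
  set l := log n with hl
  have hl9 : 9.5 ≤ l := by
    rw [hl, Real.le_log_iff_exp_le hn0]
    refine le_trans ?_ hn'
    have e : exp 9.5 ^ 2 = exp 1 ^ 19 := by
      rw [← Real.exp_nat_mul, ← Real.exp_nat_mul]; norm_num
    have h2 : exp 1 ^ 19 ≤ 13400 ^ 2 := by
      calc exp 1 ^ 19 ≤ 2.7182818286 ^ 19 := by gcongr; exact Real.exp_one_lt_d9.le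
        _ ≤ _ := by norm_num
    rw [← e] at h2
    exact (pow_le_pow_iff_left₀ (Real.exp_pos _).le (by norm_num) two_ne_zero).1 h2
  have hl0 : 0 < l := by linarith
  set R := log ((n : ℝ) * l) + 1 with hR
  have hRl : R = l + log l + 1 := by rw [hR, Real.log_mul hn0.ne' hl0.ne', ← hl]
  have hlogl : 0 < log l := Real.log_pos (by linarith)
  have hR0 : 0 < R := by rw [hRl]; linarith
  set L := l + log R with hL
  have hx : (n : ℝ) * R = exp L := by
    rw [hL, Real.exp_add, hl, Real.exp_log hn0, Real.exp_log hR0]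
  have hRq : L + 1 - (log l + 1) / l ≤ R := by
    have h1 : log R = log l + log (R / l) := by
      rw [← Real.log_mul hl0.ne' (by positivity)]; congr 1; field_simp
    have h2 := Real.log_le_sub_one_of_pos (show 0 < R / l by positivity)
    have h3 : R / l = 1 + (log l + 1) / l := by rw [hRl]; field_simp; ring
    linarith
  have hlog95 : log 9.5 ≤ 2.252 ∧ 2.25 ≤ log 9.5 := by
    have e : log 9.5 = 3 * log 2 + log (19 / 16) := by
      rw [show (3 : ℝ) * log 2 = log (2 ^ 3) by rw [Real.log_pow]; norm_num,
        ← Real.log_mul (by norm_num) (by norm_num)]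
      norm_num
    have e2 : log (19 / 16) = -log (1 - 3 / 19) := by rw [← Real.log_inv]; norm_num
    have := Real.abs_log_sub_add_sum_range_le (x := 3 / 19) (by norm_num [abs_of_pos]) 5
    norm_num [sum_range_succ, abs_of_pos] at this
    have h3 := abs_le.1 this
    norm_num at e2
    have := Real.log_two_lt_d9
    have := Real.log_two_gt_d9
    constructor <;> linarith [h3.1, h3.2]
  have hL12 : 12 ≤ L := by
    have h1 : 12.75 ≤ R := by
      rw [hRl]
      have := Real.log_le_log (by norm_num) hl9
      linarith [hlog95.2]
    have h2 : log 9.5 + log (12.75 / 9.5) ≤ log R := by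
      rw [← Real.log_mul (by norm_num) (by norm_num)]
      refine Real.log_le_log (by norm_num) ?_
      norm_num at h1 ⊢; linarith
    have h3 := Real.one_sub_inv_le_log_of_pos (show (0 : ℝ) < 12.75 / 9.5 by norm_num)
    have h4 : (0.25 : ℝ) ≤ 1 - (12.75 / 9.5)⁻¹ := by norm_num
    linarith [hlog95.2]
  have hL0 : 0 < L := by linarith
  rcases le_total L 80 with hL80 | hL80
  · have hq : (log l + 1) / l ≤ 0.3424 := by
      refine (log_add_one_div_le (by norm_num) hl9).trans ?_
      rw [div_le_iff₀ (by norm_num)]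
      linarith [hlog95.1]
    have hA := theta_lower_of_psi (psi_lower_twelve hRH hL12 hL80)
    refine nth_prime_lt_of_theta (q := 0.3424) (by omega) hL12 hx (by linarith) (by norm_num)
      (a := exp 10) (c := 0.82) (by linarith [Real.add_one_le_exp 10]) (Real.exp_le_exp.2 (by linarith))
      (by norm_num) hA (fun t ht _ => theta_lower_ten hRH ht) ?_
    have b1 : exp 10 / exp L ≤ 0.1354 := by
      rw [← Real.exp_sub, show 10 - L = -(L - 10) by ring]
      exact (exp_neg_le_of_add (n := 2) (r := 0) le_rfl (by push_cast; linarith)).trans (by norm_num)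
    have b2 : 0.708 / L ≤ 0.82 * (1 - exp 10 / exp L) / L := by
      gcongr; linarith
    have b3 : L / (L + 1 - 0.3424) ≤ 1 - 0.623 / L := by
      rw [div_le_iff₀ (by linarith)]
      have : (1 - 0.623 / L) * (L + 1 - 0.3424) = L + 0.6576 - 0.623 - 0.623 * 0.6576 / L := by
        field_simp; ring
      rw [this]
      have : 0.623 * 0.6576 / L ≤ 0.0343 := by rw [div_le_iff₀ hL0]; linarith
      linarith
    have key : ∀ (y : ℝ), 6 ≤ y → L ≤ 2 * y → L * exp (-y) ≤ 12 * exp (-6) := by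
      intro y hy hLy
      have h := exp_neg_le_pow (a := 6) (y := y) 1 (by norm_num) hy (by norm_num)
      calc L * exp (-y) ≤ 2 * y * (exp (-6) * (6 / y) ^ 1) := by gcongr
        _ = _ := by
          have : y ≠ 0 := by linarith
          field_simp; norm_num
    have e6 : exp (-6) ≤ 0.00248 :=
      (exp_neg_le_of_add (n := 6) (r := 0) le_rfl (by push_cast; linarith)).trans (by norm_num)
    have e8 : exp (-(2 * L / 3)) ≤ exp (-(L / 2)) * 0.136 := by
      have : exp (-(L / 6)) ≤ 0.136 :=
        (exp_neg_le_of_add (n := 2) (r := 0) le_rfl (by push_cast; linarith)).trans (by norm_num)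
      rw [show -(2 * L / 3) = -(L / 2) + -(L / 6) by ring, Real.exp_add]
      gcongr
    have e9 : exp (-(4 * L / 5)) ≤ exp (-(L / 2)) * 0.03 := by
      have : exp (-(3 * L / 10)) ≤ 0.03 :=
        (exp_neg_le_of_add (n := 3) (r := 0.6) (by norm_num) (by norm_num; linarith)).trans (by norm_num)
      rw [show -(4 * L / 5) = -(L / 2) + -(3 * L / 10) by ring, Real.exp_add]
      gcongr
    have e10 : 2 * L / exp L ≤ 0.01 / L := by
      have h := exp_neg_le_pow (a := 12) (y := L) 2 (by norm_num) hL12 (by norm_num)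
      have h2 : exp (-12) ≤ 0.00000001 * 700 :=
        (exp_neg_le_of_add (n := 12) (r := 0) le_rfl (by push_cast; linarith)).trans (by norm_num)
      rw [div_eq_mul_inv, ← Real.exp_neg]
      calc 2 * L * exp (-L) ≤ 2 * L * (0.00000001 * 700 * (12 / L) ^ 2) := by
            gcongr
            exact h.trans (by gcongr)
        _ = (2 * (0.00000001 * 700 * 144)) / L := by field_simp; norm_num
        _ ≤ _ := by gcongr; norm_num
    have k := key (L / 2) (by linarith) (by linarith)
    have hk : 5.4 * (exp (-(L / 2)) + exp (-(2 * L / 3)) + exp (-(4 * L / 5))) ≤ 0.1875 / L := by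
      rw [le_div_iff₀ hL0]
      have : 0 < L * exp (-(L / 2)) := by positivity
      linarith only [this, k, e6, mul_le_mul_of_nonneg_left e8 hL0.le, mul_le_mul_of_nonneg_left e9 hL0.le]
    have e : 1.1 / L = 0.708 / L + 0.623 / L - 0.1875 / L - 0.0435 / L := by field_simp; norm_num
    have : 0.01 / L ≤ 0.0435 / L := by gcongr; norm_num
    linarith
  · have hl75 : 75 ≤ l := by
      by_contra hcon
      push Not at hcon
      have h1 : log 75 ≤ 5 := by
        rw [Real.log_le_iff_le_exp (by norm_num)]
        calc (75 : ℝ) ≤ 2.7 ^ 5 := by norm_num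
          _ ≤ exp 1 ^ 5 := by gcongr; linarith [Real.exp_one_gt_d9]
          _ = exp 5 := by rw [← Real.exp_nat_mul]; norm_num
      have h2 : log l ≤ 5 := (Real.log_le_log hl0 hcon.le).trans h1
      have h3 : log R ≤ 5 := by
        rw [Real.log_le_iff_le_exp hR0]
        calc R ≤ 81 := by rw [hRl]; linarith
          _ ≤ 2.7 ^ 5 := by norm_num
          _ ≤ exp 1 ^ 5 := by gcongr; linarith [Real.exp_one_gt_d9]
          _ = exp 5 := by rw [← Real.exp_nat_mul]; norm_num
      linarith
    have hq : (log l + 1) / l ≤ 0.0715 := by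
      refine (log_add_one_div_le (by norm_num) hl75).trans ?_
      rw [div_le_iff₀ (by norm_num)]
      have e : log 75 = 6 * log 2 + log (75 / 64) := by
        rw [show (6 : ℝ) * log 2 = log (2 ^ 6) by rw [Real.log_pow]; norm_num,
          ← Real.log_mul (by norm_num) (by norm_num)]
        norm_num
      have := Real.log_le_sub_one_of_pos (show (0 : ℝ) < 75 / 64 by norm_num)
      have := Real.log_two_lt_d9
      linarith
    have hpsi : (1 - 1.85 / L) * exp L ≤ ψ (exp L) := by
      rcases le_total L 480 with h2 | h2
      · exact psi_lower_eighty hRH hL80 h2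
      · exact psi_lower_large hRH h2
    have hA := theta_lower_of_psi hpsi
    refine nth_prime_lt_of_theta (q := 0.0715) (by omega) hL12 hx (by linarith) (by norm_num)
      (a := exp 40) (c := 0.97) (by linarith [Real.add_one_le_exp 40]) (Real.exp_le_exp.2 (by linarith))
      (by norm_num) hA (fun t ht _ => theta_lower_forty hRH ht) ?_
    have a1 : ∀ y : ℝ, 20 ≤ y → exp (-y) ≤ 0.00001 := fun y hy =>
      (exp_neg_le_of_add (n := 20) (r := 0) le_rfl (by push_cast; linarith)).trans (by norm_num)
    have b1 : exp 40 / exp L ≤ 0.00001 := by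
      rw [← Real.exp_sub, show 40 - L = -(L - 40) by ring]
      exact a1 _ (by linarith)
    have b2 : 0.969 / L ≤ 0.97 * (1 - exp 40 / exp L) / L := by
      gcongr; linarith
    have b3 : L / (L + 1 - 0.0715) ≤ 1 - 0.915 / L := by
      rw [div_le_iff₀ (by linarith)]
      have : (1 - 0.915 / L) * (L + 1 - 0.0715) = L + 0.9285 - 0.915 - 0.915 * 0.9285 / L := by
        field_simp; ring
      rw [this]
      have : 0.915 * 0.9285 / L ≤ 0.0108 := by rw [div_le_iff₀ hL0]; linarith
      linarith
    have b4 : ∀ y : ℝ, L / 2 ≤ y → L * exp (-y) ≤ 0.0001 := by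
      intro y hy
      have h := exp_neg_le_pow (a := 40) (y := y) 1 (by norm_num) (by linarith) (by norm_num)
      have h2 : exp (-40) ≤ 0.000000001 :=
        (exp_neg_le_of_add (n := 24) (r := 0) le_rfl (by norm_num)).trans (by norm_num)
      have hy0 : 0 < y := by linarith
      calc L * exp (-y) ≤ (2 * y) * (0.000000001 * (40 / y) ^ 1) := by
            gcongr
            · linarith
            · exact h.trans (by gcongr)
        _ = 2 * 0.000000001 * 40 := by field_simp
        _ ≤ _ := by norm_num
    have hk : 5.4 * (exp (-(L / 2)) + exp (-(2 * L / 3)) + exp (-(4 * L / 5))) ≤ 0.002 / L := by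
      rw [le_div_iff₀ hL0]
      have := b4 (L / 2) le_rfl
      have := b4 (2 * L / 3) (by linarith)
      have := b4 (4 * L / 5) (by linarith)
      linarith
    have e10 : 2 * L / exp L ≤ 0.001 / L := by
      have h := exp_ge_mul hL80
      have h1 := b4 (L / 2) le_rfl
      have e : exp L = exp (L / 2) * exp (L / 2) := by rw [← Real.exp_add]; ring_nf
      have h3 : exp (-(L / 2)) = (exp (L / 2))⁻¹ := Real.exp_neg _
      rw [h3, ← div_eq_mul_inv] at h1
      have hL1 : 0 < L / exp (L / 2) := by positivity
      rw [le_div_iff₀ hL0, e]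
      calc 2 * L / (exp (L / 2) * exp (L / 2)) * L =
            2 * (L / exp (L / 2)) * (L / exp (L / 2)) := by field_simp
        _ ≤ 2 * 0.0001 * 0.0001 := by gcongr
        _ ≤ _ := by norm_num
    have e : 1.85 / L = 0.969 / L + 0.915 / L - 0.002 / L - 0.032 / L := by field_simp; norm_num
    have : 0.001 / L ≤ 0.032 / L := by gcongr; norm_num
    linarith

end Theta

section SmallCases

/-- Sums over an initial segment, in a form the kernel evaluates quickly. -/
noncomputable def recSum (f : ℕ → ℕ) (m : ℕ) : ℕ := Nat.rec 0 (fun k ih => Nat.add ih (f k)) m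

lemma recSum_eq (f : ℕ → ℕ) (m : ℕ) : recSum f m = ∑ k ∈ range m, f k := by
  induction m with
  | zero => rfl
  | succ m ih => rw [sum_range_succ, ← ih]; rfl

/-- The number of `k` in `[lo, lo + len)` that are coprime to `F`. -/
noncomputable def roughCount (F lo len : ℕ) : ℕ :=
  recSum (fun b => recSum (fun i => bif Nat.beq (Nat.gcd (Nat.add lo (Nat.add (Nat.mul b 256) i)) F) 1 then 1 else 0) 256)
    (len / 256) +
  recSum (fun i => bif Nat.beq (Nat.gcd (Nat.add lo (Nat.add (Nat.mul (len / 256) 256) i)) F) 1 then 1 else 0) (len % 256)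

lemma sum_range_block (g : ℕ → ℕ) (a : ℕ) :
    ∑ b ∈ range a, ∑ i ∈ range 256, g (b * 256 + i) = ∑ i ∈ range (a * 256), g i := by
  induction a with
  | zero => simp
  | succ a ih => rw [sum_range_succ, ih, Nat.succ_mul, sum_range_add]

lemma roughCount_eq (F lo len : ℕ) :
    roughCount F lo len = ∑ i ∈ range len, if Nat.gcd (lo + i) F = 1 then 1 else 0 := by
  have e : ∀ i, (bif Nat.beq (Nat.gcd (lo + i) F) 1 then 1 else 0 : ℕ) = if Nat.gcd (lo + i) F = 1 then 1 else 0 := by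
    intro i
    rcases h : Nat.beq (Nat.gcd (lo + i) F) 1 with _ | _
    · rw [if_neg (Nat.ne_of_beq_eq_false h)]; rfl
    · rw [if_pos (Nat.eq_of_beq_eq_true h)]; rfl
  have h := sum_range_block (fun i => if Nat.gcd (lo + i) F = 1 then 1 else 0) (len / 256)
  have h3 : len = len / 256 * 256 + len % 256 := by omega
  have h4 : ∑ i ∈ range len, (if Nat.gcd (lo + i) F = 1 then 1 else 0) =
      ∑ i ∈ range (len / 256 * 256 + len % 256), (if Nat.gcd (lo + i) F = 1 then 1 else 0) :=
    congrArg (fun m => ∑ i ∈ range m, (if Nat.gcd (lo + i) F = 1 then 1 else 0)) h3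
  have h5 := h4.trans (sum_range_add _ _ _)
  refine Eq.trans ?_ (h5.trans (congrArg (· + _) h.symm)).symm
  refine congrArg₂ (· + ·) ((recSum_eq _ _).trans ?_) ((recSum_eq _ _).trans ?_)
  · refine sum_congr rfl fun b _ => ?_
    exact (recSum_eq _ _).trans (sum_congr rfl fun i _ => e _)
  · exact sum_congr rfl fun i _ => e _

lemma prime_of_gcd_eq_one {F B k : ℕ} (hF : ∀ p < B, 2 ≤ p → Nat.gcd p F ≠ 1) (h1 : 1 < k) (hk : k < B ^ 2)
    (h : Nat.gcd k F = 1) : k.Prime := by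
  by_contra hnp
  have hp := Nat.minFac_prime (n := k) (by omega)
  have h2 := Nat.minFac_sq_le_self (by omega) hnp
  have h3 : k.minFac < B := by
    by_contra hcon
    have := Nat.pow_le_pow_left (not_lt.1 hcon) 2
    omega
  have h4 := hF _ h3 hp.two_le
  have h5 : k.minFac ∣ F := by
    by_contra hcon
    exact h4 ((Nat.Prime.coprime_iff_not_dvd hp).2 hcon)
  have h6 := Nat.dvd_gcd (Nat.minFac_dvd k) h5
  rw [h] at h6
  exact hp.one_lt.ne' (Nat.dvd_one.1 h6)

lemma count_add_roughCount_le {F B lo len : ℕ} (hF : ∀ p < B, 2 ≤ p → Nat.gcd p F ≠ 1) (h1 : 1 < lo)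
    (hB : lo + len ≤ B ^ 2) :
    Nat.count Nat.Prime lo + roughCount F lo len ≤ Nat.count Nat.Prime (lo + len) := by
  rw [roughCount_eq]
  induction len with
  | zero => simp
  | succ m ih =>
    have := ih (by omega)
    rw [sum_range_succ, ← Nat.add_assoc lo m 1, Nat.count_succ]
    have h2 : (if Nat.gcd (lo + m) F = 1 then 1 else 0) ≤ if (lo + m).Prime then 1 else 0 := by
      split_ifs with h3 h4
      · exact le_rfl
      · exact absurd (prime_of_gcd_eq_one hF (by omega) (by omega) h3) h4
      · exact zero_le_one
      · exact le_rfl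
    omega

/-- One checkpoint: `exp (a / 16) ≤ n`, `exp (b / 16) ≤ n a / 16` and `y ≤ n (b / 16 + 1)`. -/
def checkpointOK (n a b y : ℕ) : Bool :=
  (Nat.ble (27183 ^ a) (n ^ 16 * 10000 ^ a) && Nat.ble (27183 ^ b * 16 ^ 16) ((n * a) ^ 16 * 10000 ^ b)) &&
    Nat.ble (16 * y) (n * (b + 16))

lemma exp_div_le {a n : ℕ} {c : ℝ} (hc : 0 ≤ c) (h : (27183 : ℝ) ^ a ≤ c ^ 16 * 10000 ^ a) (hn : n = 16) :
    exp (a / n) ≤ c := by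
  subst hn
  refine (pow_le_pow_iff_left₀ (Real.exp_pos _).le hc (show 16 ≠ 0 by norm_num)).1 ?_
  rw [← Real.exp_nat_mul]
  have e : ((16 : ℕ) : ℝ) * (a / (16 : ℕ)) = a * 1 := by push_cast; ring
  rw [e, Real.exp_nat_mul]
  have h2 : exp 1 ^ a ≤ (27183 / 10000 : ℝ) ^ a := by
    gcongr
    linarith [Real.exp_one_lt_d9]
  refine h2.trans ?_
  rw [div_pow, div_le_iff₀ (by positivity)]
  exact h

lemma le_of_checkpointOK {n a b y : ℕ} (hn : 2 ≤ n) (ha : 1 ≤ a) (h : checkpointOK n a b y = true) :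
    (y : ℝ) ≤ n * (log (n * log n) + 1) := by
  simp only [checkpointOK, Bool.and_eq_true, Nat.ble_eq] at h
  obtain ⟨⟨h1, h2⟩, h3⟩ := h
  have hn0 : (0 : ℝ) < n := by positivity
  have ha0 : (0 : ℝ) < a := by exact_mod_cast ha
  have e1 : (a / 16 : ℝ) ≤ log n := by
    rw [Real.le_log_iff_exp_le hn0]
    exact_mod_cast exp_div_le (n := 16) (c := n) hn0.le (by exact_mod_cast h1) rfl
  have e2 : (b / 16 : ℝ) ≤ log (n * (a / 16)) := by
    rw [Real.le_log_iff_exp_le (by positivity)]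
    have h2' : (27183 : ℝ) ^ b * 16 ^ 16 ≤ (n * a) ^ 16 * 10000 ^ b := by exact_mod_cast h2
    have h4 : (27183 : ℝ) ^ b ≤ (n * (a / 16)) ^ 16 * 10000 ^ b := by
      rw [mul_div_assoc', div_pow, div_mul_eq_mul_div, le_div_iff₀ (by positivity)]
      exact h2'
    have h5 := exp_div_le (a := b) (n := 16) (c := n * (a / 16)) (by positivity) h4 rfl
    exact_mod_cast h5
  have e3 : log (n * (a / 16)) ≤ log (n * log n) :=
    Real.log_le_log (by positivity) (by gcongr)
  have h3' : (16 : ℝ) * y ≤ n * (b + 16) := by exact_mod_cast h3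
  have h4 : (n : ℝ) * (b / 16 + 1) ≤ n * (log (n * log n) + 1) := by gcongr; linarith
  linarith

/-- Runs through a list of checkpoints `(a, b, y, c)`, where `c` is the number of primes below `y`. -/
noncomputable def checkpointsOK (F B : ℕ) : List (ℕ × ℕ × ℕ × ℕ) → ℕ → ℕ → Bool
  | [], _, _ => true
  | (a, b, y', c') :: l, y, c =>
    (checkpointOK c a b y' && Nat.ble 1 a) && ((Nat.ble y y' && Nat.ble y' (B ^ 2)) &&
      (Nat.beq (c + roughCount F y (y' - y)) c' && checkpointsOK F B l y' c'))

lemma nth_prime_lt_of_checkpoints {F B : ℕ} (hF : ∀ p < B, 2 ≤ p → Nat.gcd p F ≠ 1) :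
    ∀ (l : List (ℕ × ℕ × ℕ × ℕ)) (y c : ℕ), 1 < y → 2 ≤ c → c ≤ Nat.count Nat.Prime y →
      checkpointsOK F B l y c = true →
      (∀ n, c ≤ n → n < (l.getLast?.elim c fun q => q.2.2.2) →
        (Nat.nth Nat.Prime n : ℝ) < n * (log (n * log n) + 1)) ∧
      (l.getLast?.elim c fun q => q.2.2.2) ≤ Nat.count Nat.Prime (l.getLast?.elim y fun q => q.2.2.1)
  | [], y, c, hy, hc, hcy, _ => ⟨fun n h1 h2 => absurd h2 (not_lt.2 h1), hcy⟩
  | (a, b, y', c') :: l, y, c, hy, hc, hcy, h => by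
    simp only [checkpointsOK, Bool.and_eq_true, Nat.ble_eq] at h
    obtain ⟨⟨h1, ha⟩, ⟨hyy, hB⟩, hcnt, hrest⟩ := h
    have hcnt := Nat.eq_of_beq_eq_true hcnt
    have hle := le_of_checkpointOK hc ha h1
    have hcount := count_add_roughCount_le (lo := y) (len := y' - y) hF hy (by omega)
    rw [Nat.add_sub_cancel' hyy] at hcount
    have hc' : c' ≤ Nat.count Nat.Prime y' := by omega
    obtain ⟨ih1, ih2⟩ := nth_prime_lt_of_checkpoints hF l y' c' (by omega) (by omega) hc' hrest
    have elast : ∀ {β : Type} (d d' : β) (f : ℕ × ℕ × ℕ × ℕ → β), f (a, b, y', c') = d' →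
        ((a, b, y', c') :: l).getLast?.elim d f = l.getLast?.elim d' f := by
      intro β d d' f hd
      cases l with
      | nil => simpa using hd
      | cons x l => rw [List.getLast?_cons_cons, List.getLast?_cons, Option.elim_some, Option.elim_some]
    rw [elast c c' _ rfl, elast y y' _ rfl]
    refine ⟨fun n hn hn2 => ?_, ih2⟩
    rcases lt_or_ge n c' with hlt | hge
    · have h5 : Nat.nth Nat.Prime n < y' := Nat.nth_lt_of_lt_count (by omega)
      have h6 : (Nat.nth Nat.Prime n : ℝ) < y' := by exact_mod_cast h5
      refine h6.trans_le (hle.trans ?_)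
      have hc0 : (2 : ℝ) ≤ c := by exact_mod_cast hc
      have hcn : (c : ℝ) ≤ n := by exact_mod_cast hn
      have hl : 0 < log c := Real.log_pos (by linarith)
      have hll : log c ≤ log n := Real.log_le_log (by linarith) hcn
      have h7 : log (c * log c) ≤ log (n * log n) :=
        Real.log_le_log (by positivity) (by gcongr)
      have h8 : 0 ≤ log (c * log c) + 1 := by
        have : (0 : ℝ) < y' := lt_of_le_of_lt (Nat.cast_nonneg _) h6
        by_contra hcon
        push Not at hcon
        have : (c : ℝ) * (log (c * log c) + 1) < 0 := mul_neg_of_pos_of_neg (by linarith) hcon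
        linarith
      gcongr
    · exact ih1 n hge hn2

/-- The product of the primes below `409`. -/
def roughModulus : ℕ :=
  40786437068665554814618971683922828694582892964708884701862361274616519644579867220074319283900539893834048687270253154873138028145776983601098265140488742774844290

lemma gcd_small_ne_one : ∀ p < 23, 2 ≤ p → Nat.gcd p 9699690 ≠ 1 := by decide +kernel

lemma gcd_roughModulus_ne_one : ∀ p < 409, 2 ≤ p → Nat.gcd p roughModulus ≠ 1 := by decide +kernel

/-- Checkpoints below `529`. -/
def firstCheckpoints : List (ℕ × ℕ × ℕ × ℕ) :=
  [(33, 44, 30, 10), (36, 49, 40, 12), (39, 54, 52, 15), (43, 59, 70, 19), (47, 64, 95, 24), (50, 69, 127, 30), (54, 73, 166, 38), (58, 78, 223, 47), (61, 83, 290, 61), (65, 88, 396, 77), (69, 92, 519, 97), (73, 97, 529, 99)]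

/-- Checkpoints above `529`. -/
def laterCheckpoints : List (ℕ × ℕ × ℕ × ℕ) :=
  [(73, 97, 699, 125), (77, 102, 921, 157), (80, 106, 1197, 196), (84, 110, 1543, 242), (87, 114, 1966, 297), (91, 118, 2487, 367), (94, 122, 3165, 447), (97, 126, 3967, 548), (100, 130, 5000, 669), (104, 134, 6271, 815), (107, 137, 7793, 986), (110, 141, 9675, 1193), (113, 144, 11930, 1429), (116, 147, 14557, 1705), (119, 151, 17795, 2042), (121, 154, 21696, 2434), (124, 157, 26317, 2891), (127, 160, 31801, 3419), (130, 163, 38250, 4037), (132, 166, 45920, 4754), (135, 169, 54968, 5587), (138, 172, 65647, 6556), (140, 175, 78262, 7685), (143, 178, 93180, 9000), (145, 180, 110250, 10468), (148, 183, 130195, 12175), (150, 186, 153709, 14166)]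

lemma firstCheckpoints_ok : checkpointsOK 9699690 23 firstCheckpoints 23 8 = true := by decide +kernel

lemma laterCheckpoints_ok : checkpointsOK roughModulus 409 laterCheckpoints 529 99 = true := by decide +kernel

lemma count_prime_23 : Nat.count Nat.Prime 23 = 8 := by decide +kernel

lemma nth_prime_lt_of_small {n : ℕ} (h5 : 5 ≤ n) (hn : n < 13400) :
    (Nat.nth Nat.Prime n : ℝ) < n * (log (n * log n) + 1) := by
  have key : ∀ {a b y : ℕ}, 1 ≤ a → n < Nat.count Nat.Prime y → checkpointOK n a b y = true →
      (Nat.nth Nat.Prime n : ℝ) < n * (log (n * log n) + 1) := by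
    intro a b y ha hcount hok
    have h5 : (Nat.nth Nat.Prime n : ℝ) < y := by exact_mod_cast Nat.nth_lt_of_lt_count hcount
    exact h5.trans_le (le_of_checkpointOK (by omega) ha hok)
  rcases lt_or_ge n 8 with h8 | h8
  · interval_cases n
    · exact key (a := 25) (b := 32) (y := 14) (by norm_num) (by decide +kernel) (by decide +kernel)
    · exact key (a := 28) (b := 37) (y := 18) (by norm_num) (by decide +kernel) (by decide +kernel)
    · exact key (a := 31) (b := 41) (y := 20) (by norm_num) (by decide +kernel) (by decide +kernel)
  obtain ⟨h1, h2⟩ := nth_prime_lt_of_checkpoints gcd_small_ne_one firstCheckpoints 23 8 (by norm_num) (by norm_num)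
    count_prime_23.ge firstCheckpoints_ok
  have e1 : (firstCheckpoints.getLast?.elim 8 fun q => q.2.2.2) = 99 := rfl
  have e2 : (firstCheckpoints.getLast?.elim 23 fun q => q.2.2.1) = 529 := rfl
  rw [e1] at h1 h2
  rw [e2] at h2
  obtain ⟨h3, -⟩ := nth_prime_lt_of_checkpoints gcd_roughModulus_ne_one laterCheckpoints 529 99 (by norm_num)
    (by norm_num) h2 laterCheckpoints_ok
  have e3 : (laterCheckpoints.getLast?.elim 99 fun q => q.2.2.2) = 14166 := rfl
  rw [e3] at h3
  rcases lt_or_ge n 99 with hlt | hge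
  · exact h1 n h8 hlt
  · exact h3 n hge (by omega)

end SmallCases

section EulerMaclaurin

/-- The normalized Bernoulli polynomial `B_k(x) / k!`. -/
noncomputable def bernoulliDiv (k : ℕ) (x : ℝ) : ℝ := bernoulliFun k x / k.factorial

lemma bernoulliDiv_zero (x : ℝ) : bernoulliDiv 0 x = 1 := by
  simp [bernoulliDiv, bernoulliFun]

lemma hasDerivAt_bernoulliDiv (k : ℕ) (x : ℝ) :
    HasDerivAt (bernoulliDiv (k + 1)) (bernoulliDiv k x) x := by
  have h := (hasDerivAt_bernoulliFun (k + 1) x).div_const ((k + 1).factorial : ℝ)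
  refine h.congr_deriv ?_
  rw [bernoulliDiv, Nat.factorial_succ]
  have : (k.factorial : ℝ) ≠ 0 := by exact_mod_cast k.factorial_ne_zero
  push_cast
  field_simp

/-- The boundary term of the Euler–Maclaurin formula for `∑ n ^ (-s)`. -/
noncomputable def emBoundary (K : ℕ) (s : ℂ) (x : ℝ) : ℂ :=
  (x : ℂ) ^ (1 - s) / (s - 1) +
    ∑ k ∈ range K, (ascPochhammer ℂ k).eval s * (bernoulliDiv (k + 1) 0 : ℂ) * (x : ℂ) ^ (-s - k)

lemma bernoulliDiv_one_eq (k : ℕ) :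
    bernoulliDiv (k + 1) 1 = bernoulliDiv (k + 1) 0 + if k = 0 then 1 else 0 := by
  rw [bernoulliDiv, bernoulliDiv, bernoulliFun_eval_one, add_div]
  congr 1
  rcases Nat.eq_zero_or_pos k with rfl | hk
  · simp
  · rw [if_neg (by omega), if_neg (by omega), zero_div]

lemma emBoundary_step {K : ℕ} (hK : 1 ≤ K) {s : ℂ} (hs : 0 < s.re) (hs1 : s ≠ 1) {C : ℝ} (hC : ∀ x ∈ Set.Icc (0 : ℝ) 1, |bernoulliDiv K x| ≤ C)
    {M : ℝ} (hM : 0 < M) :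
    ‖((M + 1 : ℝ) : ℂ) ^ (-s) + emBoundary K s (M + 1) - emBoundary K s M‖ ≤
      ‖(ascPochhammer ℂ K).eval s‖ * C * M ^ (-s.re - K) := by
  set G : ℝ → ℂ := fun x => (x : ℂ) ^ (1 - s) / (1 - s) -
    ∑ k ∈ range K, (ascPochhammer ℂ k).eval s * (bernoulliDiv (k + 1) (x - M) : ℂ) * (x : ℂ) ^ (-s - k) with hG
  have hsk : ∀ k : ℕ, -s - (k : ℂ) ≠ 0 := by
    intro k h
    have := congrArg Complex.re h
    simp at this
    have hk : (0 : ℝ) ≤ k := Nat.cast_nonneg k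
    linarith
  have h1s : 1 - s ≠ 0 := sub_ne_zero.2 (Ne.symm hs1)
  have hder : ∀ x : ℝ, 0 < x → HasDerivAt G
      ((ascPochhammer ℂ K).eval s * (bernoulliDiv K (x - M) : ℂ) * (x : ℂ) ^ (-s - K)) x := by
    intro x hx
    have h1 := (hasDerivAt_ofReal_cpow_const hx.ne' h1s).div_const (1 - s)
    have h2 : ∀ k ∈ range K, HasDerivAt
        (fun x : ℝ => (ascPochhammer ℂ k).eval s * (bernoulliDiv (k + 1) (x - M) : ℂ) * (x : ℂ) ^ (-s - k))
        ((ascPochhammer ℂ k).eval s * (bernoulliDiv k (x - M) : ℂ) * (x : ℂ) ^ (-s - k) -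
          (ascPochhammer ℂ (k + 1)).eval s * (bernoulliDiv (k + 1) (x - M) : ℂ) * (x : ℂ) ^ (-s - (k + 1 : ℕ))) x := by
      intro k _
      have h3 : HasDerivAt (fun x : ℝ => bernoulliDiv (k + 1) (x - M)) (bernoulliDiv k (x - M)) x := by
        exact (hasDerivAt_bernoulliDiv k (x - M)).comp_sub_const x M
      have h4 := ((h3.ofReal_comp.const_mul ((ascPochhammer ℂ k).eval s)).mul
        (hasDerivAt_ofReal_cpow_const hx.ne' (hsk k)))
      refine h4.congr_deriv ?_
      rw [ascPochhammer_succ_eval]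
      have e : -s - ((k + 1 : ℕ) : ℂ) = -s - k - 1 := by push_cast; ring
      rw [e]
      ring
    have h5 := h1.sub (HasDerivAt.fun_sum h2)
    refine h5.congr_deriv ?_
    rw [sum_range_sub' (fun k : ℕ => (ascPochhammer ℂ k).eval s * (bernoulliDiv k (x - M) : ℂ) * (x : ℂ) ^ (-s - k))]
    have e : (1 - s) * (x : ℂ) ^ (1 - s - 1) / (1 - s) = (x : ℂ) ^ (-s) := by
      rw [mul_div_cancel_left₀ _ h1s]; congr 1; ring
    rw [e]
    simp [bernoulliDiv_zero]
  have hbound : ∀ x ∈ Set.Icc M (M + 1),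
      ‖(ascPochhammer ℂ K).eval s * (bernoulliDiv K (x - M) : ℂ) * (x : ℂ) ^ (-s - K)‖ ≤
        ‖(ascPochhammer ℂ K).eval s‖ * C * M ^ (-s.re - K) := by
    intro x hx
    have hx0 : 0 < x := hM.trans_le hx.1
    have hb := hC (x - M) ⟨by linarith [hx.1], by linarith [hx.2]⟩
    rw [norm_mul, norm_mul, Complex.norm_real, Complex.norm_cpow_eq_rpow_re_of_pos hx0]
    have e : (-s - (K : ℂ)).re = -s.re - K := by simp
    rw [e]
    have hK0 : (0 : ℝ) ≤ K := Nat.cast_nonneg K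
    have hp : x ^ (-s.re - K) ≤ M ^ (-s.re - K) :=
      Real.rpow_le_rpow_of_nonpos hM hx.1 (by linarith)
    have hC0 : 0 ≤ C := (abs_nonneg _).trans hb
    have := Real.norm_eq_abs (bernoulliDiv K (x - M))
    rw [this]
    gcongr
  have hmv := Convex.norm_image_sub_le_of_norm_hasDerivWithin_le (f := G) (s := Set.Icc M (M + 1)) (x := M) (y := M + 1)
    (fun x hx => (hder x (hM.trans_le hx.1)).hasDerivWithinAt) hbound (convex_Icc _ _)
    ⟨le_rfl, by linarith⟩ ⟨by linarith, le_rfl⟩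
  have hn : ‖M + 1 - M‖ = 1 := by simp
  rw [hn, mul_one] at hmv
  refine le_trans (le_of_eq ?_) hmv
  rw [← norm_neg]
  congr 1
  have e1 : G M = -emBoundary K s M := by
    simp only [hG, emBoundary, sub_self]
    rw [← neg_sub s 1, div_neg]; ring
  have e2 : G (M + 1) = -emBoundary K s (M + 1) - ((M + 1 : ℝ) : ℂ) ^ (-s) := by
    simp only [hG, emBoundary, add_sub_cancel_left]
    have : ∑ k ∈ range K, (ascPochhammer ℂ k).eval s * (bernoulliDiv (k + 1) 1 : ℂ) * ((M + 1 : ℝ) : ℂ) ^ (-s - k) =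
        ∑ k ∈ range K, (ascPochhammer ℂ k).eval s * (bernoulliDiv (k + 1) 0 : ℂ) * ((M + 1 : ℝ) : ℂ) ^ (-s - k) +
        ∑ k ∈ range K, if k = 0 then ((M + 1 : ℝ) : ℂ) ^ (-s) else 0 := by
      rw [← sum_add_distrib]
      refine sum_congr rfl fun k _ => ?_
      rw [bernoulliDiv_one_eq]
      rcases Nat.eq_zero_or_pos k with rfl | hk
      · simp; ring
      · rw [if_neg (by omega), if_neg (by omega)]; simp
    rw [this, sum_ite_eq' , if_pos (Finset.mem_range.2 (by omega)), ← neg_sub s 1, div_neg]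
    ring
  rw [e1, e2]
  ring

/-- Euler–Maclaurin approximation of `ζ(s)` with the first `M` terms of the series. -/
noncomputable def emApprox (K : ℕ) (s : ℂ) (M : ℕ) : ℂ :=
  ∑ n ∈ range M, ((n + 1 : ℝ) : ℂ) ^ (-s) + emBoundary K s M

lemma emApprox_step {K : ℕ} (hK : 1 ≤ K) {s : ℂ} (hs : 0 < s.re) (hs1 : s ≠ 1) {C : ℝ}
    (hC : ∀ x ∈ Set.Icc (0 : ℝ) 1, |bernoulliDiv K x| ≤ C) {M : ℕ} (hM : 1 ≤ M) :
    ‖emApprox K s (M + 1) - emApprox K s M‖ ≤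
      ‖(ascPochhammer ℂ K).eval s‖ * C * (M : ℝ) ^ (-s.re - K) := by
  have h := emBoundary_step hK hs hs1 hC (M := M) (by exact_mod_cast hM)
  refine le_trans (le_of_eq ?_) h
  congr 1
  rw [emApprox, emApprox, sum_range_succ]
  push_cast
  ring

lemma tendsto_emBoundary {K : ℕ} {s : ℂ} (hs : 1 < s.re) :
    Filter.Tendsto (fun M : ℕ => emBoundary K s M) Filter.atTop (nhds 0) := by
  have key : ∀ w : ℂ, w.re < 0 → Filter.Tendsto (fun M : ℕ => ((M : ℝ) : ℂ) ^ w) Filter.atTop (nhds 0) := by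
    intro w hw
    rw [tendsto_zero_iff_norm_tendsto_zero]
    have h1 := (tendsto_rpow_neg_atTop (y := -w.re) (by linarith)).comp tendsto_natCast_atTop_atTop
    refine h1.congr' ?_
    filter_upwards [Filter.eventually_ge_atTop 1] with M hM
    rw [Complex.norm_cpow_eq_rpow_re_of_pos (by exact_mod_cast hM)]
    simp
  have h1 := (key (1 - s) (by simp; linarith)).div_const (s - 1)
  have h2 := tendsto_finsetSum (range K) fun k _ =>
    (key (-s - k) (by simp; have : (0 : ℝ) ≤ k := Nat.cast_nonneg k; linarith)).const_mul
      ((ascPochhammer ℂ k).eval s * (bernoulliDiv (k + 1) 0 : ℂ))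
  simpa [emBoundary] using h1.add h2

lemma tendsto_emApprox_of_one_lt {K : ℕ} {s : ℂ} (hs : 1 < s.re) :
    Filter.Tendsto (fun M : ℕ => emApprox K s M) Filter.atTop (nhds (riemannZeta s)) := by
  have hsum : Summable fun n : ℕ => ((n + 1 : ℝ) : ℂ) ^ (-s) := by
    have := (summable_nat_add_iff 1).2 (Complex.summable_one_div_nat_cpow.2 hs)
    refine this.congr fun n => ?_
    rw [Complex.cpow_neg, one_div]; push_cast; rfl
  have h1 := hsum.hasSum.tendsto_sum_nat
  have e : ∑' n : ℕ, ((n + 1 : ℝ) : ℂ) ^ (-s) = riemannZeta s := by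
    rw [zeta_eq_tsum_one_div_nat_add_one_cpow hs]
    refine tsum_congr fun n => ?_
    rw [Complex.cpow_neg, one_div]; push_cast; rfl
  rw [e] at h1
  simpa [emApprox] using h1.add (tendsto_emBoundary (K := K) hs)

lemma differentiableAt_emApprox {K : ℕ} {s : ℂ} (hs1 : s ≠ 1) {M : ℕ} (hM : 1 ≤ M) :
    DifferentiableAt ℂ (fun s => emApprox K s M) s := by
  have hc : ∀ x : ℝ, 0 < x → ∀ f : ℂ → ℂ, DifferentiableAt ℂ f s → DifferentiableAt ℂ (fun s => (x : ℂ) ^ f s) s :=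
    fun x hx f hf => hf.const_cpow (Or.inl (by exact_mod_cast hx.ne'))
  have hM0 : (0 : ℝ) < M := by exact_mod_cast hM
  unfold emApprox emBoundary
  refine DifferentiableAt.add ?_ (DifferentiableAt.add ?_ ?_)
  · exact DifferentiableAt.fun_sum fun n _ => hc _ (by positivity) _ (by fun_prop)
  · exact (hc _ hM0 _ (by fun_prop)).div (by fun_prop) (sub_ne_zero.2 hs1)
  · refine DifferentiableAt.fun_sum fun k _ => DifferentiableAt.mul (DifferentiableAt.mul ?_ ?_) ?_
    · exact (ascPochhammer ℂ k).differentiable.differentiableAt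
    · fun_prop
    · exact hc _ hM0 _ (by fun_prop)

/-- A telescoping majorant for the tail of `∑ M ^ (-16)`. -/
noncomputable def tailMajorant (M : ℝ) : ℝ := (M ^ 16)⁻¹ + (M ^ 15)⁻¹ / 15

lemma inv_pow_le_tailMajorant_sub {M : ℝ} (hM : 0 < M) :
    (M ^ 16)⁻¹ ≤ tailMajorant M - tailMajorant (M + 1) := by
  have hb : 1 + (15 : ℕ) * (1 / M) ≤ (1 + 1 / M) ^ 15 :=
    one_add_mul_le_pow (by have : 0 < 1 / M := by positivity
                           linarith) 15
  have h1 : (M ^ 15)⁻¹ = (1 + 1 / M) ^ 15 * ((M + 1) ^ 15)⁻¹ := by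
    have : 1 + 1 / M = (M + 1) / M := by field_simp
    rw [this, div_pow]
    field_simp
  have h2 : ((M + 1) ^ 16)⁻¹ * (15 * (M + 1)) = 15 * ((M + 1) ^ 15)⁻¹ := by field_simp
  have h3 : (1 + (15 : ℕ) * (1 / M)) * ((M + 1) ^ 15)⁻¹ ≤ (M ^ 15)⁻¹ := by
    rw [h1]; gcongr
  have h4 : 15 * ((M + 1) ^ 16)⁻¹ ≤ 15 * (1 / M) * ((M + 1) ^ 15)⁻¹ := by
    have : ((M + 1) ^ 16)⁻¹ = 1 / (M + 1) * ((M + 1) ^ 15)⁻¹ := by field_simp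
    rw [this, ← mul_assoc]
    gcongr
    linarith
  unfold tailMajorant
  push_cast at h3
  linarith

lemma emApprox_sub_le {s : ℂ} (hs : 0 < s.re) (hs1 : s ≠ 1) {C : ℝ}
    (hC : ∀ x ∈ Set.Icc (0 : ℝ) 1, |bernoulliDiv 16 x| ≤ C) {N : ℕ} (hN : 1 ≤ N) (m : ℕ) :
    ‖emApprox 16 s (N + m) - emApprox 16 s N‖ ≤
      ‖(ascPochhammer ℂ 16).eval s‖ * C * (N : ℝ) ^ (-s.re) * (tailMajorant N - tailMajorant (N + m)) := by
  have hN0 : (0 : ℝ) < N := by exact_mod_cast hN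
  have hC0 : 0 ≤ C := (abs_nonneg _).trans (hC 0 ⟨le_rfl, zero_le_one⟩)
  induction m with
  | zero => simp
  | succ m ih =>
    have h1 := emApprox_step (K := 16) (by norm_num) hs hs1 hC (M := N + m) (by omega)
    have h2 := inv_pow_le_tailMajorant_sub (M := (N + m : ℝ)) (by positivity)
    have h3 : ((N + m : ℕ) : ℝ) ^ (-s.re - (16 : ℕ)) ≤ (N : ℝ) ^ (-s.re) * (((N : ℝ) + m) ^ 16)⁻¹ := by
      push_cast
      have e : (-s.re - 16 : ℝ) = -s.re + (-(16 : ℕ) : ℝ) := by push_cast; ring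
      rw [e, Real.rpow_add (by positivity), Real.rpow_neg (by positivity) ((16 : ℕ) : ℝ), Real.rpow_natCast]
      refine mul_le_mul_of_nonneg_right ?_ (by positivity)
      exact Real.rpow_le_rpow_of_nonpos hN0 (by linarith [(Nat.cast_nonneg m : (0 : ℝ) ≤ m)]) (by linarith)
    set A := ‖(ascPochhammer ℂ 16).eval s‖ * C with hA
    have hA0 : 0 ≤ A := by positivity
    have h4 : A * ((N + m : ℕ) : ℝ) ^ (-s.re - (16 : ℕ)) ≤
        A * (N : ℝ) ^ (-s.re) * (tailMajorant (N + m) - tailMajorant (N + m + 1)) := by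
      rw [mul_assoc A]
      refine mul_le_mul_of_nonneg_left (h3.trans ?_) hA0
      exact mul_le_mul_of_nonneg_left h2 (by positivity)
    have h5 : ‖emApprox 16 s (N + (m + 1)) - emApprox 16 s N‖ ≤
        ‖emApprox 16 s (N + m + 1) - emApprox 16 s (N + m)‖ + ‖emApprox 16 s (N + m) - emApprox 16 s N‖ := by
      refine le_trans (le_of_eq ?_) (norm_add_le _ _)
      rw [sub_add_sub_cancel]; rfl
    push_cast at *
    rw [← add_assoc (N : ℝ)]
    linarith

lemma tendsto_emApprox {s : ℂ} (hs : 0 < s.re) (him : 0 < s.im) {C : ℝ}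
    (hC : ∀ x ∈ Set.Icc (0 : ℝ) 1, |bernoulliDiv 16 x| ≤ C) :
    Filter.Tendsto (fun M : ℕ => emApprox 16 s M) Filter.atTop (nhds (riemannZeta s)) := by
  have hC0 : 0 ≤ C := (abs_nonneg _).trans (hC 0 ⟨le_rfl, zero_le_one⟩)
  set U : Set ℂ := {w | 0 < w.re} ∩ {w | 0 < w.im} ∩ Metric.ball 0 (‖s‖ + 10) with hU
  have hUo : IsOpen U := ((isOpen_lt continuous_const Complex.continuous_re).inter
    (isOpen_lt continuous_const Complex.continuous_im)).inter Metric.isOpen_ball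
  have hUc : Convex ℝ U := ((convex_halfSpace_re_gt 0).inter (convex_halfSpace_im_gt 0)).inter (convex_ball _ _)
  have hne : ∀ w ∈ U, w ≠ 1 := by
    rintro w ⟨⟨-, h⟩, -⟩ rfl
    simp at h
  obtain ⟨B, hB⟩ : ∃ B, ∀ w ∈ U, ‖(ascPochhammer ℂ 16).eval w‖ ≤ B := by
    obtain ⟨B, hB⟩ := (isCompact_closedBall (0 : ℂ) (‖s‖ + 10)).exists_bound_of_continuousOn
      (ascPochhammer ℂ 16).continuous.continuousOn
    exact ⟨B, fun w hw => hB w (Metric.ball_subset_closedBall hw.2)⟩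
  set F : ℕ → ℂ → ℂ := fun m w => emApprox 16 w (m + 1 + 1) - emApprox 16 w (m + 1) with hF
  have hFb : ∀ m, ∀ w ∈ U, ‖F m w‖ ≤ B * C * (1 / ((m + 1 : ℕ) : ℝ) ^ 16) := by
    intro m w hw
    refine (emApprox_step (K := 16) (by norm_num) hw.1.1 (hne w hw) hC (M := m + 1) (by omega)).trans ?_
    have hB' := hB w hw
    have h1 : (1 : ℝ) ≤ ((m + 1 : ℕ) : ℝ) := by push_cast; linarith [(Nat.cast_nonneg m : (0 : ℝ) ≤ m)]
    have h3 : ((m + 1 : ℕ) : ℝ) ^ (-w.re - (16 : ℕ)) ≤ 1 / ((m + 1 : ℕ) : ℝ) ^ 16 := by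
      rw [one_div, ← Real.rpow_natCast, ← Real.rpow_neg (by positivity)]
      exact Real.rpow_le_rpow_of_exponent_le h1 (by linarith [show 0 < w.re from hw.1.1])
    have : 0 ≤ B := (norm_nonneg _).trans hB'
    gcongr
  have hsum : Summable fun m : ℕ => B * C * (1 / ((m + 1 : ℕ) : ℝ) ^ 16) :=
    ((summable_nat_add_iff 1).2 (Real.summable_one_div_nat_pow.2 (by norm_num : 1 < 16))).mul_left _
  have hFd : ∀ m, DifferentiableOn ℂ (F m) U := fun m w hw =>
    ((differentiableAt_emApprox (hne w hw) (by omega)).sub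
      (differentiableAt_emApprox (hne w hw) (by omega))).differentiableWithinAt
  have hG : DifferentiableOn ℂ (fun w => emApprox 16 w 1 + ∑' m, F m w) U :=
    DifferentiableOn.add (fun w hw => (differentiableAt_emApprox (hne w hw) le_rfl).differentiableWithinAt)
      (Complex.differentiableOn_tsum_of_summable_norm hsum hFd hUo hFb)
  have hlim : ∀ w ∈ U, Filter.Tendsto (fun M : ℕ => emApprox 16 w M) Filter.atTop
      (nhds (emApprox 16 w 1 + ∑' m, F m w)) := by
    intro w hw
    have h1 := (Summable.of_norm_bounded hsum fun m => hFb m w hw).hasSum.tendsto_sum_nat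
    have h2 : ∀ n, ∑ m ∈ range n, F m w = emApprox 16 w (n + 1) - emApprox 16 w 1 := by
      intro n
      exact sum_range_sub (fun m => emApprox 16 w (m + 1)) n
    rw [← Filter.tendsto_add_atTop_iff_nat 1]
    refine (h1.const_add (emApprox 16 w 1)).congr fun n => ?_
    rw [h2]; ring
  have hζ : DifferentiableOn ℂ riemannZeta U := fun w hw =>
    (differentiableAt_riemannZeta (hne w hw)).differentiableWithinAt
  have hz0 : (2 + Complex.I) ∈ U := by
    refine ⟨⟨by simp, by simp⟩, ?_⟩
    rw [Metric.mem_ball, dist_zero_right]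
    have : ‖(2 : ℂ) + Complex.I‖ ≤ 2 + 1 := by
      refine (norm_add_le _ _).trans ?_
      simp
    linarith [norm_nonneg s]
  have heq := (hG.analyticOnNhd hUo).eqOn_of_preconnected_of_eventuallyEq (hζ.analyticOnNhd hUo)
    hUc.isPreconnected hz0 (by
      filter_upwards [hUo.mem_nhds hz0, (isOpen_lt continuous_const Complex.continuous_re).mem_nhds
        (show (1 : ℝ) < (2 + Complex.I).re by simp)] with w hw hw1
      exact tendsto_nhds_unique (hlim w hw) (tendsto_emApprox_of_one_lt hw1))
  have hsU : s ∈ U := ⟨⟨hs, him⟩, by rw [Metric.mem_ball, dist_zero_right]; linarith⟩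
  have := hlim s hsU
  rwa [show emApprox 16 s 1 + ∑' m, F m s = riemannZeta s from heq hsU] at this

lemma norm_zeta_sub_emApprox_le {s : ℂ} (hs : 0 < s.re) (him : 0 < s.im) {C : ℝ}
    (hC : ∀ x ∈ Set.Icc (0 : ℝ) 1, |bernoulliDiv 16 x| ≤ C) {N : ℕ} (hN : 1 ≤ N) :
    ‖riemannZeta s - emApprox 16 s N‖ ≤
      ‖(ascPochhammer ℂ 16).eval s‖ * C * (N : ℝ) ^ (-s.re) * tailMajorant N := by
  have hs1 : s ≠ 1 := by rintro rfl; simp at him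
  have hC0 : 0 ≤ C := (abs_nonneg _).trans (hC 0 ⟨le_rfl, zero_le_one⟩)
  have hlim := ((Filter.tendsto_add_atTop_iff_nat N).2 (tendsto_emApprox hs him hC)).sub_const (emApprox 16 s N)
  refine le_of_tendsto hlim.norm (Filter.Eventually.of_forall fun m => ?_)
  rw [add_comm m N]
  refine (emApprox_sub_le hs hs1 hC hN m).trans ?_
  refine mul_le_mul_of_nonneg_left ?_ (by positivity)
  have : 0 ≤ tailMajorant (N + m) := by unfold tailMajorant; positivity
  linarith

lemma bernoulli_even_values : bernoulli 2 = 1 / 6 ∧ bernoulli 4 = -1 / 30 ∧ bernoulli 6 = 1 / 42 ∧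
    bernoulli 8 = -1 / 30 ∧ bernoulli 10 = 5 / 66 ∧ bernoulli 12 = -691 / 2730 ∧ bernoulli 14 = 7 / 6 ∧
    bernoulli 16 = -3617 / 510 := by
  have odd : ∀ k, 1 < k → Odd k → bernoulli k = 0 := fun k h1 h2 => by
    rw [bernoulli_eq_bernoulli'_of_ne_one (by omega), bernoulli'_eq_zero_of_odd h2 h1]
  have o3 := odd 3 (by norm_num) (by decide)
  have o5 := odd 5 (by norm_num) (by decide)
  have o7 := odd 7 (by norm_num) (by decide)
  have o9 := odd 9 (by norm_num) (by decide)
  have o11 := odd 11 (by norm_num) (by decide)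
  have o13 := odd 13 (by norm_num) (by decide)
  have o15 := odd 15 (by norm_num) (by decide)
  have h4 := sum_bernoulli 5
  have h6 := sum_bernoulli 7
  have h8 := sum_bernoulli 9
  have h10 := sum_bernoulli 11
  have h12 := sum_bernoulli 13
  have h14 := sum_bernoulli 15
  have h16 := sum_bernoulli 17
  simp only [sum_range_succ, sum_range_zero, bernoulli_zero, bernoulli_one, o3, o5, o7, o9, o11, o13, o15,
    mul_zero, add_zero, zero_add] at h4 h6 h8 h10 h12 h14 h16
  norm_num [Nat.choose] at h4 h6 h8 h10 h12 h14 h16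
  refine ⟨by norm_num, ?_, ?_, ?_, ?_, ?_, ?_, ?_⟩ <;> linarith

lemma abs_bernoulliDiv_sixteen_le {x : ℝ} (hx : x ∈ Set.Icc (0 : ℝ) 1) :
    |bernoulliDiv 16 x| ≤ 3617 / 510 / (Nat.factorial 16 : ℝ) := by
  have h1 := hasSum_one_div_nat_pow_mul_cos (k := 8) (by norm_num) hx
  have h0 := hasSum_one_div_nat_pow_mul_cos (k := 8) (x := 0) (by norm_num) ⟨le_rfl, zero_le_one⟩
  have key : |(-1) ^ (8 + 1) * (2 * π) ^ (2 * 8) / 2 / ((2 * 8).factorial : ℝ) * bernoulliFun 16 x| ≤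
      (-1) ^ (8 + 1) * (2 * π) ^ (2 * 8) / 2 / ((2 * 8).factorial : ℝ) * bernoulliFun 16 0 := by
    rw [abs_le]
    constructor
    · refine neg_le_iff_add_nonneg.2 ?_
      refine (h1.add h0).nonneg fun n => ?_
      rw [← mul_add]
      refine mul_nonneg (by positivity) ?_
      simp only [mul_zero, Real.cos_zero]
      linarith [Real.neg_one_le_cos (2 * π * n * x)]
    · refine hasSum_le (fun n => ?_) h1 h0
      refine mul_le_mul_of_nonneg_left ?_ (by positivity)
      simp only [mul_zero, Real.cos_zero]
      exact Real.cos_le_one _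
  have hval : bernoulliFun 16 0 = -3617 / 510 := by
    rw [bernoulliFun_eval_zero, bernoulli_even_values.2.2.2.2.2.2.2]; norm_num
  rw [abs_mul, hval] at key
  set c := (2 * π) ^ (2 * 8) / 2 / ((2 * 8).factorial : ℝ) with hc
  have hc0 : 0 < c := by positivity
  have e : (-1 : ℝ) ^ (8 + 1) * (2 * π) ^ (2 * 8) / 2 / ((2 * 8).factorial : ℝ) = -c := by rw [hc]; ring
  rw [e, abs_neg, abs_of_pos hc0] at key
  have h3 : |bernoulliFun 16 x| ≤ 3617 / 510 := by
    refine le_of_mul_le_mul_left (key.trans (le_of_eq ?_)) hc0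
    ring
  rw [bernoulliDiv, abs_div, abs_of_pos (by positivity : (0 : ℝ) < (Nat.factorial 16 : ℝ))]
  gcongr

lemma norm_ascPochhammer_sixteen_le (t : ℝ) :
    ‖(ascPochhammer ℂ 16).eval (1 / 2 + t * Complex.I)‖ ≤ (t ^ 2 + 481 / 4) ^ 8 := by
  have hsq : ∀ k : ℕ, Complex.normSq (1 / 2 + t * Complex.I + (k : ℂ)) = (k + 1 / 2) ^ 2 + t ^ 2 := by
    intro k
    rw [Complex.normSq_apply]; simp; ring
  have hpair : ∀ a b : ℝ, 0 ≤ a → 0 ≤ b → a + b ≤ 481 / 2 → (a + t ^ 2) * (b + t ^ 2) ≤ (t ^ 2 + 481 / 4) ^ 2 := by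
    intro a b ha hb hab
    nlinarith [sq_nonneg (a - b), sq_nonneg t]
  refine (pow_le_pow_iff_left₀ (norm_nonneg _) (by positivity) two_ne_zero).1 ?_
  rw [← Complex.normSq_eq_norm_sq]
  simp only [ascPochhammer_succ_eval, ascPochhammer_zero, Polynomial.eval_one, map_mul, hsq, one_mul]
  have e : ((t ^ 2 + 481 / 4) ^ 8) ^ 2 = (t ^ 2 + 481 / 4) ^ 2 * (t ^ 2 + 481 / 4) ^ 2 * (t ^ 2 + 481 / 4) ^ 2 *
    (t ^ 2 + 481 / 4) ^ 2 * (t ^ 2 + 481 / 4) ^ 2 * (t ^ 2 + 481 / 4) ^ 2 * (t ^ 2 + 481 / 4) ^ 2 * (t ^ 2 + 481 / 4) ^ 2 := by ring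
  rw [e]
  calc _ = ((((0 : ℕ) + 1 / 2) ^ 2 + t ^ 2) * (((15 : ℕ) + 1 / 2) ^ 2 + t ^ 2)) *
      ((((1 : ℕ) + 1 / 2) ^ 2 + t ^ 2) * (((14 : ℕ) + 1 / 2) ^ 2 + t ^ 2)) *
      ((((2 : ℕ) + 1 / 2) ^ 2 + t ^ 2) * (((13 : ℕ) + 1 / 2) ^ 2 + t ^ 2)) *
      ((((3 : ℕ) + 1 / 2) ^ 2 + t ^ 2) * (((12 : ℕ) + 1 / 2) ^ 2 + t ^ 2)) *
      ((((4 : ℕ) + 1 / 2) ^ 2 + t ^ 2) * (((11 : ℕ) + 1 / 2) ^ 2 + t ^ 2)) *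
      ((((5 : ℕ) + 1 / 2) ^ 2 + t ^ 2) * (((10 : ℕ) + 1 / 2) ^ 2 + t ^ 2)) *
      ((((6 : ℕ) + 1 / 2) ^ 2 + t ^ 2) * (((9 : ℕ) + 1 / 2) ^ 2 + t ^ 2)) *
      ((((7 : ℕ) + 1 / 2) ^ 2 + t ^ 2) * (((8 : ℕ) + 1 / 2) ^ 2 + t ^ 2)) := by
        generalize (((0 : ℕ) : ℝ) + 1 / 2) ^ 2 + t ^ 2 = a0
        generalize (((1 : ℕ) : ℝ) + 1 / 2) ^ 2 + t ^ 2 = a1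
        generalize (((2 : ℕ) : ℝ) + 1 / 2) ^ 2 + t ^ 2 = a2
        generalize (((3 : ℕ) : ℝ) + 1 / 2) ^ 2 + t ^ 2 = a3
        generalize (((4 : ℕ) : ℝ) + 1 / 2) ^ 2 + t ^ 2 = a4
        generalize (((5 : ℕ) : ℝ) + 1 / 2) ^ 2 + t ^ 2 = a5
        generalize (((6 : ℕ) : ℝ) + 1 / 2) ^ 2 + t ^ 2 = a6
        generalize (((7 : ℕ) : ℝ) + 1 / 2) ^ 2 + t ^ 2 = a7
        ring
    _ ≤ _ := by
        gcongr <;> exact hpair _ _ (by positivity) (by positivity) (by norm_num)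

/-- The Euler–Maclaurin error on the critical line. -/
lemma norm_zeta_sub_emApprox_half_le {t : ℝ} (ht : 0 < t) {N : ℕ} (hN : 1 ≤ N) (hN2 : N ≤ 660)
    (htN : t ^ 2 + 481 / 4 ≤ 16 * (N : ℝ) ^ 2) :
    ‖riemannZeta (1 / 2 + t * Complex.I) - emApprox 16 (1 / 2 + t * Complex.I) N‖ ≤ 26 / 10000 := by
  have hre : (1 / 2 + t * Complex.I : ℂ).re = 1 / 2 := by simp
  have h := norm_zeta_sub_emApprox_le (s := 1 / 2 + t * Complex.I) (by rw [hre]; norm_num) (by simpa using ht)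
    (fun x hx => abs_bernoulliDiv_sixteen_le hx) hN
  rw [hre] at h
  refine h.trans ?_
  have hN0 : (0 : ℝ) < N := by exact_mod_cast hN
  have hN1 : (1 : ℝ) ≤ N := by exact_mod_cast hN
  have hN3 : (N : ℝ) ≤ 660 := by exact_mod_cast hN2
  have h1 : ‖(ascPochhammer ℂ 16).eval (1 / 2 + t * Complex.I)‖ ≤ (16 * (N : ℝ) ^ 2) ^ 8 :=
    (norm_ascPochhammer_sixteen_le t).trans (by gcongr)
  have hsqrt : (N : ℝ) ^ (-(1 / 2) : ℝ) = (√N)⁻¹ := by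
    rw [Real.rpow_neg hN0.le, Real.sqrt_eq_rpow]
  have h2 : (√(N : ℝ))⁻¹ * (1 + N / 15) ≤ 1.76 := by
    refine (pow_le_pow_iff_left₀ (by positivity) (by norm_num) two_ne_zero).1 ?_
    rw [mul_pow, inv_pow, Real.sq_sqrt hN0.le, inv_mul_le_iff₀ hN0]
    nlinarith
  have hM : tailMajorant N * ((N : ℝ) ^ 2) ^ 8 = 1 + N / 15 := by
    unfold tailMajorant; field_simp
  have hM0 : 0 ≤ tailMajorant N := by unfold tailMajorant; positivity
  rw [hsqrt]
  calc _ ≤ (16 * (N : ℝ) ^ 2) ^ 8 * (3617 / 510 / (Nat.factorial 16 : ℝ)) * (√(N : ℝ))⁻¹ * tailMajorant N := by gcongr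
    _ = 16 ^ 8 * (3617 / 510 / (Nat.factorial 16 : ℝ)) * ((√(N : ℝ))⁻¹ * (tailMajorant N * ((N : ℝ) ^ 2) ^ 8)) := by ring
    _ ≤ 16 ^ 8 * (3617 / 510 / (Nat.factorial 16 : ℝ)) * 1.76 := by rw [hM]; gcongr
    _ ≤ 26 / 10000 := by norm_num [Nat.factorial]

end EulerMaclaurin

section GammaPhase

/-- An antiderivative of `u ↦ arctan (y / u)`. -/
noncomputable def arctanPrimitive (y u : ℝ) : ℝ := u * arctan (y / u) + y / 2 * log (u ^ 2 + y ^ 2)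

lemma hasDerivAt_arctanPrimitive (y : ℝ) {u : ℝ} (hu : 0 < u) :
    HasDerivAt (arctanPrimitive y) (arctan (y / u)) u := by
  have h1 : HasDerivAt (fun u : ℝ => y / u) (-y / u ^ 2) u := by
    have := (hasDerivAt_inv hu.ne').const_mul y
    refine this.congr_deriv ?_
    ring
  have h2 := (hasDerivAt_id u).mul h1.arctan
  have h3 : HasDerivAt (fun u : ℝ => u ^ 2 + y ^ 2) (2 * u) u := by
    simpa using (hasDerivAt_pow 2 u).add_const (y ^ 2)
  have h4 := (h3.log (by positivity)).const_mul (y / 2)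
  refine (h2.add h4).congr_deriv ?_
  have : u ^ 2 + y ^ 2 ≠ 0 := by positivity
  simp only [id]
  field_simp
  ring

lemma arctanPrimitive_sub_bounds {y u : ℝ} (hy : 0 < y) (hu : 0 < u) :
    arctan (y / (u + 1)) ≤ arctanPrimitive y (u + 1) - arctanPrimitive y u ∧
      arctanPrimitive y (u + 1) - arctanPrimitive y u ≤ arctan (y / u) := by
  obtain ⟨c, hc, he⟩ := exists_hasDerivAt_eq_slope (arctanPrimitive y) (fun u => arctan (y / u))
    (show u < u + 1 by linarith)
    (fun x hx => (hasDerivAt_arctanPrimitive y (hu.trans_le hx.1)).continuousAt.continuousWithinAt)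
    (fun x hx => hasDerivAt_arctanPrimitive y (hu.trans hx.1))
  rw [add_sub_cancel_left, div_one] at he
  rw [← he]
  have hc0 : 0 < c := hu.trans hc.1
  constructor
  · apply arctan_mono
    have := hc.2.le
    gcongr
  · apply arctan_mono
    have := hc.1.le
    gcongr

lemma sum_arctan_bounds {x y : ℝ} (hx : 0 < x) (hy : 0 < y) (n : ℕ) :
    arctan (y / (x + n)) ≤
      ∑ j ∈ range (n + 1), arctan (y / (x + j)) - (arctanPrimitive y (x + n) - arctanPrimitive y x) ∧
    ∑ j ∈ range (n + 1), arctan (y / (x + j)) - (arctanPrimitive y (x + n) - arctanPrimitive y x) ≤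
      arctan (y / x) := by
  induction n with
  | zero => simp
  | succ n ih =>
    have h := arctanPrimitive_sub_bounds hy (show 0 < x + n by positivity)
    rw [sum_range_succ]
    push_cast
    rw [← add_assoc x]
    constructor <;> linarith [ih.1, ih.2, h.1, h.2]

lemma tendsto_mul_log_sub_arctanPrimitive (x : ℝ) {y : ℝ} (hy : 0 < y) :
    Filter.Tendsto (fun n : ℕ => y * log n - arctanPrimitive y (x + n) + y) Filter.atTop (nhds 0) := by
  have hv : Filter.Tendsto (fun n : ℕ => x + (n : ℝ)) Filter.atTop Filter.atTop :=
    Filter.tendsto_atTop_add_const_left _ _ tendsto_natCast_atTop_atTop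
  have hyv : Filter.Tendsto (fun n : ℕ => y / (x + n)) Filter.atTop (nhds 0) := hv.const_div_atTop y
  have h1 : Filter.Tendsto (fun n : ℕ => (x + n) * arctan (y / (x + n))) Filter.atTop (nhds y) := by
    have hd := hasDerivAt_iff_tendsto_slope_zero.1 (hasDerivAt_arctan 0)
    have hyv' : Filter.Tendsto (fun n : ℕ => y / (x + n)) Filter.atTop (nhdsWithin 0 {0}ᶜ) := by
      refine tendsto_nhdsWithin_iff.2 ⟨hyv, ?_⟩
      filter_upwards [hv.eventually_gt_atTop 0] with n hn
      exact (div_pos hy hn).ne'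
    have h2 := (hd.comp hyv').const_mul y
    norm_num at h2
    refine h2.congr' ?_
    filter_upwards [hv.eventually_gt_atTop 0] with n hn
    rw [div_eq_mul_inv y (x + n)]
    field_simp
  have h2 : Filter.Tendsto (fun n : ℕ => log (((x + n) ^ 2 + y ^ 2) / (n : ℝ) ^ 2)) Filter.atTop (nhds 0) := by
    have h3 : Filter.Tendsto (fun n : ℕ => (x / n + 1) ^ 2 + (y / n) ^ 2) Filter.atTop (nhds ((0 + 1) ^ 2 + 0 ^ 2)) :=
      (((tendsto_const_div_atTop_nhds_zero_nat x).add_const 1).pow 2).add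
        ((tendsto_const_div_atTop_nhds_zero_nat y).pow 2)
    have h4 := h3.log (by norm_num)
    norm_num at h4
    refine h4.congr' ?_
    filter_upwards [Filter.eventually_ge_atTop 1] with n hn
    have hn0 : (0 : ℝ) < n := by exact_mod_cast hn
    congr 1
    field_simp
  have h3 := (h1.sub_const y).neg.sub (h2.const_mul (y / 2))
  norm_num at h3
  refine h3.congr' ?_
  filter_upwards [Filter.eventually_ge_atTop 1] with n hn
  have hn0 : (0 : ℝ) < n := by exact_mod_cast hn
  rw [Real.log_div (by positivity) (by positivity), Real.log_pow, arctanPrimitive]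
  push_cast
  ring

lemma arctanPrimitive_quarter_bounds {y : ℝ} (hy : 4 ≤ y) :
    |arctanPrimitive y (1 / 4) - (y * log y + π / 8)| ≤ 1 / 64 := by
  have hy0 : 0 < y := by linarith
  have h1 : arctan (y / (1 / 4)) = π / 2 - arctan ((1 / 4) / y) := by
    rw [← arctan_inv_of_pos (by positivity), inv_div]
  have h2 : arctan ((1 / 4) / y) ≤ (1 / 4) / y := by
    have hpos : 0 ≤ (1 / 4) / y := by positivity
    have := Real.le_tan (arctan_nonneg.2 hpos) (arctan_lt_pi_div_two _)
    rwa [tan_arctan] at this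
  have h3 : 0 ≤ arctan ((1 / 4) / y) := arctan_nonneg.2 (by positivity)
  have h4 : (1 / 4) / y ≤ 1 / 16 := by rw [div_le_iff₀ hy0]; linarith
  have h5 : log ((1 / 4) ^ 2 + y ^ 2) = 2 * log y + log (1 + (1 / 16) / y ^ 2) := by
    rw [show (2 : ℝ) * log y = log (y ^ 2) by rw [Real.log_pow]; norm_num,
      ← Real.log_mul (by positivity) (by positivity)]
    congr 1
    field_simp
    ring
  have h6 : log (1 + (1 / 16) / y ^ 2) ≤ (1 / 16) / y ^ 2 := by
    have := Real.log_le_sub_one_of_pos (show 0 < 1 + (1 / 16) / y ^ 2 by positivity)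
    linarith
  have h7 : 0 ≤ log (1 + (1 / 16) / y ^ 2) :=
    Real.log_nonneg (le_add_of_nonneg_right (by positivity))
  have h8 : y / 2 * log (1 + (1 / 16) / y ^ 2) ≤ 1 / 128 := by
    refine (mul_le_mul_of_nonneg_left h6 (by positivity)).trans ?_
    rw [show y / 2 * ((1 / 16) / y ^ 2) = (1 / 32) / y by field_simp; ring, div_le_iff₀ hy0]
    linarith
  have h9 : 0 ≤ y / 2 * log (1 + (1 / 16) / y ^ 2) := by positivity
  rw [arctanPrimitive, h1, h5, abs_le]
  constructor <;> nlinarith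

lemma gammaSeq_polar {x y : ℝ} (hx : 0 < x) {n : ℕ} (hn : 1 ≤ n) :
    Complex.GammaSeq (x + y * Complex.I) n = (‖Complex.GammaSeq (x + y * Complex.I) n‖ : ℂ) *
      Complex.exp ((y * log n - ∑ j ∈ range (n + 1), arctan (y / (x + j)) : ℝ) * Complex.I) := by
  have hfac : ∀ j : ℕ, (x + y * Complex.I + j : ℂ) =
      (‖(x + y * Complex.I + j : ℂ)‖ : ℂ) * Complex.exp ((arctan (y / (x + j)) : ℝ) * Complex.I) := by
    intro j
    have hxj : 0 < x + j := by positivity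
    have harg : Complex.arg (x + y * Complex.I + j : ℂ) = arctan (y / (x + j)) := by
      have hre : (x + y * Complex.I + j : ℂ).re = x + j := by simp
      have him : (x + y * Complex.I + j : ℂ).im = y := by simp
      have h1 := Complex.abs_arg_lt_pi_div_two_iff.2 (Or.inl (by rw [hre]; exact hxj))
      have h2 := Complex.tan_arg (x + y * Complex.I + j : ℂ)
      rw [hre, him] at h2
      rw [← h2, Real.arctan_tan (abs_lt.1 h1).1 (abs_lt.1 h1).2]
    have := Complex.norm_mul_exp_arg_mul_I (x + y * Complex.I + j : ℂ)
    rw [harg] at this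
    exact this.symm
  have hn0 : (0 : ℝ) < n := by exact_mod_cast hn
  have hpow : (n : ℂ) ^ (x + y * Complex.I : ℂ) = (‖(n : ℂ) ^ (x + y * Complex.I : ℂ)‖ : ℂ) *
      Complex.exp ((y * log n : ℝ) * Complex.I) := by
    have h1 : ‖(n : ℂ) ^ (x + y * Complex.I : ℂ)‖ = exp (log n * x) := by
      rw [← Complex.ofReal_natCast, Complex.norm_cpow_eq_rpow_re_of_pos hn0, Real.rpow_def_of_pos hn0]
      simp
    rw [h1, Complex.cpow_def_of_ne_zero (by exact_mod_cast hn0.ne'), Complex.ofReal_exp, ← Complex.exp_add,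
      ← Complex.ofReal_natCast, ← Complex.ofReal_log hn0.le]
    congr 1
    push_cast
    ring
  have hprod : ∏ j ∈ range (n + 1), (x + y * Complex.I + j : ℂ) =
      (‖∏ j ∈ range (n + 1), (x + y * Complex.I + j : ℂ)‖ : ℂ) *
        Complex.exp ((∑ j ∈ range (n + 1), arctan (y / (x + j)) : ℝ) * Complex.I) := by
    rw [norm_prod, Complex.ofReal_prod, Complex.ofReal_sum, sum_mul, Complex.exp_sum, ← Finset.prod_mul_distrib]
    exact Finset.prod_congr rfl fun j _ => hfac j
  have hfact : ‖(n.factorial : ℂ)‖ = n.factorial := by simp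
  rw [Complex.GammaSeq, norm_div, norm_mul, hfact]
  conv_lhs => rw [hpow, hprod]
  rw [Complex.ofReal_sub, sub_mul, Complex.exp_sub]
  push_cast
  ring

lemma re_exp_mul_Gamma_pos {y φ : ℝ} (hy : 4 ≤ y) (hφ : |φ - (y * log y - y - π / 8)| ≤ 1 / 2) :
    0 < (Complex.exp (-φ * Complex.I) * Complex.Gamma (1 / 4 + y * Complex.I)).re := by
  have hy0 : 0 < y := by linarith
  have hlim := Complex.GammaSeq_tendsto_Gamma (1 / 4 + y * Complex.I)
  have hlim2 := (Complex.continuous_re.tendsto _).comp (hlim.const_mul (Complex.exp (-φ * Complex.I)))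
  have hlim3 := hlim.norm.const_mul (Real.cos 1.5)
  have hb := arctanPrimitive_quarter_bounds hy
  have hcos : 0 < Real.cos 1.5 := Real.cos_pos_of_mem_Ioo ⟨by linarith [pi_pos], by linarith [pi_gt_d2]⟩
  have hev : ∀ᶠ n : ℕ in Filter.atTop, Real.cos 1.5 * ‖Complex.GammaSeq (1 / 4 + y * Complex.I) n‖ ≤
      (Complex.exp (-φ * Complex.I) * Complex.GammaSeq (1 / 4 + y * Complex.I) n).re := by
    have h0 := (tendsto_mul_log_sub_arctanPrimitive (1 / 4) hy0).eventually (Metric.ball_mem_nhds 0 (show (0 : ℝ) < 0.1 by norm_num))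
    filter_upwards [h0, Filter.eventually_ge_atTop 1] with n hn hn1
    rw [dist_zero_right, Real.norm_eq_abs] at hn
    have hpol := gammaSeq_polar (x := 1 / 4) (y := y) (by norm_num) hn1
    have hs := sum_arctan_bounds (x := 1 / 4) (by norm_num) hy0 n
    have hs1 : 0 ≤ arctan (y / (1 / 4 + n)) := arctan_nonneg.2 (by positivity)
    have hs2 := (arctan_lt_pi_div_two (y / (1 / 4))).le
    rw [show ((1 / 4 : ℝ) : ℂ) = 1 / 4 by push_cast; rfl] at hpol
    rw [hpol]
    set S := ∑ j ∈ range (n + 1), arctan (y / (1 / 4 + j))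
    set R := ‖Complex.GammaSeq (1 / 4 + y * Complex.I) n‖
    have e : Complex.exp (-φ * Complex.I) * ((R : ℂ) * Complex.exp ((y * log n - S : ℝ) * Complex.I)) =
        (R : ℂ) * Complex.exp ((y * log n - S - φ : ℝ) * Complex.I) := by
      rw [mul_left_comm, ← Complex.exp_add]
      congr 2
      push_cast
      ring
    rw [e, Complex.re_ofReal_mul, Complex.exp_ofReal_mul_I_re, Complex.norm_mul, Complex.norm_real,
      Complex.norm_exp_ofReal_mul_I, mul_one, norm_norm, mul_comm]
    refine mul_le_mul_of_nonneg_left ?_ (norm_nonneg _)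
    rw [← Real.cos_abs (y * log n - S - φ)]
    rw [abs_le] at hφ hb
    rw [abs_lt] at hn
    refine Real.cos_le_cos_of_nonneg_of_le_pi (abs_nonneg _) (by linarith [pi_gt_d2]) (abs_le.2 ⟨?_, ?_⟩)
    · linarith [pi_lt_d2, hs.2]
    · linarith [pi_lt_d2, hs.1]
  have hge := le_of_tendsto_of_tendsto hlim3 hlim2 hev
  refine lt_of_lt_of_le (mul_pos hcos (norm_pos_iff.2 ?_)) hge
  refine Complex.Gamma_ne_zero_of_re_pos ?_
  simp

lemma xi_half_im (t : ℝ) : (xi (1 / 2 + t * Complex.I)).im = 0 := by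
  have h1 := xi_conj (1 / 2 + t * Complex.I)
  have h2 := xi_one_sub (1 / 2 + t * Complex.I)
  have e : (starRingEnd ℂ) (1 / 2 + t * Complex.I) = 1 - (1 / 2 + t * Complex.I) := by
    apply Complex.ext <;> simp
    norm_num
  rw [e, h2] at h1
  exact Complex.conj_eq_iff_im.1 h1.symm

/-- On the critical line, `ξ` has the opposite sign to the real part of `ζ` rotated by an approximate theta function. -/
lemma exists_xi_half_re_eq {t Θ : ℝ} (ht : 8 ≤ t)
    (hΘ : |Θ - (t / 2 * log (t / 2) - t / 2 - π / 8 - t / 2 * log π)| ≤ 1 / 2) :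
    ∃ c > 0, (xi (1 / 2 + t * Complex.I)).re =
      -c * (Complex.exp (Θ * Complex.I) * riemannZeta (1 / 2 + t * Complex.I)).re := by
  set s : ℂ := 1 / 2 + t * Complex.I with hs
  set φ : ℝ := Θ + t / 2 * log π with hφ
  set g := Complex.exp (-φ * Complex.I) * Complex.Gamma (1 / 4 + (t / 2 : ℝ) * Complex.I) with hg
  set w := Complex.exp (Θ * Complex.I) * riemannZeta s with hw
  have hg0 : 0 < g.re := re_exp_mul_Gamma_pos (by linarith) (by
    rw [hφ]; convert hΘ using 2; ring)
  have hsre : s.re = 1 / 2 := by simp [hs]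
  have hsim : s.im = t := by simp [hs]
  have hs0 : s ≠ 0 := fun h => by rw [h] at hsre; norm_num at hsre
  have hs1 : s ≠ 1 := fun h => by rw [h] at hsre; norm_num at hsre
  have hG := Complex.Gammaℝ_ne_zero_of_re_pos (s := s) (by rw [hsre]; norm_num)
  have hπ : (π : ℂ) ^ (-s / 2) = (exp (-(log π) / 4) : ℝ) * Complex.exp (-(t / 2 * log π : ℝ) * Complex.I) := by
    rw [Complex.cpow_def_of_ne_zero (by exact_mod_cast pi_ne_zero), ← Complex.ofReal_log pi_pos.le, Complex.ofReal_exp,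
      ← Complex.exp_add, hs]
    congr 1
    push_cast
    ring
  have hss : s * (s - 1) = ((-(1 / 4 + t ^ 2) : ℝ) : ℂ) := by
    rw [hs]; push_cast
    linear_combination (t : ℂ) ^ 2 * Complex.I_sq
  have hxi : xi s = ((-((1 / 4 + t ^ 2) * exp (-(log π) / 4)) : ℝ) : ℂ) * (g * w) := by
    rw [xi_eq_zeta hs0 hs1 hG, Complex.Gammaℝ_def, hπ, hss, hg, hw]
    have e1 : s / 2 = 1 / 4 + (t / 2 : ℝ) * Complex.I := by rw [hs]; push_cast; ring
    have e2 : Complex.exp (-(t / 2 * log π : ℝ) * Complex.I) = Complex.exp (-φ * Complex.I) * Complex.exp (Θ * Complex.I) := by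
      rw [← Complex.exp_add, hφ]; congr 1; push_cast; ring
    rw [e1, e2]
    push_cast
    ring
  set K : ℝ := (1 / 4 + t ^ 2) * exp (-(log π) / 4) with hK
  have hK0 : 0 < K := by positivity
  have him : (g * w).im = 0 := by
    have h1 := xi_half_im t
    rw [← hs, hxi, Complex.im_ofReal_mul] at h1
    rcases mul_eq_zero.1 h1 with h2 | h2
    · linarith
    · exact h2
  have hre : (xi s).re = -K * (g * w).re := by rw [hxi, Complex.re_ofReal_mul]
  have hgw : (g * w).re = Complex.normSq g / g.re * w.re := by
    rw [Complex.mul_im] at him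
    rw [Complex.mul_re, Complex.normSq_apply]
    field_simp
    linear_combination (-g.im) * him
  have hn : 0 < Complex.normSq g := Complex.normSq_pos.2 fun h => by rw [h] at hg0; simp at hg0
  refine ⟨K * (Complex.normSq g / g.re), by positivity, ?_⟩
  rw [hre, hgw]
  ring

end GammaPhase

section FixedPoint

/-- The values `2 ^ 18 (1 + cos (2 π k / 256))` for `0 ≤ k ≤ 256`, rounded, packed in base `2 ^ 20`. -/
def cosTable : ℕ :=
  9843467943881209475034325100982982416868742566771591393673493651897450911281487858161278191553989582390271656561161687814065110693433173398929276390099973386303208402107988614661937371084654189003343959035931164415480434173558858270196101095559658260395035973745102512096952483056777634524191128737892692220021840274787082019000084188352008840947347323091327377088758560951647553935717491254817475217365349146263926549978489783824056477785090156936498694943718781196320323577272254795494702147490257724251919980097796166820469491178028190794941315747294087219382897354294250223937457280162559215175297407006679593352428126978131606161200288824765606341382414236141898748389023310638157118206184643422077813195395712746159836899924711987768275931974830180152764960810005604949050667882498223903042506522530200810355567802799550000287218922825804424099804616813396185293832544575184083731532676868324109105163103549730539303565526541178619462162683351051258091143433404544805397556543471171293098013134098234288339309633538778202842395019839286742266970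9798066945343242951579146818370196570306886613570263230292143071278949563688496564558033120381775456397463805590553429717226623634370397575729777864510571660560631329669217596635311682070336545533348443054365607464893024926962874861976402250384492003652842886344209975621386368237879978510117380073548560073911411066499922829689742946138353848159941211001842362744938233071173290493616331958150652680429826559871747812432220151563729230283264104320102745543143526706093159654014069017952533348352

/-- Linear interpolation of `2 ^ 56 (1 + cos (2 π v / 2 ^ 46))`. -/
noncomputable def cosFix (v : ℕ) : ℕ :=
  (fun q => (fun f => (fun X => Nat.add (Nat.mul (Nat.mod X 1048576) (Nat.sub 274877906944 f))
      (Nat.mul (Nat.shiftRight X 20) f))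
    (Nat.mod (Nat.shiftRight cosTable (Nat.mul 20 (Nat.shiftRight q 38))) 1099511627776)) (Nat.mod q 274877906944))
    (Nat.mod v 70368744177664)

/-- The pairs `(2 ^ 40 log n / (2 π), 2 ^ 20 / √n)`, rounded, for `n = 1, 2, …`. -/
def logTable : List (ℕ × ℕ) :=
  [(0, 1048576), (121295703935, 741455), (192249142235, 605395), (242591407869, 524288), (281639902755, 468937),
   (313544846169, 428079), (340520091465, 396324), (363887111804, 370727), (384498284470, 349525), (402935606689,
   331588), (419614193396, 316157), (434840550104, 302697), (448847440479, 290822), (461815795400, 280243),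
   (473889044990, 270741), (485182815738, 262144), (495791682636, 254317), (505793988404, 247151), (515255358006,
   240559), (524231310624, 234468), (532769233700, 228818), (540909897331, 223557), (548688631752, 218643),
   (556136254039, 214039), (563279805510, 209715), (570143144414, 205642), (576747426705, 201798), (583111499334,
   198162), (589252224505, 194715), (595184748924, 191442), (600922728899, 188329), (606478519673, 185363),
   (611863335631, 182533), (617087386571, 179829), (622159994220, 177241), (627089692339, 174762), (631884313098,
   172384), (636551061941, 170101), (641096582714, 167906), (645527014559, 165794), (649848041766, 163760),
   (654064937635, 161798), (658182603157, 159906), (662205601265, 158078), (666138187225, 156312), (669984335686,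
   154604), (673747764831, 152950), (677431957973, 151348), (681040182930, 149796), (684575509444, 148291),
   (688040824871, 146830), (691438848349, 145411), (694772143618, 144032), (698043130639, 142693), (701254096151,
   141389), (704407203269, 140121), (707504500241, 138887), (710547928439, 137684), (713539329668, 136512),
   (716480452859, 135370), (719372960211, 134256), (722218432833, 133169), (725018375935, 132108), (727774223608,
   131072), (730487343234, 130059), (733159039566, 129070), (735790558487, 128103), (738383090505, 127158),
   (740937773987, 126233), (743455698155, 125328), (745937905880, 124443), (748385396274, 123575), (750799127101,
   122726), (753180017033, 121894), (755528947745, 121079), (757846765875, 120279), (760134284861, 119496),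
   (762392286649, 118727), (764621523299, 117974), (766822718493, 117234), (768996568940, 116508), (771143745701,
   115795), (773264895436, 115096), (775360641569, 114409), (777431585391, 113734), (779478307092, 113070),
   (781501366740, 112419), (783501305200, 111778), (785478645002, 111148), (787433891159, 110529), (789367531945,
   109920), (791280039621, 109321), (793171871133, 108732), (795043468766, 108152), (796895260761, 107581),
   (798727661908, 107019), (800541074100, 106466), (802335886865, 105922), (804112477866, 105385), (805871213379,
   104857), (807612448746, 104337), (809336528805, 103824), (811043788304, 103319), (812734552283, 102821),
   (814409136455, 102330), (816067847552, 101846), (817710983667, 101369), (819338834574, 100899), (820951682033,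
   100435), (822549800086, 99977), (824133455333, 99526), (825702907204, 99081), (827258408206, 98641), (828800204176,
   98208), (830328534507, 97780), (831843632374, 97357), (833345724949, 96940), (834835033603, 96529), (836311774101,
   96122), (837776156794, 95721), (839228386792, 95325), (840668664145, 94933), (842097184001, 94546), (843514136768,
   94164), (844919708265, 93787), (846314079870, 93414), (847697428659, 93046), (849069927542, 92681), (850431745392,
   92321), (851783047169, 91966), (853123994041, 91614), (854454743500, 91266), (855775449471, 90923), (857086262421,
   90583), (858387329460, 90247), (859678794440, 89914), (860960798053, 89585), (862233477921, 89260), (863496968685,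
   88939), (864751402089, 88620), (865996907066, 88306), (867233609815, 87994), (868461633876, 87686), (869681100208,
   87381), (870892127260, 87079), (872094831036, 86780), (873289325165, 86485), (874475720968, 86192), (875654127512,
   85902), (876824651679, 85615), (877987398220, 85331), (879142469810, 85050), (880289967106, 84772), (881429988796,
   84496), (882562631653, 84223), (883687990584, 83953), (884806158673, 83685), (885917227234, 83420), (887021285852,
   83157), (888118422428, 82897), (889208723217, 82639), (890292272874, 82383), (891369154491, 82130), (892439449635,
   81880), (893503238386, 81631), (894560599371, 81385), (895611609800, 81141), (896656345504, 80899), (897694880959,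
   80659), (898727289325, 80422), (899753642476, 80186), (900774011026, 79953), (901788464363, 79721), (902797070674,
   79492), (903799896975, 79264), (904797009135, 79039), (905788471903, 78815), (906774348936, 78594), (907754702820,
   78374), (908729595094, 78156), (909699086275, 77940), (910663235879, 77725), (911622102446, 77512), (912575743555,
   77302), (913524215853, 77092), (914467575068, 76885), (915405876032, 76679), (916339172701, 76475), (917267518170,
   76272), (918190964696, 76071), (919109563711, 75872), (920023365842, 75674), (920932420929, 75478), (921836778035,
   75283), (922736485469, 75090), (923631590800, 74898), (924522140867, 74707), (925408181801, 74519), (926289759033,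
   74331), (927166917313, 74145), (928039700721, 73960), (928908152680, 73777), (929772315970, 73595), (930632232740,
   73415), (931487944521, 73235), (932339492238, 73057), (933186916221, 72881), (934030256218, 72705), (934869551402,
   72531), (935704840390, 72358), (936536161243, 72186), (937363551487, 72016), (938187048115, 71847), (939006687602,
   71679), (939822505912, 71512), (940634538508, 71346), (941442820364, 71181), (942247385967, 71018), (943048269336,
   70856), (943845504020, 70694), (944639123115, 70534), (945429159268, 70375), (946215644684, 70217), (946998611138,
   70060), (947778089980, 69905), (948554112141, 69750), (949326708144, 69596), (950095908110, 69443), (950861741764,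
   69291), (951624238441, 69141), (952383427096, 68991), (953139336309, 68842), (953891994288, 68694), (954641428884,
   68547), (955387667586, 68401), (956130737537, 68256), (956870665534, 68112), (957607478036, 67969), (958341201167,
   67826), (959071860728, 67685), (959799482195, 67544), (960524090727, 67405), (961245711174, 67266), (961964368080,
   67128), (962680085685, 66991), (963392887936, 66854), (964102798486, 66719), (964809840702, 66584), (965514037671,
   66450), (966215412199, 66317), (966913986822, 66185), (967609783804, 66054), (968302825148, 65923), (968993132593,
   65793), (969680727626, 65664), (970365631477, 65536), (971047865130, 65408), (971727449327, 65281), (972404404564,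
   65155), (973078751103, 65029), (973750508975, 64905), (974419697976, 64781), (975086337679, 64657), (975750447435,
   64535), (976412046372, 64413), (977071153406, 64292), (977727787237, 64171), (978381966356, 64051), (979033709048,
   63932), (979683033394, 63814), (980329957275, 63696), (980974498374, 63579), (981616674180, 63462), (982256501988,
   63346), (982893998906, 63231), (983529181856, 63116), (984162067575, 63002), (984792672619, 62889), (985421013368,
   62776), (986047106024, 62664), (986670966615, 62552), (987292611001, 62441), (987912054871, 62331), (988529313749,
   62221), (989144402996, 62112), (989757337810, 62003), (990368133232, 61895), (990976804143, 61787), (991583365272,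
   61680), (992187831194, 61574), (992790216335, 61468), (993390534970, 61363), (993988801230, 61258), (994585029100,
   61154), (995179232423, 61050), (995771424902, 60947), (996361620101, 60844), (996949831446, 60742), (997536072231,
   60640), (998120355614, 60539), (998702694622, 60438), (999283102154, 60338), (999861590981, 60239), (1000438173745,
   60139), (1001012862966, 60041), (1001585671040, 59943), (1002156610244, 59845), (1002725692731, 59748),
   (1003292930539, 59651), (1003858335588, 59555), (1004421919684, 59459), (1004983694518, 59363), (1005543671670,
   59269), (1006101862607, 59174), (1006658278690, 59080), (1007212931169, 58987), (1007765831188, 58893),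
   (1008316989787, 58801), (1008866417901, 58708), (1009414126362, 58617), (1009960125902, 58525), (1010504427151,
   58434), (1011047040642, 58344), (1011587976809, 58254), (1012127245989, 58164), (1012664858426, 58075),
   (1013200824268, 57986), (1013735153570, 57897), (1014267856297, 57809), (1014798942321, 57722), (1015328421425,
   57634), (1015856303305, 57548), (1016382597568, 57461), (1016907313735, 57375), (1017430461241, 57289),
   (1017952049438, 57204), (1018472087594, 57119), (1018990584893, 57035), (1019507550441, 56950), (1020022993260,
   56867), (1020536922295, 56783), (1021049346411, 56700), (1021560274396, 56617), (1022069714961, 56535),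
   (1022577676741, 56453), (1023084168298, 56371), (1023589198116, 56290), (1024092774609, 56209), (1024594906117,
   56128), (1025095600910, 56048), (1025594867184, 55968), (1026092713069, 55889), (1026589146623, 55810),
   (1027084175838, 55731), (1027577808635, 55652), (1028070052871, 55574), (1028560916336, 55496), (1029050406755,
   55418), (1029538531787, 55341), (1030025299028, 55264), (1030510716012, 55188), (1030994790209, 55111),
   (1031477529027, 55035), (1031958939814, 54960), (1032439029856, 54884), (1032917806380, 54809), (1033395276555,
   54735), (1033871447490, 54660), (1034346326236, 54586), (1034819919788, 54512), (1035292235083, 54439),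
   (1035763279003, 54366), (1036233058373, 54293), (1036701579967, 54220), (1037168850499, 54148), (1037634876635,
   54076), (1038099664984, 54004), (1038563222104, 53932), (1039025554502, 53861), (1039486668630, 53790),
   (1039946570894, 53720), (1040405267645, 53649), (1040862765188, 53579), (1041319069777, 53509), (1041774187616,
   53440), (1042228124863, 53371), (1042680887627, 53302), (1043132481969, 53233), (1043582913905, 53164),
   (1044032189404, 53096), (1044480314388, 53028), (1044927294734, 52961), (1045373136276, 52893), (1045817844801,
   52826), (1046261426054, 52759), (1046703885735, 52692), (1047145229501, 52626), (1047585462968, 52560),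
   (1048024591706, 52494), (1048462621248, 52428), (1048899557082, 52363), (1049335404656, 52298), (1049770169378,
   52233), (1050203856615, 52168), (1050636471694, 52104), (1051068019905, 52039), (1051498506495, 51975),
   (1051927936675, 51912), (1052356315617, 51848), (1052783648456, 51785), (1053209940288, 51722), (1053635196173,
   51659), (1054059421133, 51597), (1054482620156, 51534), (1054904798191, 51472), (1055325960152, 51410),
   (1055746110920, 51348), (1056165255337, 51287), (1056583398214, 51226), (1057000544324, 51165), (1057416698410,
   51104), (1057831865178, 51043), (1058246049301, 50983), (1058659255421, 50923), (1059071488146, 50863),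
   (1059482752050, 50803), (1059893051676, 50744), (1060302391536, 50684), (1060710776111, 50625), (1061118209846,
   50566), (1061524697162, 50508), (1061930242443, 50449), (1062334850047, 50391), (1062738524298, 50333),
   (1063141269495, 50275), (1063543089902, 50217), (1063943989758, 50160), (1064343973270, 50102), (1064743044619,
   50045), (1065141207955, 49988), (1065538467400, 49932), (1065934827050, 49875), (1066330290971, 49819),
   (1066724863202, 49763), (1067118547757, 49707), (1067511348619, 49651), (1067903269747, 49595), (1068294315073,
   49540), (1068684488502, 49485), (1069073793914, 49430), (1069462235162, 49375), (1069849816075, 49320),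
   (1070236540455, 49266), (1070622412079, 49212), (1071007434700, 49158), (1071391612045, 49104), (1071774947818,
   49050), (1072157445698, 48996), (1072539109341, 48943), (1072919942376, 48890), (1073299948411, 48837),
   (1073679131031, 48784), (1074057493796, 48731), (1074435040243, 48678), (1074811773888, 48626), (1075187698223,
   48574), (1075562816717, 48522), (1075937132818, 48470), (1076310649952, 48418), (1076683371521, 48367),
   (1077055300908, 48315), (1077426441472, 48264), (1077796796553, 48213), (1078166369469, 48162), (1078535163516,
   48111), (1078903181970, 48061), (1079270428087, 48010), (1079636905102, 47960), (1080002616229, 47910),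
   (1080367564663, 47860), (1080731753578, 47810), (1081095186129, 47761), (1081457865452, 47711), (1081819794662,
   47662), (1082180976855, 47613), (1082541415109, 47564), (1082901112482, 47515), (1083260072015, 47466),
   (1083618296726, 47418), (1083975789620, 47369), (1084332553679, 47321), (1084688591870, 47273), (1085043907141,
   47225), (1085398502420, 47177), (1085752380621, 47129), (1086105544637, 47082), (1086457997345, 47035),
   (1086809741605, 46987), (1087160780260, 46940), (1087511116134, 46893), (1087860752035, 46846), (1088209690756,
   46800), (1088557935071, 46753), (1088905487739, 46707), (1089252351501, 46661), (1089598529082, 46614),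
   (1089944023194, 46568), (1090288836528, 46523), (1090632971763, 46477), (1090976431560, 46431), (1091319218566,
   46386), (1091661335411, 46340), (1092002784711, 46295), (1092343569065, 46250), (1092683691059, 46205),
   (1093023153261, 46160), (1093361958228, 46116), (1093700108498, 46071), (1094037606598, 46027), (1094374455038,
   45983), (1094710656314, 45938), (1095046212909, 45894), (1095381127290, 45851), (1095715401910, 45807),
   (1096049039210, 45763), (1096382041614, 45720), (1096714411534, 45676), (1097046151369, 45633), (1097377263503,
   45590), (1097707750307, 45547), (1098037614138, 45504), (1098366857341, 45461), (1098695482246, 45418),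
   (1099023491171, 45376), (1099350886422, 45333), (1099677670290, 45291), (1100003845055, 45249), (1100329412982,
   45207), (1100654376327, 45165), (1100978737329, 45123), (1101302498218, 45081), (1101625661210, 45040),
   (1101948228510, 44998), (1102270202309, 44957), (1102591584788, 44916), (1102912378114, 44874), (1103232584444,
   44833), (1103552205922, 44792), (1103871244681, 44752), (1104189702840, 44711), (1104507582511, 44670),
   (1104824885790, 44630), (1105141614765, 44589), (1105457771509, 44549), (1105773358088, 44509), (1106088376554,
   44469), (1106402828949, 44429), (1106716717303, 44389), (1107030043636, 44350), (1107342809958, 44310),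
   (1107655018267, 44270), (1107966670550, 44231), (1108277768784, 44192), (1108588314936, 44153), (1108898310961,
   44113), (1109207758806, 44074), (1109516660405, 44036), (1109825017684, 43997), (1110132832557, 43958),
   (1110440106931, 43920), (1110746842698, 43881), (1111053041745, 43843), (1111358705946, 43804), (1111663837166,
   43766), (1111968437261, 43728), (1112272508077, 43690), (1112576051450, 43652), (1112879069206, 43615),
   (1113181563163, 43577), (1113483535129, 43539), (1113784986901, 43502), (1114085920270, 43464), (1114386337014,
   43427), (1114686238905, 43390), (1114985627704, 43353), (1115284505165, 43316), (1115582873030, 43279),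
   (1115880733034, 43242), (1116178086905, 43205), (1116474936358, 43169), (1116771283102, 43132), (1117067128837,
   43096), (1117362475254, 43059), (1117657324035, 43023), (1117951676856, 42987), (1118245535381, 42951),
   (1118538901268, 42915), (1118831776166, 42879), (1119124161715, 42843), (1119416059548, 42807), (1119707471290,
   42772), (1119998398557, 42736), (1120288842956, 42701), (1120578806089, 42665), (1120868289547, 42630),
   (1121157294915, 42595), (1121445823770, 42560), (1121733877679, 42525), (1122021458205, 42490), (1122308566900,
   42455), (1122595205311, 42420), (1122881374975, 42386), (1123167077423, 42351), (1123452314178, 42317),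
   (1123737086756, 42282), (1124021396665, 42248), (1124305245406, 42214), (1124588634473, 42179), (1124871565352,
   42145), (1125154039523, 42111), (1125436058456, 42077), (1125717623619, 42044), (1125998736467, 42010),
   (1126279398453, 41976), (1126559611019, 41943), (1126839375604, 41909), (1127118693637, 41876), (1127397566542,
   41842), (1127675995734, 41809), (1127953982624, 41776), (1128231528615, 41743), (1128508635103, 41710),
   (1128785303478, 41677), (1129061535123, 41644), (1129337331414, 41611), (1129612693722, 41578), (1129887623410,
   41546), (1130162121836, 41513), (1130436190350, 41481), (1130709830297, 41448), (1130983043015, 41416),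
   (1131255829837, 41383), (1131528192087, 41351), (1131800131086, 41319), (1132071648147, 41287), (1132342744577,
   41255), (1132613421677, 41223), (1132883680743, 41191), (1133153523064, 41160), (1133422949924, 41128),
   (1133691962599, 41096), (1133960562361, 41065), (1134228750475, 41033), (1134496528202, 41002), (1134763896796,
   40971), (1135030857505, 40940)]

/-- The sum of `f` over the first `m` entries of a list. -/
noncomputable def listSum (f : ℕ × ℕ → ℕ) (l : List (ℕ × ℕ)) : ℕ → ℕ :=
  List.rec (motive := fun _ => ℕ → ℕ) (fun _ => 0)
    (fun w _ ih m => Nat.rec 0 (fun k _ => Nat.add (f w) (ih k)) m) l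

/-- The entry of index `m` of a list. -/
noncomputable def entry (l : List (ℕ × ℕ)) : ℕ → ℕ × ℕ :=
  List.rec (motive := fun _ => ℕ → ℕ × ℕ) (fun _ => (0, 0))
    (fun w _ ih m => Nat.rec w (fun k _ => ih k) m) l

/-- The negative of the approximate theta function at `T / 64`, in units of `2 π / 2 ^ 46`. -/
noncomputable def phaseFix (T N lamN : ℕ) : ℕ :=
  (fun x => (T * (140737488355328 + 496607800052 + (349985421095 * (x + x * x * x / 55340232221128654848)) / 4294967296 -
    lamN - 242591407869)) / 2 + 4398046511104) ((256 * N - T) * 4294967296 / (256 * N + T))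

/-- Multiplication of Gaussian integers. -/
def gaussMul (a b : ℤ × ℤ) : ℤ × ℤ := (a.1 * b.1 - a.2 * b.2, a.1 * b.2 + a.2 * b.1)

/-- One Horner step of the Bernoulli sum. -/
def hornerStep (T M j d : ℤ) (H : ℤ × ℤ) : ℤ × ℤ :=
  (fun G => (G.1 + d * M ^ (16 - 2 * j.toNat), G.2)) (gaussMul (gaussMul (64 * (2 * j - 1) + 32, T) (64 * (2 * j) + 32, T)) H)

/-- The Bernoulli sum of the Euler–Maclaurin formula, up to the factor `D M ^ 15`. -/
def hornerSum (T M : ℤ) : ℤ × ℤ :=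
  gaussMul (32, T) (hornerStep T M 1 (889218570240000) (hornerStep T M 2 (-14820309504000) (hornerStep T M 3 (352864512000)
    (hornerStep T M 4 (-8821612800) (hornerStep T M 5 (222768000) (hornerStep T M 6 (-5638560)
    (hornerStep T M 7 (142800) (-3617, 0))))))))

/-- The boundary factor of the Euler–Maclaurin formula, multiplied by `2 ^ 20` and rounded. -/
def boundaryFix (T M : ℤ) : ℤ × ℤ :=
  (fun H Q E => (1048576 * (H.1 * E - 32 * M * Q) / (Q * E) + 524288, 1048576 * (H.2 * E - T * M * Q) / (Q * E)))
    (hornerSum T M) (10670622842880000 * M ^ 15) (1024 + T * T)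

/-- An approximation to `2 ^ 96` times the rotated zeta value at height `T / 64`. -/
noncomputable def zetaFix (T : ℕ) : ℤ × ℤ × ℤ :=
  (fun N => (fun w => (fun Φ => (fun A =>
    (A.1, A.2, 1048576 * ((listSum (fun p => Nat.mul p.2 (cosFix (Nat.add Φ (Nat.mul T p.1)))) logTable (Nat.pred N) : ℕ) -
        (72057594037927936 * listSum (fun p => p.2) logTable (Nat.pred N) : ℕ) : ℤ) +
      (w.2 : ℤ) * (((cosFix (Nat.add Φ (Nat.mul T w.1)) : ℤ) - 72057594037927936) * A.1 +
        ((cosFix (Nat.add (Nat.add Φ (Nat.mul T w.1)) 52776558133248) : ℤ) - 72057594037927936) * A.2)))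
    (boundaryFix T (64 * N : ℕ))) (phaseFix T N w.1)) (entry logTable (Nat.pred N))) (Nat.add (Nat.div T 256) 6)

/-- The rotated zeta value at height `T / 64` is certified to have the given sign. -/
noncomputable def signOK (b : Bool) (T : ℕ) : Bool :=
  (fun Z => ((Nat.ble 640 T && Nat.ble T 165887) && (Nat.ble Z.1.natAbs 2097152 && Nat.ble Z.2.1.natAbs 2097152)) &&
    bif b then decide (752673760633528860137324544 ≤ Z.2.2) else decide (Z.2.2 ≤ -752673760633528860137324544)) (zetaFix T)

/-- The signs at the points of the list alternate. -/
noncomputable def signsOK (l : List ℕ) : Bool → Bool :=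
  List.rec (motive := fun _ => Bool → Bool) (fun _ => true) (fun T _ ih b => signOK b T && ih (!b)) l

end FixedPoint

section CosTable

lemma abs_cos_interpolation_le (a h : ℝ) {θ : ℝ} (h0 : 0 ≤ θ) (h1 : θ ≤ 1) :
    |(1 - θ) * Real.cos a + θ * Real.cos (a + h) - Real.cos (a + θ * h)| ≤ h ^ 2 / 8 := by
  have conv : ∀ ε : ℝ, |ε| ≤ 1 → ConvexOn ℝ Set.univ fun u : ℝ => u ^ 2 / 2 + ε * Real.cos u := by
    intro ε hε
    have hd1 : ∀ u : ℝ, HasDerivAt (fun u : ℝ => u ^ 2 / 2 + ε * Real.cos u) (u - ε * Real.sin u) u := by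
      intro u
      refine (((hasDerivAt_pow 2 u).div_const 2).add ((Real.hasDerivAt_cos u).const_mul ε)).congr_deriv ?_
      push_cast; ring
    have hd2 : ∀ u : ℝ, HasDerivAt (fun u : ℝ => u - ε * Real.sin u) (1 - ε * Real.cos u) u := fun u =>
      (hasDerivAt_id u).sub ((Real.hasDerivAt_sin u).const_mul ε)
    have e1 : deriv (fun u : ℝ => u ^ 2 / 2 + ε * Real.cos u) = fun u => u - ε * Real.sin u := funext fun u => (hd1 u).deriv
    refine convexOn_univ_of_deriv2_nonneg (fun u => (hd1 u).differentiableAt) ?_ fun u => ?_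
    · rw [e1]; exact fun u => (hd2 u).differentiableAt
    · rw [Function.iterate_succ, Function.iterate_one, Function.comp, e1, (hd2 u).deriv]
      have : |ε * Real.cos u| ≤ 1 * 1 := by
        rw [abs_mul]; exact mul_le_mul hε (Real.abs_cos_le_one u) (abs_nonneg _) zero_le_one
      linarith [(abs_le.1 this).2]
  have key : ∀ ε : ℝ, |ε| ≤ 1 →
      ε * (Real.cos (a + θ * h) - ((1 - θ) * Real.cos a + θ * Real.cos (a + h))) ≤ h ^ 2 / 8 := by
    intro ε hε
    have := (conv ε hε).2 (Set.mem_univ a) (Set.mem_univ (a + h)) (by linarith : 0 ≤ 1 - θ) h0 (by ring)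
    simp only [smul_eq_mul] at this
    have e : (1 - θ) * a + θ * (a + h) = a + θ * h := by ring
    rw [e] at this
    nlinarith [mul_nonneg (sq_nonneg h) (sq_nonneg (2 * θ - 1))]
  have k1 := key 1 (by simp)
  have k2 := key (-1) (by simp)
  rw [abs_le]
  constructor <;> linarith

/-- An entry of the table of cosines. -/
def cosNode (k : ℕ) : ℕ := cosTable / 2 ^ (20 * k) % 2 ^ 20

/-- Powers of a Gaussian integer close to `2 ^ 30 exp (2 π i / 256)`. -/
def gaussPow (k : ℕ) : ℤ × ℤ := Nat.rec (1, 0) (fun _ ih => gaussMul (1073418433, 26350943) ih) k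

/-- Comparison of the table of cosines with the powers of a Gaussian integer. -/
def cosNodesOK (m : ℕ) : Bool :=
  Nat.rec true (fun k ih => ih && decide (((cosNode k * 2 ^ (30 * k) : ℕ) - 2 ^ 18 * ((2 ^ (30 * k) : ℕ) + (gaussPow k).1)).natAbs ≤
    2 ^ (30 * k))) m

lemma cosNodesOK_257 : cosNodesOK 257 = true := by decide +kernel

lemma norm_pow_sub_pow_le {x y : ℂ} (hx : ‖x‖ ≤ 1) (hy : ‖y‖ ≤ 1) (k : ℕ) : ‖x ^ k - y ^ k‖ ≤ k * ‖x - y‖ := by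
  induction k with
  | zero => simp
  | succ k ih =>
    have e : x ^ (k + 1) - y ^ (k + 1) = x ^ k * (x - y) + (x ^ k - y ^ k) * y := by ring
    rw [e]
    refine (norm_add_le _ _).trans ?_
    rw [norm_mul, norm_mul, norm_pow]
    have h1 : ‖x‖ ^ k ≤ 1 := pow_le_one₀ (norm_nonneg _) hx
    have h2 := mul_le_mul_of_nonneg_right h1 (norm_nonneg (x - y))
    have h3 := mul_le_mul ih hy (norm_nonneg _) (by positivity)
    push_cast
    linarith

lemma gaussPow_cast (k : ℕ) : (((gaussPow k).1 : ℂ) + (gaussPow k).2 * Complex.I) = (1073418433 + 26350943 * Complex.I) ^ k := by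
  induction k with
  | zero => simp [gaussPow]
  | succ k ih =>
    have e : gaussPow (k + 1) = gaussMul (1073418433, 26350943) (gaussPow k) := rfl
    rw [e, pow_succ, ← ih, gaussMul]
    push_cast
    linear_combination (-26350943 * (gaussPow k).2 : ℂ) * Complex.I_sq

lemma norm_gauss_sub_exp_le :
    ‖((1073418433 + 26350943 * Complex.I) / 2 ^ 30 : ℂ) - Complex.exp ((2 * π / 256 : ℝ) * Complex.I)‖ ≤ 0.000000045 := by
  have hπ1 := pi_gt_d20
  have hπ2 := pi_lt_d20
  set x : ℝ := 2 * π / 256 with hx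
  have hx1 : 0.0245436926061702596 ≤ x := by rw [hx]; linarith
  have hx2 : x ≤ 0.0245436926061702598 := by rw [hx]; linarith
  have hx0 : 0 ≤ x := by linarith
  have habs : |x| ≤ 1 := by rw [abs_of_nonneg hx0]; linarith
  have hc := Real.cos_bound habs
  have hs := Real.sin_bound habs
  have h2a : (0.0245436926061702596 : ℝ) ^ 2 ≤ x ^ 2 := by gcongr
  have h2b : x ^ 2 ≤ (0.0245436926061702598 : ℝ) ^ 2 := by gcongr
  have h3a : (0.0245436926061702596 : ℝ) ^ 3 ≤ x ^ 3 := by gcongr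
  have h3b : x ^ 3 ≤ (0.0245436926061702598 : ℝ) ^ 3 := by gcongr
  have h4b : |x| ^ 4 ≤ (0.0245436926061702598 : ℝ) ^ 4 := by rw [abs_of_nonneg hx0]; gcongr
  have h5b : |x| ^ 5 ≤ (0.0245436926061702598 : ℝ) ^ 5 := by rw [abs_of_nonneg hx0]; gcongr
  have hcc : |1073418433 / 2 ^ 30 - Real.cos x| ≤ 0.000000035 := by
    rw [abs_le] at hc ⊢
    constructor <;> norm_num at * <;> linarith [hc.1, hc.2]
  have hss : |26350943 / 2 ^ 30 - Real.sin x| ≤ 0.00000001 := by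
    rw [abs_le] at hs ⊢
    constructor <;> norm_num at * <;> linarith [hs.1, hs.2]
  have e : ((1073418433 + 26350943 * Complex.I) / 2 ^ 30 : ℂ) - Complex.exp ((x : ℝ) * Complex.I) =
      ((1073418433 / 2 ^ 30 - Real.cos x : ℝ) : ℂ) + ((26350943 / 2 ^ 30 - Real.sin x : ℝ) : ℂ) * Complex.I := by
    rw [Complex.exp_mul_I, ← Complex.ofReal_cos, ← Complex.ofReal_sin]
    push_cast
    ring
  rw [e]
  refine (norm_add_le _ _).trans ?_
  rw [norm_mul, Complex.norm_I, mul_one, Complex.norm_real, Complex.norm_real, Real.norm_eq_abs, Real.norm_eq_abs]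
  linarith

lemma cosNode_bound {k : ℕ} (hk : k ≤ 256) :
    |(cosNode k : ℝ) / 2 ^ 18 - 1 - Real.cos (2 * π / 256 * k)| ≤ 0.000016 := by
  have hall : ∀ m, cosNodesOK m = true → ∀ k < m,
      ((cosNode k : ℤ) * 2 ^ (30 * k) - 2 ^ 18 * (2 ^ (30 * k) + (gaussPow k).1)).natAbs ≤ 2 ^ (30 * k) := by
    intro m
    induction m with
    | zero => intro _ k hk; omega
    | succ m ih =>
      intro h k hk
      have e : cosNodesOK (m + 1) = (cosNodesOK m && decide (((cosNode m : ℤ) * 2 ^ (30 * m) -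
        2 ^ 18 * (2 ^ (30 * m) + (gaussPow m).1)).natAbs ≤ 2 ^ (30 * m))) := rfl
      rw [e, Bool.and_eq_true, decide_eq_true_eq] at h
      rcases Nat.lt_succ_iff_lt_or_eq.1 hk with h1 | rfl
      · exact ih h.1 k h1
      · exact h.2
  have h1 := hall 257 cosNodesOK_257 k (by omega)
  have h2 : |(cosNode k : ℝ) * 2 ^ (30 * k) - 2 ^ 18 * (2 ^ (30 * k) + (gaussPow k).1)| ≤ 2 ^ (30 * k) := by
    have : (((cosNode k : ℤ) * 2 ^ (30 * k) - 2 ^ 18 * (2 ^ (30 * k) + (gaussPow k).1)).natAbs : ℤ) ≤ 2 ^ (30 * k) := by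
      exact_mod_cast h1
    rw [Int.natCast_natAbs] at this
    exact_mod_cast this
  have hre : ((gaussPow k).1 : ℝ) = ((1073418433 + 26350943 * Complex.I : ℂ) ^ k).re := by
    rw [← gaussPow_cast]; simp
  have hnorm : ‖((1073418433 + 26350943 * Complex.I) / 2 ^ 30 : ℂ)‖ ≤ 1 := by
    rw [norm_div, div_le_one (by simp)]
    refine (pow_le_pow_iff_left₀ (norm_nonneg _) (norm_nonneg _) two_ne_zero).1 ?_
    rw [← Complex.normSq_eq_norm_sq, Complex.normSq_apply]
    norm_num
  have hpow := (norm_pow_sub_pow_le hnorm (Complex.norm_exp_ofReal_mul_I (2 * π / 256)).le k).trans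
    (mul_le_mul_of_nonneg_left norm_gauss_sub_exp_le (Nat.cast_nonneg k))
  have hk' : (k : ℝ) ≤ 256 := by exact_mod_cast hk
  have h3 := (Complex.abs_re_le_norm _).trans hpow
  have e1 : (((1073418433 + 26350943 * Complex.I) / 2 ^ 30 : ℂ) ^ k).re = ((gaussPow k).1 : ℝ) / 2 ^ (30 * k) := by
    rw [div_pow, ← pow_mul, hre]
    have : (2 : ℂ) ^ (30 * k) = ((2 ^ (30 * k) : ℝ) : ℂ) := by push_cast; rfl
    rw [this, Complex.div_ofReal_re]
  have e2 : (Complex.exp ((2 * π / 256 : ℝ) * Complex.I) ^ k).re = Real.cos (2 * π / 256 * k) := by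
    rw [← Complex.exp_nat_mul, ← mul_assoc, ← Complex.ofReal_natCast, ← Complex.ofReal_mul, Complex.exp_ofReal_mul_I_re, mul_comm]
  rw [Complex.sub_re, e1, e2] at h3
  have hp : (0 : ℝ) < 2 ^ (30 * k) := by positivity
  have h4 : |(cosNode k : ℝ) / 2 ^ 18 - 1 - (gaussPow k).1 / 2 ^ (30 * k)| ≤ 1 / 2 ^ 18 := by
    have e : (cosNode k : ℝ) / 2 ^ 18 - 1 - (gaussPow k).1 / 2 ^ (30 * k) =
        ((cosNode k : ℝ) * 2 ^ (30 * k) - 2 ^ 18 * (2 ^ (30 * k) + (gaussPow k).1)) / (2 ^ 18 * 2 ^ (30 * k)) := by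
      field_simp
      ring
    rw [e, abs_div, abs_of_pos (by positivity : (0 : ℝ) < 2 ^ 18 * 2 ^ (30 * k)), div_le_div_iff₀ (by positivity) (by positivity)]
    nlinarith
  have h5 := abs_add_le ((cosNode k : ℝ) / 2 ^ 18 - 1 - (gaussPow k).1 / 2 ^ (30 * k))
    ((gaussPow k).1 / 2 ^ (30 * k) - Real.cos (2 * π / 256 * k))
  rw [sub_add_sub_cancel] at h5
  norm_num at h4 h3 ⊢
  linarith

lemma cosFix_eq (v : ℕ) : cosFix v =
    cosNode (v % 2 ^ 46 / 2 ^ 38) * (2 ^ 38 - v % 2 ^ 46 % 2 ^ 38) +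
      cosNode (v % 2 ^ 46 / 2 ^ 38 + 1) * (v % 2 ^ 46 % 2 ^ 38) := by
  have e : cosFix v = (cosTable >>> (20 * ((v % 2 ^ 46) >>> 38)) % (2 ^ 20 * 2 ^ 20)) % 2 ^ 20 * (2 ^ 38 - v % 2 ^ 46 % 2 ^ 38) +
      ((cosTable >>> (20 * ((v % 2 ^ 46) >>> 38)) % (2 ^ 20 * 2 ^ 20)) >>> 20) * (v % 2 ^ 46 % 2 ^ 38) := rfl
  rw [e, Nat.shiftRight_eq_div_pow _ 20, Nat.shiftRight_eq_div_pow _ 38, Nat.shiftRight_eq_div_pow, Nat.mod_mul_right_mod,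
    Nat.mod_mul_right_div_self, Nat.div_div_eq_div_mul, ← pow_add]
  rfl

lemma cosFix_bound (v : ℕ) : |(cosFix v : ℝ) / 2 ^ 56 - 1 - Real.cos (2 * π * v / 2 ^ 46)| ≤ 0.000092 := by
  set q := v % 2 ^ 46 with hq
  set k := q / 2 ^ 38 with hk
  set f := q % 2 ^ 38 with hf
  have hq1 : q < 2 ^ 46 := Nat.mod_lt _ (by norm_num)
  have hk1 : k < 256 := by omega
  have hf1 : f < 2 ^ 38 := Nat.mod_lt _ (by norm_num)
  have hqk : q = 2 ^ 38 * k + f := (Nat.div_add_mod q (2 ^ 38)).symm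
  have hv : v = 2 ^ 46 * (v / 2 ^ 46) + q := (Nat.div_add_mod v (2 ^ 46)).symm
  set θ : ℝ := f / 2 ^ 38 with hθ
  have hθ0 : 0 ≤ θ := by positivity
  have hθ1 : θ ≤ 1 := by
    rw [hθ, div_le_one (by norm_num)]
    exact_mod_cast hf1.le
  set m := v / 2 ^ 46 with hm
  have hcos : Real.cos (2 * π * v / 2 ^ 46) = Real.cos (2 * π / 256 * k + θ * (2 * π / 256)) := by
    rw [← Real.cos_add_nat_mul_two_pi (2 * π / 256 * k + θ * (2 * π / 256)) m]
    congr 1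
    rw [hv, hqk, hθ]
    push_cast
    field_simp
    ring
  have hfix : (cosFix v : ℝ) / 2 ^ 56 = (1 - θ) * (cosNode k / 2 ^ 18) + θ * (cosNode (k + 1) / 2 ^ 18) := by
    rw [cosFix_eq, ← hq, ← hk, ← hf, hθ]
    rw [Nat.cast_add, Nat.cast_mul, Nat.cast_mul, Nat.cast_sub hf1.le]
    push_cast
    field_simp
    norm_num
  have n1 := cosNode_bound (k := k) (by omega)
  have n2 := cosNode_bound (k := k + 1) (by omega)
  have hi := abs_cos_interpolation_le (2 * π / 256 * k) (2 * π / 256) hθ0 hθ1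
  have e2 : 2 * π / 256 * ((k + 1 : ℕ) : ℝ) = 2 * π / 256 * k + 2 * π / 256 := by push_cast; ring
  rw [e2] at n2
  have hh : (2 * π / 256) ^ 2 / 8 ≤ 0.000076 := by
    have := pi_lt_d2
    have hp := pi_pos
    nlinarith
  rw [hcos, hfix]
  rw [abs_le] at n1 n2 hi ⊢
  have m1 := mul_le_mul_of_nonneg_left n1.1 (sub_nonneg.2 hθ1)
  have m2 := mul_le_mul_of_nonneg_left n1.2 (sub_nonneg.2 hθ1)
  have m3 := mul_le_mul_of_nonneg_left n2.1 hθ0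
  have m4 := mul_le_mul_of_nonneg_left n2.2 hθ0
  norm_num at *
  constructor <;> linarith [hi.1, hi.2]

end CosTable

section LogTable

lemma log_div_series_bounds {x : ℝ} (h0 : 0 ≤ x) (h1 : x < 1) (K : ℕ) :
    ∑ k ∈ range K, 2 * (1 / (2 * (k : ℝ) + 1)) * x ^ (2 * k + 1) ≤ log ((1 + x) / (1 - x)) ∧
    log ((1 + x) / (1 - x)) ≤ ∑ k ∈ range K, 2 * (1 / (2 * (k : ℝ) + 1)) * x ^ (2 * k + 1) +
      2 * x ^ (2 * K + 1) / ((2 * K + 1) * (1 - x ^ 2)) := by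
  have hs := Real.hasSum_log_sub_log_of_abs_lt_one (x := x) (by rwa [abs_of_nonneg h0])
  rw [← Real.log_div (by linarith) (by linarith)] at hs
  have hsK := (hasSum_nat_add_iff' K).2 hs
  have hx2 : x ^ 2 < 1 := by nlinarith
  have hg := (hasSum_geometric_of_lt_one (sq_nonneg x) hx2).mul_left (2 * x ^ (2 * K + 1) / (2 * K + 1))
  constructor
  · exact sub_nonneg.1 (hsK.nonneg fun k => by positivity)
  · have := hasSum_le (fun k => ?_) hsK hg
    · rw [sub_le_iff_le_add'] at this
      refine this.trans (le_of_eq ?_)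
      have : 1 - x ^ 2 ≠ 0 := by linarith
      field_simp
    · have e : 2 * x ^ (2 * K + 1) / (2 * K + 1) * (x ^ 2) ^ k = 2 * (1 / (2 * (K : ℝ) + 1)) * x ^ (2 * (k + K) + 1) := by
        rw [← pow_mul, show 2 * (k + K) + 1 = (2 * K + 1) + 2 * k by ring, pow_add]
        ring
      rw [e]
      push_cast
      have hk : (0 : ℝ) ≤ k := Nat.cast_nonneg k
      gcongr
      linarith

/-- The quantity `2 ^ 40 log n / (2 π)`. -/
noncomputable def logScale (n : ℕ) : ℝ := 2 ^ 40 * log n / (2 * π)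

/-- Comparison of `b - a` with `2 ^ 40 artanh (1 / m) / π`. -/
def logIncrementOK (m a b : ℕ) : Bool :=
  (fun W B => Nat.ble (b * W) (a * W + B + W) && Nat.ble (a * W + B) (b * W + W)) (45045 * m ^ 15 * 3141592653589793)
    (2 ^ 40 * (45045 * m ^ 14 + 15015 * m ^ 12 + 9009 * m ^ 10 + 6435 * m ^ 8 + 5005 * m ^ 6 + 4095 * m ^ 4 +
      3465 * m ^ 2 + 3003) * 10 ^ 15)

lemma abs_sub_logScale_le {n : ℕ} (hn : 2 ≤ n) {a b m : ℝ} (hm : m = 2 * n + 1)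
    (h1 : b * (45045 * m ^ 15 * 3141592653589793) ≤ a * (45045 * m ^ 15 * 3141592653589793) +
      1099511627776 * (45045 * m ^ 14 + 15015 * m ^ 12 + 9009 * m ^ 10 + 6435 * m ^ 8 + 5005 * m ^ 6 + 4095 * m ^ 4 +
        3465 * m ^ 2 + 3003) * 1000000000000000 + 45045 * m ^ 15 * 3141592653589793)
    (h2 : a * (45045 * m ^ 15 * 3141592653589793) +
      1099511627776 * (45045 * m ^ 14 + 15015 * m ^ 12 + 9009 * m ^ 10 + 6435 * m ^ 8 + 5005 * m ^ 6 + 4095 * m ^ 4 +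
        3465 * m ^ 2 + 3003) * 1000000000000000 ≤ b * (45045 * m ^ 15 * 3141592653589793) + 45045 * m ^ 15 * 3141592653589793) :
    |(b - a) - (logScale (n + 1) - logScale n)| ≤ 1.05 := by
  have hn' : (2 : ℝ) ≤ n := by exact_mod_cast hn
  have hm5 : 5 ≤ m := by linarith
  have hm0 : 0 < m := by linarith
  obtain ⟨Num, hNum⟩ : ∃ Num : ℝ, Num = 45045 * m ^ 14 + 15015 * m ^ 12 + 9009 * m ^ 10 + 6435 * m ^ 8 + 5005 * m ^ 6 +
      4095 * m ^ 4 + 3465 * m ^ 2 + 3003 := ⟨_, rfl⟩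
  obtain ⟨W, hW⟩ : ∃ W : ℝ, W = 45045 * m ^ 15 := ⟨_, rfl⟩
  rw [← hNum, ← hW] at h1 h2
  have hW0 : 0 < W := by rw [hW]; positivity
  have hNum0 : 0 < Num := by rw [hNum]; positivity
  set x : ℝ := 1 / m with hx
  have hx0 : 0 ≤ x := by positivity
  have hx5 : x ≤ 1 / 5 := by rw [hx]; gcongr
  have hser := log_div_series_bounds hx0 (by linarith) 8
  have hlog : log ((1 + x) / (1 - x)) = log (n + 1 : ℕ) - log n := by
    rw [← Real.log_div (by positivity) (by positivity)]
    congr 1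
    have : m - 1 ≠ 0 := by linarith
    have h3 : 1 - x ≠ 0 := by linarith
    have hn0 : (n : ℝ) ≠ 0 := by positivity
    rw [div_eq_div_iff h3 hn0, hx, hm]
    have : (2 * (n : ℝ) + 1) ≠ 0 := by positivity
    push_cast
    field_simp
    ring
  have hS : ∑ k ∈ range 8, 2 * (1 / (2 * (k : ℝ) + 1)) * x ^ (2 * k + 1) = 2 * (Num / W) := by
    simp only [sum_range_succ, sum_range_zero, hx, hNum, hW]
    push_cast
    field_simp
    ring
  rw [hS, hlog] at hser
  set L : ℝ := log (n + 1 : ℕ) - log n with hL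
  set Y : ℝ := Num / W with hY
  have hL1 : L ≤ 1 / 2 := by
    have : log ((n + 1 : ℕ) / (n : ℝ)) ≤ (n + 1 : ℕ) / (n : ℝ) - 1 := Real.log_le_sub_one_of_pos (by positivity)
    rw [Real.log_div (by positivity) (by positivity)] at this
    refine this.trans ?_
    push_cast
    rw [sub_le_iff_le_add, div_le_iff₀ (by positivity)]
    linarith
  have hY0 : 0 ≤ Y := by positivity
  have hY1 : Y ≤ 1 / 4 := by linarith [hser.1]
  have herr : 2 * x ^ (2 * 8 + 1) / ((2 * (8 : ℕ) + 1) * (1 - x ^ 2)) ≤ 0.0000000000002 := by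
    have h3 : x ^ (2 * 8 + 1) ≤ (1 / 5) ^ 17 := by gcongr
    have h4 : x ^ 2 ≤ (1 / 5) ^ 2 := by gcongr
    norm_num at h3 h4 ⊢
    rw [div_le_iff₀ (by linarith only [h4])]
    linarith only [h3, h4]
  have hrel : 3141592653589793 * (b - a) - 3141592653589793 ≤ 2 ^ 40 * Y * 10 ^ 15 ∧
      2 ^ 40 * Y * 10 ^ 15 ≤ 3141592653589793 * (b - a) + 3141592653589793 := by
    have e : Num = Y * W := by rw [hY]; field_simp
    rw [e] at h1 h2
    constructor
    · refine le_of_mul_le_mul_right ?_ hW0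
      linarith
    · refine le_of_mul_le_mul_right ?_ hW0
      linarith
  have hdiff : logScale (n + 1) - logScale n = 2 ^ 40 * (L / 2) / π := by
    rw [logScale, logScale, hL]; field_simp
  have hp1 := pi_gt_d20
  have hp2 := pi_lt_d20
  have hpp := pi_pos
  set dl : ℝ := b - a with hdl
  have hZ := hser.2.trans (add_le_add_right herr _)
  have hdl0 : dl ≤ 100000000000 := by linarith [hrel.1]
  have hdl1 : -2 ≤ dl := by linarith [hrel.2]
  have hpd : |π * dl - 3.141592653589793 * dl| ≤ 0.01 := by
    rw [← sub_mul, abs_mul, abs_of_nonneg (by linarith : 0 ≤ π - 3.141592653589793)]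
    have : |dl| ≤ 100000000000 := abs_le.2 ⟨by linarith, hdl0⟩
    calc (π - 3.141592653589793) * |dl| ≤ 0.000000000000001 * 100000000000 := by gcongr; linarith
      _ ≤ 0.01 := by norm_num
  rw [hdiff, abs_le]
  rw [abs_le] at hpd
  constructor
  · rw [neg_le_sub_iff_le_add, div_le_iff₀ hpp]
    linarith only [hrel.1, hrel.2, hZ, hser.1, hpd.1, hpd.2, hp1, hp2]
  · rw [sub_le_iff_le_add, ← sub_le_iff_le_add', le_div_iff₀ hpp]
    linarith only [hrel.1, hrel.2, hZ, hser.1, hpd.1, hpd.2, hp1, hp2]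

lemma abs_sub_le_of_logIncrementOK {n a b : ℕ} (hn : 2 ≤ n) (h : logIncrementOK (2 * n + 1) a b = true) :
    |((b : ℝ) - a) - (logScale (n + 1) - logScale n)| ≤ 1.05 := by
  simp only [logIncrementOK, Bool.and_eq_true, Nat.ble_eq] at h
  have h1 := (Nat.cast_le (α := ℝ)).2 h.1
  have h2 := (Nat.cast_le (α := ℝ)).2 h.2
  push_cast at h1 h2
  exact abs_sub_logScale_le hn rfl h1 h2

/-- Comparison of `r` with `2 ^ 20 / √n`. -/
def sqrtOK (n r : ℕ) : Bool := Nat.ble (r ^ 2 * n) (2 ^ 40) && Nat.ble (2 ^ 40) ((r + 1) ^ 2 * n)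

lemma sqrtOK_bounds {n r : ℕ} (hn : 1 ≤ n) (h : sqrtOK n r = true) :
    (r : ℝ) / 2 ^ 20 ≤ 1 / √n ∧ 1 / √n ≤ (r : ℝ) / 2 ^ 20 + 1 / 2 ^ 20 := by
  simp only [sqrtOK, Bool.and_eq_true, Nat.ble_eq] at h
  have hn0 : (0 : ℝ) < n := by exact_mod_cast hn
  have h1 : (r : ℝ) ^ 2 * n ≤ 2 ^ 40 := by exact_mod_cast h.1
  have h2 : (2 : ℝ) ^ 40 ≤ (r + 1) ^ 2 * n := by exact_mod_cast h.2
  have hs : 0 < √(n : ℝ) := Real.sqrt_pos.2 hn0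
  constructor
  · rw [div_le_div_iff₀ (by positivity) hs]
    refine (pow_le_pow_iff_left₀ (by positivity) (by positivity) two_ne_zero).1 ?_
    rw [mul_pow, Real.sq_sqrt hn0.le]
    linarith
  · rw [← add_div, div_le_div_iff₀ hs (by positivity)]
    refine (pow_le_pow_iff_left₀ (by positivity) (by positivity) two_ne_zero).1 ?_
    rw [mul_pow, mul_pow, Real.sq_sqrt hn0.le]
    linarith

/-- Verification of the entries with index at least `3`. -/
def logTableOK : List (ℕ × ℕ) → ℕ → ℕ → Bool
  | [], _, _ => true
  | w :: l, n, a => (logIncrementOK (2 * n + 1) a w.1 && sqrtOK (n + 1) w.2) && logTableOK l (n + 1) w.1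

lemma logTableOK_spec (l : List (ℕ × ℕ)) (n a : ℕ) (hn : 2 ≤ n) (ha : |(a : ℝ) - logScale n| ≤ 20 + 1.05 * n)
    (h : logTableOK l n a = true) (i : ℕ) (hi : i < l.length) :
    |((entry l i).1 : ℝ) - logScale (n + 1 + i)| ≤ 20 + 1.05 * ((n + 1 + i : ℕ) : ℝ) ∧
      sqrtOK (n + 1 + i) (entry l i).2 = true := by
  induction l generalizing n a i with
  | nil => exact absurd hi (Nat.not_lt_zero i)
  | cons w l ih =>
    have e : logTableOK (w :: l) n a =
      ((logIncrementOK (2 * n + 1) a w.1 && sqrtOK (n + 1) w.2) && logTableOK l (n + 1) w.1) := rfl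
    rw [e, Bool.and_eq_true, Bool.and_eq_true] at h
    have hinc := abs_sub_le_of_logIncrementOK hn h.1.1
    have hw : |(w.1 : ℝ) - logScale (n + 1)| ≤ 20 + 1.05 * ((n + 1 : ℕ) : ℝ) := by
      rw [abs_le] at *
      push_cast
      constructor <;> linarith [hinc.1, hinc.2, ha.1, ha.2]
    rcases i with _ | i
    · rw [show entry (w :: l) 0 = w from rfl, add_zero]
      exact ⟨hw, h.1.2⟩
    · rw [show entry (w :: l) (i + 1) = entry l i from rfl, show n + 1 + (i + 1) = n + 1 + 1 + i by omega]
      exact ih (n + 1) w.1 (by omega) hw h.2 i (by simpa using hi)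

lemma logTable_tail_ok : logTableOK (logTable.drop 2) 2 (entry logTable 1).1 = true := by decide +kernel

lemma logTable_length : logTable.length = 656 := by decide +kernel

lemma entry_drop (l : List (ℕ × ℕ)) (i j : ℕ) : entry (l.drop i) j = entry l (i + j) := by
  induction l generalizing i with
  | nil => rw [List.drop_nil]; rfl
  | cons w l ih =>
    rcases i with _ | i
    · rw [zero_add]; rfl
    · rw [List.drop_succ_cons, ih, Nat.add_right_comm]; rfl

lemma logTable_spec {i : ℕ} (hi : i < 656) :
    |((entry logTable i).1 : ℝ) - logScale (i + 1)| ≤ 720 ∧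
      ((entry logTable i).2 : ℝ) / 2 ^ 20 ≤ 1 / √((i + 1 : ℕ) : ℝ) ∧
      1 / √((i + 1 : ℕ) : ℝ) ≤ ((entry logTable i).2 : ℝ) / 2 ^ 20 + 1 / 2 ^ 20 := by
  have h0 : entry logTable 0 = (0, 1048576) := by decide +kernel
  have h1 : entry logTable 1 = (121295703935, 741455) := by decide +kernel
  have hlog2 : |((121295703935 : ℕ) : ℝ) - logScale 2| ≤ 20 := by
    have hl := Real.log_two_near_10
    rw [abs_le] at hl ⊢
    have hp1 := pi_gt_d20
    have hp2 := pi_lt_d20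
    have hpp := pi_pos
    rw [logScale]
    push_cast
    constructor
    · rw [neg_le_sub_iff_le_add, div_le_iff₀ (by positivity)]
      linarith [hl.1, hl.2]
    · rw [sub_le_iff_le_add, ← sub_le_iff_le_add', le_div_iff₀ (by positivity)]
      linarith [hl.1, hl.2]
  rcases i with _ | _ | i
  · rw [h0]
    refine ⟨?_, ?_⟩
    · simp [logScale]
    · exact sqrtOK_bounds le_rfl (by decide +kernel)
  · rw [h1]
    exact ⟨hlog2.trans (by norm_num), sqrtOK_bounds (by norm_num) (by decide +kernel)⟩
  · have h := logTableOK_spec (logTable.drop 2) 2 (entry logTable 1).1 le_rfl (by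
      rw [h1]; refine hlog2.trans ?_; norm_num) logTable_tail_ok i (by rw [List.length_drop, logTable_length]; omega)
    rw [entry_drop, show 2 + 1 + i = i + 1 + 1 + 1 by omega, Nat.add_comm 2 i] at h
    refine ⟨h.1.trans ?_, sqrtOK_bounds (by omega) h.2⟩
    have : ((i + 1 + 1 + 1 : ℕ) : ℝ) ≤ 656 := by exact_mod_cast hi
    linarith

end LogTable

section PhaseAndBoundary

lemma natCast_div_bounds (a : ℕ) {b : ℕ} (hb : 0 < b) :
    (a : ℝ) / b - 1 ≤ ((a / b : ℕ) : ℝ) ∧ ((a / b : ℕ) : ℝ) ≤ a / b := by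
  have hb0 : (0 : ℝ) < b := by exact_mod_cast hb
  have h1 := Nat.div_add_mod a b
  have h2 := Nat.mod_lt a hb
  have h1' : (b : ℝ) * ((a / b : ℕ) : ℝ) + ((a % b : ℕ) : ℝ) = a := by exact_mod_cast h1
  have h2' : ((a % b : ℕ) : ℝ) < b := by exact_mod_cast h2
  have h3 : (0 : ℝ) ≤ ((a % b : ℕ) : ℝ) := Nat.cast_nonneg _
  constructor
  · rw [sub_le_iff_le_add, div_le_iff₀ hb0]; nlinarith
  · rw [le_div_iff₀ hb0]; nlinarith

lemma intCast_div_bounds (a : ℤ) {b : ℤ} (hb : 0 < b) :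
    (a : ℝ) / b - 1 ≤ ((a / b : ℤ) : ℝ) ∧ ((a / b : ℤ) : ℝ) ≤ a / b := by
  have hb0 : (0 : ℝ) < b := by exact_mod_cast hb
  have h1 := Int.mul_ediv_add_emod a b
  have h2 := Int.emod_lt_of_pos a hb
  have h3 := Int.emod_nonneg a hb.ne'
  have h1' : (b : ℝ) * ((a / b : ℤ) : ℝ) + ((a % b : ℤ) : ℝ) = a := by exact_mod_cast h1
  have h2' : ((a % b : ℤ) : ℝ) < b := by exact_mod_cast h2
  have h3' : (0 : ℝ) ≤ ((a % b : ℤ) : ℝ) := by exact_mod_cast h3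
  constructor
  · rw [sub_le_iff_le_add, div_le_iff₀ hb0]; nlinarith
  · rw [le_div_iff₀ hb0]; nlinarith

lemma cube_sub_cube_le {x z δ : ℝ} (hz : 0 ≤ z) (hzx : z ≤ x) (hx : x ≤ 6 / 11) (hδ : x - z ≤ δ) : x ^ 3 - z ^ 3 ≤ δ := by
  have e : x ^ 3 - z ^ 3 = (x - z) * (x ^ 2 + x * z + z ^ 2) := by ring
  have h1 : x ^ 2 + x * z + z ^ 2 ≤ 1 := by nlinarith
  rw [e]
  refine (mul_le_of_le_one_right (by linarith) h1).trans hδ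

lemma artanhFix_bounds {x : ℝ} (hx0 : 0 ≤ x) (hx : x ≤ 6 / 11) {X B : ℕ} (hB : 0 < B) (hX : (X : ℝ) / B = x * 4294967296)
    {xf af : ℕ} (hxf : xf = X / B) (haf : af = (349985421095 * (xf + xf * xf * xf / 55340232221128654848)) / 4294967296) :
    |(af : ℝ) * (2 * π) - 2 ^ 40 * (2 * (x + x ^ 3 / 3))| ≤ 2 ^ 40 * 0.00000001 := by
  obtain ⟨yf, hyf⟩ : ∃ yf : ℕ, yf = xf * xf * xf / 55340232221128654848 := ⟨_, rfl⟩
  rw [← hyf] at haf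
  have bx := natCast_div_bounds X hB
  rw [← hxf, hX] at bx
  have byy := natCast_div_bounds (xf * xf * xf) (b := 55340232221128654848) (by norm_num)
  rw [← hyf] at byy
  push_cast at byy
  have ba := natCast_div_bounds (349985421095 * (xf + yf)) (b := 4294967296) (by norm_num)
  rw [← haf] at ba
  push_cast at ba
  clear haf hyf hxf hX
  obtain ⟨z, hz⟩ : ∃ z : ℝ, z = xf / 4294967296 := ⟨_, rfl⟩
  have hz0 : 0 ≤ z := by rw [hz]; positivity
  have hzx : z ≤ x := by rw [hz]; linarith [bx.2]
  have hzx2 : x - z ≤ 1 / 4294967296 := by rw [hz]; linarith [bx.1]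
  have hz3 : (xf : ℝ) * xf * xf / 55340232221128654848 = 4294967296 * (z ^ 3 / 3) := by rw [hz]; ring
  rw [hz3] at byy
  have hcube := cube_sub_cube_le hz0 hzx hx hzx2
  have hcube0 : z ^ 3 ≤ x ^ 3 := by gcongr
  have hxf' : (xf : ℝ) = 4294967296 * z := by rw [hz]; ring
  rw [hxf'] at ba
  obtain ⟨u, hu⟩ : ∃ u : ℝ, u = x + x ^ 3 / 3 := ⟨_, rfl⟩
  have hu0 : 0 ≤ u := by rw [hu]; positivity
  have hu1 : u ≤ 1 := by
    have : x ^ 3 ≤ (6 / 11) ^ 3 := by gcongr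
    norm_num at this
    linarith
  have haf1 : (af : ℝ) ≤ 349985421095 * u := by linarith [ba.2, byy.2]
  have haf2 : 349985421095 * u - 400 ≤ (af : ℝ) := by linarith [ba.1, byy.1]
  rw [← hu]
  have hπ1 := pi_gt_d20
  have hπ2 := pi_lt_d20
  have m1 := mul_le_mul_of_nonneg_right haf1 pi_pos.le
  have m2 := mul_le_mul_of_nonneg_right haf2 pi_pos.le
  have m3 := mul_le_mul_of_nonneg_left hπ1.le hu0
  have m4 := mul_le_mul_of_nonneg_left hπ2.le hu0
  rw [abs_le]
  constructor <;> linarith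

lemma phase_error_le {t x E P : ℝ} (ht10 : 10 ≤ t) (ht26 : t ≤ 2592) (hx0 : 0 ≤ x) (hx1 : x ≤ 12 / (t + 12))
    (hE : |E * (2 * π) / 2 ^ 40 - (1 + log 2 + log π - log t)| ≤
      0.00010 + 2 * x ^ 5 / ((2 * 2 + 1) * (1 - x ^ 2)))
    (bp1 : 64 * t * 2 ^ 46 + 32 * t * E - 1 ≤ P) (bp2 : P ≤ 64 * t * 2 ^ 46 + 32 * t * E) :
    |(-(2 * π * (P + 4398046511104) / 2 ^ 46) + 64 * t * (2 * π)) -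
      (t / 2 * log (t / 2) - t / 2 - π / 8 - t / 2 * log π)| ≤ 1 / 2 := by
  have hx2 : x ≤ 6 / 11 := hx1.trans (by rw [div_le_div_iff₀ (by linarith) (by norm_num)]; linarith)
  have htail : t * (2 * x ^ 5 / ((2 * 2 + 1) * (1 - x ^ 2))) ≤ 0.3 := by
    have h4 : x ^ 2 ≤ (6 / 11) ^ 2 := by gcongr
    norm_num at h4
    have h5 : t * x ^ 5 ≤ 0.5 := by
      have h6 : t * x ^ 5 ≤ t * (12 / (t + 12)) ^ 5 := by gcongr
      refine h6.trans ?_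
      rw [div_pow, mul_div_assoc', div_le_iff₀ (by positivity)]
      have h7 : (22 : ℝ) ^ 3 * (48 * t) ≤ (t + 12) ^ 3 * (t + 12) ^ 2 := by
        apply mul_le_mul
        · gcongr; linarith
        · nlinarith [sq_nonneg (t - 12)]
        · positivity
        · positivity
      linarith
    rw [mul_div_assoc', div_le_iff₀ (by linarith)]
    linarith
  obtain ⟨Δ, hΔ⟩ : ∃ Δ : ℝ, Δ = P - (64 * t * 2 ^ 46 + 32 * t * E) := ⟨_, rfl⟩
  have hΔ1 : -1 ≤ Δ := by linarith
  have hΔ2 : Δ ≤ 0 := by linarith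
  have hP' : P = 64 * t * 2 ^ 46 + 32 * t * E + Δ := by linarith
  rw [Real.log_div (by positivity) (by norm_num)]
  have eall : -(2 * π * (P + 4398046511104) / 2 ^ 46) + 64 * t * (2 * π) -
      (t / 2 * (log t - log 2) - t / 2 - π / 8 - t / 2 * log π) =
      -(t / 2) * (E * (2 * π) / 2 ^ 40 - (1 + log 2 + log π - log t)) - 2 * π * Δ / 2 ^ 46 := by
    rw [hP']; ring
  rw [eall]
  have h1 : |-(t / 2) * (E * (2 * π) / 2 ^ 40 - (1 + log 2 + log π - log t))| ≤
      t / 2 * (0.00010 + 2 * x ^ 5 / ((2 * 2 + 1) * (1 - x ^ 2))) := by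
    rw [abs_mul, abs_neg, abs_of_pos (by linarith : 0 < t / 2)]
    exact mul_le_mul_of_nonneg_left hE (by linarith)
  have h2 : |2 * π * Δ / 2 ^ 46| ≤ 0.01 := by
    have hπ2 := pi_lt_d2
    have := mul_le_mul_of_nonneg_left hΔ1 pi_pos.le
    have := mul_nonpos_of_nonneg_of_nonpos pi_pos.le hΔ2
    rw [abs_le]; constructor
    · rw [le_div_iff₀ (by norm_num)]; linarith
    · rw [div_le_iff₀ (by norm_num)]; linarith
  refine (abs_sub _ _).trans ?_
  linarith

lemma phaseFix_bound {T N lamN : ℕ} (hT : 640 ≤ T) (hT2 : T < 165888) (hN : N = T / 256 + 6)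
    (hl : |(lamN : ℝ) - logScale N| ≤ 720) :
    |(-(2 * π * phaseFix T N lamN / 2 ^ 46) + T * (2 * π)) - ((T / 64 : ℝ) / 2 * log ((T / 64 : ℝ) / 2) -
      (T / 64 : ℝ) / 2 - π / 8 - (T / 64 : ℝ) / 2 * log π)| ≤ 1 / 2 := by
  have hπ1 := pi_gt_d20
  have hπ2 := pi_lt_d20
  have hπ := pi_pos
  obtain ⟨lp1, lp2⟩ := log_pi_bounds
  have hl2 := abs_le.1 Real.log_two_near_10
  have hTr : (640 : ℝ) ≤ T := by exact_mod_cast hT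
  have hTr2 : (T : ℝ) < 165888 := by exact_mod_cast hT2
  have hN1 : 8 ≤ N := by omega
  have hN2 : N ≤ 653 := by omega
  have hNr : (8 : ℝ) ≤ N := by exact_mod_cast hN1
  have hNr2 : (N : ℝ) ≤ 653 := by exact_mod_cast hN2
  have hd1 : T + 1280 < 256 * N := by omega
  have hd2 : 256 * N ≤ T + 1536 := by omega
  have hd1r : (T : ℝ) + 1280 < 256 * N := by exact_mod_cast hd1
  have hd2r : (256 : ℝ) * N ≤ T + 1536 := by exact_mod_cast hd2
  have hlogN : log N ≤ 7 := by
    have h1 : log N ≤ log (2 ^ 10) := Real.log_le_log (by linarith) (by linarith)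
    rw [Real.log_pow] at h1
    push_cast at h1
    linarith [hl2.2]
  obtain ⟨t, ht⟩ : ∃ t : ℝ, t = T / 64 := ⟨_, rfl⟩
  rw [← ht]
  have hT64 : (T : ℝ) = 64 * t := by rw [ht]; ring
  have ht10 : 10 ≤ t := by linarith
  have ht26 : t ≤ 2592 := by linarith
  obtain ⟨x, hx⟩ : ∃ x : ℝ, x = (256 * N - T) / (256 * N + T) := ⟨_, rfl⟩
  have hx0 : 0 ≤ x := by rw [hx]; apply div_nonneg <;> linarith
  have hx1 : x ≤ 12 / (t + 12) := by
    rw [hx, div_le_div_iff₀ (by linarith) (by linarith), hT64]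
    rw [hT64] at hd2r
    nlinarith only [hd2r, ht10]
  have hx2 : x ≤ 6 / 11 := hx1.trans (by rw [div_le_div_iff₀ (by linarith) (by norm_num)]; linarith)
  have hlogt : log ((1 + x) / (1 - x)) = log 4 + log N - log t := by
    rw [← Real.log_mul (by norm_num) (by positivity), ← Real.log_div (by positivity) (by positivity)]
    congr 1
    have h3 : 1 - x ≠ 0 := by linarith
    rw [div_eq_div_iff h3 (by positivity), hx, ht]
    have : (256 * (N : ℝ) + T) ≠ 0 := by positivity
    field_simp
    ring
  have hlog4 : log 4 = 2 * log 2 := by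
    rw [show (4 : ℝ) = 2 ^ 2 by norm_num, Real.log_pow]; norm_num
  have hser := log_div_series_bounds hx0 (by linarith) 2
  rw [hlogt, hlog4] at hser
  simp only [sum_range_succ, sum_range_zero] at hser
  push_cast at hser
  obtain ⟨af, haf⟩ : ∃ af : ℕ, af = (fun xf : ℕ => (349985421095 * (xf + xf * xf * xf / 55340232221128654848)) / 4294967296)
    ((256 * N - T) * 4294967296 / (256 * N + T)) := ⟨_, rfl⟩
  have hphase : phaseFix T N lamN = (T * (141234096155380 + af - lamN - 242591407869)) / 2 + 4398046511104 := by
    rw [haf]; rfl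
  have hA := artanhFix_bounds hx0 hx2 (X := (256 * N - T) * 4294967296) (B := 256 * N + T) (by omega) (by
    rw [hx]; push_cast [Nat.cast_sub (by omega : T ≤ 256 * N)]; ring) rfl haf
  clear haf
  have hscale : logScale N * (2 * π) = 2 ^ 40 * log N := by rw [logScale]; field_simp
  have hl' := abs_le.1 hl
  have hlam : (lamN : ℝ) ≤ 1500000000000 := by
    have h2 : logScale N ≤ 1400000000000 := by
      rw [logScale, div_le_iff₀ (by positivity)]
      linarith
    linarith
  have hlam' : lamN ≤ 1500000000000 := by exact_mod_cast hlam
  obtain ⟨F, hF⟩ : ∃ F : ℕ, F = 141234096155380 + af - lamN - 242591407869 := ⟨_, rfl⟩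
  have hFr : (F : ℝ) = 2 ^ 47 + (496607800052 + af - lamN - 242591407869) := by
    have h1 : F + lamN + 242591407869 = 141234096155380 + af := by omega
    have h2 : (F : ℝ) + lamN + 242591407869 = 141234096155380 + af := by exact_mod_cast h1
    linarith only [h2]
  rw [hphase, ← hF]
  have bp := natCast_div_bounds (T * F) (b := 2) (by norm_num)
  rw [Nat.cast_add]
  generalize ((T * F / 2 : ℕ) : ℝ) = P at bp ⊢
  rw [Nat.cast_mul, hFr, hT64] at bp
  obtain ⟨E, hEd⟩ : ∃ E : ℝ, E = 496607800052 + af - lamN - 242591407869 := ⟨_, rfl⟩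
  rw [← hEd] at bp
  push_cast at bp ⊢
  rw [hT64]
  refine phase_error_le (E := E) ht10 ht26 hx0 hx1 ?_ (by linarith only [bp.1]) (by linarith only [bp.2])
  have hl1 : (lamN : ℝ) * (2 * π) ≤ (logScale N + 720) * (2 * π) := by
    apply mul_le_mul_of_nonneg_right _ (by positivity); linarith only [hl'.2]
  have hl2 : (logScale N - 720) * (2 * π) ≤ (lamN : ℝ) * (2 * π) := by
    apply mul_le_mul_of_nonneg_right _ (by positivity); linarith only [hl'.1]
  obtain ⟨e, he⟩ : ∃ e : ℝ, e = 2 * x ^ 5 / ((2 * 2 + 1) * (1 - x ^ 2)) := ⟨_, rfl⟩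
  rw [← he] at hser ⊢
  have hs1 := hser.1
  have hs2 := hser.2
  norm_num at hs1 hs2
  have hA' := abs_le.1 hA
  rw [hEd, abs_le]
  constructor
  · rw [neg_le_sub_iff_le_add, ← sub_le_iff_le_add, le_div_iff₀ (by norm_num)]
    linarith [hA'.1, hA'.2]
  · rw [sub_le_iff_le_add, div_le_iff₀ (by norm_num)]
    linarith [hA'.1, hA'.2]

/-- A pair of integers as a complex number. -/
def gaussCast (a : ℤ × ℤ) : ℂ := a.1 + a.2 * Complex.I

lemma gaussCast_mul (a b : ℤ × ℤ) : gaussCast (gaussMul a b) = gaussCast a * gaussCast b := by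
  simp only [gaussCast, gaussMul]
  push_cast
  linear_combination (-(a.2 : ℂ) * b.2) * Complex.I_sq

lemma gaussCast_hornerStep {T M j d : ℤ} {H : ℤ × ℤ} {e : ℕ} {D β h u v : ℂ} (he : 16 - 2 * j.toNat = e + 2)
    (hH : gaussCast H = D * (M : ℂ) ^ e * h) (hd : (d : ℂ) = D * β)
    (hu : ((64 * (2 * j - 1) + 32 : ℤ) : ℂ) + T * Complex.I = M * u)
    (hv : ((64 * (2 * j) + 32 : ℤ) : ℂ) + T * Complex.I = M * v) :
    gaussCast (hornerStep T M j d H) = D * (M : ℂ) ^ (e + 2) * (β + u * v * h) := by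
  have e1 : gaussCast (hornerStep T M j d H) =
      gaussCast (gaussMul (gaussMul (64 * (2 * j - 1) + 32, T) (64 * (2 * j) + 32, T)) H) +
        ((d * M ^ (16 - 2 * j.toNat) : ℤ) : ℂ) := by
    simp only [hornerStep, gaussCast]
    push_cast
    ring
  have h1 : gaussCast (64 * (2 * j - 1) + 32, T) = M * u := hu
  have h2 : gaussCast (64 * (2 * j) + 32, T) = M * v := hv
  rw [e1, gaussCast_mul, gaussCast_mul, h1, h2, hH, he]
  push_cast
  rw [hd]
  ring

lemma emBoundary_sixteen {s : ℂ} {x : ℝ} (hx : 0 < x) : emBoundary 16 s x = (x : ℂ) ^ (-s) *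
    (x / (s - 1) - 1 / 2 + s / x * (1 / 12 + (s + 1) / x * ((s + 2) / x) * (-1 / 720 + (s + 3) / x * ((s + 4) / x) *
      (1 / 30240 + (s + 5) / x * ((s + 6) / x) * (-1 / 1209600 + (s + 7) / x * ((s + 8) / x) * (1 / 47900160 +
      (s + 9) / x * ((s + 10) / x) * (-691 / 1307674368000 + (s + 11) / x * ((s + 12) / x) * (1 / 74724249600 +
      (s + 13) / x * ((s + 14) / x) * (-3617 / 10670622842880000))))))))) := by
  have hxc : (x : ℂ) ≠ 0 := by exact_mod_cast hx.ne'
  have odd : ∀ k, 1 < k → Odd k → bernoulliDiv k 0 = 0 := fun k h1 h2 => by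
    rw [bernoulliDiv, bernoulliFun_eval_zero, bernoulli_eq_bernoulli'_of_ne_one (by omega), bernoulli'_eq_zero_of_odd h2 h1]
    simp
  obtain ⟨b2, b4, b6, b8, b10, b12, b14, b16⟩ := bernoulli_even_values
  have hb : ∀ k, bernoulliDiv k 0 = (bernoulli k : ℝ) / k.factorial := fun k => by
    rw [bernoulliDiv, bernoulliFun_eval_zero]
  have v1 : bernoulliDiv 1 0 = -1 / 2 := by rw [hb, bernoulli_one]; norm_num
  have v2 : bernoulliDiv 2 0 = 1 / 12 := by rw [hb, b2]; norm_num [Nat.factorial]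
  have v4 : bernoulliDiv 4 0 = -1 / 720 := by rw [hb, b4]; norm_num [Nat.factorial]
  have v6 : bernoulliDiv 6 0 = 1 / 30240 := by rw [hb, b6]; norm_num [Nat.factorial]
  have v8 : bernoulliDiv 8 0 = -1 / 1209600 := by rw [hb, b8]; norm_num [Nat.factorial]
  have v10 : bernoulliDiv 10 0 = 1 / 47900160 := by rw [hb, b10]; norm_num [Nat.factorial]
  have v12 : bernoulliDiv 12 0 = -691 / 1307674368000 := by rw [hb, b12]; norm_num [Nat.factorial]
  have v14 : bernoulliDiv 14 0 = 1 / 74724249600 := by rw [hb, b14]; norm_num [Nat.factorial]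
  have v16 : bernoulliDiv 16 0 = -3617 / 10670622842880000 := by rw [hb, b16]; norm_num [Nat.factorial]
  have hpow : ∀ k : ℕ, (x : ℂ) ^ (-s - k) = (x : ℂ) ^ (-s) * ((x : ℂ)⁻¹) ^ k := fun k => by
    rw [Complex.cpow_sub _ _ hxc, Complex.cpow_natCast, div_eq_mul_inv, inv_pow]
  have hpow1 : (x : ℂ) ^ (1 - s) = (x : ℂ) ^ (-s) * x := by
    rw [sub_eq_neg_add, Complex.cpow_add _ _ hxc, Complex.cpow_one]
  rw [emBoundary, hpow1]
  simp only [hpow, sum_range_succ, sum_range_zero, ascPochhammer_succ_eval, ascPochhammer_zero, Polynomial.eval_one,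
    v1, v2, v4, v6, v8, v10, v12, v14, v16, odd 3 (by norm_num) (by decide), odd 5 (by norm_num) (by decide),
    odd 7 (by norm_num) (by decide), odd 9 (by norm_num) (by decide), odd 11 (by norm_num) (by decide),
    odd 13 (by norm_num) (by decide), odd 15 (by norm_num) (by decide), Complex.ofReal_zero, mul_zero, zero_mul,
    Nat.reduceAdd, zero_add, add_zero, one_mul, div_eq_mul_inv]
  generalize (x : ℂ)⁻¹ = y
  push_cast
  ring

end PhaseAndBoundary

section Evaluation

lemma gaussCast_hornerSum {T N : ℕ} (hN : 0 < N) {s : ℂ} (hs : s = 1 / 2 + ((T / 64 : ℝ) : ℂ) * Complex.I) :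
    gaussCast (hornerSum T (64 * N : ℕ)) = 10670622842880000 * ((64 * N : ℕ) : ℂ) ^ 15 * (s / N * (1 / 12 +
      (s + 1) / N * ((s + 2) / N) * (-1 / 720 + (s + 3) / N * ((s + 4) / N) *
      (1 / 30240 + (s + 5) / N * ((s + 6) / N) * (-1 / 1209600 + (s + 7) / N * ((s + 8) / N) * (1 / 47900160 +
      (s + 9) / N * ((s + 10) / N) * (-691 / 1307674368000 + (s + 11) / N * ((s + 12) / N) * (1 / 74724249600 +
      (s + 13) / N * ((s + 14) / N) * (-3617 / 10670622842880000))))))))) := by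
  have hNc : (N : ℂ) ≠ 0 := by exact_mod_cast hN.ne'
  have hu : ∀ a b : ℤ, a = 64 * b + 32 → ((a : ℤ) : ℂ) + ((T : ℤ) : ℂ) * Complex.I = (((64 * N : ℕ) : ℤ) : ℂ) * ((s + b) / N) := by
    intro a b hab
    rw [hs, hab]
    push_cast
    field_simp
    ring
  have h8 : gaussCast (-3617, 0) = 10670622842880000 * (((64 * N : ℕ) : ℤ) : ℂ) ^ 0 * (-3617 / 10670622842880000) := by
    norm_num [gaussCast]
  have h7 := gaussCast_hornerStep (T := T) (M := (64 * N : ℕ)) (j := 7) (d := 142800) (by decide) h8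
    (β := 1 / 74724249600) (by norm_num) (hu _ 13 (by norm_num)) (hu _ 14 (by norm_num))
  have h6 := gaussCast_hornerStep (T := T) (M := (64 * N : ℕ)) (j := 6) (d := -5638560) (by decide) h7
    (β := -691 / 1307674368000) (by norm_num) (hu _ 11 (by norm_num)) (hu _ 12 (by norm_num))
  have h5 := gaussCast_hornerStep (T := T) (M := (64 * N : ℕ)) (j := 5) (d := 222768000) (by decide) h6
    (β := 1 / 47900160) (by norm_num) (hu _ 9 (by norm_num)) (hu _ 10 (by norm_num))
  have h4 := gaussCast_hornerStep (T := T) (M := (64 * N : ℕ)) (j := 4) (d := -8821612800) (by decide) h5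
    (β := -1 / 1209600) (by norm_num) (hu _ 7 (by norm_num)) (hu _ 8 (by norm_num))
  have h3 := gaussCast_hornerStep (T := T) (M := (64 * N : ℕ)) (j := 3) (d := 352864512000) (by decide) h4
    (β := 1 / 30240) (by norm_num) (hu _ 5 (by norm_num)) (hu _ 6 (by norm_num))
  have h2 := gaussCast_hornerStep (T := T) (M := (64 * N : ℕ)) (j := 2) (d := -14820309504000) (by decide) h3
    (β := -1 / 720) (by norm_num) (hu _ 3 (by norm_num)) (hu _ 4 (by norm_num))
  have h1 := gaussCast_hornerStep (T := T) (M := (64 * N : ℕ)) (j := 1) (d := 889218570240000) (by decide) h2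
    (β := 1 / 12) (by norm_num) (hu _ 1 (by norm_num)) (hu _ 2 (by norm_num))
  have h0 : gaussCast (32, (T : ℤ)) = (((64 * N : ℕ) : ℤ) : ℂ) * (s / N) := by
    have := hu 32 0 (by norm_num)
    simpa [gaussCast] using this
  rw [hornerSum, gaussCast_mul, h1, h0]
  generalize s / (N : ℂ) = w
  push_cast
  ring

lemma emBoundary_eq_boundaryFix {T N : ℕ} (hT : 0 < T) (hN : 0 < N) {s : ℂ}
    (hs : s = 1 / 2 + ((T / 64 : ℝ) : ℂ) * Complex.I) :
    ∃ A : ℂ, emBoundary 16 s N + (N : ℂ) ^ (-s) = (N : ℂ) ^ (-s) * A ∧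
      |A.re - ((boundaryFix T (64 * N : ℕ)).1 : ℝ) / 2 ^ 20| ≤ 1 / 2 ^ 20 ∧
      |A.im - ((boundaryFix T (64 * N : ℕ)).2 : ℝ) / 2 ^ 20| ≤ 1 / 2 ^ 20 := by
  have hNr : (0 : ℝ) < N := by exact_mod_cast hN
  have hNc : (N : ℂ) ≠ 0 := by exact_mod_cast hN.ne'
  have hTr : (0 : ℝ) < T := by exact_mod_cast hT
  have hb := emBoundary_sixteen (s := s) hNr
  have hH := gaussCast_hornerSum (T := T) hN hs
  rw [Complex.ofReal_natCast] at hb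
  generalize (s / (N : ℂ) * (1 / 12 + (s + 1) / N * ((s + 2) / N) * (-1 / 720 + (s + 3) / N * ((s + 4) / N) *
      (1 / 30240 + (s + 5) / N * ((s + 6) / N) * (-1 / 1209600 + (s + 7) / N * ((s + 8) / N) * (1 / 47900160 +
      (s + 9) / N * ((s + 10) / N) * (-691 / 1307674368000 + (s + 11) / N * ((s + 12) / N) * (1 / 74724249600 +
      (s + 13) / N * ((s + 14) / N) * (-3617 / 10670622842880000))))))))) = B at hb hH
  obtain ⟨H, hHd⟩ : ∃ H, H = hornerSum T (64 * N : ℕ) := ⟨_, rfl⟩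
  obtain ⟨M, hM⟩ : ∃ M : ℕ, M = 64 * N := ⟨_, rfl⟩
  have hM0 : 0 < M := by omega
  have hMr : (M : ℝ) = 64 * N := by rw [hM]; push_cast; rfl
  obtain ⟨Q, hQ⟩ : ∃ Q : ℤ, Q = 10670622842880000 * (M : ℤ) ^ 15 := ⟨_, rfl⟩
  obtain ⟨E, hE⟩ : ∃ E : ℤ, E = 1024 + (T : ℤ) * T := ⟨_, rfl⟩
  have hQ0 : 0 < Q := by rw [hQ]; positivity
  have hE0 : 0 < E := by rw [hE]; positivity
  have hQr : (0 : ℝ) < Q := by exact_mod_cast hQ0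
  have hEr : (0 : ℝ) < E := by exact_mod_cast hE0
  have hEr' : (E : ℝ) = 1024 + T * T := by rw [hE]; push_cast; rfl
  have hfix : boundaryFix T (64 * N : ℕ) = (1048576 * (H.1 * E - 32 * M * Q) / (Q * E) + 524288,
      1048576 * (H.2 * E - T * M * Q) / (Q * E)) := by
    rw [hHd, hE, hQ, hM]; rfl
  rw [← hHd, ← hM] at hH
  have hBH : B = ((H.1 / Q : ℝ) : ℂ) + ((H.2 / Q : ℝ) : ℂ) * Complex.I := by
    have hQc : (Q : ℂ) ≠ 0 := by exact_mod_cast hQ0.ne'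
    have h1 : (H.1 : ℂ) + H.2 * Complex.I = Q * B := by
      rw [hQ]; push_cast; exact hH
    push_cast
    field_simp
    linear_combination (-1 : ℂ) * h1
  have hs1 : s - 1 = ((-32 : ℝ) + (T : ℝ) * Complex.I) / 64 := by rw [hs]; push_cast; ring
  have hfrac : (N : ℂ) / (s - 1) = ((-32 * M / E : ℝ) : ℂ) + ((-(T * M / E) : ℝ) : ℂ) * Complex.I := by
    have hEc : (E : ℂ) ≠ 0 := by exact_mod_cast hE0.ne'
    have hEc' : (E : ℂ) = 1024 + (T : ℂ) * T := by rw [hE]; push_cast; rfl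
    have hne : s - 1 ≠ 0 := by
      intro h
      have := congrArg Complex.re h
      rw [hs] at this
      norm_num at this
    rw [div_eq_iff hne, hs1, hM]
    push_cast
    field_simp
    linear_combination hEc' + (T : ℂ) ^ 2 * Complex.I_sq
  refine ⟨N / (s - 1) + 1 / 2 + B, ?_, ?_, ?_⟩
  · rw [hb]; ring
  · have hre : (N / (s - 1) + 1 / 2 + B : ℂ).re = -32 * M / E + 1 / 2 + H.1 / Q := by
      rw [hfrac, hBH]; simp
    have hd := intCast_div_bounds (1048576 * (H.1 * E - 32 * M * Q)) (b := Q * E) (by positivity)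
    have e1 : ((1048576 * (H.1 * E - 32 * M * Q) : ℤ) : ℝ) / ((Q * E : ℤ) : ℝ) = 1048576 * (-32 * M / E + H.1 / Q) := by
      push_cast
      field_simp
      ring
    rw [e1] at hd
    rw [hre, hfix]
    push_cast
    rw [abs_le]
    constructor <;> linarith [hd.1, hd.2]
  · have him : (N / (s - 1) + 1 / 2 + B : ℂ).im = -(T * M / E) + H.2 / Q := by
      rw [hfrac, hBH]; simp
    have hd := intCast_div_bounds (1048576 * (H.2 * E - T * M * Q)) (b := Q * E) (by positivity)
    have e1 : ((1048576 * (H.2 * E - T * M * Q) : ℤ) : ℝ) / ((Q * E : ℤ) : ℝ) = 1048576 * (-(T * M / E) + H.2 / Q) := by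
      push_cast
      field_simp
      ring
    rw [e1] at hd
    rw [him, hfix]
    rw [abs_le]
    constructor <;> linarith [hd.1, hd.2]

lemma listSum_eq (f : ℕ × ℕ → ℕ) (l : List (ℕ × ℕ)) (m : ℕ) (hm : m ≤ l.length) :
    listSum f l m = ∑ i ∈ range m, f (entry l i) := by
  induction l generalizing m with
  | nil => rw [Nat.le_zero.1 hm]; rfl
  | cons w l ih =>
    rcases m with _ | m
    · rfl
    · rw [sum_range_succ', show listSum f (w :: l) (m + 1) = f w + listSum f l m from rfl,
        ih m (by simpa using hm), add_comm]
      rfl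

lemma sum_one_div_sqrt_le (m : ℕ) : ∑ i ∈ range m, 1 / √((i + 1 : ℕ) : ℝ) ≤ 2 * √m := by
  induction m with
  | zero => simp
  | succ m ih =>
    rw [sum_range_succ]
    have h1 : (0 : ℝ) < √((m + 1 : ℕ) : ℝ) := Real.sqrt_pos.2 (by positivity)
    have h2 : 1 / √((m + 1 : ℕ) : ℝ) ≤ 2 * √((m + 1 : ℕ) : ℝ) - 2 * √m := by
      rw [div_le_iff₀ h1]
      have e1 := Real.mul_self_sqrt (Nat.cast_nonneg (α := ℝ) (m + 1))
      have e2 := Real.mul_self_sqrt (Nat.cast_nonneg (α := ℝ) m)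
      push_cast at *
      nlinarith [sq_nonneg (√((m : ℝ) + 1) - √m)]
    linarith

lemma exp_mul_natCast_cpow {n : ℕ} (hn : 0 < n) (Θ t : ℝ) :
    Complex.exp (Θ * Complex.I) * (n : ℂ) ^ (-(1 / 2 + (t : ℂ) * Complex.I)) =
      ((1 / √(n : ℝ) : ℝ) : ℂ) * Complex.exp ((-(t * log n - Θ) : ℝ) * Complex.I) := by
  have hn0 : (0 : ℝ) < n := by exact_mod_cast hn
  have h1 : 1 / √(n : ℝ) = exp (-(1 / 2) * log n) := by
    rw [Real.sqrt_eq_rpow, one_div, ← Real.rpow_neg hn0.le, Real.rpow_def_of_pos hn0]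
    congr 1; ring
  rw [h1, Complex.cpow_def_of_ne_zero (by exact_mod_cast hn.ne'), ← Complex.ofReal_natCast, ← Complex.ofReal_log hn0.le,
    Complex.ofReal_exp, ← Complex.exp_add, ← Complex.exp_add]
  congr 1
  push_cast
  ring

/-- The phase of the `n`-th term of the rotated Dirichlet series, in fixed point. -/
lemma cosFix_phase_bounds {T Φ i : ℕ} (hT : T < 165888) (hi : i < 656) {u : ℝ}
    (hu : u = (T / 64 : ℝ) * log (i + 1 : ℕ) + 2 * π * Φ / 2 ^ 46) :
    |(cosFix (Φ + T * (entry logTable i).1) : ℝ) / 2 ^ 56 - 1 - Real.cos u| ≤ 0.000103 ∧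
    |(cosFix (Φ + T * (entry logTable i).1 + 52776558133248) : ℝ) / 2 ^ 56 - 1 - Real.sin u| ≤ 0.000103 := by
  obtain ⟨hl, -⟩ := logTable_spec hi
  generalize (entry logTable i).1 = lam at hl ⊢
  obtain ⟨w, hw⟩ : ∃ w : ℝ, w = 2 * π * ((Φ + T * lam : ℕ) : ℝ) / 2 ^ 46 := ⟨_, rfl⟩
  have hTr : (T : ℝ) ≤ 165888 := by exact_mod_cast hT.le
  have hπ := pi_pos
  have hwu : |w - u| ≤ 0.000011 := by
    have e : w - u = 2 * π * T / 2 ^ 46 * (lam - logScale (i + 1)) := by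
      rw [hw, hu, logScale]; push_cast; field_simp; ring
    rw [e, abs_mul, abs_of_nonneg (by positivity)]
    have h1 : 2 * π * T / 2 ^ 46 ≤ 2 * 3.15 * 165888 / 2 ^ 46 := by
      have := pi_lt_d2
      gcongr
    exact (mul_le_mul h1 hl (abs_nonneg _) (by norm_num)).trans (by norm_num)
  have h1 := cosFix_bound (Φ + T * lam)
  have h2 := cosFix_bound (Φ + T * lam + 52776558133248)
  have e2 : 2 * π * ((Φ + T * lam + 52776558133248 : ℕ) : ℝ) / 2 ^ 46 = w - π / 2 + 2 * π := by
    rw [hw]; push_cast; ring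
  rw [← hw] at h1
  rw [e2, Real.cos_add_two_pi, Real.cos_sub_pi_div_two] at h2
  have h3 := (Real.abs_cos_sub_cos_le w u).trans hwu
  have h4 := (Real.abs_sin_sub_sin_le w u).trans hwu
  generalize (cosFix (Φ + T * lam) : ℝ) / 2 ^ 56 - 1 = x at h1 ⊢
  generalize (cosFix (Φ + T * lam + 52776558133248) : ℝ) / 2 ^ 56 - 1 = y at h2 ⊢
  rw [abs_le] at h1 h2 h3 h4 ⊢
  rw [abs_le]
  refine ⟨⟨?_, ?_⟩, ?_, ?_⟩ <;> linarith [h1.1, h1.2, h2.1, h2.2, h3.1, h3.2, h4.1, h4.2]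

lemma abs_mul_sub_mul_le {r a x c ε δ C : ℝ} (hr : 0 ≤ r) (hra : r ≤ a) (har : a ≤ r + δ) (hxc : |x - c| ≤ ε) (hc : |c| ≤ C) :
    |r * x - a * c| ≤ a * ε + δ * C := by
  have e : r * x - a * c = r * (x - c) + (r - a) * c := by ring
  rw [e]
  refine (abs_add_le _ _).trans ?_
  rw [abs_mul, abs_mul, abs_of_nonneg hr, abs_of_nonpos (by linarith : r - a ≤ 0)]
  have h1 : r * |x - c| ≤ a * ε := mul_le_mul hra hxc (abs_nonneg _) (hr.trans hra)
  have h2 : -(r - a) * |c| ≤ δ * C := mul_le_mul (by linarith) hc (abs_nonneg _) (by linarith)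
  linarith

lemma main_sum_bound {T Φ m : ℕ} (hT : T < 165888) (hm : m ≤ 652) :
    |((listSum (fun p => Nat.mul p.2 (cosFix (Nat.add Φ (Nat.mul T p.1)))) logTable m : ℕ) : ℝ) / 2 ^ 76 -
        ((listSum (fun p => p.2) logTable m : ℕ) : ℝ) / 2 ^ 20 -
      ∑ i ∈ range m, 1 / √((i + 1 : ℕ) : ℝ) *
        Real.cos ((T / 64 : ℝ) * log (i + 1 : ℕ) + 2 * π * Φ / 2 ^ 46)| ≤ 0.006 := by
  have hlen : m ≤ logTable.length := by rw [logTable_length]; omega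
  rw [listSum_eq _ _ _ hlen, listSum_eq _ _ _ hlen]
  push_cast
  rw [sum_div, sum_div, ← sum_sub_distrib, ← sum_sub_distrib]
  refine (Finset.abs_sum_le_sum_abs _ _).trans ?_
  have hterm : ∀ i ∈ range m, |((Nat.mul (entry logTable i).2 (cosFix (Nat.add Φ (Nat.mul T (entry logTable i).1))) : ℕ) : ℝ) / 2 ^ 76 -
      ((entry logTable i).2 : ℝ) / 2 ^ 20 - 1 / √((i : ℝ) + 1) *
        Real.cos ((T / 64 : ℝ) * log ((i : ℝ) + 1) + 2 * π * Φ / 2 ^ 46)| ≤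
      1 / √((i + 1 : ℕ) : ℝ) * 0.000103 + 1 / 2 ^ 20 * 1 := by
    intro i hi
    have hi' : i < 656 := by have := Finset.mem_range.1 hi; omega
    obtain ⟨-, hr1, hr2⟩ := logTable_spec hi'
    obtain ⟨hc, -⟩ := cosFix_phase_bounds (Φ := Φ) hT hi' rfl
    have h := abs_mul_sub_mul_le (r := ((entry logTable i).2 : ℝ) / 2 ^ 20) (by positivity) hr1 hr2 hc (Real.abs_cos_le_one _)
    refine le_trans (le_of_eq ?_) h
    congr 1
    have e : ((Nat.mul (entry logTable i).2 (cosFix (Nat.add Φ (Nat.mul T (entry logTable i).1))) : ℕ) : ℝ) =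
        ((entry logTable i).2 : ℝ) * (cosFix (Φ + T * (entry logTable i).1) : ℝ) := Nat.cast_mul _ _
    rw [e]
    push_cast
    ring
  refine (sum_le_sum hterm).trans ?_
  rw [sum_add_distrib, ← sum_mul, sum_const, Finset.card_range, nsmul_eq_mul]
  have h1 := sum_one_div_sqrt_le m
  have hmr : (m : ℝ) ≤ 652 := by exact_mod_cast hm
  have h2 : √(m : ℝ) ≤ 25.6 := by
    rw [Real.sqrt_le_left (by norm_num)]
    norm_num
    linarith
  linarith

lemma tail_bound {T Φ i : ℕ} (hT : T < 165888) (hi : i < 656) (hi7 : 7 ≤ i) {A : ℂ} {a b : ℝ} (ha : |A.re - a| ≤ 1 / 2 ^ 20)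
    (hb : |A.im - b| ≤ 1 / 2 ^ 20) (ha2 : |a| ≤ 2) (hb2 : |b| ≤ 2) {u : ℝ}
    (hu : u = (T / 64 : ℝ) * log (i + 1 : ℕ) + 2 * π * Φ / 2 ^ 46) :
    |((entry logTable i).2 : ℝ) / 2 ^ 20 * (((cosFix (Φ + T * (entry logTable i).1) : ℝ) / 2 ^ 56 - 1) * a +
        ((cosFix (Φ + T * (entry logTable i).1 + 52776558133248) : ℝ) / 2 ^ 56 - 1) * b) -
      1 / √((i + 1 : ℕ) : ℝ) * (Real.cos u * A.re + Real.sin u * A.im)| ≤ 0.0003 := by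
  obtain ⟨-, hr1, hr2⟩ := logTable_spec hi
  obtain ⟨hc, hs⟩ := cosFix_phase_bounds (Φ := Φ) hT hi hu
  generalize (cosFix (Φ + T * (entry logTable i).1) : ℝ) / 2 ^ 56 - 1 = x at hc ⊢
  generalize (cosFix (Φ + T * (entry logTable i).1 + 52776558133248) : ℝ) / 2 ^ 56 - 1 = y at hs ⊢
  have hcu := Real.abs_cos_le_one u
  have hsu := Real.abs_sin_le_one u
  have prod : ∀ {x c a A : ℝ}, |x - c| ≤ 0.000103 → |c| ≤ 1 → |A - a| ≤ 1 / 2 ^ 20 → |a| ≤ 2 →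
      |x * a - c * A| ≤ 0.00021 ∧ |c * A| ≤ 2.1 := by
    intro x c a A h1 h2 h3 h4
    have hA : |A| ≤ 2.1 := by
      have := abs_add_le (A - a) a
      rw [sub_add_cancel] at this
      norm_num at h3 ⊢
      linarith
    refine ⟨?_, ?_⟩
    · have e : x * a - c * A = (x - c) * a - c * (A - a) := by ring
      rw [e]
      refine (abs_sub _ _).trans ?_
      rw [abs_mul, abs_mul]
      have m1 := mul_le_mul h1 h4 (abs_nonneg _) (by norm_num)
      have m2 := mul_le_mul h2 h3 (abs_nonneg _) zero_le_one
      norm_num at *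
      linarith
    · rw [abs_mul]
      have := mul_le_mul h2 hA (abs_nonneg _) zero_le_one
      linarith
  obtain ⟨p1, p2⟩ := prod hc hcu ha ha2
  obtain ⟨q1, q2⟩ := prod hs hsu hb hb2
  have hX : |(x * a + y * b) - (Real.cos u * A.re + Real.sin u * A.im)| ≤ 0.00042 := by
    have := abs_add_le (x * a - Real.cos u * A.re) (y * b - Real.sin u * A.im)
    rw [add_sub_add_comm]
    norm_num at *
    linarith
  have hC : |Real.cos u * A.re + Real.sin u * A.im| ≤ 4.2 := by
    refine (abs_add_le _ _).trans ?_
    linarith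
  have h := abs_mul_sub_mul_le (r := ((entry logTable i).2 : ℝ) / 2 ^ 20) (by positivity) hr1 hr2 hX hC
  refine h.trans ?_
  have h8 : 1 / √((i + 1 : ℕ) : ℝ) ≤ 1 / 2 := by
    apply one_div_le_one_div_of_le (by norm_num)
    apply Real.le_sqrt_of_sq_le
    have : (8 : ℝ) ≤ ((i + 1 : ℕ) : ℝ) := by exact_mod_cast (by omega : 8 ≤ i + 1)
    linarith
  norm_num at *
  linarith

end Evaluation

section Signs

lemma re_ofReal_mul_exp_mul (a u : ℝ) (A : ℂ) :
    ((a : ℂ) * Complex.exp ((-u : ℝ) * Complex.I) * A).re = a * (Real.cos u * A.re + Real.sin u * A.im) := by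
  rw [mul_assoc, Complex.re_ofReal_mul, Complex.mul_re, Complex.exp_ofReal_mul_I_re, Complex.exp_ofReal_mul_I_im,
    Real.cos_neg, Real.sin_neg]
  ring

lemma zetaFix_eq (T i Φ : ℕ) (A : ℤ × ℤ) (hi : i = T / 256 + 5) (hΦ : Φ = phaseFix T (i + 1) (entry logTable i).1)
    (hA : A = boundaryFix T (64 * (i + 1) : ℕ)) :
    zetaFix T = (A.1, A.2,
      1048576 * ((listSum (fun p => Nat.mul p.2 (cosFix (Nat.add Φ (Nat.mul T p.1)))) logTable i : ℕ) -
        (72057594037927936 * listSum (fun p => p.2) logTable i : ℕ) : ℤ) +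
      ((entry logTable i).2 : ℤ) * (((cosFix (Φ + T * (entry logTable i).1) : ℤ) - 72057594037927936) * A.1 +
        ((cosFix (Φ + T * (entry logTable i).1 + 52776558133248) : ℤ) - 72057594037927936) * A.2)) := by
  rw [hA, hΦ, hi]
  rfl

lemma height_sq_le {T N : ℕ} (h : T + 1280 < 256 * N) : (T / 64 : ℝ) ^ 2 + 481 / 4 ≤ 16 * (N : ℝ) ^ 2 := by
  have hr : (T : ℝ) + 1280 < 256 * (N : ℝ) := by exact_mod_cast h
  have hT0 : (0 : ℝ) ≤ T := Nat.cast_nonneg T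
  nlinarith

/-- The fixed point value is close to the real part of a rotation of `ζ`. -/
lemma zetaFix_bound {T : ℕ} (hT : 640 ≤ T) (hT2 : T < 165888) (h1 : (zetaFix T).1.natAbs ≤ 2097152)
    (h2 : (zetaFix T).2.1.natAbs ≤ 2097152) :
    ∃ Θ : ℝ, |Θ - ((T / 64 : ℝ) / 2 * log ((T / 64 : ℝ) / 2) - (T / 64 : ℝ) / 2 - π / 8 -
        (T / 64 : ℝ) / 2 * log π)| ≤ 1 / 2 ∧
      |((zetaFix T).2.2 : ℝ) / 2 ^ 96 - (Complex.exp (Θ * Complex.I) *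
        riemannZeta (1 / 2 + ((T / 64 : ℝ) : ℂ) * Complex.I)).re| ≤ 0.009 := by
  obtain ⟨i, hi⟩ : ∃ i, i = T / 256 + 5 := ⟨_, rfl⟩
  obtain ⟨Φ, hΦ⟩ : ∃ Φ, Φ = phaseFix T (i + 1) (entry logTable i).1 := ⟨_, rfl⟩
  obtain ⟨A', hA'⟩ : ∃ A', A' = boundaryFix T (64 * (i + 1) : ℕ) := ⟨_, rfl⟩
  have hZ := zetaFix_eq T i Φ A' hi hΦ hA'
  have hi656 : i < 656 := by omega
  have hphase := phaseFix_bound hT hT2 (N := i + 1) (by omega) (logTable_spec hi656).1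
  rw [← hΦ] at hphase
  obtain ⟨s, hs⟩ : ∃ s : ℂ, s = 1 / 2 + ((T / 64 : ℝ) : ℂ) * Complex.I := ⟨_, rfl⟩
  obtain ⟨A, hA1, hA2, hA3⟩ := emBoundary_eq_boundaryFix (T := T) (N := i + 1) (by omega) (by omega) hs
  rw [← hA'] at hA2 hA3
  rw [hZ] at h1 h2 ⊢
  clear hΦ hA' hZ
  simp only at h1 h2 ⊢
  refine ⟨_, hphase, ?_⟩
  obtain ⟨Θ, hΘ⟩ : ∃ Θ : ℝ, Θ = -(2 * π * Φ / 2 ^ 46) := ⟨_, rfl⟩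
  have hexp : Complex.exp (((-(2 * π * Φ / 2 ^ 46) + T * (2 * π) : ℝ) : ℂ) * Complex.I) = Complex.exp (Θ * Complex.I) := by
    rw [← hΘ]
    push_cast
    rw [add_mul, mul_assoc (T : ℂ)]
    exact Complex.exp_periodic.nat_mul T _
  rw [hexp, ← hs]
  have hN : (1 : ℕ) ≤ i + 1 := by omega
  have hTr : (640 : ℝ) ≤ T := by exact_mod_cast hT
  have hem := norm_zeta_sub_emApprox_half_le (t := T / 64) (by linarith) hN (by omega)
    (height_sq_le (by omega))
  rw [← hs] at hem
  have hre1 : |(Complex.exp (Θ * Complex.I) * riemannZeta s).re - (Complex.exp (Θ * Complex.I) * emApprox 16 s (i + 1)).re| ≤ 26 / 10000 := by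
    rw [← Complex.sub_re, ← mul_sub]
    refine (Complex.abs_re_le_norm _).trans ?_
    rw [norm_mul, Complex.norm_exp_ofReal_mul_I, one_mul]
    exact hem
  have hu : ∀ j : ℕ, (T / 64 : ℝ) * log (j + 1 : ℕ) - Θ = (T / 64 : ℝ) * log (j + 1 : ℕ) + 2 * π * Φ / 2 ^ 46 := by
    intro j; rw [hΘ]; ring
  have hpow : ∀ j : ℕ, Complex.exp (Θ * Complex.I) * ((j + 1 : ℕ) : ℂ) ^ (-s) = ((1 / √((j + 1 : ℕ) : ℝ) : ℝ) : ℂ) *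
      Complex.exp ((-((T / 64 : ℝ) * log (j + 1 : ℕ) + 2 * π * Φ / 2 ^ 46) : ℝ) * Complex.I) := by
    intro j
    rw [hs, exp_mul_natCast_cpow (by omega), hu]
  have hem2 : (Complex.exp (Θ * Complex.I) * emApprox 16 s (i + 1)).re =
      ∑ j ∈ range i, 1 / √((j + 1 : ℕ) : ℝ) *
        Real.cos ((T / 64 : ℝ) * log (j + 1 : ℕ) + 2 * π * Φ / 2 ^ 46) +
      1 / √((i + 1 : ℕ) : ℝ) * (Real.cos ((T / 64 : ℝ) * log (i + 1 : ℕ) + 2 * π * Φ / 2 ^ 46) * A.re +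
        Real.sin ((T / 64 : ℝ) * log (i + 1 : ℕ) + 2 * π * Φ / 2 ^ 46) * A.im) := by
    have e1 : emApprox 16 s (i + 1) = ∑ j ∈ range i, ((j + 1 : ℕ) : ℂ) ^ (-s) + ((i + 1 : ℕ) : ℂ) ^ (-s) * A := by
      rw [← hA1, emApprox, sum_range_succ]
      push_cast
      ring
    rw [e1, mul_add, Complex.add_re, mul_sum, Complex.re_sum, ← mul_assoc, hpow, re_ofReal_mul_exp_mul]
    congr 1
    refine sum_congr rfl fun j _ => ?_
    have := re_ofReal_mul_exp_mul (1 / √((j + 1 : ℕ) : ℝ)) ((T / 64 : ℝ) * log (j + 1 : ℕ) + 2 * π * Φ / 2 ^ 46) 1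
    rw [mul_one] at this
    rw [hpow, this]
    simp
  have hmain := main_sum_bound (Φ := Φ) (m := i) hT2 (by omega)
  have habs : ∀ z : ℤ, z.natAbs ≤ 2097152 → |(z : ℝ) / 2 ^ 20| ≤ 2 := by
    intro z hz
    have h3 : ((z.natAbs : ℤ) : ℝ) ≤ 2097152 := by exact_mod_cast hz
    rw [Int.natCast_natAbs, Int.cast_abs] at h3
    rw [abs_div, abs_of_pos (by norm_num : (0 : ℝ) < 2 ^ 20), div_le_iff₀ (by norm_num)]
    linarith
  have htail := tail_bound (Φ := Φ) hT2 hi656 (by omega) hA2 hA3 (habs _ h1) (habs _ h2) rfl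
  rw [← hem2.symm] at hre1
  generalize ∑ j ∈ range i, 1 / √((j + 1 : ℕ) : ℝ) *
        Real.cos ((T / 64 : ℝ) * log (j + 1 : ℕ) + 2 * π * Φ / 2 ^ 46) = S1 at hmain hre1
  generalize 1 / √((i + 1 : ℕ) : ℝ) * (Real.cos ((T / 64 : ℝ) * log (i + 1 : ℕ) + 2 * π * Φ / 2 ^ 46) * A.re +
        Real.sin ((T / 64 : ℝ) * log (i + 1 : ℕ) + 2 * π * Φ / 2 ^ 46) * A.im) = S2 at htail hre1
  generalize (Complex.exp (Θ * Complex.I) * riemannZeta s).re = R at hre1 ⊢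
  generalize listSum (fun p => Nat.mul p.2 (cosFix (Nat.add Φ (Nat.mul T p.1)))) logTable i = L1 at hmain ⊢
  generalize listSum (fun p => p.2) logTable i = L2 at hmain ⊢
  generalize cosFix (Φ + T * (entry logTable i).1 + 52776558133248) = c2 at htail ⊢
  generalize cosFix (Φ + T * (entry logTable i).1) = c1 at htail ⊢
  generalize (entry logTable i).2 = r at htail ⊢
  have e : ((1048576 * ((L1 : ℤ) - (72057594037927936 * L2 : ℕ)) + (r : ℤ) * (((c1 : ℤ) - 72057594037927936) * A'.1 +
      ((c2 : ℤ) - 72057594037927936) * A'.2) : ℤ) : ℝ) / 2 ^ 96 = (L1 / 2 ^ 76 - L2 / 2 ^ 20) +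
      (r : ℝ) / 2 ^ 20 * (((c1 : ℝ) / 2 ^ 56 - 1) * (A'.1 / 2 ^ 20) + ((c2 : ℝ) / 2 ^ 56 - 1) * (A'.2 / 2 ^ 20)) := by
    push_cast
    ring
  rw [e]
  rw [abs_le] at hmain htail hre1 ⊢
  constructor <;> linarith [hmain.1, hmain.2, htail.1, htail.2, hre1.1, hre1.2]

/-- The sign of `ξ` at height `T / 64` on the critical line. -/
def XiSign (b : Bool) (T : ℕ) : Prop :=
  if b then (xi (1 / 2 + ((T / 64 : ℝ) : ℂ) * Complex.I)).re < 0 else 0 < (xi (1 / 2 + ((T / 64 : ℝ) : ℂ) * Complex.I)).re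

lemma xiSign_of_signOK {b : Bool} {T : ℕ} (h : signOK b T = true) : XiSign b T := by
  have e : signOK b T = (((Nat.ble 640 T && Nat.ble T 165887) && (Nat.ble (zetaFix T).1.natAbs 2097152 &&
    Nat.ble (zetaFix T).2.1.natAbs 2097152)) &&
    bif b then decide (752673760633528860137324544 ≤ (zetaFix T).2.2)
      else decide ((zetaFix T).2.2 ≤ -752673760633528860137324544)) := rfl
  rw [e] at h
  simp only [Bool.and_eq_true, Nat.ble_eq] at h
  obtain ⟨⟨⟨hT, hT2⟩, h1, h2⟩, h3⟩ := h
  obtain ⟨Θ, hΘ, hV⟩ := zetaFix_bound hT (by omega) h1 h2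
  have hTr : (640 : ℝ) ≤ T := by exact_mod_cast hT
  obtain ⟨c, hc, hxi⟩ := exists_xi_half_re_eq (t := T / 64) (by linarith) hΘ
  rw [XiSign, hxi]
  generalize (Complex.exp (Θ * Complex.I) * riemannZeta (1 / 2 + ((T / 64 : ℝ) : ℂ) * Complex.I)).re = R at *
  generalize (zetaFix T).2.2 = V at *
  rw [abs_le] at hV
  cases b with
  | true =>
    have h4 : (752673760633528860137324544 : ℝ) ≤ V := by
      have : (752673760633528860137324544 : ℤ) ≤ V := of_decide_eq_true h3
      exact_mod_cast this
    have h5 : (0.0095 : ℝ) ≤ V / 2 ^ 96 := by rw [le_div_iff₀ (by norm_num)]; linarith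
    rw [if_pos rfl]
    nlinarith [hV.2]
  | false =>
    have h4 : (V : ℝ) ≤ -752673760633528860137324544 := by
      have : V ≤ (-752673760633528860137324544 : ℤ) := of_decide_eq_true h3
      exact_mod_cast this
    have h5 : (V : ℝ) / 2 ^ 96 ≤ -0.0095 := by rw [div_le_iff₀ (by norm_num)]; linarith
    rw [if_neg (by decide)]
    nlinarith [hV.1]

end Signs

section Exclusion

lemma abs_neg_logDeriv_zeta_re_le {s : ℂ} (hs : 1 < s.re) :
    |(-deriv riemannZeta s / riemannZeta s).re| ≤ (-deriv riemannZeta s.re / riemannZeta s.re).re := by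
  have h1 := hasSum_neg_logDeriv_zeta_re hs
  have h2 := hasSum_neg_logDeriv_zeta_re (s := (s.re : ℂ)) (by simpa using hs)
  simp only [Complex.ofReal_re, Complex.ofReal_im, zero_mul, Real.cos_zero, mul_one] at h2
  have key : ∀ n : ℕ, |ArithmeticFunction.vonMangoldt n * (exp (-(s.re * Real.log n)) * Real.cos (s.im * Real.log n))| ≤
      ArithmeticFunction.vonMangoldt n * exp (-(s.re * Real.log n)) := by
    intro n
    rw [abs_mul, abs_mul, abs_of_nonneg ArithmeticFunction.vonMangoldt_nonneg, abs_of_pos (Real.exp_pos _)]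
    exact mul_le_mul_of_nonneg_left (mul_le_of_le_one_right (Real.exp_pos _).le (Real.abs_cos_le_one _))
      ArithmeticFunction.vonMangoldt_nonneg
  rw [abs_le]
  exact ⟨by have := hasSum_le (fun n => (abs_le.1 (key n)).1) h2.neg h1; exact this,
    hasSum_le (fun n => (abs_le.1 (key n)).2) h1 h2⟩

lemma half_mul_re (w : ℂ) : (1 / 2 * w).re = 1 / 2 * w.re := by
  rw [show (1 / 2 : ℂ) = ((1 / 2 : ℝ) : ℂ) by push_cast; rfl, Complex.re_ofReal_mul]

lemma neg_logDeriv_zeta_five_halves_le : (-deriv riemannZeta ((5 / 2 : ℝ) : ℂ) / riemannZeta ((5 / 2 : ℝ) : ℂ)).re ≤ 0.389 := by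
  rw [neg_logDeriv_zeta_eq (by norm_num), logDeriv_xi_ofReal]
  have h0 := sum_pairKernel_le (z := ((5 / 2 : ℝ) : ℂ)) (by norm_num) ∅ (by simp)
  rw [sum_empty] at h0
  have hd := digamma_re_le_log_sub (x := 9 / 4) (by norm_num)
  have hl : Real.log (9 / 4) ≤ 0.811 := by
    have h1 : (9 / 4 : ℝ) = 2 * (9 / 8) := by norm_num
    rw [h1, Real.log_mul (by norm_num) (by norm_num)]
    have h2 := log_div_series_bounds (x := 1 / 17) (by norm_num) (by norm_num) 2
    norm_num [sum_range_succ] at h2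
    linarith [Real.log_two_lt_d9, h2.2]
  have e1 : (1 / (((5 / 2 : ℝ) : ℂ) - 1)).re = 2 / 3 := by
    rw [show (1 / (((5 / 2 : ℝ) : ℂ) - 1)) = ((2 / 3 : ℝ) : ℂ) by push_cast; norm_num, Complex.ofReal_re]
  have e2 : ((5 / 2 : ℝ) : ℂ) / 2 + 1 = ((9 / 4 : ℝ) : ℂ) := by push_cast; norm_num
  rw [Complex.sub_re, Complex.sub_re, Complex.add_re, e1, half_mul_re, half_mul_re, e2, Complex.ofReal_re, Complex.ofReal_re]
  have := log_pi_bounds.1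
  norm_num at *
  linarith

open ArithmeticFunction in
lemma neg_logDeriv_zeta_nine_halves_le : (-deriv riemannZeta ((9 / 2 : ℝ) : ℂ) / riemannZeta ((9 / 2 : ℝ) : ℂ)).re ≤ 0.0604 := by
  have h1 := hasSum_neg_logDeriv_zeta_re (s := ((9 / 2 : ℝ) : ℂ)) (by norm_num)
  have h2 := hasSum_neg_logDeriv_zeta_re (s := ((5 / 2 : ℝ) : ℂ)) (by norm_num)
  simp only [Complex.ofReal_re, Complex.ofReal_im, zero_mul, Real.cos_zero, mul_one] at h1 h2
  have hexp : ∀ n : ℕ, 0 < n → exp (-(9 / 2 * Real.log n)) = exp (-(5 / 2 * Real.log n)) / (n : ℝ) ^ 2 := by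
    intro n hn
    have hn0 : (0 : ℝ) < n := by exact_mod_cast hn
    have : (n : ℝ) ^ 2 = exp (2 * Real.log n) := by
      rw [mul_comm, Real.exp_mul, Real.exp_log hn0]; norm_num
    rw [this, ← Real.exp_sub]
    congr 1; ring
  set g : ℝ := Real.log 2 * exp (-(5 / 2 * Real.log 2)) with hg
  have hd : HasSum (fun n : ℕ => if n = 2 then (5 / 36 : ℝ) * g else 0) (5 / 36 * g) := by
    simpa using hasSum_ite_eq (2 : ℕ) ((5 / 36 : ℝ) * g)
  have hle := hasSum_le (fun n => ?_) h1 ((h2.mul_left (1 / 9)).add hd)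
  · have hg1 : g ≤ 0.12255 := by
      have h3 : exp (-(5 / 2 * Real.log 2)) ≤ 0.1768 := by
        refine (pow_le_pow_iff_left₀ (Real.exp_pos _).le (by norm_num) two_ne_zero).1 ?_
        rw [← Real.exp_nat_mul, show ((2 : ℕ) : ℝ) * -(5 / 2 * Real.log 2) = Real.log 2 * (-5 : ℝ) by push_cast; ring,
          Real.exp_mul, Real.exp_log (by norm_num)]
        rw [show (-5 : ℝ) = -((5 : ℕ) : ℝ) by norm_num, Real.rpow_neg (by norm_num), Real.rpow_natCast]
        norm_num
      have h4 := Real.log_two_lt_d9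
      have h5 : 0 < Real.log 2 := Real.log_pos (by norm_num)
      rw [hg]
      calc _ ≤ 0.6931471808 * 0.1768 := mul_le_mul h4.le h3 (Real.exp_pos _).le (by norm_num)
        _ ≤ 0.12255 := by norm_num
    linarith [neg_logDeriv_zeta_five_halves_le]
  · rcases Nat.lt_or_ge n 3 with hn | hn
    · interval_cases n
      · simp
      · simp
      · have hΛ : vonMangoldt 2 = Real.log 2 := vonMangoldt_apply_prime Nat.prime_two
        have := hexp 2 (by norm_num)
        simp only [Nat.cast_ofNat, if_true] at *
        rw [hΛ, this, hg]
        refine le_of_eq ?_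
        ring
    · have hn3 : (3 : ℝ) ≤ n := by exact_mod_cast hn
      rw [if_neg (by omega), add_zero, hexp n (by omega)]
      have hΛ : 0 ≤ vonMangoldt n := vonMangoldt_nonneg
      have h5 : exp (-(5 / 2 * Real.log n)) / (n : ℝ) ^ 2 ≤ 1 / 9 * exp (-(5 / 2 * Real.log n)) := by
        rw [div_le_iff₀ (by positivity)]
        have h9 : (9 : ℝ) ≤ (n : ℝ) ^ 2 := by nlinarith
        nlinarith [mul_le_mul_of_nonneg_left h9 (Real.exp_pos (-(5 / 2 * Real.log n))).le]
      calc _ ≤ vonMangoldt n * (1 / 9 * exp (-(5 / 2 * Real.log n))) := mul_le_mul_of_nonneg_left h5 hΛ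
        _ = _ := by ring

/-- The upper bound for the sum over the zeros seen from `9 / 2 + 2 k i`. -/
lemma logDeriv_xi_re_le {k : ℕ} (hk : 2 ≤ k) : (logDeriv xi ((9 / 2 : ℝ) + ((2 * k : ℝ) : ℂ) * Complex.I)).re ≤
    3.5 / (12.25 + 4 * (k : ℝ) ^ 2) + 1 / 2 * Real.log k + 2.3 / (k : ℝ) ^ 2 - 0.51195 := by
  obtain ⟨z, hz⟩ : ∃ z : ℂ, z = (9 / 2 : ℝ) + ((2 * k : ℝ) : ℂ) * Complex.I := ⟨_, rfl⟩
  have hk2 : (2 : ℝ) ≤ k := by exact_mod_cast hk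
  have hre : z.re = 9 / 2 := by rw [hz]; simp
  have him : z.im = 2 * k := by rw [hz]; simp
  rw [← hz]
  have heq := congrArg Complex.re (neg_logDeriv_zeta_eq (s := z) (by rw [hre]; norm_num))
  have habs := abs_neg_logDeriv_zeta_re_le (s := z) (by rw [hre]; norm_num)
  rw [hre] at habs
  have hb := (abs_le.1 (habs.trans neg_logDeriv_zeta_nine_halves_le)).1
  have hw : z / 2 + 1 = ((13 / 4 : ℝ) : ℂ) + ((k : ℝ) : ℂ) * Complex.I := by rw [hz]; push_cast; ring
  have hd := (digamma_re_bounds (w := z / 2 + 1) (by rw [hw]; norm_num) (by rw [hw]; simpa using hk2))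
  have e1 : (1 / (z - 1)).re = 3.5 / (12.25 + 4 * (k : ℝ) ^ 2) := by
    rw [one_div, Complex.inv_re, Complex.normSq_apply, Complex.sub_re, Complex.sub_im, hre, him]
    norm_num
    ring
  rw [Complex.sub_re, Complex.sub_re, Complex.add_re, e1, half_mul_re, half_mul_re, Complex.ofReal_re] at heq
  have hwre : (z / 2 + 1).re = 13 / 4 := by rw [hw]; simp
  have hwim : (z / 2 + 1).im = k := by rw [hw]; simp
  rw [hwre, hwim] at hd
  have hlog : Real.log ((13 / 4 - 1 / 2) ^ 2 + (k : ℝ) ^ 2) ≤ 2 * Real.log k + 7.5625 / (k : ℝ) ^ 2 := by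
    have e : (13 / 4 - 1 / 2 : ℝ) ^ 2 + (k : ℝ) ^ 2 = (k : ℝ) ^ 2 * (1 + 7.5625 / (k : ℝ) ^ 2) := by
      field_simp; norm_num; ring
    rw [e, Real.log_mul (by positivity) (by positivity), Real.log_pow]
    have := Real.log_le_sub_one_of_pos (show 0 < 1 + 7.5625 / (k : ℝ) ^ 2 by positivity)
    push_cast
    linarith
  have e4 : 7.5625 / (k : ℝ) ^ 2 / 4 + 0.4 / (k : ℝ) ^ 2 ≤ 2.3 / (k : ℝ) ^ 2 := by
    rw [div_div, div_add_div _ _ (by positivity) (by positivity), div_le_div_iff₀ (by positivity) (by positivity)]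
    have : (0 : ℝ) < (k : ℝ) ^ 2 := by positivity
    nlinarith
  have := log_pi_bounds.1
  have e5 : (4 / 5 : ℝ) / (k : ℝ) ^ 2 = 2 * (0.4 / (k : ℝ) ^ 2) := by ring
  rw [e5] at hd
  linarith

lemma pairKernel_ge {z ρ : ℂ} (hz : z.re = 9 / 2) (hρ : xi ρ = 0) (hd : |z.im - ρ.im| ≤ 1) : 8 / 17 ≤ pairKernel z ρ := by
  have h0 := zero_re_of_xi_eq_zero hρ
  have hne1 : z ≠ ρ := fun h => by rw [h] at hz; linarith
  have hne2 : z ≠ 1 - (starRingEnd ℂ) ρ := fun h => by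
    have := congrArg Complex.re h
    simp at this
    linarith
  rw [pairKernel_eq hne1 hne2, hz]
  have hb : (ρ.re - 1 / 2) ^ 2 ≤ 1 / 4 := by nlinarith
  have hd2 : (z.im - ρ.im) ^ 2 ≤ 1 := by rw [← sq_abs]; nlinarith [abs_nonneg (z.im - ρ.im)]
  have hb0 := sq_nonneg (ρ.re - 1 / 2)
  have hd0 := sq_nonneg (z.im - ρ.im)
  generalize (ρ.re - 1 / 2) ^ 2 = b at *
  generalize (z.im - ρ.im) ^ 2 = d at *
  have hX : 15.75 ≤ (9 / 2 - 1 / 2 : ℝ) ^ 2 - b + d := by norm_num; linarith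
  rw [div_le_div_iff₀ (by norm_num) (by positivity)]
  norm_num
  nlinarith [mul_nonneg hb0 hd0, mul_nonneg hb0 (sub_nonneg.2 hd2)]

end Exclusion

section Counting

/-- The signs of xi at the points of the list alternate. -/
def SignsHold : List ℕ → Bool → Prop
  | [], _ => True
  | T :: l, b => XiSign b T ∧ SignsHold l (!b)

/-- The points with the successive differences `d`, starting after `a`, followed by the list `rest`. -/
noncomputable def prependDiffs (rest d : List ℕ) : ℕ → List ℕ :=
  List.rec (motive := fun _ => ℕ → List ℕ) (fun _ => rest) (fun x _ ih a => (a + x) :: ih (a + x)) d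

lemma signsHold_prependDiffs {rest : List ℕ} (d : List ℕ) {a : ℕ} {b : Bool} (h : signsOK (prependDiffs [] d a) b = true)
    (hr : SignsHold rest (xor b d.length.bodd)) : SignsHold (prependDiffs rest d a) b := by
  induction d generalizing a b with
  | nil =>
    rw [List.length_nil, Nat.bodd_zero, Bool.xor_false] at hr
    exact hr
  | cons x d ih =>
    have e : signsOK (prependDiffs [] (x :: d) a) b = (signOK b (a + x) && signsOK (prependDiffs [] d (a + x)) (!b)) := rfl
    rw [e, Bool.and_eq_true] at h
    refine ⟨xiSign_of_signOK h.1, ih h.2 ?_⟩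
    rw [List.length_cons, Nat.bodd_succ] at hr
    cases b <;> cases hd : d.length.bodd <;> rw [hd] at hr <;> exact hr

lemma exists_zero_between {a c : ℕ} {b : Bool} (ha : XiSign b a) (hc : XiSign (!b) c) (hac : a < c) :
    ∃ t : ℝ, (a / 64 : ℝ) < t ∧ t < c / 64 ∧ xi (1 / 2 + t * Complex.I) = 0 := by
  have hcont : Continuous fun t : ℝ => (xi (1 / 2 + t * Complex.I)).re :=
    Complex.continuous_re.comp (differentiable_xi.continuous.comp (by fun_prop))
  have hlt : (a / 64 : ℝ) < c / 64 := by
    have : (a : ℝ) < c := by exact_mod_cast hac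
    linarith
  have key : ∃ t ∈ Set.Ioo (a / 64 : ℝ) (c / 64), (xi (1 / 2 + t * Complex.I)).re = 0 := by
    cases b with
    | true =>
      simp only [XiSign, if_true, Bool.not_true, Bool.false_eq_true, if_false] at ha hc
      exact intermediate_value_Ioo hlt.le hcont.continuousOn ⟨ha, hc⟩
    | false =>
      simp only [XiSign, if_true, Bool.not_false, Bool.false_eq_true, if_false] at ha hc
      exact intermediate_value_Ioo' hlt.le hcont.continuousOn ⟨hc, ha⟩
  obtain ⟨t, ht, h0⟩ := key
  exact ⟨t, ht.1, ht.2, Complex.ext h0 (xi_half_im t)⟩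

/-- A lower bound for the contribution of the zeros between consecutive points to the sum seen from `9 / 2 + 2 k i`,
in units of `2 ^ (-40)`. -/
noncomputable def windowSum (k : ℕ) (l : List ℕ) : ℕ → ℕ :=
  List.rec (motive := fun _ => ℕ → ℕ) (fun _ => 0) (fun T _ ih a => bif Nat.ble (a + 1) T && Nat.ble T (128 * k + 5120)
    then 18014398509481984 / (65536 + (128 * k - a) ^ 2 + (T - 128 * k) ^ 2) + ih T else 0) l

lemma one_div_sub_re (k : ℕ) (t : ℝ) :
    (1 / (((9 / 2 : ℝ) + ((2 * k : ℝ) : ℂ) * Complex.I) - (1 / 2 + t * Complex.I))).re = 4 / (16 + (2 * k - t) ^ 2) := by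
  rw [show (((9 / 2 : ℝ) + ((2 * k : ℝ) : ℂ) * Complex.I) - (1 / 2 + t * Complex.I)) =
    ((4 : ℝ) : ℂ) + ((2 * k - t : ℝ) : ℂ) * Complex.I by push_cast; ring, one_div, Complex.inv_re, Complex.normSq_add_mul_I]
  norm_num

lemma window_weight_le {k a c : ℕ} {t : ℝ} (ha : (a / 64 : ℝ) < t) (hc : t < c / 64) :
    ((18014398509481984 / (65536 + (128 * k - a) ^ 2 + (c - 128 * k) ^ 2) : ℕ) : ℝ) / 2 ^ 40 ≤ 4 / (16 + (2 * k - t) ^ 2) := by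
  have h1 : 128 * (k : ℝ) - a ≤ ((128 * k - a : ℕ) : ℝ) := by
    have : 128 * k ≤ (128 * k - a) + a := by omega
    have : (128 * k : ℝ) ≤ (128 * k - a : ℕ) + a := by exact_mod_cast this
    linarith
  have h2 : (c : ℝ) - 128 * k ≤ ((c - 128 * k : ℕ) : ℝ) := by
    have : c ≤ (c - 128 * k) + 128 * k := by omega
    have : (c : ℝ) ≤ (c - 128 * k : ℕ) + 128 * k := by exact_mod_cast this
    linarith
  have h := Nat.cast_div_le (α := ℝ) (m := 18014398509481984) (n := 65536 + (128 * k - a) ^ 2 + (c - 128 * k) ^ 2)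
  rw [Nat.cast_add, Nat.cast_add, Nat.cast_pow, Nat.cast_pow] at h
  generalize ((128 * k - a : ℕ) : ℝ) = x at *
  generalize ((c - 128 * k : ℕ) : ℝ) = y at *
  have hm : (128 * (k : ℝ) - 64 * t) ^ 2 ≤ x ^ 2 + y ^ 2 := by
    rcases le_total (64 * t) (128 * k) with h3 | h3
    · nlinarith [sq_nonneg y]
    · nlinarith [sq_nonneg x]
  calc _ ≤ ((18014398509481984 : ℕ) : ℝ) / ((65536 : ℕ) + x ^ 2 + y ^ 2) / 2 ^ 40 := by gcongr
    _ ≤ 4 / (16 + (2 * k - t) ^ 2) := by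
      rw [div_div, div_le_div_iff₀ (by positivity) (by positivity)]
      push_cast
      nlinarith

lemma exists_zeros_windowSum_le (k : ℕ) (l : List ℕ) {a : ℕ} {b : Bool} (h : SignsHold (a :: l) b) :
    ∃ S : Finset ℂ, (∀ ρ ∈ S, xi ρ = 0 ∧ ρ.re = 1 / 2 ∧ (a / 64 : ℝ) < ρ.im) ∧ (windowSum k l a : ℝ) / 2 ^ 40 ≤
      ∑ ρ ∈ S, (1 / (((9 / 2 : ℝ) + ((2 * k : ℝ) : ℂ) * Complex.I) - ρ)).re := by
  classical
  have trivial_case : ∀ n : ℕ, n = 0 → ∃ S : Finset ℂ, (∀ ρ ∈ S, xi ρ = 0 ∧ ρ.re = 1 / 2 ∧ (a / 64 : ℝ) < ρ.im) ∧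
      (n : ℝ) / 2 ^ 40 ≤ ∑ ρ ∈ S, (1 / (((9 / 2 : ℝ) + ((2 * k : ℝ) : ℂ) * Complex.I) - ρ)).re := by
    rintro n rfl
    exact ⟨∅, by simp, by simp⟩
  induction l generalizing a b with
  | nil => exact trivial_case _ rfl
  | cons T l ih =>
    have e : windowSum k (T :: l) a = bif Nat.ble (a + 1) T && Nat.ble T (128 * k + 5120)
      then 18014398509481984 / (65536 + (128 * k - a) ^ 2 + (T - 128 * k) ^ 2) + windowSum k l T else 0 := rfl
    cases hc : Nat.ble (a + 1) T && Nat.ble T (128 * k + 5120) with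
    | false => exact trivial_case _ (by rw [e, hc, cond_false])
    | true =>
      rw [e, hc, cond_true]
      rw [Bool.and_eq_true, Nat.ble_eq, Nat.ble_eq] at hc
      obtain ⟨t, hat, htc, ht0⟩ := exists_zero_between h.1 h.2.1 hc.1
      obtain ⟨S, hS, hsum⟩ := ih h.2 (fun n hn => ⟨∅, by simp, by simp [hn]⟩)
      have hre : ((1 / 2 : ℂ) + t * Complex.I).re = 1 / 2 := by simp
      have him : ((1 / 2 : ℂ) + t * Complex.I).im = t := by simp
      have hnot : (1 / 2 + t * Complex.I : ℂ) ∉ S := fun hmem => by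
        have := (hS _ hmem).2.2
        rw [him] at this
        linarith
      refine ⟨insert (1 / 2 + t * Complex.I) S, fun ρ hρ => ?_, ?_⟩
      · rcases Finset.mem_insert.1 hρ with rfl | hρ
        · exact ⟨ht0, hre, by rw [him]; exact hat⟩
        · exact ⟨(hS ρ hρ).1, (hS ρ hρ).2.1, by linarith [(hS ρ hρ).2.2]⟩
      · rw [sum_insert hnot, one_div_sub_re, Nat.cast_add, add_div]
        exact add_le_add (window_weight_le hat htc) hsum

/-- Drops the points below the window around `128 k`. -/
noncomputable def slide (k : ℕ) (l : List ℕ) : List ℕ :=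
  List.rec (motive := fun _ => List ℕ) [] (fun T l ih => bif Nat.ble (128 * k) (T + 5120) then T :: l else ih) l

/-- The lower bound for the sum over the zeros on the line that are separated by the points. -/
noncomputable def zeroSum (k : ℕ) (l : List ℕ) : ℕ :=
  List.rec (motive := fun _ => ℕ) 0 (fun T l _ => windowSum k l T) l

/-- An off-line zero near `2 k` would make the sum over the zeros, seen from `9 / 2 + 2 k i`, too large. -/
noncomputable def targetOK (k s : ℕ) : Bool :=
  Nat.ble (15393162788864 / (49 + 16 * k ^ 2) + 25288767438848 / (10 * k ^ 2) +
    314159266 * ((entry logTable ((k - 1) / 2)).1 + 121295705375) / 100000000 + 4) (s + 1080312214440)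

noncomputable def exclusionOK (n : ℕ) : ℕ → List ℕ → Bool :=
  Nat.rec (motive := fun _ => ℕ → List ℕ → Bool) (fun _ _ => true)
    (fun _ ih k l => (fun l' => targetOK k (zeroSum k l') && ih (k + 1) l') (slide k l)) n

lemma exists_signsHold_slide (k : ℕ) {l : List ℕ} {b : Bool} (h : SignsHold l b) : ∃ b', SignsHold (slide k l) b' := by
  induction l generalizing b with
  | nil => exact ⟨b, trivial⟩
  | cons T l ih =>
    have e : slide k (T :: l) = bif Nat.ble (128 * k) (T + 5120) then T :: l else slide k l := rfl
    cases hc : Nat.ble (128 * k) (T + 5120) with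
    | true => exact ⟨b, by rw [e, hc]; exact h⟩
    | false => rw [e, hc]; exact ih h.2

lemma exists_zeros_zeroSum_le (k : ℕ) {l : List ℕ} {b : Bool} (h : SignsHold l b) :
    ∃ S : Finset ℂ, (∀ ρ ∈ S, xi ρ = 0 ∧ ρ.re = 1 / 2) ∧ (zeroSum k l : ℝ) / 2 ^ 40 ≤
      ∑ ρ ∈ S, (1 / (((9 / 2 : ℝ) + ((2 * k : ℝ) : ℂ) * Complex.I) - ρ)).re := by
  cases l with
  | nil => exact ⟨∅, by simp, by simp [zeroSum]⟩
  | cons T l =>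
    obtain ⟨S, hS, hsum⟩ := exists_zeros_windowSum_le k l h
    exact ⟨S, fun ρ hρ => ⟨(hS ρ hρ).1, (hS ρ hρ).2.1⟩, hsum⟩

lemma lt_div_add_one (a b : ℕ) : (a : ℝ) / b < (a / b : ℕ) + 1 := by
  rcases Nat.eq_zero_or_pos b with rfl | hb
  · simp
  · rw [div_lt_iff₀ (by exact_mod_cast hb)]
    have := Nat.lt_div_mul_add (a := a) hb
    have h : (a : ℝ) < (a / b : ℕ) * b + b := by exact_mod_cast this
    linarith

lemma target_lt_of_targetOK {k s : ℕ} (hk : 2 ≤ k) (hk' : k ≤ 1250) (h : targetOK k s = true) :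
    3.5 / (12.25 + 4 * (k : ℝ) ^ 2) + 1 / 2 * log k + 2.3 / (k : ℝ) ^ 2 - 0.51195 < (s : ℝ) / 2 ^ 40 + 8 / 17 := by
  rw [targetOK, Nat.ble_eq] at h
  have h0 := (logTable_spec (i := (k - 1) / 2) (by omega)).1
  have h1 := (logTable_spec (i := 1) (by omega)).1
  have e1 : (entry logTable 1).1 = 121295703935 := by decide +kernel
  rw [e1] at h1
  generalize (entry logTable ((k - 1) / 2)).1 = lam at *
  have hk0 : (2 : ℝ) ≤ k := by exact_mod_cast hk
  have hkh : (k : ℝ) ≤ ((1 + 1 : ℕ) : ℝ) * (((k - 1) / 2 + 1 : ℕ) : ℝ) := by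
    have : k ≤ (1 + 1) * ((k - 1) / 2 + 1) := by omega
    exact_mod_cast this
  have hlog : log k ≤ log ((1 + 1 : ℕ) : ℝ) + log (((k - 1) / 2 + 1 : ℕ) : ℝ) := by
    rw [← Real.log_mul (by norm_num) (by positivity)]
    exact Real.log_le_log (by linarith) hkh
  have hs : ∀ n : ℕ, 2 ^ 40 * (1 / 2 * log n) = π * logScale n := fun n => by
    rw [logScale]; field_simp
  have hS : 2 ^ 40 * (1 / 2 * log k) ≤ 3.14159266 * ((lam : ℝ) + 121295705375) := by
    have h2 : logScale (1 + 1) + logScale ((k - 1) / 2 + 1) ≤ (lam : ℝ) + 121295705375 := by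
      have h3 := (abs_le.1 h0).1
      have h4 := (abs_le.1 h1).1
      push_cast at *
      linarith
    calc _ ≤ π * (logScale (1 + 1) + logScale ((k - 1) / 2 + 1)) := by
          rw [mul_add, ← hs, ← hs]; linarith
      _ ≤ π * ((lam : ℝ) + 121295705375) := mul_le_mul_of_nonneg_left h2 Real.pi_pos.le
      _ ≤ _ := mul_le_mul_of_nonneg_right (by linarith [Real.pi_lt_d20]) (by positivity)
  have d1 := lt_div_add_one 15393162788864 (49 + 16 * k ^ 2)
  have d2 := lt_div_add_one 25288767438848 (10 * k ^ 2)
  have d3 := lt_div_add_one (314159266 * (lam + 121295705375)) 100000000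
  obtain ⟨q₁, hq₁⟩ : ∃ q : ℕ, q = 15393162788864 / (49 + 16 * k ^ 2) := ⟨_, rfl⟩
  obtain ⟨q₂, hq₂⟩ : ∃ q : ℕ, q = 25288767438848 / (10 * k ^ 2) := ⟨_, rfl⟩
  obtain ⟨q₃, hq₃⟩ : ∃ q : ℕ, q = 314159266 * (lam + 121295705375) / 100000000 := ⟨_, rfl⟩
  rw [← hq₁] at d1 h
  rw [← hq₂] at d2 h
  rw [← hq₃] at d3 h
  have h' : (q₁ : ℝ) + q₂ + q₃ + 4 ≤ (s : ℝ) + 1080312214440 := by exact_mod_cast h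
  have f1 : 3.5 / (12.25 + 4 * (k : ℝ) ^ 2) = 15393162788864 / (49 + 16 * (k : ℝ) ^ 2) / 2 ^ 40 := by
    rw [div_div, div_eq_div_iff (by positivity) (by positivity)]
    ring
  have f2 : 2.3 / (k : ℝ) ^ 2 = 25288767438848 / (10 * (k : ℝ) ^ 2) / 2 ^ 40 := by
    rw [div_div, div_eq_div_iff (by positivity) (by positivity)]
    ring
  rw [f1, f2]
  push_cast at d1 d2 d3
  linarith

lemma re_eq_half_of_targetOK {k : ℕ} (hk : 2 ≤ k) (hk' : k ≤ 1250) {l : List ℕ} {b : Bool} (hl : SignsHold l b)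
    (h : targetOK k (zeroSum k l) = true) {ρ : ℂ} (hρ : xi ρ = 0) (hd : |2 * k - ρ.im| ≤ 1) : ρ.re = 1 / 2 := by
  by_contra hoff
  obtain ⟨S, hS, hsum⟩ := exists_zeros_zeroSum_le k hl
  have h1 := pairKernel_add_sum_le (z := (9 / 2 : ℝ) + ((2 * k : ℝ) : ℂ) * Complex.I) (by simp; norm_num) hρ hoff S hS
  have h2 := pairKernel_ge (z := (9 / 2 : ℝ) + ((2 * k : ℝ) : ℂ) * Complex.I) (by simp) hρ (by simpa using hd)
  linarith [logDeriv_xi_re_le hk, target_lt_of_targetOK hk hk' h]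

lemma re_eq_half_of_exclusionOK {n k : ℕ} (hk : 2 ≤ k) (hk' : k + n ≤ 1251) {l : List ℕ} {b : Bool} (hl : SignsHold l b)
    (h : exclusionOK n k l = true) {ρ : ℂ} (hρ : xi ρ = 0) (h1 : 2 * k - 1 ≤ ρ.im) (h2 : ρ.im < 2 * (k + n) - 1) :
    ρ.re = 1 / 2 := by
  induction n generalizing k l b with
  | zero => rw [Nat.cast_zero] at h2; linarith
  | succ n ih =>
    obtain ⟨b', hl'⟩ := exists_signsHold_slide k hl
    have e : exclusionOK (n + 1) k l = (targetOK k (zeroSum k (slide k l)) && exclusionOK n (k + 1) (slide k l)) := rfl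
    rw [e, Bool.and_eq_true] at h
    rcases le_or_gt ρ.im (2 * k + 1) with h3 | h3
    · exact re_eq_half_of_targetOK hk (by omega) hl' h.1 hρ (by rw [abs_le]; constructor <;> linarith)
    · refine ih (by omega) (by omega) hl' h.2 ?_ ?_ <;> push_cast at * <;> linarith

/-- Zeros near the real axis are excluded from the centre `9 / 2`. -/
lemma re_eq_half_of_abs_im_lt_three {ρ : ℂ} (hρ : xi ρ = 0) (h3 : |ρ.im| < 3) : ρ.re = 1 / 2 := by
  by_contra hoff
  have h := pairKernel_add_sum_le (z := ((9 / 2 : ℝ) : ℂ)) (by norm_num) hρ hoff ∅ (by simp)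
  rw [sum_empty, add_zero] at h
  have h0 := zero_re_of_xi_eq_zero hρ
  have hne1 : ((9 / 2 : ℝ) : ℂ) ≠ ρ := fun h => by rw [← h] at h0; norm_num at h0
  have hne2 : ((9 / 2 : ℝ) : ℂ) ≠ 1 - (starRingEnd ℂ) ρ := fun h => by
    have := congrArg Complex.re h
    rw [Complex.sub_re, Complex.conj_re, Complex.one_re, Complex.ofReal_re] at this
    linarith
  rw [pairKernel_eq hne1 hne2, Complex.ofReal_re, Complex.ofReal_im] at h
  have hb : (ρ.re - 1 / 2) ^ 2 ≤ 1 / 4 := by nlinarith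
  have hd : (0 - ρ.im) ^ 2 ≤ 9 := by rw [zero_sub, neg_sq, ← sq_abs]; nlinarith [abs_nonneg ρ.im]
  have hk : 0.3 ≤ 2 * (9 / 2 - 1 / 2) * ((9 / 2 - 1 / 2) ^ 2 - (ρ.re - 1 / 2) ^ 2 + (0 - ρ.im) ^ 2)
      / (((9 / 2 - 1 / 2) ^ 2 - (ρ.re - 1 / 2) ^ 2 + (0 - ρ.im) ^ 2) ^ 2
        + 4 * (ρ.re - 1 / 2) ^ 2 * (0 - ρ.im) ^ 2) := by
    have hb0 := sq_nonneg (ρ.re - 1 / 2)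
    have hd0 := sq_nonneg (0 - ρ.im)
    generalize (ρ.re - 1 / 2) ^ 2 = β at *
    generalize (0 - ρ.im) ^ 2 = δ at *
    obtain ⟨X, hX⟩ : ∃ X : ℝ, X = (9 / 2 - 1 / 2) ^ 2 - β + δ := ⟨_, rfl⟩
    rw [← hX]
    have hX1 : 15.75 ≤ X := by rw [hX]; norm_num; linarith
    have hX2 : X ≤ 25 := by rw [hX]; norm_num; linarith
    have hbd : β * δ ≤ 1 / 4 * 9 := mul_le_mul hb hd hd0 (by norm_num)
    have : 0 < X ^ 2 + 4 * β * δ := by nlinarith [mul_nonneg hb0 hd0]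
    rw [le_div_iff₀ this]
    nlinarith
  have heq := congrArg Complex.re (neg_logDeriv_zeta_eq (s := ((9 / 2 : ℝ) : ℂ)) (by norm_num))
  have hz := (abs_nonneg _).trans (abs_neg_logDeriv_zeta_re_le (s := ((9 / 2 : ℝ) : ℂ)) (by norm_num))
  rw [Complex.ofReal_re] at hz
  have hψ := digamma_re_le_log_sub (x := 13 / 4) (by norm_num)
  have hl : log (13 / 4) ≤ 1.2 := by
    rw [show (13 / 4 : ℝ) = 2 * 2 * (13 / 16) by norm_num, Real.log_mul (by norm_num) (by norm_num),
      Real.log_mul (by norm_num) (by norm_num)]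
    have := Real.log_le_sub_one_of_pos (show (0 : ℝ) < 13 / 16 by norm_num)
    linarith [Real.log_two_lt_d9]
  have e1 : (1 / (((9 / 2 : ℝ) : ℂ) - 1)).re = 2 / 7 := by
    rw [show (1 / (((9 / 2 : ℝ) : ℂ) - 1)) = ((2 / 7 : ℝ) : ℂ) by push_cast; norm_num, Complex.ofReal_re]
  have e2 : ((9 / 2 : ℝ) : ℂ) / 2 + 1 = ((13 / 4 : ℝ) : ℂ) := by push_cast; norm_num
  rw [Complex.sub_re, Complex.sub_re, Complex.add_re, e1, half_mul_re, half_mul_re, e2, Complex.ofReal_re] at heq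
  have := log_pi_bounds.1
  rw [heq] at hz
  linarith

end Counting

section Points

noncomputable def gaps160947 : List ℕ :=
  [72, 61, 67, 74, 62, 74, 82, 69, 48, 57, 69, 56, 85, 84, 64, 62, 53, 75, 71, 59, 49, 79, 87, 69, 64, 69, 47, 53, 80,
   76, 72, 69, 62, 74, 64, 59, 61, 62, 64, 87, 94, 44, 51, 69, 67, 66, 64, 75, 74, 64, 74, 67, 59, 53, 52, 84, 87, 67,
   64, 66, 49, 72, 74, 59, 56, 82, 82, 69, 61, 49, 64, 64]

noncomputable def points160947 : List ℕ := prependDiffs [] gaps160947 160947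

set_option maxRecDepth 100000 in
lemma signsHold_points160947 : SignsHold points160947 false :=
  signsHold_prependDiffs gaps160947 (by decide +kernel) trivial

noncomputable def gaps147441 : List ℕ :=
  [71, 69, 62, 56, 64, 57, 87, 92, 61, 49, 74, 72, 59, 61, 72, 69, 82, 82, 56, 64, 46, 69, 77, 74, 74, 72, 64, 59, 74,
   75, 40, 64, 90, 87, 64, 59, 61, 57, 71, 70, 74, 74, 61, 77, 80, 46, 59, 66, 64, 82, 90, 66, 49, 61, 75, 69, 64, 56,
   82, 82, 64, 69, 59, 61, 44, 87, 87, 66, 67, 64, 64, 72, 59, 64, 61, 79, 87, 77, 49, 51, 67, 74, 61, 77, 82, 56, 69,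
   75, 66, 54, 54, 69, 92, 85, 51, 66, 62, 53, 80, 69, 59, 74, 79, 77, 54, 67, 56, 56, 74, 85, 82, 61, 49, 72, 76, 59,
   51, 75, 79, 77, 74, 67, 43, 62, 66, 77, 77, 69, 69, 64, 69, 62, 66, 64, 44, 97, 95, 48, 62, 59, 66, 64, 72, 69, 74,
   69, 67, 79, 59, 44, 64, 76, 80, 79, 69, 57, 51, 74, 77, 54, 61, 77, 82, 77, 51, 64, 64, 48, 75, 87, 82, 46, 69, 74,
   62, 61, 61, 62, 77, 84, 77, 56, 57, 48, 80, 74, 59, 79, 77, 54, 71, 75, 53, 54, 59, 90, 87, 61, 59, 56]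

noncomputable def points147441 : List ℕ := prependDiffs points160947 gaps147441 147441

set_option maxRecDepth 100000 in
lemma signsHold_points147441 : SignsHold points147441 false :=
  signsHold_prependDiffs gaps147441 (by decide +kernel) signsHold_points160947

noncomputable def gaps133711 : List ℕ :=
  [64, 41, 69, 93, 84, 64, 69, 57, 66, 74, 64, 67, 69, 84, 85, 56, 57, 61, 72, 61, 87, 87, 51, 67, 74, 72, 56, 59, 69,
   87, 85, 64, 66, 54, 54, 84, 77, 62, 79, 74, 64, 69, 64, 64, 49, 84, 93, 79, 49, 56, 77, 69, 59, 71, 77, 69, 80, 82,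
   43, 62, 61, 72, 84, 79, 67, 64, 59, 72, 74, 61, 49, 90, 94, 59, 62, 66, 51, 69, 77, 80, 74, 59, 71, 77, 67, 43, 72,
   69, 85, 89, 62, 51, 56, 77, 74, 59, 77, 74, 74, 69, 64, 67, 54, 54, 92, 92, 56, 64, 67, 64, 66, 72, 59, 72, 84, 79,
   69, 49, 56, 70, 74, 74, 79, 80, 41, 77, 79, 56, 54, 64, 87, 87, 67, 58, 62, 59, 66, 80, 74, 61, 75, 79, 64, 56, 67,
   56, 67, 92, 87, 51, 64, 56, 77, 72, 49, 79, 79, 72, 72, 71, 57, 43, 74, 82, 80, 74, 59, 64, 69, 67, 64, 61, 61, 93,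
   89, 54, 51, 69, 62, 64, 79, 79, 70, 58, 75, 74, 56, 57, 56, 89, 85, 66, 75, 46, 59, 76, 75, 56, 74, 80]

noncomputable def points133711 : List ℕ := prependDiffs points147441 gaps133711 133711

set_option maxRecDepth 100000 in
lemma signsHold_points133711 : SignsHold points133711 false :=
  signsHold_prependDiffs gaps133711 (by decide +kernel) signsHold_points147441

noncomputable def gaps119736 : List ℕ :=
  [64, 52, 69, 61, 87, 92, 67, 64, 51, 77, 79, 59, 64, 87, 85, 61, 74, 62, 48, 72, 87, 87, 67, 61, 69, 77, 59, 64, 69,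
   74, 90, 89, 44, 59, 69, 72, 71, 77, 82, 64, 69, 74, 67, 64, 41, 95, 94, 67, 64, 67, 53, 75, 79, 61, 75, 81, 77, 72,
   51, 64, 67, 69, 89, 87, 57, 54, 79, 77, 51, 69, 74, 85, 82, 64, 64, 53, 62, 79, 85, 71, 67, 77, 61, 72, 66, 59, 59,
   95, 92, 59, 59, 59, 71, 75, 61, 82, 79, 59, 85, 71, 49, 59, 69, 85, 84, 77, 56, 62, 69, 71, 72, 56, 77, 90, 79, 49,
   69, 66, 49, 85, 89, 72, 59, 69, 74, 69, 57, 61, 77, 84, 82, 72, 54, 46, 82, 74, 66, 80, 77, 64, 71, 72, 56, 62, 59,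
   94, 98, 43, 69, 64, 67, 66, 75, 71, 67, 84, 77, 59, 59, 56, 72, 79, 82, 79, 62, 51, 77, 79, 54, 54, 89, 85, 72, 69,
   56, 59, 61, 80, 82, 74, 61, 72, 79, 52, 66, 69, 57, 89, 95, 61, 49, 64, 69, 74, 67, 72, 81, 67, 69, 74]

noncomputable def points119736 : List ℕ := prependDiffs points133711 gaps119736 119736

set_option maxRecDepth 100000 in
lemma signsHold_points119736 : SignsHold points119736 false :=
  signsHold_prependDiffs gaps119736 (by decide +kernel) signsHold_points133711

noncomputable def gaps105439 : List ℕ :=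
  [77, 71, 80, 74, 74, 69, 56, 72, 59, 95, 97, 61, 52, 74, 77, 61, 74, 77, 80, 79, 77, 61, 56, 59, 87, 87, 77, 72, 64,
   61, 82, 75, 43, 85, 94, 82, 56, 67, 59, 72, 74, 84, 85, 54, 79, 82, 54, 61, 69, 80, 92, 84, 54, 59, 66, 80, 74, 64,
   82, 82, 69, 69, 69, 59, 51, 98, 94, 62, 66, 64, 74, 70, 64, 74, 77, 84, 82, 67, 38, 77, 74, 74, 87, 77, 56, 72, 79,
   67, 56, 62, 95, 94, 59, 64, 69, 51, 82, 82, 69, 72, 79, 77, 62, 66, 57, 69, 89, 90, 74, 46, 67, 79, 74, 52, 84, 82,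
   72, 82, 61, 59, 56, 74, 93, 82, 61, 69, 72, 64, 71, 70, 53, 95, 95, 59, 59, 61, 69, 72, 79, 79, 75, 61, 77, 82, 46,
   56, 80, 89, 82, 72, 64, 48, 77, 77, 67, 71, 80, 82, 71, 54, 72, 59, 61, 95, 94, 52, 64, 74, 69, 69, 59, 74, 85, 82,
   74, 61, 54, 56, 87, 77, 75, 81, 59, 69, 75, 69, 54, 64, 92, 92, 64, 54, 66, 69, 67, 77, 82, 64, 74, 84]

noncomputable def points105439 : List ℕ := prependDiffs points119736 gaps105439 105439

set_option maxRecDepth 100000 in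
lemma signsHold_points105439 : SignsHold points105439 false :=
  signsHold_prependDiffs gaps105439 (by decide +kernel) signsHold_points119736

noncomputable def gaps90819 : List ℕ :=
  [58, 75, 66, 90, 95, 74, 54, 64, 71, 82, 77, 82, 82, 61, 80, 76, 57, 53, 100, 98, 66, 69, 62, 71, 77, 72, 77, 76,
   85, 84, 54, 62, 74, 69, 95, 94, 52, 66, 77, 79, 62, 64, 87, 92, 74, 67, 74, 41, 84, 90, 77, 74, 74, 72, 72, 69, 61,
   69, 98, 92, 66, 49, 74, 77, 67, 79, 87, 67, 79, 84, 52, 64, 64, 92, 95, 66, 69, 64, 69, 80, 71, 59, 92, 93, 64, 66,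
   64, 62, 76, 90, 87, 61, 64, 82, 77, 49, 74, 82, 87, 87, 67, 53, 62, 82, 77, 76, 80, 74, 77, 64, 74, 59, 56, 103,
   99, 52, 66, 72, 66, 77, 69, 77, 79, 82, 80, 59, 53, 70, 84, 84, 85, 72, 46, 84, 77, 61, 62, 84, 95, 77, 59, 64, 66,
   62, 92, 87, 61, 75, 79, 69, 62, 69, 61, 92, 95, 67, 61, 54, 79, 79, 62, 84, 82, 67, 79, 74, 52, 56, 87, 92, 82, 59,
   69, 69, 69, 72, 72, 69, 89, 93, 51, 61, 69, 64, 80, 89, 80, 59, 71, 77, 72, 53, 64, 95, 87, 69, 75, 51, 61, 85]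

noncomputable def points90819 : List ℕ := prependDiffs points105439 gaps90819 90819

set_option maxRecDepth 100000 in
lemma signsHold_points90819 : SignsHold points90819 false :=
  signsHold_prependDiffs gaps90819 (by decide +kernel) signsHold_points105439

noncomputable def gaps75722 : List ℕ :=
  [80, 71, 75, 89, 85, 79, 77, 59, 53, 95, 92, 82, 77, 64, 77, 79, 67, 66, 92, 98, 79, 49, 77, 69, 76, 95, 85, 61, 85,
   81, 59, 67, 72, 97, 95, 69, 69, 54, 87, 82, 66, 87, 90, 71, 75, 69, 54, 76, 100, 95, 59, 69, 79, 77, 62, 81, 80,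
   87, 92, 59, 59, 71, 80, 87, 87, 74, 67, 76, 77, 72, 49, 99, 103, 66, 67, 69, 62, 84, 82, 79, 80, 76, 85, 56, 67,
   71, 85, 97, 87, 49, 66, 88, 71, 67, 82, 87, 84, 72, 66, 62, 61, 98, 94, 64, 77, 72, 69, 77, 66, 69, 95, 97, 64, 62,
   59, 84, 74, 85, 90, 61, 77, 84, 62, 53, 82, 95, 90, 69, 64, 64, 74, 82, 74, 74, 87, 88, 58, 70, 69, 59, 97, 97, 67,
   59, 76, 80, 69, 61, 85, 89, 80, 82, 53, 57, 82, 84, 82, 82, 66, 72, 77, 69, 67, 64, 99, 100, 49, 69, 72, 69, 74,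
   87, 77, 72, 84, 74, 64, 54, 77, 92, 90, 74, 66, 54, 85, 82, 53, 85, 89, 80, 72, 64, 64, 61, 87, 97, 75, 56, 82, 77]

noncomputable def points75722 : List ℕ := prependDiffs points90819 gaps75722 75722

set_option maxRecDepth 100000 in
lemma signsHold_points75722 : SignsHold points75722 false :=
  signsHold_prependDiffs gaps75722 (by decide +kernel) signsHold_points90819

noncomputable def gaps60045 : List ℕ :=
  [74, 72, 74, 97, 98, 79, 64, 59, 92, 84, 85, 92, 72, 79, 85, 61, 64, 102, 105, 72, 67, 76, 75, 82, 84, 79, 93, 92,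
   56, 74, 67, 89, 103, 87, 61, 72, 87, 79, 57, 97, 100, 77, 76, 64, 62, 92, 95, 82, 76, 80, 82, 64, 74, 74, 100, 105,
   59, 59, 84, 77, 79, 90, 82, 82, 82, 74, 56, 72, 105, 95, 69, 79, 59, 87, 82, 64, 90, 97, 82, 64, 66, 72, 82, 97,
   95, 54, 82, 89, 62, 66, 87, 95, 95, 66, 64, 67, 84, 90, 77, 84, 82, 74, 75, 74, 51, 105, 105, 67, 66, 72, 82, 71,
   80, 87, 82, 89, 80, 43, 80, 81, 95, 90, 71, 64, 82, 80, 66, 69, 100, 100, 59, 74, 67, 66, 95, 92, 72, 77, 82, 74,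
   66, 64, 87, 98, 92, 66, 52, 82, 87, 66, 90, 84, 77, 85, 64, 66, 62, 102, 100, 64, 69, 79, 69, 80, 74, 74, 98, 89,
   62, 64, 69, 79, 90, 89, 77, 61, 85, 84, 49, 74, 100, 92, 75, 71, 54, 79, 82, 85, 79, 79, 85, 72, 64, 74, 61, 100,
   105, 56, 67, 74]

noncomputable def points60045 : List ℕ := prependDiffs points75722 gaps60045 60045

set_option maxRecDepth 100000 in
lemma signsHold_points60045 : SignsHold points60045 false :=
  signsHold_prependDiffs gaps60045 (by decide +kernel) signsHold_points75722

noncomputable def gaps43453 : List ℕ :=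
  [111, 99, 69, 75, 74, 95, 97, 82, 95, 89, 69, 80, 71, 108, 110, 72, 66, 87, 90, 74, 97, 95, 87, 90, 56, 74, 103,
   102, 87, 74, 82, 82, 82, 74, 103, 110, 66, 70, 79, 82, 100, 94, 77, 87, 87, 69, 67, 102, 105, 87, 75, 58, 95, 87,
   82, 97, 90, 82, 74, 69, 77, 108, 107, 56, 82, 90, 72, 82, 87, 99, 95, 72, 64, 74, 97, 95, 90, 79, 74, 92, 72, 62,
   110, 105, 74, 69, 74, 82, 90, 92, 82, 87, 92, 59, 74, 82, 102, 105, 67, 67, 84, 87, 72, 89, 100, 85, 74, 79, 51,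
   103, 105, 79, 77, 79, 82, 77, 72, 89, 105, 95, 54, 69, 87, 82, 95, 92, 69, 89, 82, 64, 67, 105, 105, 72, 76, 67,
   82, 89, 77, 90, 97, 77, 69, 72, 71, 100, 103, 76, 59, 90, 87, 59, 89, 95, 92, 85, 61, 64, 87, 95, 92, 77, 82, 77,
   76, 77, 64, 108, 107, 54, 77, 72, 81, 85, 90, 84, 79, 90, 69, 56, 87, 100, 95, 82, 56, 80, 89, 72, 77, 97, 95, 71,
   67, 74, 67, 102, 103, 61, 79, 85]

noncomputable def points43453 : List ℕ := prependDiffs points60045 gaps43453 43453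

set_option maxRecDepth 100000 in
lemma signsHold_points43453 : SignsHold points43453 false :=
  signsHold_prependDiffs gaps43453 (by decide +kernel) signsHold_points60045

noncomputable def gaps25341 : List ℕ :=
  [82, 113, 115, 97, 80, 74, 110, 115, 95, 95, 89, 95, 74, 116, 125, 79, 77, 95, 97, 105, 103, 94, 103, 64, 89, 118,
   113, 84, 79, 98, 92, 90, 112, 108, 76, 85, 77, 118, 112, 80, 92, 97, 74, 92, 116, 107, 87, 62, 99, 100, 103, 97,
   90, 94, 80, 74, 118, 120, 69, 87, 85, 94, 98, 97, 105, 92, 69, 79, 105, 113, 97, 69, 95, 95, 69, 108, 112, 90, 79,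
   72, 95, 110, 97, 82, 100, 79, 79, 85, 115, 113, 66, 77, 95, 89, 98, 99, 90, 95, 77, 61, 115, 113, 87, 77, 82, 94,
   82, 92, 111, 99, 64, 82, 82, 105, 113, 71, 88, 97, 74, 77, 107, 110, 85, 74, 69, 103, 94, 93, 97, 84, 87, 72, 77,
   115, 113, 66, 74, 95, 80, 94, 95, 97, 98, 69, 66, 95, 107, 100, 77, 79, 88, 89, 69, 108, 112, 72, 79, 70, 92, 105,
   94, 77, 95, 87, 64, 84, 103, 110, 87, 54, 89, 92, 85, 95, 97, 87, 79, 80, 61, 113, 112, 70, 81, 82, 85, 82, 87,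
   105, 97, 74, 62, 87, 95, 102, 92, 67, 92, 92, 56, 92]

noncomputable def points25341 : List ℕ := prependDiffs points43453 gaps25341 25341

set_option maxRecDepth 100000 in
lemma signsHold_points25341 : SignsHold points25341 false :=
  signsHold_prependDiffs gaps25341 (by decide +kernel) signsHold_points43453

noncomputable def gaps0 : List ℕ :=
  [653, 491, 336, 294, 254, 238, 240, 192, 223, 207, 169, 205, 195, 151, 189, 190, 148, 161, 185, 169, 125, 177, 171,
   144, 135, 164, 174, 118, 143, 162, 153, 136, 118, 166, 156, 113, 135, 144, 153, 136, 100, 151, 156, 120, 126, 120,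
   146, 154, 102, 115, 146, 139, 125, 118, 107, 151, 144, 94, 121, 128, 135, 133, 113, 92, 144, 146, 99, 118, 113,
   123, 140, 123, 82, 123, 138, 123, 108, 118, 92, 138, 141, 94, 98, 123, 125, 120, 118, 97, 98, 135, 139, 84, 110,
   110, 115, 128, 118, 92, 90, 133, 131, 97, 107, 105, 98, 130, 131, 84, 95, 113, 128, 110, 105, 110, 77, 122, 136,
   103, 81, 108, 113, 110, 123, 102, 90, 87, 130, 128, 82, 108, 97, 100, 120, 120, 100, 72, 107, 123, 116, 94, 103,
   97, 84, 128, 126, 79, 92, 100, 115, 108, 105, 107, 80, 89, 123, 126, 87, 84, 108, 92, 110, 120, 98, 89, 74, 121,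
   123, 89, 97, 98, 87, 100, 120, 118, 69, 89, 103, 110, 110, 95, 100, 92, 71, 126, 120, 85, 84, 92, 105, 100, 108,
   110, 82, 76, 98, 123, 112, 69, 103, 94]

noncomputable def points0 : List ℕ := prependDiffs points25341 gaps0 0

set_option maxRecDepth 100000 in
lemma signsHold_points0 : SignsHold points0 false :=
  signsHold_prependDiffs gaps0 (by decide +kernel) signsHold_points25341

end Points

section Verification

set_option maxRecDepth 100000 in
lemma exclusionOK_points0_2 : exclusionOK 250 2 points0 = true := by decide +kernel

set_option maxRecDepth 100000 in
lemma exclusionOK_points25341_252 : exclusionOK 250 252 points25341 = true := by decide +kernel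

set_option maxRecDepth 100000 in
lemma exclusionOK_points43453_502 : exclusionOK 250 502 points43453 = true := by decide +kernel

set_option maxRecDepth 100000 in
lemma exclusionOK_points90819_752 : exclusionOK 250 752 points90819 = true := by decide +kernel

set_option maxRecDepth 100000 in
lemma exclusionOK_points119736_1002 : exclusionOK 249 1002 points119736 = true := by decide +kernel

/-- The zeros up to height `2500` lie on the critical line. -/
lemma re_eq_half_of_abs_im_le {ρ : ℂ} (hρ : xi ρ = 0) (h : |ρ.im| ≤ 2500) : ρ.re = 1 / 2 := by
  wlog h0 : 0 ≤ ρ.im generalizing ρ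
  · have := this (ρ := (starRingEnd ℂ) ρ) (by rw [xi_conj, hρ, map_zero]) (by rwa [Complex.conj_im, abs_neg])
      (by rw [Complex.conj_im]; linarith)
    rwa [Complex.conj_re] at this
  rw [abs_of_nonneg h0] at h
  rcases lt_or_ge ρ.im 3 with h3 | h3
  · exact re_eq_half_of_abs_im_lt_three hρ (by rwa [abs_of_nonneg h0])
  rcases lt_or_ge ρ.im 503 with h503 | h503
  · exact re_eq_half_of_exclusionOK (by norm_num) (by norm_num) signsHold_points0 exclusionOK_points0_2 hρ (by norm_num; linarith)
      (by norm_num; linarith)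
  rcases lt_or_ge ρ.im 1003 with h1003 | h1003
  · exact re_eq_half_of_exclusionOK (by norm_num) (by norm_num) signsHold_points25341 exclusionOK_points25341_252 hρ (by norm_num; linarith)
      (by norm_num; linarith)
  rcases lt_or_ge ρ.im 1503 with h1503 | h1503
  · exact re_eq_half_of_exclusionOK (by norm_num) (by norm_num) signsHold_points43453 exclusionOK_points43453_502 hρ (by norm_num; linarith)
      (by norm_num; linarith)
  rcases lt_or_ge ρ.im 2003 with h2003 | h2003
  · exact re_eq_half_of_exclusionOK (by norm_num) (by norm_num) signsHold_points90819 exclusionOK_points90819_752 hρ (by norm_num; linarith)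
      (by norm_num; linarith)
  exact re_eq_half_of_exclusionOK (by norm_num) (by norm_num) signsHold_points119736 exclusionOK_points119736_1002 hρ (by norm_num; linarith)
    (by norm_num; linarith)

end Verification

theorem stmt1 (n : ℕ) (hn : 5 ≤ n) :
    (nthPrime (n + 1) : ℝ) < (n : ℝ) * (Real.log ((n : ℝ) * Real.log n) + 1) := by
  rcases lt_or_ge n 13400 with h | h
  · exact nth_prime_lt_of_small hn h
  · exact nth_prime_lt_of_large (fun ρ hρ h => re_eq_half_of_abs_im_le hρ h) h
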